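/- For admissible T → ∞, ∑_{0<γ≤T} ζ''(ρ) = −(T/6π) log³(T/2π) − (−1 + C_0)(T/2π) log²(T/2π) + (−2 + 2C_0 − 2C_1)(T/2π) log(T/2π) + (2 − 2C_0 + 2C_1 + 4C_2 − 6C_0C_1 + 2C_0³)(T/2π) + E_2(T), where unconditionally E_2(T) = O(T e^{−C√(log T)}) for some constant C > 0, and under the Riemann Hypothesis E_2(T) = O(T^{1/2} log^{9/2} T). -/

import Mathlib

open Complex Filter Finset

/-- The order of vanishing of the Riemann zeta function at a point `ρ`:
the least `k` such that the `k`-th derivative of `ζ` is nonzero at `ρ`. -/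
noncomputable def zetaZeroOrder (ρ : ℂ) : ℕ :=
  sInf {k : ℕ | iteratedDeriv k riemannZeta ρ ≠ 0}

/-- A non-trivial zero of the Riemann zeta function. -/
def IsNontrivialZero (ρ : ℂ) : Prop :=
  riemannZeta ρ = 0 ∧ 0 < ρ.re ∧ ρ.re < 1

/-- `∑_{0<γ≤T} ζ^{(n)}(ρ)`, the sum of the `n`-th derivative of `ζ` over the
non-trivial zeros `ρ = β + iγ` with `0 < γ ≤ T`, counted with multiplicity. -/
noncomputable def zetaZeroSum (n : ℕ) (T : ℝ) : ℂ :=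
  ∑ᶠ ρ ∈ {ρ : ℂ | IsNontrivialZero ρ ∧ 0 < ρ.im ∧ ρ.im ≤ T},
    (zetaZeroOrder ρ : ℂ) * iteratedDeriv n riemannZeta ρ

/-- `T` is admissible: `|T - γ| ≥ δ / log T` for every ordinate `γ` of a
non-trivial zero of `ζ`. -/
def AdmissibleHeight (δ T : ℝ) : Prop :=
  ∀ ρ : ℂ, IsNontrivialZero ρ → δ / Real.log T ≤ |T - ρ.im|

/-- The main term in the asymptotic expansion of `∑_{0<γ≤T} ζ''(ρ)`, in terms
of the Laurent coefficients `C j` of `ζ` about `s = 1`. -/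
noncomputable def secondDerivMainTerm (C : ℕ → ℂ) (T : ℝ) : ℂ :=
  -(((T / (6 * Real.pi)) * Real.log (T / (2 * Real.pi)) ^ 3 : ℝ) : ℂ)
  - (-1 + C 0) * (((T / (2 * Real.pi)) * Real.log (T / (2 * Real.pi)) ^ 2 : ℝ) : ℂ)
  + (-2 + 2 * C 0 - 2 * C 1) *
      (((T / (2 * Real.pi)) * Real.log (T / (2 * Real.pi)) : ℝ) : ℂ)
  + (2 - 2 * C 0 + 2 * C 1 + 4 * C 2 - 6 * C 0 * C 1 + 2 * (C 0) ^ 3) *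
      ((T / (2 * Real.pi) : ℝ) : ℂ)

/-- boundary integral over a rectangle (counterclockwise) -/
noncomputable def rectInt (f : ℂ → ℂ) (x0 x1 y0 y1 : ℝ) : ℂ :=
  (∫ x in x0..x1, f (x + y0 * I)) - (∫ x in x0..x1, f (x + y1 * I))
    + I * (∫ y in y0..y1, f (x1 + y * I)) - I * (∫ y in y0..y1, f (x0 + y * I))

/-- closed rectangle -/
def RC (x0 x1 y0 y1 : ℝ) : Set ℂ := {s | x0 ≤ s.re ∧ s.re ≤ x1 ∧ y0 ≤ s.im ∧ s.im ≤ y1}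

/-- boundary of the rectangle -/
def RB (x0 x1 y0 y1 : ℝ) : Set ℂ :=
  {s | s ∈ RC x0 x1 y0 y1 ∧ (s.re = x0 ∨ s.re = x1 ∨ s.im = y0 ∨ s.im = y1)}

lemma RB_subset (x0 x1 y0 y1 : ℝ) : RB x0 x1 y0 y1 ⊆ RC x0 x1 y0 y1 := fun _ h => h.1

lemma isCompact_RC (x0 x1 y0 y1 : ℝ) : IsCompact (RC x0 x1 y0 y1) := by
  have : RC x0 x1 y0 y1 = Set.Icc x0 x1 ×ℂ Set.Icc y0 y1 := by
    ext s; simp [RC, Complex.mem_reProdIm]; tauto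
  rw [this]
  exact isCompact_Icc.reProdIm isCompact_Icc

lemma hasDerivAt_line_h {F : ℂ → ℂ} {f' : ℂ} {x y : ℝ} (h : HasDerivAt F f' (x + y * I)) :
    HasDerivAt (fun x : ℝ => F (x + y * I)) f' x := by
  have h1 : HasDerivAt (fun z : ℂ => z + y * I) 1 (x : ℂ) := (hasDerivAt_id (x : ℂ)).add_const _
  have h2 := HasDerivAt.comp (x : ℂ) (h₂ := F) h h1
  rw [mul_one] at h2
  exact h2.comp_ofReal

lemma hasDerivAt_line_v {F : ℂ → ℂ} {f' : ℂ} {x y : ℝ} (h : HasDerivAt F f' (x + y * I)) :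
    HasDerivAt (fun y : ℝ => F (x + y * I)) (I * f') y := by
  have h1 : HasDerivAt (fun z : ℂ => x + z * I) I (y : ℂ) := by
    simpa using ((hasDerivAt_id (y : ℂ)).mul_const I).const_add (x : ℂ)
  have h2 := HasDerivAt.comp (y : ℂ) (h₂ := F) h h1
  rw [mul_comm] at h2
  exact h2.comp_ofReal

section
variable {x0 x1 y0 y1 : ℝ}

lemma edge_h (hx : x0 ≤ x1) (hy : y0 ≤ y1) {f : ℂ → ℂ} (hf : ContinuousOn f (RB x0 x1 y0 y1))
    {y : ℝ} (h : y = y0 ∨ y = y1) :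
    IntervalIntegrable (fun x : ℝ => f (x + y * I)) MeasureTheory.volume x0 x1 := by
  apply ContinuousOn.intervalIntegrable_of_Icc hx
  apply hf.comp (by fun_prop)
  intro x hx'
  rcases h with rfl | rfl <;> simp [RB, RC, hx'.1, hx'.2, hy]

lemma edge_v (hx : x0 ≤ x1) (hy : y0 ≤ y1) {f : ℂ → ℂ} (hf : ContinuousOn f (RB x0 x1 y0 y1))
    {x : ℝ} (h : x = x0 ∨ x = x1) :
    IntervalIntegrable (fun y : ℝ => f (x + y * I)) MeasureTheory.volume y0 y1 := by
  apply ContinuousOn.intervalIntegrable_of_Icc hy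
  apply hf.comp (by fun_prop)
  intro x hx'
  rcases h with rfl | rfl <;> simp [RB, RC, hx'.1, hx'.2, hx]

lemma rectInt_add (hx : x0 ≤ x1) (hy : y0 ≤ y1) {f g : ℂ → ℂ}
    (hf : ContinuousOn f (RB x0 x1 y0 y1)) (hg : ContinuousOn g (RB x0 x1 y0 y1)) :
    rectInt (fun s => f s + g s) x0 x1 y0 y1 = rectInt f x0 x1 y0 y1 + rectInt g x0 x1 y0 y1 := by
  unfold rectInt
  rw [intervalIntegral.integral_add (edge_h hx hy hf (.inl rfl)) (edge_h hx hy hg (.inl rfl)),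
    intervalIntegral.integral_add (edge_h hx hy hf (.inr rfl)) (edge_h hx hy hg (.inr rfl)),
    intervalIntegral.integral_add (edge_v hx hy hf (.inl rfl)) (edge_v hx hy hg (.inl rfl)),
    intervalIntegral.integral_add (edge_v hx hy hf (.inr rfl)) (edge_v hx hy hg (.inr rfl))]
  ring

lemma rectInt_const_mul (c : ℂ) (f : ℂ → ℂ) :
    rectInt (fun s => c * f s) x0 x1 y0 y1 = c * rectInt f x0 x1 y0 y1 := by
  unfold rectInt
  simp only [intervalIntegral.integral_const_mul]
  ring

lemma rectInt_sum (hx : x0 ≤ x1) (hy : y0 ≤ y1) {ι : Type*} (S : Finset ι) (f : ι → ℂ → ℂ)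
    (hf : ∀ i ∈ S, ContinuousOn (f i) (RB x0 x1 y0 y1)) :
    rectInt (fun s => ∑ i ∈ S, f i s) x0 x1 y0 y1 = ∑ i ∈ S, rectInt (f i) x0 x1 y0 y1 := by
  classical
  induction S using Finset.induction_on with
  | empty => simp [rectInt]
  | insert a S ha ih =>
    simp only [Finset.sum_insert ha]
    rw [rectInt_add hx hy (hf a (by simp)) (continuousOn_finsetSum _ fun i hi => hf i (by simp [hi])),
      ih (fun i hi => hf i (by simp [hi]))]

lemma rectInt_congr (hx : x0 ≤ x1) (hy : y0 ≤ y1) {f g : ℂ → ℂ}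
    (h : Set.EqOn f g (RB x0 x1 y0 y1)) :
    rectInt f x0 x1 y0 y1 = rectInt g x0 x1 y0 y1 := by
  unfold rectInt
  have e1 : ∀ y, (y = y0 ∨ y = y1) → (∫ x in x0..x1, f (x + y * I)) = ∫ x in x0..x1, g (x + y * I) := by
    intro y h'
    apply intervalIntegral.integral_congr
    intro x hx'
    rw [Set.uIcc_of_le hx] at hx'
    apply h
    rcases h' with rfl | rfl <;> simp [RB, RC, hx'.1, hx'.2, hy]
  have e2 : ∀ x, (x = x0 ∨ x = x1) → (∫ y in y0..y1, f (x + y * I)) = ∫ y in y0..y1, g (x + y * I) := by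
    intro y h'
    apply intervalIntegral.integral_congr
    intro x hx'
    rw [Set.uIcc_of_le hy] at hx'
    apply h
    rcases h' with rfl | rfl <;> simp [RB, RC, hx'.1, hx'.2, hx]
  rw [e1 _ (.inl rfl), e1 _ (.inr rfl), e2 _ (.inl rfl), e2 _ (.inr rfl)]

lemma rectInt_zero (hx : x0 ≤ x1) (hy : y0 ≤ y1) {f : ℂ → ℂ}
    (hf : DifferentiableOn ℂ f (RC x0 x1 y0 y1)) : rectInt f x0 x1 y0 y1 = 0 := by
  have := Complex.integral_boundary_rect_eq_zero_of_differentiableOn f ⟨x0, y0⟩ ⟨x1, y1⟩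
    (hf.mono (by
      intro s hs
      simp only [Complex.mem_reProdIm, Set.uIcc_of_le hx, Set.uIcc_of_le hy] at hs
      exact ⟨hs.1.1, hs.1.2, hs.2.1, hs.2.2⟩))
  simpa [rectInt] using this

lemma rectInt_prim (hx : x0 ≤ x1) (hy : y0 ≤ y1) {f F : ℂ → ℂ}
    (hf : ContinuousOn f (RB x0 x1 y0 y1))
    (hF : ∀ s ∈ RB x0 x1 y0 y1, HasDerivAt F (f s) s) : rectInt f x0 x1 y0 y1 = 0 := by
  have e1 : ∀ y, (y = y0 ∨ y = y1) → (∫ x in x0..x1, f (x + y * I)) = F (x1 + y * I) - F (x0 + y * I) := by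
    intro y h'
    apply intervalIntegral.integral_eq_sub_of_hasDerivAt (f := fun x : ℝ => F (x + y * I))
    · intro x hx'
      rw [Set.uIcc_of_le hx] at hx'
      have hm : (x + y * I : ℂ) ∈ RB x0 x1 y0 y1 := by
        rcases h' with rfl | rfl <;> simp [RB, RC, hx'.1, hx'.2, hy]
      exact hasDerivAt_line_h (hF _ hm)
    · exact edge_h hx hy hf h'
  have e2 : ∀ x, (x = x0 ∨ x = x1) → (I * ∫ y in y0..y1, f (x + y * I)) = F (x + y1 * I) - F (x + y0 * I) := by
    intro x h'
    rw [← intervalIntegral.integral_const_mul]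
    apply intervalIntegral.integral_eq_sub_of_hasDerivAt (f := fun y : ℝ => F (x + y * I))
    · intro y hx'
      rw [Set.uIcc_of_le hy] at hx'
      have hm : (x + y * I : ℂ) ∈ RB x0 x1 y0 y1 := by
        rcases h' with rfl | rfl <;> simp [RB, RC, hx'.1, hx'.2, hx]
      exact hasDerivAt_line_v (hF _ hm)
    · exact (edge_v hx hy hf h').const_mul I
  unfold rectInt
  rw [e1 _ (.inl rfl), e1 _ (.inr rfl), e2 _ (.inl rfl), e2 _ (.inr rfl)]
  ring

lemma RB_ne {p : ℂ} (h0 : x0 < p.re) (h1 : p.re < x1) (h2 : y0 < p.im) (h3 : p.im < y1)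
    {s : ℂ} (hs : s ∈ RB x0 x1 y0 y1) : s - p ≠ 0 := by
  intro h
  rw [sub_eq_zero] at h
  subst h
  rcases hs.2 with h | h | h | h <;> linarith

lemma rectInt_inv {p : ℂ} (h0 : x0 < p.re) (h1 : p.re < x1) (h2 : y0 < p.im) (h3 : p.im < y1) :
    rectInt (fun s => 1 / (s - p)) x0 x1 y0 y1 = 2 * Real.pi * I := by
  have hx : x0 ≤ x1 := by linarith
  have hy : y0 ≤ y1 := by linarith
  have hc : ContinuousOn (fun s => 1 / (s - p)) (RB x0 x1 y0 y1) := by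
    apply ContinuousOn.div continuousOn_const (by fun_prop)
    intro s hs; exact RB_ne h0 h1 h2 h3 hs
  have e1 : ∀ y : ℝ, (y = y0 ∨ y = y1) → (∫ x in x0..x1, (1 / ((x + y * I : ℂ) - p)))
      = log (x1 + y * I - p) - log (x0 + y * I - p) := by
    intro y h'
    apply intervalIntegral.integral_eq_sub_of_hasDerivAt (f := fun x : ℝ => log (x + y * I - p))
    · intro x hx'
      have : (x + y * I - p : ℂ) ∈ slitPlane := by
        right; rcases h' with rfl | rfl <;> simp <;> intro h <;> linarith
      have h5 : HasDerivAt (fun z => log (z - p)) (1 / (x + y * I - p)) (x + y * I) :=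
        ((hasDerivAt_id _).sub_const p).clog this
      exact hasDerivAt_line_h h5
    · exact edge_h hx hy hc h'
  have e2 : (I * ∫ y in y0..y1, (1 / ((x1 + y * I : ℂ) - p)))
      = log (x1 + y1 * I - p) - log (x1 + y0 * I - p) := by
    rw [← intervalIntegral.integral_const_mul]
    apply intervalIntegral.integral_eq_sub_of_hasDerivAt (f := fun y : ℝ => log (x1 + y * I - p))
    · intro y hx'
      have : (x1 + y * I - p : ℂ) ∈ slitPlane := by
        left; simp; linarith
      have h5 : HasDerivAt (fun z => log (z - p)) (1 / (x1 + y * I - p)) (x1 + y * I) :=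
        ((hasDerivAt_id _).sub_const p).clog this
      exact hasDerivAt_line_v h5
    · exact (edge_v hx hy hc (.inr rfl)).const_mul I
  have e3 : (I * ∫ y in y0..y1, (1 / ((x0 + y * I : ℂ) - p)))
      = log (-(x0 + y1 * I - p)) - log (-(x0 + y0 * I - p)) := by
    rw [← intervalIntegral.integral_const_mul]
    apply intervalIntegral.integral_eq_sub_of_hasDerivAt (f := fun y : ℝ => log (-(x0 + y * I - p)))
    · intro y hx'
      have : (-(x0 + y * I - p) : ℂ) ∈ slitPlane := by
        left; simp; linarith
      have h5 : HasDerivAt (fun z => log (-(z - p))) (-1 / -(x0 + y * I - p)) (x0 + y * I) :=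
        ((hasDerivAt_id _).sub_const p).neg.clog this
      rw [neg_div_neg_eq] at h5
      exact hasDerivAt_line_v h5
    · exact (edge_v hx hy hc (.inl rfl)).const_mul I
  have hl1 : log (-(x0 + y1 * I - p)) = log (x0 + y1 * I - p) - Real.pi * I := by
    have : 0 < (x0 + y1 * I - p : ℂ).im := by simp; linarith
    rw [Complex.log, Complex.log, Complex.arg_neg_eq_arg_sub_pi_of_im_pos this]
    simp only [norm_neg]; push_cast; ring
  have hl2 : log (-(x0 + y0 * I - p)) = log (x0 + y0 * I - p) + Real.pi * I := by
    have : (x0 + y0 * I - p : ℂ).im < 0 := by simp; linarith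
    rw [Complex.log, Complex.log, Complex.arg_neg_eq_arg_add_pi_of_im_neg this]
    simp only [norm_neg]; push_cast; ring
  unfold rectInt
  rw [e1 _ (.inl rfl), e1 _ (.inr rfl), e2, e3, hl1, hl2]
  ring

lemma rectInt_inv_pow {p : ℂ} (h0 : x0 < p.re) (h1 : p.re < x1) (h2 : y0 < p.im) (h3 : p.im < y1)
    (k : ℕ) : rectInt (fun s => 1 / (s - p) ^ (k + 2)) x0 x1 y0 y1 = 0 := by
  have hx : x0 ≤ x1 := by linarith
  have hy : y0 ≤ y1 := by linarith
  apply rectInt_prim hx hy (F := fun s => -(1 / (k + 1)) * ((s - p) ^ (k + 1))⁻¹)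
  · apply ContinuousOn.div continuousOn_const (by fun_prop)
    intro s hs; exact pow_ne_zero _ (RB_ne h0 h1 h2 h3 hs)
  · intro s hs
    have hne := RB_ne h0 h1 h2 h3 hs
    have h6 : HasDerivAt (fun s => (s - p) ^ (k + 1)) (((k + 1 : ℕ) : ℂ) * (s - p) ^ k * 1) s :=
      ((hasDerivAt_id s).sub_const p).pow (k + 1)
    have := (h6.inv (pow_ne_zero _ hne)).const_mul (-(1 / ((k : ℂ) + 1)))
    refine this.congr_deriv ?_
    have : (k : ℂ) + 1 ≠ 0 := by exact_mod_cast Nat.succ_ne_zero k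
    push_cast
    field_simp
    ring

/-- Residue formula at a pole of order `n+1`. -/
lemma rectInt_residue {p : ℂ} (h0 : x0 < p.re) (h1 : p.re < x1) (h2 : y0 < p.im) (h3 : p.im < y1)
    (n : ℕ) (a : ℕ → ℂ) {f h : ℂ → ℂ} (hh : DifferentiableOn ℂ h (RC x0 x1 y0 y1))
    (hf : ∀ s ∈ RB x0 x1 y0 y1,
      f s = (∑ j ∈ range (n + 1), a j * (s - p) ^ j) / (s - p) ^ (n + 1) + h s) :
    rectInt f x0 x1 y0 y1 = 2 * Real.pi * I * a n := by
  have hx : x0 ≤ x1 := by linarith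
  have hy : y0 ≤ y1 := by linarith
  have hcp : ∀ k : ℕ, ContinuousOn (fun s => 1 / (s - p) ^ k) (RB x0 x1 y0 y1) := by
    intro k
    apply ContinuousOn.div continuousOn_const (by fun_prop)
    intro s hs; exact pow_ne_zero _ (RB_ne h0 h1 h2 h3 hs)
  have hcc : ∀ j, ContinuousOn (fun s => a j * (1 / (s - p) ^ (n + 1 - j))) (RB x0 x1 y0 y1) :=
    fun j => continuousOn_const.mul (hcp _)
  have hcs : ContinuousOn (fun s => ∑ j ∈ range (n + 1), a j * (1 / (s - p) ^ (n + 1 - j)))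
      (RB x0 x1 y0 y1) := continuousOn_finsetSum _ fun j _ => hcc j
  rw [rectInt_congr hx hy (g := fun s => (∑ j ∈ range (n + 1), a j * (1 / (s - p) ^ (n + 1 - j))) + h s),
    rectInt_add hx hy hcs (hh.continuousOn.mono (RB_subset _ _ _ _)), rectInt_zero hx hy hh, add_zero,
    rectInt_sum hx hy _ _ (fun j _ => hcc j)]
  · simp only [rectInt_const_mul]
    rw [Finset.sum_range_succ, Finset.sum_eq_zero, zero_add]
    · simp only [Nat.add_sub_cancel_left, pow_one]
      rw [rectInt_inv h0 h1 h2 h3]; ring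
    · intro j hj
      rw [Finset.mem_range] at hj
      obtain ⟨k, hk⟩ : ∃ k, n + 1 - j = k + 2 := ⟨n - 1 - j, by omega⟩
      rw [hk, rectInt_inv_pow h0 h1 h2 h3, mul_zero]
  · intro s hs
    have hne := RB_ne h0 h1 h2 h3 hs
    simp only
    rw [hf s hs, Finset.sum_div]
    congr 1
    apply Finset.sum_congr rfl
    intro j hj
    rw [Finset.mem_range] at hj
    rw [mul_div_assoc, one_div, pow_sub₀ _ hne (by omega)]
    congr 1
    rw [mul_inv, inv_inv, div_eq_mul_inv, mul_comm]
end

lemma intervalIntegral_conj' {f : ℝ → ℂ} {a b : ℝ} :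
    (∫ x in a..b, (starRingEnd ℂ) (f x)) = (starRingEnd ℂ) (∫ x in a..b, f x) := by
  simp only [intervalIntegral, integral_conj, map_sub]

lemma coef_bound {g : ℂ → ℂ} {c : ℂ} {R : ℝ} (hR : 0 < R)
    (hg : DiffContOnCl ℂ g (Metric.ball c R)) (h0 : g c = 0) (k : ℕ) (hk : 1 ≤ k) :
    ‖iteratedDeriv k g c‖ ≤ (k.factorial : ℝ) / R ^ k *
      (4 * ((2 * Real.pi)⁻¹ * ∫ θ in (0 : ℝ)..2 * Real.pi, max (g (circleMap c R θ)).re 0)) := by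
  set γ : ℝ → ℂ := fun θ => g (circleMap c R θ) with hγ
  have hcont : Continuous γ := by
    have : ContinuousOn g (Metric.closedBall c R) := by
      have := hg.continuousOn
      rwa [closure_ball c hR.ne'] at this
    exact this.comp_continuous (continuous_circleMap c R)
      (fun θ => circleMap_mem_closedBall c hR.le θ)
  have hRc : (R : ℂ) ≠ 0 := by exact_mod_cast hR.ne'
  have hpi := Real.pi_pos
  have hcm : ∀ θ : ℝ, circleMap 0 R θ = R * exp (θ * I) := fun θ => by simp [circleMap]
  have hJ : (∫ θ in (0 : ℝ)..2 * Real.pi, exp (-(k * θ * I)) * γ θ)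
      = 2 * Real.pi * R ^ k / k.factorial * iteratedDeriv k g c := by
    have := hg.circleIntegral_one_div_sub_center_pow_smul hR k
    rw [circleIntegral] at this
    have e : ∀ θ : ℝ, deriv (circleMap c R) θ • ((1 / (circleMap c R θ - c) ^ (k + 1)) • g (circleMap c R θ))
        = (I / R ^ k) * (exp (-(k * θ * I)) * γ θ) := by
      intro θ
      simp only [smul_eq_mul, deriv_circleMap, hγ, circleMap_sub_center, hcm]
      have : exp (-(k * θ * I)) = (exp (θ * I) ^ k)⁻¹ := by
        rw [← Complex.exp_nat_mul, ← Complex.exp_neg]; congr 1; ring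
      rw [this]
      have := Complex.exp_ne_zero (θ * I)
      field_simp
      ring
    simp only [e] at this
    rw [intervalIntegral.integral_const_mul, smul_eq_mul] at this
    have hk' : (k.factorial : ℂ) ≠ 0 := by exact_mod_cast k.factorial_ne_zero
    field_simp at this ⊢
    linear_combination this
  have hK : ∀ j : ℕ, 1 ≤ j → (∫ θ in (0 : ℝ)..2 * Real.pi, exp (j * θ * I) * γ θ) = 0 := by
    intro j hj
    have hd : DiffContOnCl ℂ (fun z => (z - c) ^ (j - 1) * g z) (Metric.ball c R) := by
      have h1 : Differentiable ℂ (fun z : ℂ => (z - c) ^ (j - 1)) := by fun_prop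
      exact h1.diffContOnCl.smul hg
    have := hd.circleIntegral_eq_zero hR.le
    rw [circleIntegral] at this
    have e : ∀ θ : ℝ, deriv (circleMap c R) θ • ((circleMap c R θ - c) ^ (j - 1) * g (circleMap c R θ))
        = (I * R ^ j) * (exp (j * θ * I) * γ θ) := by
      intro θ
      simp only [smul_eq_mul, deriv_circleMap, hγ, circleMap_sub_center, hcm]
      have : exp (j * θ * I) = exp (θ * I) ^ j := by
        rw [← Complex.exp_nat_mul]; congr 1; ring
      rw [this]
      obtain ⟨m, rfl⟩ : ∃ m, j = m + 1 := ⟨j - 1, by omega⟩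
      simp only [Nat.add_sub_cancel]
      ring
    simp only [e] at this
    rw [intervalIntegral.integral_const_mul] at this
    rcases mul_eq_zero.mp this with h | h
    · exact absurd h (mul_ne_zero I_ne_zero (pow_ne_zero _ hRc))
    · exact h
  have hM : (∫ θ in (0 : ℝ)..2 * Real.pi, γ θ) = 0 := by
    have := hg.circleIntegral_one_div_sub_center_pow_smul hR 0
    rw [circleIntegral] at this
    have e : ∀ θ : ℝ, deriv (circleMap c R) θ • ((1 / (circleMap c R θ - c) ^ (0 + 1)) • g (circleMap c R θ))
        = I * γ θ := by
      intro θ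
      simp only [smul_eq_mul, deriv_circleMap, hγ, circleMap_sub_center, hcm]
      have := Complex.exp_ne_zero (θ * I)
      field_simp
      ring
    simp only [e] at this
    rw [intervalIntegral.integral_const_mul] at this
    simpa [h0] using this
  have hMre : (∫ θ in (0 : ℝ)..2 * Real.pi, (γ θ).re) = 0 := by
    have h := Complex.reCLM.intervalIntegral_comp_comm
      (hcont.intervalIntegrable 0 (2 * Real.pi) (μ := MeasureTheory.volume))
    simp only [Complex.reCLM_apply] at h
    rw [h, hM]; simp
  have hKc : (∫ θ in (0 : ℝ)..2 * Real.pi, exp (-(k * θ * I)) * (starRingEnd ℂ) (γ θ)) = 0 := by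
    have h1 := congrArg (starRingEnd ℂ) (hK k hk)
    rw [map_zero, ← intervalIntegral_conj'] at h1
    rw [← h1]
    apply intervalIntegral.integral_congr
    intro θ _
    simp only [map_mul, ← Complex.exp_conj, Complex.conj_I, Complex.conj_ofReal, map_natCast]
    congr 2; ring
  have hJ2 : (∫ θ in (0 : ℝ)..2 * Real.pi, exp (-(k * θ * I)) * (2 * (γ θ).re : ℂ))
      = 2 * Real.pi * R ^ k / k.factorial * iteratedDeriv k g c := by
    rw [← hJ, ← add_zero (∫ θ in (0 : ℝ)..2 * Real.pi, exp (-(k * θ * I)) * γ θ), ← hKc,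
      ← intervalIntegral.integral_add]
    · apply intervalIntegral.integral_congr
      intro θ _
      simp only
      rw [← mul_add, Complex.add_conj]
      push_cast; ring
    · exact Continuous.intervalIntegrable (by fun_prop) _ _
    · exact Continuous.intervalIntegrable (by fun_prop) _ _
  have hle : ‖(2 * Real.pi * R ^ k / k.factorial * iteratedDeriv k g c : ℂ)‖
      ≤ ∫ θ in (0 : ℝ)..2 * Real.pi, (4 * max (γ θ).re 0 - 2 * (γ θ).re) := by
    rw [← hJ2]
    apply intervalIntegral.norm_integral_le_of_norm_le (by positivity)
    · refine Filter.Eventually.of_forall fun θ _ => ?_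
      rw [norm_mul, show (-(k * θ * I) : ℂ) = ((-(k * θ) : ℝ) : ℂ) * I by push_cast; ring,
        Complex.norm_exp_ofReal_mul_I, one_mul]
      rw [show (2 * ((γ θ).re : ℂ)) = ((2 * (γ θ).re : ℝ) : ℂ) by push_cast; ring, Complex.norm_real,
        Real.norm_eq_abs]
      rcases le_total 0 (γ θ).re with h | h
      · rw [max_eq_left h, abs_of_nonneg (by linarith)]; linarith
      · rw [max_eq_right h, abs_of_nonpos (by linarith)]; linarith
    · exact Continuous.intervalIntegrable (by fun_prop) _ _
  rw [intervalIntegral.integral_sub (Continuous.intervalIntegrable (by fun_prop) _ _)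
    (Continuous.intervalIntegrable (by fun_prop) _ _), intervalIntegral.integral_const_mul,
    intervalIntegral.integral_const_mul, hMre, mul_zero, sub_zero] at hle
  rw [norm_mul] at hle
  have hn : ‖(2 * Real.pi * R ^ k / k.factorial : ℂ)‖ = 2 * Real.pi * R ^ k / k.factorial := by
    rw [show (2 * Real.pi * R ^ k / k.factorial : ℂ) = ((2 * Real.pi * R ^ k / k.factorial : ℝ) : ℂ) by
      push_cast; ring, Complex.norm_real, Real.norm_eq_abs, abs_of_pos]
    have := k.factorial_pos
    positivity
  rw [hn] at hle
  have hkf : (0 : ℝ) < k.factorial := by exact_mod_cast k.factorial_pos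
  have hRk : 0 < R ^ k := by positivity
  set Q := ∫ θ in (0 : ℝ)..2 * Real.pi, max (γ θ).re 0
  have : (k.factorial : ℝ) / R ^ k * (4 * ((2 * Real.pi)⁻¹ * Q)) = (4 * Q) / (2 * Real.pi * R ^ k / k.factorial) := by
    field_simp
  rw [this, le_div_iff₀ (by positivity)]
  linarith

lemma exists_log {f : ℂ → ℂ} {c : ℂ} {R : ℝ} (hR : 0 < R)
    (hf : DifferentiableOn ℂ f (Metric.ball c R)) (hne : ∀ z ∈ Metric.ball c R, f z ≠ 0) :
    ∃ g : ℂ → ℂ, DifferentiableOn ℂ g (Metric.ball c R) ∧ g c = 0 ∧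
      (∀ z ∈ Metric.ball c R, f z = f c * exp (g z)) ∧
      ∀ z ∈ Metric.ball c R, HasDerivAt g (logDeriv f z) z := by
  have hd : DifferentiableOn ℂ (logDeriv f) (Metric.ball c R) := by
    have : DifferentiableOn ℂ (deriv f) (Metric.ball c R) := hf.deriv Metric.isOpen_ball
    exact this.div hf hne
  obtain ⟨g0, hg0⟩ := hd.isExactOn_ball
  have hc : c ∈ Metric.ball c R := Metric.mem_ball_self hR
  have hg : ∀ z ∈ Metric.ball c R, HasDerivAt (fun z => g0 z - g0 c) (logDeriv f z) z :=
    fun z hz => (hg0 z hz).sub_const _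
  refine ⟨fun z => g0 z - g0 c, fun z hz => (hg z hz).differentiableAt.differentiableWithinAt,
    by simp, ?_, hg⟩
  intro z hz
  have hder : ∀ w ∈ Metric.ball c R, HasDerivAt (fun w => f w * exp (-(g0 w - g0 c))) 0 w := by
    intro w hw
    have h1 := (hf.differentiableAt (Metric.isOpen_ball.mem_nhds hw)).hasDerivAt
    have h2 := h1.mul ((hg w hw).neg.cexp)
    refine h2.congr_deriv ?_
    have := hne w hw
    simp only [logDeriv, Pi.div_apply, Pi.neg_apply]
    field_simp
    ring
  have := (convex_ball c R).is_const_of_fderivWithin_eq_zero (𝕜 := ℂ)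
    (f := fun w => f w * exp (-(g0 w - g0 c))) (fun w hw => (hder w hw).differentiableAt.differentiableWithinAt)
    (fun w hw => by
      rw [fderivWithin_of_isOpen Metric.isOpen_ball hw]
      have := (hder w hw).hasFDerivAt.fderiv
      rw [this]; ext; simp) hz hc
  simp only [sub_self, neg_zero, Complex.exp_zero, mul_one] at this
  rw [← this, mul_assoc, ← Complex.exp_add]
  simp

/-- main tool: bound derivatives of log derivative -/
lemma logDeriv_bound_aux {f : ℂ → ℂ} {c : ℂ} {R r : ℝ} (hr : 0 < r) (hrR : r < R)
    (hf : DifferentiableOn ℂ f (Metric.ball c R)) (hne : ∀ z ∈ Metric.ball c R, f z ≠ 0) (k : ℕ) :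
    ‖iteratedDeriv k (logDeriv f) c‖ ≤ ((k + 1).factorial : ℝ) / r ^ (k + 1) *
      (4 * ((2 * Real.pi)⁻¹ * ∫ θ in (0 : ℝ)..2 * Real.pi,
        max (Real.log (‖f (circleMap c r θ)‖ / ‖f c‖)) 0)) := by
  have hR : 0 < R := hr.trans hrR
  obtain ⟨g, hg, hg0, hexp, hder⟩ := exists_log hR hf hne
  have hc : c ∈ Metric.ball c R := Metric.mem_ball_self hR
  have hdc : DiffContOnCl ℂ g (Metric.ball c r) := by
    apply DifferentiableOn.diffContOnCl
    rw [closure_ball c hr.ne']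
    exact hg.mono (Metric.closedBall_subset_ball hrR)
  have hb := coef_bound hr hdc hg0 (k + 1) (by omega)
  have hi : iteratedDeriv (k + 1) g c = iteratedDeriv k (logDeriv f) c := by
    rw [iteratedDeriv_succ']
    apply Filter.EventuallyEq.iteratedDeriv_eq
    filter_upwards [Metric.isOpen_ball.mem_nhds hc] with z hz
    exact (hder z hz).deriv
  rw [hi] at hb
  refine hb.trans (le_of_eq ?_)
  congr 3
  apply intervalIntegral.integral_congr
  intro θ _
  have hz : circleMap c r θ ∈ Metric.ball c R :=
    Metric.closedBall_subset_ball hrR (circleMap_mem_closedBall c hr.le θ)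
  simp only
  rw [hexp _ hz, norm_mul, mul_div_cancel_left₀ _ (norm_ne_zero_iff.mpr (hne c hc)), Complex.norm_exp,
    Real.log_exp]

lemma logDeriv_bound_max {f : ℂ → ℂ} {c : ℂ} {R r M : ℝ} (hr : 0 < r) (hrR : r < R)
    (hf : DifferentiableOn ℂ f (Metric.ball c R)) (hne : ∀ z ∈ Metric.ball c R, f z ≠ 0)
    (hM : ∀ z ∈ Metric.ball c R, ‖f z‖ ≤ M) (k : ℕ) :
    ‖iteratedDeriv k (logDeriv f) c‖ ≤ ((k + 1).factorial : ℝ) / r ^ (k + 1) *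
      (4 * Real.log (M / ‖f c‖)) := by
  refine (logDeriv_bound_aux hr hrR hf hne k).trans ?_
  have hR : 0 < R := hr.trans hrR
  have hc : c ∈ Metric.ball c R := Metric.mem_ball_self hR
  have hfc : 0 < ‖f c‖ := norm_pos_iff.mpr (hne c hc)
  have hpi := Real.pi_pos
  gcongr
  have hL : 0 ≤ Real.log (M / ‖f c‖) := Real.log_nonneg (by rw [le_div_iff₀ hfc]; simpa using hM c hc)
  have h1 : (∫ θ in (0 : ℝ)..2 * Real.pi, max (Real.log (‖f (circleMap c r θ)‖ / ‖f c‖)) 0)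
      ≤ Real.log (M / ‖f c‖) * |2 * Real.pi - 0| := by
    refine (Real.le_norm_self _).trans ?_
    apply intervalIntegral.norm_integral_le_of_norm_le_const
    intro θ _
    have hz : circleMap c r θ ∈ Metric.ball c R :=
      Metric.closedBall_subset_ball hrR (circleMap_mem_closedBall c hr.le θ)
    rw [Real.norm_eq_abs, abs_of_nonneg (le_max_right _ _)]
    apply max_le _ hL
    apply Real.log_le_log (div_pos (norm_pos_iff.mpr (hne _ hz)) hfc)
    gcongr
    exact hM _ hz
  rw [sub_zero, abs_of_pos (by positivity)] at h1
  calc _ ≤ (2 * Real.pi)⁻¹ * (Real.log (M / ‖f c‖) * (2 * Real.pi)) := by gcongr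
    _ = _ := by field_simp

/-- The function f times the second derivative of its log derivative. -/
noncomputable def Gop (f : ℂ → ℂ) (s : ℂ) : ℂ := f s * iteratedDeriv 2 (logDeriv f) s

lemma Gop_bound {f : ℂ → ℂ} {c : ℂ} {R r : ℝ} (hr : 0 < r) (hrR : r < R)
    (hf : DifferentiableOn ℂ f (Metric.ball c R)) (hne : ∀ z ∈ Metric.ball c R, f z ≠ 0) :
    ‖Gop f c‖ ≤ 24 / r ^ 3 * ((2 * Real.pi)⁻¹ * ∫ θ in (0 : ℝ)..2 * Real.pi, ‖f (circleMap c r θ)‖) := by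
  have hR : 0 < R := hr.trans hrR
  have hc : c ∈ Metric.ball c R := Metric.mem_ball_self hR
  have hfc : 0 < ‖f c‖ := norm_pos_iff.mpr (hne c hc)
  have hpi := Real.pi_pos
  have hz : ∀ θ, circleMap c r θ ∈ Metric.ball c R := fun θ =>
      Metric.closedBall_subset_ball hrR (circleMap_mem_closedBall c hr.le θ)
  have hcont : Continuous fun θ => ‖f (circleMap c r θ)‖ :=
    (hf.continuousOn.comp_continuous (continuous_circleMap c r) hz).norm
  have h1 : (∫ θ in (0 : ℝ)..2 * Real.pi, max (Real.log (‖f (circleMap c r θ)‖ / ‖f c‖)) 0)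
      ≤ ∫ θ in (0 : ℝ)..2 * Real.pi, ‖f (circleMap c r θ)‖ / ‖f c‖ := by
    apply intervalIntegral.integral_mono_on (by positivity)
    · apply Continuous.intervalIntegrable
      apply Continuous.max _ continuous_const
      apply Continuous.log (by fun_prop)
      intro θ
      exact (div_pos (norm_pos_iff.mpr (hne _ (hz θ))) hfc).ne'
    · apply Continuous.intervalIntegrable; fun_prop
    · intro θ _
      have : 0 < ‖f (circleMap c r θ)‖ / ‖f c‖ := div_pos (norm_pos_iff.mpr (hne _ (hz θ))) hfc
      exact max_le ((Real.log_le_sub_one_of_pos this).trans (by linarith)) this.le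
  rw [intervalIntegral.integral_div] at h1
  rw [Gop, norm_mul]
  calc _ ≤ ‖f c‖ * (((2 + 1).factorial : ℝ) / r ^ (2 + 1) * (4 * ((2 * Real.pi)⁻¹ *
        ((∫ θ in (0 : ℝ)..2 * Real.pi, ‖f (circleMap c r θ)‖) / ‖f c‖)))) := by
        gcongr
        refine (logDeriv_bound_aux hr hrR hf hne 2).trans ?_
        gcongr
    _ = _ := by
        norm_num [Nat.factorial]
        field_simp
        ring

lemma Gop_bound_max {f : ℂ → ℂ} {c : ℂ} {R r M : ℝ} (hr : 0 < r) (hrR : r < R)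
    (hf : DifferentiableOn ℂ f (Metric.ball c R)) (hne : ∀ z ∈ Metric.ball c R, f z ≠ 0)
    (hM : ∀ z ∈ Metric.ball c R, ‖f z‖ ≤ M) :
    ‖Gop f c‖ ≤ 24 / r ^ 3 * M := by
  refine (Gop_bound hr hrR hf hne).trans ?_
  have hpi := Real.pi_pos
  gcongr
  have h1 : (∫ θ in (0 : ℝ)..2 * Real.pi, ‖f (circleMap c r θ)‖) ≤ M * |2 * Real.pi - 0| := by
    refine (Real.le_norm_self _).trans ?_
    apply intervalIntegral.norm_integral_le_of_norm_le_const
    intro θ _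
    rw [norm_norm]
    exact hM _ (Metric.closedBall_subset_ball hrR (circleMap_mem_closedBall c hr.le θ))
  rw [sub_zero, abs_of_pos (by positivity)] at h1
  calc _ ≤ (2 * Real.pi)⁻¹ * (M * (2 * Real.pi)) := by gcongr
    _ = _ := by field_simp

/-- finite products approximating `Γ(σ)²/|Γ(σ+it)|²` -/
noncomputable def PG (t : ℝ) (n : ℕ) (σ : ℝ) : ℝ := ∏ j ∈ range (n + 1), (1 + t ^ 2 / (σ + j) ^ 2)

lemma PG_ge_one (t : ℝ) (n : ℕ) (σ : ℝ) : 1 ≤ PG t n σ := by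
  unfold PG
  refine le_of_eq_of_le (Finset.prod_const_one (s := range (n + 1))).symm ?_
  apply Finset.prod_le_prod (fun _ _ => zero_le_one)
  intro j _
  have : 0 ≤ t ^ 2 / (σ + j) ^ 2 := by positivity
  linarith

lemma PG_tendsto (t σ : ℝ) (hσ : 0 < σ) :
    Tendsto (fun n => (PG t n σ)⁻¹) atTop (nhds ((‖Complex.Gamma (σ + t * I)‖ / Real.Gamma σ) ^ 2)) := by
  have h1 := (Complex.GammaSeq_tendsto_Gamma (σ + t * I)).norm
  have h2 := (Real.GammaSeq_tendsto_Gamma σ)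
  have h3 := (h1.div h2 (Real.Gamma_pos_of_pos hσ).ne').pow 2
  refine h3.congr' ?_
  filter_upwards [eventually_gt_atTop 0] with n hn
  have hn' : (0 : ℝ) < n := by exact_mod_cast hn
  have e1 : ‖Complex.GammaSeq (σ + t * I) n‖ = (n : ℝ) ^ σ * n.factorial /
      ∏ j ∈ range (n + 1), ‖(σ + t * I + j : ℂ)‖ := by
    rw [Complex.GammaSeq, norm_div, norm_mul, norm_prod]
    congr 2
    · rw [show (n : ℂ) = ((n : ℝ) : ℂ) by simp, Complex.norm_cpow_eq_rpow_re_of_pos hn']; simp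
    · simp
  have hp : ∀ j : ℕ, 0 < ‖(σ + t * I + j : ℂ)‖ := by
    intro j
    apply norm_pos_iff.mpr
    intro h
    have := congrArg Complex.re h
    simp at this
    have : (0 : ℝ) ≤ j := j.cast_nonneg
    linarith
  simp only [Pi.div_apply]
  rw [e1, Real.GammaSeq]
  have hA : 0 < (n : ℝ) ^ σ * n.factorial := by
    have : (0 : ℝ) < n.factorial := by exact_mod_cast n.factorial_pos
    have := Real.rpow_pos_of_pos hn' σ
    positivity
  have : ((n : ℝ) ^ σ * n.factorial / ∏ j ∈ range (n + 1), ‖(σ + t * I + j : ℂ)‖) /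
      ((n : ℝ) ^ σ * n.factorial / ∏ j ∈ range (n + 1), (σ + j)) =
      ∏ j ∈ range (n + 1), ((σ + j) / ‖(σ + t * I + j : ℂ)‖) := by
    rw [Finset.prod_div_distrib]
    have : ∏ j ∈ range (n + 1), ‖(σ + t * I + j : ℂ)‖ ≠ 0 := (Finset.prod_pos fun j _ => hp j).ne'
    have : ∏ j ∈ range (n + 1), (σ + j : ℝ) ≠ 0 := (Finset.prod_pos fun j _ => by positivity).ne'
    field_simp
  rw [this, ← Finset.prod_pow, PG, ← Finset.prod_inv_distrib]
  apply Finset.prod_congr rfl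
  intro j _
  rw [div_pow, Complex.sq_norm, Complex.normSq_apply]
  have : 0 < σ + j := by positivity
  simp
  field_simp

lemma factor_convex {t u v w l : ℝ} (hu : 0 < u) (hw : 0 < w) (hl0 : 0 ≤ l) (hl1 : l ≤ 1)
    (hv : v = l * u + (1 - l) * w) :
    1 + t ^ 2 / v ^ 2 ≤ (1 + t ^ 2 / u ^ 2) ^ l * (1 + t ^ 2 / w ^ 2) ^ (1 - l) := by
  have hl1' : 0 ≤ 1 - l := by linarith
  have hg := Real.geom_mean_le_arith_mean2_weighted hl0 hl1' hu.le hw.le (by ring)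
  rw [← hv] at hg
  have hup := Real.rpow_pos_of_pos hu l
  have hwp := Real.rpow_pos_of_pos hw (1 - l)
  set a := t ^ 2 / u ^ 2 with ha
  set b := t ^ 2 / w ^ 2 with hb
  have ha0 : 0 ≤ a := by positivity
  have hb0 : 0 ≤ b := by positivity
  have h1 : t ^ 2 / v ^ 2 ≤ a ^ l * b ^ (1 - l) := by
    have e : a ^ l * b ^ (1 - l) = t ^ 2 / (u ^ l * w ^ (1 - l)) ^ 2 := by
      rw [ha, hb, Real.div_rpow (by positivity) (by positivity), Real.div_rpow (by positivity) (by positivity)]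
      rw [div_mul_div_comm]
      congr 1
      · rw [← Real.rpow_add_of_nonneg (by positivity) hl0 hl1']; simp
      · rw [mul_pow, ← Real.rpow_natCast u, ← Real.rpow_natCast w, ← Real.rpow_mul hu.le,
          ← Real.rpow_mul hw.le, ← Real.rpow_natCast (u ^ l), ← Real.rpow_natCast (w ^ (1 - l)),
          ← Real.rpow_mul hu.le, ← Real.rpow_mul hw.le]
        congr 2 <;> ring
    rw [e]
    gcongr
  have hA : 0 < 1 + a := by linarith
  have hB : 0 < 1 + b := by linarith
  have h2 := Real.geom_mean_le_arith_mean2_weighted hl0 hl1' (p₁ := 1 / (1 + a)) (p₂ := 1 / (1 + b))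
    (by positivity) (by positivity) (by ring)
  have h3 := Real.geom_mean_le_arith_mean2_weighted hl0 hl1' (p₁ := a / (1 + a)) (p₂ := b / (1 + b))
    (by positivity) (by positivity) (by ring)
  rw [Real.div_rpow (by positivity) hA.le, Real.div_rpow (by positivity) hB.le, div_mul_div_comm] at h2 h3
  rw [Real.one_rpow, Real.one_rpow, one_mul] at h2
  have hAp := Real.rpow_pos_of_pos hA l
  have hBp := Real.rpow_pos_of_pos hB (1 - l)
  have h4 : (1 + a ^ l * b ^ (1 - l)) / ((1 + a) ^ l * (1 + b) ^ (1 - l)) ≤ 1 := by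
    rw [add_div]
    refine (add_le_add h2 h3).trans (le_of_eq ?_)
    field_simp
    ring
  rw [div_le_one (by positivity)] at h4
  linarith

lemma PG_convex (t : ℝ) (n : ℕ) {u v w l : ℝ} (hu : 0 < u) (hw : 0 < w) (hl0 : 0 ≤ l) (hl1 : l ≤ 1)
    (hv : v = l * u + (1 - l) * w) :
    PG t n v ≤ PG t n u ^ l * PG t n w ^ (1 - l) := by
  unfold PG
  rw [← Real.finsetProd_rpow _ _ (fun i _ => by positivity),
    ← Real.finsetProd_rpow _ _ (fun i _ => by positivity), ← Finset.prod_mul_distrib]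
  apply Finset.prod_le_prod (fun i _ => by positivity)
  intro j _
  have : (0 : ℝ) ≤ j := j.cast_nonneg
  exact factor_convex (by linarith) (by linarith) hl0 hl1 (by rw [hv]; ring)

lemma norm_Gamma_le (σ t : ℝ) (hσ : 0 < σ) : ‖Complex.Gamma (σ + t * I)‖ ≤ Real.Gamma σ := by
  have h := le_of_tendsto' (PG_tendsto t σ hσ) (fun n => inv_le_one_of_one_le₀ (PG_ge_one t n σ))
  have hG := Real.Gamma_pos_of_pos hσ
  rw [sq_le_one_iff₀ (by positivity), div_le_one hG] at h
  exact h

lemma Gamma_half_sq (t : ℝ) : ‖Complex.Gamma (1 / 2 + t * I)‖ ^ 2 = Real.pi / Real.cosh (Real.pi * t) := by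
  have h := Complex.Gamma_mul_Gamma_one_sub (1 / 2 + t * I)
  have h1 : (1 - (1 / 2 + t * I) : ℂ) = (starRingEnd ℂ) (1 / 2 + t * I) := by
    apply Complex.ext <;> norm_num
  rw [h1, Complex.Gamma_conj, Complex.mul_conj, Complex.normSq_eq_norm_sq] at h
  rw [show (Real.pi * (1 / 2 + t * I) : ℂ) = (Real.pi * t) * I + Real.pi / 2 by ring,
    Complex.sin_add_pi_div_two, Complex.cos_mul_I] at h
  exact_mod_cast h

lemma Gamma_one_sq (t : ℝ) (ht : 0 < t) :
    ‖Complex.Gamma (1 + t * I)‖ ^ 2 = Real.pi * t / Real.sinh (Real.pi * t) := by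
  have ht' : (t : ℂ) ≠ 0 := by exact_mod_cast ht.ne'
  have h := Complex.Gamma_mul_Gamma_one_sub (t * I)
  have h1 : (1 - (t * I) : ℂ) = (starRingEnd ℂ) (1 + t * I) := by
    apply Complex.ext <;> simp
  have h2 : Complex.Gamma (1 + t * I) = t * I * Complex.Gamma (t * I) := by
    rw [add_comm, Complex.Gamma_add_one _ (mul_ne_zero ht' I_ne_zero)]
  have h3 : Complex.Gamma (1 + t * I) * (starRingEnd ℂ) (Complex.Gamma (1 + t * I)) =
    (t * I) * (Real.pi / Complex.sin (Real.pi * (t * I))) := by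
    rw [← h, h1, Complex.Gamma_conj]
    nth_rewrite 1 [h2]; ring
  rw [Complex.mul_conj, Complex.normSq_eq_norm_sq, show (Real.pi * (t * I) : ℂ) = (Real.pi * t) * I by ring,
    Complex.sin_mul_I] at h3
  have hs : Complex.sinh (Real.pi * t) ≠ 0 := by
    have : Real.sinh (Real.pi * t) ≠ 0 := (Real.sinh_pos_iff.mpr (by positivity)).ne'
    exact_mod_cast this
  have h4 : (t * I) * (Real.pi / (Complex.sinh (Real.pi * t) * I)) = Real.pi * t / Complex.sinh (Real.pi * t) := by
    field_simp
  rw [h4] at h3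
  exact_mod_cast h3

lemma gamma_bd12 (σ t : ℝ) (h1 : 1 ≤ σ) (h2 : σ ≤ 2) (ht : 1 ≤ t) :
    ‖Complex.Gamma (σ + t * I)‖ ≤ (4 * Real.pi * t) ^ (σ - 1 / 2) * Real.exp (-(Real.pi * t / 2)) := by
  have hpi := Real.pi_pos
  set l := (2 * σ - 2) / (2 * σ - 1) with hl
  have hs : 0 < 2 * σ - 1 := by linarith
  have hl0 : 0 ≤ l := div_nonneg (by linarith) hs.le
  have hl1 : 1 - l = 1 / (2 * σ - 1) := by rw [hl]; field_simp; ring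
  have hl1p : 0 < 1 - l := by rw [hl1]; positivity
  have key : ∀ n, ((PG t n (1 / 2))⁻¹) ^ l * ((PG t n σ)⁻¹) ^ (1 - l) ≤ (PG t n 1)⁻¹ := by
    intro n
    have p1 := PG_ge_one t n (1 / 2)
    have p2 := PG_ge_one t n σ
    have p3 := PG_ge_one t n 1
    rw [Real.inv_rpow (by linarith), Real.inv_rpow (by linarith), ← mul_inv]
    apply inv_anti₀ (by linarith)
    exact PG_convex t n (by norm_num) (by linarith) hl0 (by linarith) (by rw [hl]; field_simp; ring)
  have hlim := le_of_tendsto_of_tendsto'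
    (((PG_tendsto t (1 / 2) (by norm_num)).rpow_const (.inr hl0)).mul
      ((PG_tendsto t σ (by linarith)).rpow_const (.inr hl1p.le))) (PG_tendsto t 1 one_pos) key
  have eh : (‖Complex.Gamma (((1 / 2 : ℝ) : ℂ) + t * I)‖ / Real.Gamma (1 / 2)) ^ 2 = 1 / Real.cosh (Real.pi * t) := by
    have := Gamma_half_sq t
    rw [div_pow, Real.Gamma_one_half_eq, Real.sq_sqrt hpi.le]
    push_cast
    rw [this]; field_simp
  have eo : (‖Complex.Gamma (((1 : ℝ) : ℂ) + t * I)‖ / Real.Gamma 1) ^ 2 = Real.pi * t / Real.sinh (Real.pi * t) := by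
    have := Gamma_one_sq t (by linarith)
    rw [Real.Gamma_one, div_one]
    push_cast
    rw [this]
  rw [eh, eo] at hlim
  set E := Real.exp (Real.pi * t) with hE
  have hEp : 0 < E := Real.exp_pos _
  have hpt : 3 < Real.pi * t := by nlinarith [Real.pi_gt_three]
  have hE4 : 4 < E := by
    have := Real.add_one_le_exp (Real.pi * t)
    linarith
  have hcosh : Real.cosh (Real.pi * t) ≤ E := by
    rw [Real.cosh_eq, Real.exp_neg, ← hE]
    have : E⁻¹ ≤ 1 := inv_le_one_of_one_le₀ (by linarith)
    linarith
  have hsinh : E / 4 ≤ Real.sinh (Real.pi * t) := by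
    rw [Real.sinh_eq, Real.exp_neg, ← hE]
    have : E⁻¹ ≤ 1 := inv_le_one_of_one_le₀ (by linarith)
    linarith
  set r := ‖Complex.Gamma (σ + t * I)‖ / Real.Gamma σ with hr
  have hG : 0 < Real.Gamma σ := Real.Gamma_pos_of_pos (by linarith)
  have hr0 : 0 ≤ r := by positivity
  have hsp : 0 < Real.sinh (Real.pi * t) := by linarith
  have h5 : (1 / E) ^ l * (r ^ 2) ^ (1 - l) ≤ (4 * Real.pi * t) / E := by
    calc _ ≤ (1 / Real.cosh (Real.pi * t)) ^ l * (r ^ 2) ^ (1 - l) := by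
          have := Real.cosh_pos (Real.pi * t)
          gcongr
      _ ≤ _ := hlim
      _ ≤ Real.pi * t / (E / 4) := by gcongr
      _ = _ := by field_simp
  have hlm : l * (2 * σ - 1) = 2 * σ - 2 := by rw [hl]; field_simp
  have hlm' : (1 - l) * (2 * σ - 1) = 1 := by rw [hl1]; field_simp
  have h6 : r ^ 2 ≤ (4 * Real.pi * t) ^ (2 * σ - 1) / E := by
    have h7 := Real.rpow_le_rpow (by positivity) h5 (show 0 ≤ 2 * σ - 1 by linarith)
    rw [Real.mul_rpow (by positivity) (by positivity), ← Real.rpow_mul (by positivity),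
      ← Real.rpow_mul (by positivity), hlm, hlm', Real.rpow_one, Real.div_rpow (by positivity) hEp.le,
      Real.div_rpow (by positivity) hEp.le, Real.one_rpow] at h7
    have hEE : E ^ (2 * σ - 1) = E ^ (2 * σ - 2) * E := by
      rw [show 2 * σ - 1 = (2 * σ - 2) + 1 by ring, Real.rpow_add hEp, Real.rpow_one]
    rw [hEE] at h7
    have hEs := Real.rpow_pos_of_pos hEp (2 * σ - 2)
    rw [le_div_iff₀ hEp]
    rw [le_div_iff₀ (by positivity)] at h7
    calc r ^ 2 * E = 1 / E ^ (2 * σ - 2) * r ^ 2 * (E ^ (2 * σ - 2) * E) := by field_simp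
      _ ≤ _ := h7
  have h8 : r ≤ (4 * Real.pi * t) ^ (σ - 1 / 2) * Real.exp (-(Real.pi * t / 2)) := by
    apply le_of_sq_le_sq _ (by positivity)
    refine h6.trans (le_of_eq ?_)
    rw [mul_pow, ← Real.rpow_natCast, ← Real.rpow_mul (by positivity), ← Real.exp_nat_mul, hE, div_eq_mul_inv,
      ← Real.exp_neg]
    congr 2
    · push_cast; ring
    · push_cast; ring
  have hG1 : Real.Gamma σ ≤ 1 := by
    have hc := Real.convexOn_Gamma.2 (show (1 : ℝ) ∈ Set.Ioi 0 by simp) (show (2 : ℝ) ∈ Set.Ioi 0 by simp)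
      (show 0 ≤ 2 - σ by linarith) (show 0 ≤ σ - 1 by linarith) (by ring)
    simp only [smul_eq_mul, Real.Gamma_one, Real.Gamma_two] at hc
    rw [show (2 - σ) * 1 + (σ - 1) * 2 = σ by ring] at hc
    linarith
  calc ‖Complex.Gamma (σ + t * I)‖ = r * Real.Gamma σ := by rw [hr]; field_simp
    _ ≤ r * 1 := by gcongr
    _ ≤ _ := by rw [mul_one]; exact h8

lemma gamma_bd : ∃ C > 0, ∀ σ t : ℝ, 0 ≤ σ → σ ≤ 3 → 1 ≤ t →
    ‖Complex.Gamma (σ + t * I)‖ ≤ C * t ^ (σ - 1 / 2) * Real.exp (-(Real.pi * t / 2)) := by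
  have hpi := Real.pi_pos
  have h4p : 1 ≤ 4 * Real.pi := by nlinarith [Real.pi_gt_three]
  have base : ∀ σ t : ℝ, 1 ≤ σ → σ ≤ 2 → 1 ≤ t →
    ‖Complex.Gamma (σ + t * I)‖ ≤ (4 * Real.pi) ^ 2 * t ^ (σ - 1 / 2) * Real.exp (-(Real.pi * t / 2)) := by
    intro σ t h1 h2 ht
    refine (gamma_bd12 σ t h1 h2 ht).trans ?_
    rw [Real.mul_rpow (by positivity) (by positivity)]
    gcongr
    calc (4 * Real.pi) ^ (σ - 1 / 2) ≤ (4 * Real.pi) ^ (2 : ℝ) := by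
          apply Real.rpow_le_rpow_of_exponent_le h4p; linarith
      _ = _ := by norm_num
  refine ⟨3 * (4 * Real.pi) ^ 2, by positivity, ?_⟩
  intro σ t h0 h3 ht
  have htp : 0 < t := by linarith
  have hE := Real.exp_pos (-(Real.pi * t / 2))
  rcases le_or_gt σ 1 with h | h
  · have hne : (σ + t * I : ℂ) ≠ 0 := by
      intro h; have := congrArg Complex.im h; simp at this; linarith
    have h5 := base (σ + 1) t (by linarith) (by linarith) ht
    have e : Complex.Gamma (((σ + 1 : ℝ) : ℂ) + t * I) = (σ + t * I) * Complex.Gamma (σ + t * I) := by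
      rw [← Complex.Gamma_add_one _ hne]; congr 1; push_cast; ring
    rw [e, norm_mul] at h5
    have hn : t ≤ ‖(σ + t * I : ℂ)‖ := by
      have := Complex.abs_im_le_norm (σ + t * I : ℂ)
      simp at this
      exact (le_abs_self t).trans this
    have h6 : t * ‖Complex.Gamma (σ + t * I)‖ ≤ (4 * Real.pi) ^ 2 * t ^ (σ + 1 - 1 / 2) * Real.exp (-(Real.pi * t / 2)) :=
      le_trans (by gcongr) h5
    rw [show σ + 1 - 1 / 2 = (σ - 1 / 2) + 1 by ring, Real.rpow_add htp, Real.rpow_one] at h6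
    have h7 : ‖Complex.Gamma (σ + t * I)‖ ≤ (4 * Real.pi) ^ 2 * t ^ (σ - 1 / 2) * Real.exp (-(Real.pi * t / 2)) := by
      apply le_of_mul_le_mul_left _ htp
      linarith
    have : 0 ≤ (4 * Real.pi) ^ 2 * t ^ (σ - 1 / 2) * Real.exp (-(Real.pi * t / 2)) := by positivity
    linarith
  rcases le_or_gt σ 2 with h' | h'
  · have := base σ t h.le h' ht
    have : 0 ≤ (4 * Real.pi) ^ 2 * t ^ (σ - 1 / 2) * Real.exp (-(Real.pi * t / 2)) := by positivity
    linarith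
  · have hne : ((σ - 1 : ℝ) + t * I : ℂ) ≠ 0 := by
      intro h; have := congrArg Complex.im h; simp at this; linarith
    have h5 := base (σ - 1) t (by linarith) (by linarith) ht
    have e : Complex.Gamma (σ + t * I) = ((σ - 1 : ℝ) + t * I) * Complex.Gamma ((σ - 1 : ℝ) + t * I) := by
      rw [← Complex.Gamma_add_one _ hne]; congr 1; push_cast; ring
    have hn : ‖((σ - 1 : ℝ) + t * I : ℂ)‖ ≤ 3 * t := by
      refine (norm_add_le _ _).trans ?_
      rw [Complex.norm_real, norm_mul, Complex.norm_real, Complex.norm_I, Real.norm_eq_abs, Real.norm_eq_abs,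
        abs_of_pos (by linarith), abs_of_pos htp]
      linarith
    rw [e, norm_mul]
    calc _ ≤ (3 * t) * ((4 * Real.pi) ^ 2 * t ^ (σ - 1 - 1 / 2) * Real.exp (-(Real.pi * t / 2))) := by gcongr
      _ = _ := by
        rw [show σ - 1 / 2 = (σ - 1 - 1 / 2) + 1 by ring, Real.rpow_add htp, Real.rpow_one]; ring

/-- Euler–Maclaurin building block -/
noncomputable def zI (n : ℕ) (s : ℂ) : ℂ := ∫ u in (n : ℝ)..(n + 1), ((u - n : ℝ) : ℂ) * (u : ℂ) ^ (-s - 1)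

noncomputable def zT (n : ℕ) (s : ℂ) : ℂ :=
  (s - 1) * ((n : ℂ) + 1) ^ (-s) + ((n : ℂ) + 1) ^ (1 - s) - (n : ℂ) ^ (1 - s)

lemma zI_intble (n : ℕ) (hn : 1 ≤ n) (s : ℂ) : IntervalIntegrable
    (fun u : ℝ => ((u - n : ℝ) : ℂ) * (u : ℂ) ^ (-s - 1)) MeasureTheory.volume (n : ℝ) (n + 1) := by
  have hn' : (1 : ℝ) ≤ n := by exact_mod_cast hn
  apply ContinuousOn.intervalIntegrable
  rw [Set.uIcc_of_le (by linarith)]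
  intro u hu
  apply ContinuousAt.continuousWithinAt
  have : ContinuousAt (fun u : ℝ => (u : ℂ) ^ (-s - 1)) u :=
    continuousAt_ofReal_cpow_const _ _ (Or.inr (by linarith [hu.1]))
  fun_prop

lemma zT_eq (n : ℕ) (hn : 1 ≤ n) (s : ℂ) : zT n s = -(s * (s - 1)) * zI n s := by
  have hn' : (1 : ℝ) ≤ n := by exact_mod_cast hn
  have key : ∫ u in (n : ℝ)..(n + 1), -(s * (s - 1)) * (((u - n : ℝ) : ℂ) * (u : ℂ) ^ (-s - 1)) =
      ((s - 1) * (((n + 1 : ℝ) - n : ℝ) : ℂ) * ((n + 1 : ℝ) : ℂ) ^ (-s) + ((n + 1 : ℝ) : ℂ) ^ (1 - s)) -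
      ((s - 1) * (((n : ℝ) - n : ℝ) : ℂ) * ((n : ℝ) : ℂ) ^ (-s) + ((n : ℝ) : ℂ) ^ (1 - s)) := by
    apply intervalIntegral.integral_eq_sub_of_hasDerivAt
      (f := fun u : ℝ => (s - 1) * ((u - n : ℝ) : ℂ) * (u : ℂ) ^ (-s) + (u : ℂ) ^ (1 - s))
    · intro u hu
      rw [Set.uIcc_of_le (by linarith)] at hu
      have hu0 : 0 < u := by linarith [hu.1]
      have hu1 : (u : ℂ) ≠ 0 := by exact_mod_cast hu0.ne'
      have hsl : (u : ℂ) ∈ slitPlane := by simp [hu0]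
      have d1 : HasDerivAt (fun z : ℂ => (s - 1) * (z - n) * z ^ (-s) + z ^ (1 - s))
          (((s - 1) * 1) * (u : ℂ) ^ (-s) + (s - 1) * ((u : ℂ) - n) * (-s * (u : ℂ) ^ (-s - 1) * 1)
            + (1 - s) * (u : ℂ) ^ (1 - s - 1) * 1) (u : ℂ) := by
        have a1 := ((hasDerivAt_id (u : ℂ)).sub_const (n : ℂ)).const_mul (s - 1)
        have a2 := (hasDerivAt_id (u : ℂ)).cpow_const (c := -s) (by simpa using hsl)
        have a3 := (hasDerivAt_id (u : ℂ)).cpow_const (c := 1 - s) (by simpa using hsl)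
        exact (a1.mul a2).add a3
      have := d1.comp_ofReal
      refine (this.congr_deriv ?_).congr_of_eventuallyEq (Filter.Eventually.of_forall fun y => ?_)
      · have e : (1 : ℂ) - s - 1 = -s := by ring
        rw [e]; push_cast; ring
      · push_cast; ring
    · exact (zI_intble n hn s).const_mul _
  rw [intervalIntegral.integral_const_mul] at key
  rw [zI, key, zT]
  push_cast
  ring

lemma zI_norm_le (n : ℕ) (hn : 1 ≤ n) (s : ℂ) (hs : 0 < s.re) :
    ‖zI n s‖ ≤ ((n : ℝ) ^ (-s.re) - ((n : ℝ) + 1) ^ (-s.re)) / s.re := by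
  have hn' : (1 : ℝ) ≤ n := by exact_mod_cast hn
  have key : ∫ u in (n : ℝ)..(n + 1), u ^ (-s.re - 1) =
      ((n : ℝ) ^ (-s.re) - ((n : ℝ) + 1) ^ (-s.re)) / s.re := by
    rw [integral_rpow]
    · rw [show -s.re - 1 + 1 = -s.re by ring]
      field_simp; ring
    · right
      refine ⟨by linarith, ?_⟩
      rw [Set.uIcc_of_le (by linarith)]
      intro h; linarith [h.1]
  rw [← key, zI]
  refine intervalIntegral.norm_integral_le_of_norm_le (by linarith) ?_ ?_
  · refine Filter.Eventually.of_forall fun u hu => ?_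
    have hu0 : 0 < u := by linarith [hu.1]
    rw [norm_mul, Complex.norm_cpow_eq_rpow_re_of_pos hu0, Complex.norm_real, Real.norm_eq_abs,
      abs_of_nonneg (by linarith [hu.1])]
    have : (-s - 1).re = -s.re - 1 := by simp
    rw [this]
    have h2 : (0:ℝ) ≤ u ^ (-s.re - 1) := Real.rpow_nonneg hu0.le _
    nlinarith [hu.2]
  · apply intervalIntegral.intervalIntegrable_rpow
    right
    rw [Set.uIcc_of_le (by linarith)]
    intro h; linarith [h.1]

lemma rpow_tel_hasSum (σ : ℝ) (hσ : 0 < σ) (N : ℕ) (hN : 1 ≤ N) :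
    HasSum (fun n : ℕ => ((n + N : ℕ) : ℝ) ^ (-σ) - (((n + N : ℕ) : ℝ) + 1) ^ (-σ)) ((N : ℝ) ^ (-σ)) := by
  rw [hasSum_iff_tendsto_nat_of_nonneg]
  · have h : ∀ k : ℕ, ∑ n ∈ range k, (((n + N : ℕ) : ℝ) ^ (-σ) - (((n + N : ℕ) : ℝ) + 1) ^ (-σ)) =
        (N : ℝ) ^ (-σ) - ((k + N : ℕ) : ℝ) ^ (-σ) := by
      intro k
      induction k with
      | zero => simp
      | succ k ih =>
        rw [sum_range_succ, ih]; push_cast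
        rw [show (k : ℝ) + 1 + N = k + N + 1 by ring]; ring
    simp_rw [h]
    have h2 : Tendsto (fun k : ℕ => ((k + N : ℕ) : ℝ) ^ (-σ)) atTop (nhds 0) :=
      (tendsto_rpow_neg_atTop hσ).comp (tendsto_natCast_atTop_atTop.comp (tendsto_add_atTop_nat N))
    simpa using h2.const_sub ((N : ℝ) ^ (-σ))
  · intro i
    have : (1 : ℝ) ≤ ((i + N : ℕ) : ℝ) := by exact_mod_cast (by omega : 1 ≤ i + N)
    have := Real.rpow_le_rpow_of_nonpos (by linarith : (0:ℝ) < ((i + N : ℕ) : ℝ)) (by linarith : ((i + N : ℕ) : ℝ) ≤ ((i + N : ℕ) : ℝ) + 1) (by linarith : -σ ≤ 0)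
    linarith

lemma zT_summable_norm (s : ℂ) (hs : 0 < s.re) (N : ℕ) (hN : 1 ≤ N) :
    Summable (fun n : ℕ => ‖zT (n + N) s‖) ∧
    ‖∑' n : ℕ, zT (n + N) s‖ ≤ ‖s‖ * ‖s - 1‖ * ((N : ℝ) ^ (-s.re) / s.re) := by
  have hb : ∀ n : ℕ, ‖zT (n + N) s‖ ≤ ‖s‖ * ‖s - 1‖ *
      ((((n + N : ℕ) : ℝ) ^ (-s.re) - (((n + N : ℕ) : ℝ) + 1) ^ (-s.re)) / s.re) := by
    intro n
    rw [zT_eq _ (by omega), norm_mul, norm_neg, norm_mul]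
    gcongr
    exact zI_norm_le _ (by omega) s hs
  have hS := ((rpow_tel_hasSum s.re hs N hN).div_const s.re).mul_left (‖s‖ * ‖s - 1‖)
  refine ⟨Summable.of_nonneg_of_le (fun _ => norm_nonneg _) hb hS.summable, ?_⟩
  exact tsum_of_norm_bounded hS hb

lemma zT_partial (s : ℂ) (k : ℕ) : ∑ n ∈ range k, zT (n + 1) s =
    (s - 1) * ∑ n ∈ range k, ((n : ℂ) + 2) ^ (-s) + ((k : ℂ) + 1) ^ (1 - s) - 1 := by
  induction k with
  | zero => simp
  | succ k ih =>
    rw [sum_range_succ, ih, sum_range_succ, zT]; push_cast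
    rw [show (k : ℂ) + 1 + 1 = k + 2 by ring]; ring

lemma zeta1_eq_of_one_lt (s : ℂ) (hs : 1 < s.re) :
    riemannZeta₁ s = s + ∑' n : ℕ, zT (n + 1) s := by
  have hs1 : s ≠ 1 := by rintro rfl; simp at hs
  have h1 := (zT_summable_norm s (by linarith) 1 le_rfl).1.of_norm.hasSum.tendsto_sum_nat
  have h2 : Tendsto (fun k : ℕ => ((k : ℂ) + 1) ^ (1 - s)) atTop (nhds 0) := by
    rw [tendsto_zero_iff_norm_tendsto_zero]
    have : ∀ k : ℕ, ‖((k : ℂ) + 1) ^ (1 - s)‖ = ((k + 1 : ℕ) : ℝ) ^ (-(s.re - 1)) := by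
      intro k
      have e : ((k : ℂ) + 1) = (((k + 1 : ℕ) : ℝ) : ℂ) := by push_cast; ring
      rw [e, Complex.norm_cpow_eq_rpow_re_of_pos (by positivity)]
      congr 1; simp
    simp_rw [this]
    exact (tendsto_rpow_neg_atTop (by linarith)).comp (tendsto_natCast_atTop_atTop.comp (tendsto_add_atTop_nat 1))
  have hz := zeta_eq_tsum_one_div_nat_add_one_cpow hs
  have hsum : Summable (fun n : ℕ => 1 / ((n : ℂ) + 1) ^ s) := by
    have := (Complex.summable_one_div_nat_cpow (p := s)).2 hs
    have := (summable_nat_add_iff 1).2 this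
    simpa using this
  have h3 : Tendsto (fun k : ℕ => ∑ n ∈ range k, ((n : ℂ) + 2) ^ (-s)) atTop (nhds (riemannZeta s - 1)) := by
    have h4 := hsum.hasSum.tendsto_sum_nat
    rw [← hz] at h4
    have h5 := (h4.comp (tendsto_add_atTop_nat 1)).sub_const 1
    refine h5.congr fun k => ?_
    simp only [Function.comp]
    rw [sum_range_succ']
    simp only [Nat.cast_zero, zero_add, one_cpow, div_one, add_sub_cancel_right]
    refine sum_congr rfl fun n _ => ?_
    rw [cpow_neg, one_div]; push_cast
    rw [show (n : ℂ) + 1 + 1 = n + 2 by ring]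
  have h6 := ((h3.const_mul (s - 1)).add h2).sub_const 1
  have h7 := tendsto_nhds_unique h1 (h6.congr fun k => (zT_partial s k).symm)
  rw [h7, riemannZeta_eq_inv_sub_mul hs1]
  field_simp [sub_ne_zero.2 hs1]
  ring

lemma zT_diff (n : ℕ) : Differentiable ℂ (zT (n + 1)) := by
  intro s
  unfold zT
  have h1 : ((n + 1 : ℕ) : ℂ) ≠ 0 := by exact_mod_cast Nat.succ_ne_zero n
  have h2 : ((n + 1 : ℕ) : ℂ) + 1 ≠ 0 := by exact_mod_cast Nat.succ_ne_zero (n + 1)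
  refine DifferentiableAt.sub (DifferentiableAt.add (DifferentiableAt.mul (by fun_prop) ?_) ?_) ?_
  · exact DifferentiableAt.const_cpow (by fun_prop) (Or.inl h2)
  · exact DifferentiableAt.const_cpow (by fun_prop) (Or.inl h2)
  · exact DifferentiableAt.const_cpow (by fun_prop) (Or.inl h1)

lemma zT_tsum_diff : DifferentiableOn ℂ (fun s => ∑' n : ℕ, zT (n + 1) s) {s | 0 < s.re} := by
  intro s hs
  apply DifferentiableAt.differentiableWithinAt
  simp only [Set.mem_setOf_eq] at hs
  set r := s.re / 2 with hr
  have hr0 : 0 < r := by positivity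
  have hU : IsOpen (Metric.ball s r) := Metric.isOpen_ball
  set M := ‖s‖ + r + 1 with hM
  have hS := ((rpow_tel_hasSum 1 one_pos 1 le_rfl))
  have hsumm : Summable (fun n : ℕ => M * M * ((n + 1 : ℕ) : ℝ) ^ (-r - 1)) := by
    apply Summable.mul_left
    exact (summable_nat_add_iff (f := fun n : ℕ => (n : ℝ) ^ (-r - 1)) 1).2 (Real.summable_nat_rpow.2 (by linarith))
  refine (differentiableOn_tsum_of_summable_norm hsumm (fun n => (zT_diff n).differentiableOn) hU ?_).differentiableAt
    (hU.mem_nhds (Metric.mem_ball_self hr0))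
  intro n w hw
  have hw' : ‖w - s‖ < r := by simpa [dist_eq_norm] using hw
  have hwre : r ≤ w.re := by
    have := Complex.abs_re_le_norm (w - s)
    rw [sub_re] at this
    have := abs_le.1 (this.trans hw'.le)
    linarith [this.1]
  have hwn : ‖w‖ ≤ M := by
    have : ‖w‖ ≤ ‖s‖ + ‖w - s‖ := by simpa using norm_add_le s (w - s)
    linarith
  have hwn1 : ‖w - 1‖ ≤ M := by
    have : ‖w‖ ≤ ‖s‖ + ‖w - s‖ := by simpa using norm_add_le s (w - s)
    have := norm_sub_le w 1
    simp at this; linarith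
  rw [zT_eq _ (by omega), norm_mul, norm_neg, norm_mul]
  have hI : ‖zI (n + 1) w‖ ≤ ((n + 1 : ℕ) : ℝ) ^ (-r - 1) := by
    have hn1 : (1 : ℝ) ≤ ((n + 1 : ℕ) : ℝ) := by exact_mod_cast (by omega : 1 ≤ n + 1)
    have := intervalIntegral.norm_integral_le_of_norm_le_const (a := ((n + 1 : ℕ) : ℝ)) (b := ((n + 1 : ℕ) : ℝ) + 1)
      (f := fun u : ℝ => ((u - (n + 1 : ℕ) : ℝ) : ℂ) * (u : ℂ) ^ (-w - 1)) (C := ((n + 1 : ℕ) : ℝ) ^ (-r - 1)) ?_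
    · simpa [zI] using this
    · intro u hu
      rw [Set.uIoc_of_le (by linarith)] at hu
      have hu0 : 0 < u := by linarith [hu.1]
      rw [norm_mul, Complex.norm_cpow_eq_rpow_re_of_pos hu0, Complex.norm_real, Real.norm_eq_abs,
        abs_of_nonneg (by linarith [hu.1])]
      have e : (-w - 1).re = -w.re - 1 := by simp
      rw [e]
      have h2 : (0:ℝ) ≤ u ^ (-w.re - 1) := Real.rpow_nonneg hu0.le _
      have h3 : u ^ (-w.re - 1) ≤ u ^ (-r - 1) := Real.rpow_le_rpow_of_exponent_le (by linarith [hu.1]) (by linarith)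
      have h4 : u ^ (-r - 1) ≤ ((n + 1 : ℕ) : ℝ) ^ (-r - 1) :=
        Real.rpow_le_rpow_of_nonpos (by linarith) hu.1.le (by linarith)
      nlinarith [hu.2]
  gcongr

lemma zeta1_eq (s : ℂ) (hs : 0 < s.re) : riemannZeta₁ s = s + ∑' n : ℕ, zT (n + 1) s := by
  have hop : IsOpen {s : ℂ | 0 < s.re} := isOpen_lt continuous_const continuous_re
  have hf : AnalyticOnNhd ℂ riemannZeta₁ {s : ℂ | 0 < s.re} :=
    differentiable_riemannZeta₁.differentiableOn.analyticOnNhd hop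
  have hg : AnalyticOnNhd ℂ (fun s => s + ∑' n : ℕ, zT (n + 1) s) {s : ℂ | 0 < s.re} :=
    (differentiableOn_id.add zT_tsum_diff).analyticOnNhd hop
  have hpre : IsPreconnected {s : ℂ | 0 < s.re} := (convex_halfSpace_re_gt 0).isPreconnected
  refine hf.eqOn_of_preconnected_of_eventuallyEq hg hpre (z₀ := 2) (by simp) ?_ hs
  have : {s : ℂ | 1 < s.re} ∈ nhds (2 : ℂ) := (isOpen_lt continuous_const continuous_re).mem_nhds (by simp)
  filter_upwards [this] with w hw
  exact zeta1_eq_of_one_lt w hw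

lemma zeta1_eq_N (s : ℂ) (hs : 0 < s.re) (N : ℕ) (hN : 1 ≤ N) : riemannZeta₁ s =
    (s - 1) * ∑ n ∈ range N, ((n : ℂ) + 1) ^ (-s) + (N : ℂ) ^ (1 - s) + ∑' n : ℕ, zT (n + N) s := by
  obtain ⟨k, rfl⟩ : ∃ k, N = k + 1 := ⟨N - 1, by omega⟩
  rw [zeta1_eq s hs, ← (zT_summable_norm s hs 1 le_rfl).1.of_norm.sum_add_tsum_nat_add k, zT_partial, sum_range_succ']
  push_cast
  have : ∀ n : ℕ, (n : ℂ) + 1 + 1 = n + 2 := fun n => by ring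
  simp only [this, add_assoc, add_comm, add_left_comm, zero_add, one_cpow]
  ring

/-- the tail in the approximate formula for zeta -/
noncomputable def zTail (N : ℕ) (s : ℂ) : ℂ := ∑' n : ℕ, zI (n + N) s

lemma zeta_eq_N (s : ℂ) (hs : 0 < s.re) (hs1 : s ≠ 1) (N : ℕ) (hN : 1 ≤ N) : riemannZeta s =
    ∑ n ∈ range N, ((n : ℂ) + 1) ^ (-s) + (N : ℂ) ^ (1 - s) / (s - 1) - s * zTail N s := by
  have h : ∑' n : ℕ, zT (n + N) s = -(s * (s - 1)) * zTail N s := by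
    rw [zTail, ← tsum_mul_left]
    exact tsum_congr fun n => zT_eq _ (by omega) s
  have h0 : s - 1 ≠ 0 := sub_ne_zero.2 hs1
  rw [riemannZeta_eq_inv_sub_mul hs1, zeta1_eq_N s hs N hN, h]
  field_simp
  ring

lemma zTail_summable (s : ℂ) (hs : 0 < s.re) (N : ℕ) (hN : 1 ≤ N) :
    Summable (fun n : ℕ => ‖zI (n + N) s‖) ∧ ‖zTail N s‖ ≤ (N : ℝ) ^ (-s.re) / s.re := by
  have hb : ∀ n : ℕ, ‖zI (n + N) s‖ ≤
      ((((n + N : ℕ) : ℝ) ^ (-s.re) - (((n + N : ℕ) : ℝ) + 1) ^ (-s.re)) / s.re) := fun n =>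
    zI_norm_le _ (by omega) s hs
  have hS := ((rpow_tel_hasSum s.re hs N hN).div_const s.re)
  exact ⟨Summable.of_nonneg_of_le (fun _ => norm_nonneg _) hb hS.summable, tsum_of_norm_bounded hS hb⟩

lemma sum_inv_le (N : ℕ) : ∑ n ∈ range N, ((n : ℝ) + 1)⁻¹ ≤ 1 + Real.log N := by
  have h := harmonic_le_one_add_log N
  simpa [harmonic] using h

lemma zeta_bd (σ t : ℝ) (h1 : 1 / 2 ≤ σ) (h3 : σ ≤ 3) (hne : (σ + t * I : ℂ) ≠ 1) :
    ‖riemannZeta (σ + t * I)‖ ≤ (|t| + 2) ^ (max (1 - σ) 0) *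
      (8 + Real.log (|t| + 2) + 1 / ‖(σ + t * I - 1 : ℂ)‖) := by
  set s : ℂ := σ + t * I with hs
  have hre : s.re = σ := by simp [hs]
  have hn1 : ‖s‖ ≤ 3 + |t| := by
    refine (norm_add_le _ _).trans ?_
    simp only [norm_mul, Complex.norm_real, norm_I, mul_one, Real.norm_eq_abs]
    rw [abs_of_nonneg (by linarith : (0:ℝ) ≤ σ)]; linarith
  set N := ⌊|t| + 2⌋₊ with hN
  have ht0 := abs_nonneg t
  have hN1 : (N : ℝ) ≤ |t| + 2 := Nat.floor_le (by positivity)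
  have hN2 : |t| + 1 ≤ (N : ℝ) := by have := Nat.lt_floor_add_one (|t| + 2); linarith
  have hN3 : 1 ≤ N := by
    have : (1 : ℝ) ≤ N := by linarith
    exact_mod_cast this
  have hNp : (1 : ℝ) ≤ N := by linarith
  set m := max (1 - σ) 0 with hm
  set A := (|t| + 2) ^ m with hA
  have hm0 : 0 ≤ m := le_max_right _ _
  have hm1 : 1 - σ ≤ m := le_max_left _ _
  have hA0 : 0 ≤ A := by positivity
  have pw : ∀ u : ℝ, 1 ≤ u → u ≤ |t| + 2 → u ^ (1 - σ) ≤ A := fun u hu hu2 =>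
    (Real.rpow_le_rpow_of_exponent_le hu hm1).trans (Real.rpow_le_rpow (by linarith) hu2 hm0)
  have pw2 : ∀ u : ℝ, 1 ≤ u → u ≤ |t| + 2 → u ^ (-σ) ≤ A * u⁻¹ := fun u hu hu2 => by
    have : u ^ (-σ) = u ^ (1 - σ) * u⁻¹ := by
      rw [← Real.rpow_neg_one u, ← Real.rpow_add (by linarith)]; congr 1; ring
    rw [this]; gcongr; exact pw u hu hu2
  rw [zeta_eq_N s (by rw [hre]; linarith) hne N hN3]
  have b1 : ‖∑ n ∈ range N, ((n : ℂ) + 1) ^ (-s)‖ ≤ A * (1 + Real.log (|t| + 2)) := by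
    refine (norm_sum_le _ _).trans ?_
    calc ∑ n ∈ range N, ‖((n : ℂ) + 1) ^ (-s)‖ ≤ ∑ n ∈ range N, A * ((n : ℝ) + 1)⁻¹ := by
          refine sum_le_sum fun n hn => ?_
          have e : ((n : ℂ) + 1) = (((n : ℝ) + 1 : ℝ) : ℂ) := by push_cast; ring
          rw [e, Complex.norm_cpow_eq_rpow_re_of_pos (by positivity), neg_re, hre]
          refine pw2 _ (by linarith [n.cast_nonneg (α := ℝ)]) ?_
          have : ((n + 1 : ℕ) : ℝ) ≤ N := by exact_mod_cast mem_range.1 hn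
          push_cast at this; linarith
      _ = A * ∑ n ∈ range N, ((n : ℝ) + 1)⁻¹ := by rw [mul_sum]
      _ ≤ A * (1 + Real.log N) := by gcongr; exact sum_inv_le N
      _ ≤ _ := by gcongr
  have b2 : ‖(N : ℂ) ^ (1 - s) / (s - 1)‖ ≤ A * (1 / ‖s - 1‖) := by
    rw [norm_div, show (N : ℂ) = ((N : ℝ) : ℂ) by simp, Complex.norm_cpow_eq_rpow_re_of_pos (by linarith),
      div_eq_mul_one_div]
    gcongr
    rw [sub_re, hre]; exact pw _ hNp hN1
  have b3 : ‖s * zTail N s‖ ≤ A * 6 := by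
    rw [norm_mul]
    have h := (zTail_summable s (by rw [hre]; linarith) N hN3).2
    rw [hre] at h
    have h4 : (N : ℝ) ^ (-σ) / σ ≤ A * (N : ℝ)⁻¹ * 2 := by
      rw [div_le_iff₀ (by linarith)]
      have := pw2 N hNp hN1
      have h5 : 0 ≤ A * (N : ℝ)⁻¹ := by positivity
      nlinarith
    calc ‖s‖ * ‖zTail N s‖ ≤ (3 * N) * (A * (N : ℝ)⁻¹ * 2) := by
          gcongr
          · linarith
          · exact h.trans h4
      _ = A * 6 := by field_simp; ring
  calc _ ≤ A * (1 + Real.log (|t| + 2)) + A * (1 / ‖s - 1‖) + A * 6 :=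
        (norm_sub_le _ _).trans (add_le_add ((norm_add_le _ _).trans (add_le_add b1 b2)) b3)
    _ ≤ _ := by nlinarith

/-- the factor in the functional equation -/
noncomputable def Xf (w : ℂ) : ℂ := 2 * (2 * Real.pi) ^ (-w) * Complex.Gamma w * Complex.cos (Real.pi * w / 2)

lemma norm_cos_le_exp (z : ℂ) : ‖Complex.cos z‖ ≤ Real.exp |z.im| := by
  rw [Complex.cos, norm_div]
  have h := norm_add_le (cexp (z * I)) (cexp (-z * I))
  rw [Complex.norm_exp, Complex.norm_exp] at h
  have a1 : (z * I).re = -z.im := by simp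
  have a2 : (-z * I).re = z.im := by simp
  rw [a1, a2] at h
  have h1 := Real.exp_le_exp.2 (neg_le_abs z.im)
  have h2 := Real.exp_le_exp.2 (le_abs_self z.im)
  rw [show ‖(2:ℂ)‖ = 2 by simp]
  linarith

lemma Xf_bd : ∃ C > 0, ∀ σ t : ℝ, 0 ≤ σ → σ ≤ 3 → 1 ≤ t → ‖Xf (σ + t * I)‖ ≤ C * t ^ (σ - 1 / 2) := by
  obtain ⟨C, hC, h⟩ := gamma_bd
  refine ⟨2 * C, by positivity, fun σ t h0 h3 h1 => ?_⟩
  have ht : 0 < t := by linarith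
  have hg := h σ t h0 h3 h1
  unfold Xf
  rw [norm_mul, norm_mul, norm_mul]
  have p1 : ‖((2:ℂ) * Real.pi) ^ (-(σ + t * I : ℂ))‖ ≤ 1 := by
    rw [show ((2:ℂ) * Real.pi) = ((2 * Real.pi : ℝ) : ℂ) by push_cast; ring,
      Complex.norm_cpow_eq_rpow_re_of_pos (by positivity)]
    refine Real.rpow_le_one_of_one_le_of_nonpos ?_ ?_
    · linarith [Real.pi_gt_three]
    · simp; exact h0
  have p2 : ‖Complex.cos (Real.pi * (σ + t * I) / 2)‖ ≤ Real.exp (Real.pi * t / 2) := by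
    refine (norm_cos_le_exp _).trans (Real.exp_le_exp.2 ?_)
    have : (Real.pi * (σ + t * I) / 2 : ℂ).im = Real.pi * t / 2 := by
      rw [show (Real.pi * (σ + t * I) / 2 : ℂ) = ((Real.pi * σ / 2 : ℝ) : ℂ) + ((Real.pi * t / 2 : ℝ) : ℂ) * I by
        push_cast; ring]
      simp
    rw [this, abs_of_nonneg (by positivity)]
  have e : Real.exp (-(Real.pi * t / 2)) * Real.exp (Real.pi * t / 2) = 1 := by
    rw [← Real.exp_add]; simp
  calc ‖(2:ℂ)‖ * ‖((2:ℂ) * Real.pi) ^ (-(σ + t * I : ℂ))‖ * ‖Complex.Gamma (σ + t * I)‖ *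
        ‖Complex.cos (Real.pi * (σ + t * I) / 2)‖
      ≤ 2 * 1 * (C * t ^ (σ - 1 / 2) * Real.exp (-(Real.pi * t / 2))) * Real.exp (Real.pi * t / 2) := by
        gcongr
        simp
    _ = 2 * C * t ^ (σ - 1 / 2) * (Real.exp (-(Real.pi * t / 2)) * Real.exp (Real.pi * t / 2)) := by ring
    _ = _ := by rw [e, mul_one]

lemma zeta_fe (w : ℂ) (hw : w.im ≠ 0) : riemannZeta (1 - w) = Xf w * riemannZeta w := by
  rw [Xf, riemannZeta_one_sub]
  · rintro n rfl; simp at hw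
  · rintro rfl; simp at hw

lemma zeta_bd_all : ∃ C > 0, ∀ σ t : ℝ, -1 ≤ σ → σ ≤ 3 → 1 ≤ t →
    ‖riemannZeta (σ + t * I)‖ ≤ C * (t + 2) ^ (1 / 2 + max (-σ) 0) * Real.log (t + 2) := by
  obtain ⟨C, hC, hX⟩ := Xf_bd
  have key : ∀ σ t : ℝ, 1 / 2 ≤ σ → σ ≤ 3 → 1 ≤ t →
      ‖riemannZeta (σ + t * I)‖ ≤ 10 * (t + 2) ^ (max (1 - σ) 0) * Real.log (t + 2) := by
    intro σ t h1 h3 ht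
    have hne : (σ + t * I : ℂ) ≠ 1 := by
      intro h; have := congrArg Complex.im h; simp at this; linarith
    have := zeta_bd σ t h1 h3 hne
    rw [abs_of_nonneg (by linarith)] at this
    have h4 : 1 ≤ ‖(σ + t * I - 1 : ℂ)‖ := by
      have := Complex.abs_im_le_norm (σ + t * I - 1 : ℂ)
      simp at this
      exact (ht.trans (le_abs_self t)).trans this
    have h5 : 1 / ‖(σ + t * I - 1 : ℂ)‖ ≤ 1 := by rw [div_le_one (by linarith)]; exact h4
    have h6 : 1 ≤ Real.log (t + 2) := by
      rw [Real.le_log_iff_exp_le (by linarith)]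
      have := Real.exp_one_lt_d9; linarith
    have h7 : 0 ≤ (t + 2) ^ (max (1 - σ) 0) := by positivity
    refine this.trans ?_
    rw [mul_assoc, mul_left_comm]
    gcongr
    linarith
  refine ⟨10 + 10 * C, by positivity, fun σ t h1 h3 ht => ?_⟩
  have h6 : 0 ≤ Real.log (t + 2) := Real.log_nonneg (by linarith)
  rcases le_total (1 / 2) σ with h | h
  · refine (key σ t h h3 ht).trans ?_
    gcongr
    · nlinarith
    · linarith
    · rcases le_total (1 - σ) 0 with h7 | h7
      · rw [max_eq_right h7]; positivity
      · rw [max_eq_left h7]; have := le_max_right (-σ) 0; linarith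
  · set w : ℂ := ((1 - σ : ℝ) : ℂ) + t * I with hw
    have e1 : riemannZeta (σ + t * I) = (starRingEnd ℂ) (riemannZeta (1 - w)) := by
      rw [← riemannZeta_conj]
      congr 1
      simp only [hw, map_sub, map_add, map_mul, conj_ofReal, conj_I, map_one]; push_cast; ring
    rw [e1, Complex.norm_conj, zeta_fe w (by simp [hw]; linarith), norm_mul]
    have b1 := hX (1 - σ) t (by linarith) (by linarith) ht
    have b2 := key (1 - σ) t (by linarith) (by linarith) ht
    have e2 : (1 - (1 - σ)) = σ := by ring
    rw [e2] at b2
    calc _ ≤ (C * t ^ (1 - σ - 1 / 2)) * (10 * (t + 2) ^ (max σ 0) * Real.log (t + 2)) := by gcongr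
      _ ≤ (C * (t + 2) ^ (1 - σ - 1 / 2)) * (10 * (t + 2) ^ (max σ 0) * Real.log (t + 2)) := by
        gcongr <;> linarith
      _ = 10 * C * (t + 2) ^ (1 / 2 + max (-σ) 0) * Real.log (t + 2) := by
        have : (t + 2) ^ (1 / 2 + max (-σ) 0) = (t + 2) ^ (1 - σ - 1 / 2) * (t + 2) ^ (max σ 0) := by
          rw [← Real.rpow_add (by linarith)]; congr 1
          rcases le_total σ 0 with h7 | h7
          · rw [max_eq_right h7, max_eq_left (by linarith)]; ring
          · rw [max_eq_left h7, max_eq_right (by linarith)]; ring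
        rw [this]; ring
      _ ≤ _ := by gcongr; linarith

lemma factor_one (g : ℂ → ℂ) (hg : Differentiable ℂ g) (hne : ∃ z, g z ≠ 0) (p : ℂ) :
    ∃ n : ℕ, ∃ h : ℂ → ℂ, Differentiable ℂ h ∧ (∀ z, g z = (z - p) ^ n * h z) ∧ h p ≠ 0 := by
  have hga : AnalyticOnNhd ℂ g Set.univ := hg.differentiableOn.analyticOnNhd isOpen_univ
  have han : AnalyticAt ℂ g p := hga p trivial
  have hord : analyticOrderAt g p ≠ ⊤ := by
    intro h
    rw [analyticOrderAt_eq_top] at h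
    obtain ⟨z, hz⟩ := hne
    exact hz (hga.eqOn_zero_of_preconnected_of_eventuallyEq_zero isPreconnected_univ trivial h trivial)
  obtain ⟨h, hh, hp, heq⟩ := han.analyticOrderAt_ne_top.1 hord
  set n := analyticOrderNatAt g p
  refine ⟨n, fun z => if z = p then h p else g z / (z - p) ^ n, ?_, ?_, by simpa using hp⟩
  · intro z
    by_cases hz : z = p
    · subst hz
      refine hh.differentiableAt.congr_of_eventuallyEq ?_
      filter_upwards [heq] with w hw
      by_cases hwz : w = z
      · simp [hwz]
      · rw [if_neg hwz, hw, smul_eq_mul, mul_div_cancel_left₀ _ (pow_ne_zero _ (sub_ne_zero.2 hwz))]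
    · have : DifferentiableAt ℂ (fun z => g z / (z - p) ^ n) z :=
        (hg z).div (by fun_prop) (pow_ne_zero _ (sub_ne_zero.2 hz))
      refine this.congr_of_eventuallyEq ?_
      filter_upwards [isOpen_ne.mem_nhds hz] with w hw
      rw [if_neg hw]
  · intro z
    by_cases hz : z = p
    · subst hz
      simpa using heq.self_of_nhds
    · simp only [if_neg hz]
      rw [mul_div_cancel₀ _ (pow_ne_zero _ (sub_ne_zero.2 hz))]

lemma factor_entire (f : ℂ → ℂ) (hf : Differentiable ℂ f) (hne : ∃ z, f z ≠ 0) (S : Finset ℂ) :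
    ∃ m : ℂ → ℕ, ∃ g : ℂ → ℂ, Differentiable ℂ g ∧ (∀ z, f z = (∏ ρ ∈ S, (z - ρ) ^ m ρ) * g z) ∧
      ∀ ρ ∈ S, g ρ ≠ 0 := by
  induction S using Finset.induction_on with
  | empty => exact ⟨0, f, hf, by simp, by simp⟩
  | insert p S hp ih =>
    obtain ⟨m, g, hg, hfg, hS⟩ := ih
    have hgne : ∃ z, g z ≠ 0 := by
      obtain ⟨z, hz⟩ := hne
      exact ⟨z, fun h => hz (by rw [hfg, h, mul_zero])⟩
    obtain ⟨n, h, hh, hgh, hhp⟩ := factor_one g hg hgne p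
    refine ⟨Function.update m p n, h, hh, fun z => ?_, ?_⟩
    · rw [prod_insert hp, Function.update_self, hfg, hgh]
      have : ∏ ρ ∈ S, (z - ρ) ^ Function.update m p n ρ = ∏ ρ ∈ S, (z - ρ) ^ m ρ :=
        prod_congr rfl fun ρ hρ => by
          rw [Function.update_of_ne]; rintro rfl; exact hp hρ
      rw [this]; ring
    · intro ρ hρ
      rcases Finset.mem_insert.1 hρ with rfl | hρ
      · exact hhp
      · intro h0; exact hS ρ hρ (by rw [hgh, h0, mul_zero])

lemma logDeriv_prod_pow {S : Finset ℂ} {q : ℂ → ℂ → ℂ} {m : ℂ → ℕ} {g : ℂ → ℂ} {c : ℂ}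
    (hq : ∀ ρ ∈ S, q ρ c ≠ 0) (hqd : ∀ ρ ∈ S, DifferentiableAt ℂ (q ρ) c) (hg : g c ≠ 0)
    (hgd : DifferentiableAt ℂ g c) :
    logDeriv (fun z => (∏ ρ ∈ S, q ρ z ^ m ρ) * g z) c = ∑ ρ ∈ S, (m ρ : ℂ) * logDeriv (q ρ) c + logDeriv g c := by
  have hd : ∀ ρ ∈ S, DifferentiableAt ℂ (fun z => q ρ z ^ m ρ) c := fun ρ hρ => (hqd ρ hρ).fun_pow _
  rw [logDeriv_mul (f := fun z => ∏ ρ ∈ S, q ρ z ^ m ρ) c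
      (prod_ne_zero_iff.2 fun ρ hρ => pow_ne_zero _ (hq ρ hρ)) hg
      (DifferentiableAt.fun_finsetProd hd) hgd,
    logDeriv_prod (f := fun ρ z => q ρ z ^ m ρ) (fun ρ hρ => pow_ne_zero _ (hq ρ hρ)) hd]
  congr 1
  refine sum_congr rfl fun ρ hρ => ?_
  rw [logDeriv_fun_pow (hqd ρ hρ)]

lemma blaschke {f : ℂ → ℂ} (hf : Differentiable ℂ f) {c : ℂ} {r R R₂ M : ℝ} (hr : 0 < r) (hrR : r < R)
    (hR2 : R < R₂) (hM : ∀ z ∈ Metric.closedBall c R₂, ‖f z‖ ≤ M) (hc : f c ≠ 0)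
    (S : Finset ℂ) (hS : ∀ z, z ∈ S ↔ z ∈ Metric.closedBall c R ∧ f z = 0)
    (hre : ∀ z ∈ S, z.re ≤ c.re) :
    -(logDeriv f c).re ≤ 4 / r * Real.log (M / ‖f c‖) ∧ ∀ ρ₀ ∈ S,
    -(logDeriv f c).re ≤ 4 / r * Real.log (M / ‖f c‖) - ((1 / (c - ρ₀)).re + (ρ₀.re - c.re) / R₂ ^ 2) := by
  obtain ⟨m, g, hg, hfg, hgS⟩ := factor_entire f hf ⟨c, hc⟩ S
  have hR : 0 < R := hr.trans hrR
  have hR20 : 0 < R₂ := hR.trans hR2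
  have hR2c : (R₂ : ℂ) ≠ 0 := by exact_mod_cast hR20.ne'
  set q : ℂ → ℂ → ℂ := fun ρ z => (R₂ ^ 2 - (starRingEnd ℂ) (ρ - c) * (z - c)) / R₂ with hq
  set F : ℂ → ℂ := fun z => (∏ ρ ∈ S, q ρ z ^ m ρ) * g z with hF
  have hqd : ∀ ρ, Differentiable ℂ (q ρ) := fun ρ => by
    intro z; simp only [hq]; fun_prop
  have hFd : Differentiable ℂ F := by
    intro z
    refine DifferentiableAt.mul ?_ (hg z)
    exact DifferentiableAt.fun_finsetProd fun ρ _ => ((hqd ρ) z).pow _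
  have hSn : ∀ ρ ∈ S, ‖ρ - c‖ ≤ R := fun ρ hρ => by
    have := ((hS ρ).1 hρ).1; rwa [Metric.mem_closedBall, dist_eq_norm] at this
  have hcS : ∀ ρ ∈ S, c - ρ ≠ 0 := fun ρ hρ h => by
    have := ((hS ρ).1 hρ).2
    rw [← sub_eq_zero.1 h] at this; exact hc this
  have hqc : ∀ ρ, q ρ c = R₂ := fun ρ => by simp only [hq]; field_simp; simp
  have hqne : ∀ ρ ∈ S, ∀ z ∈ Metric.ball c R, q ρ z ≠ 0 := by
    intro ρ hρ z hz h
    rw [hq, div_eq_zero_iff] at h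
    have h := h.resolve_right hR2c
    have h2 : (R₂ : ℂ) ^ 2 = (starRingEnd ℂ) (ρ - c) * (z - c) := sub_eq_zero.1 h
    have h3 := congrArg norm h2
    rw [norm_mul, norm_conj, norm_pow, norm_real, Real.norm_of_nonneg hR20.le] at h3
    have h4 : ‖z - c‖ < R := by rwa [Metric.mem_ball, dist_eq_norm] at hz
    have h5 := hSn ρ hρ
    nlinarith [norm_nonneg (ρ - c), norm_nonneg (z - c)]
  have hFM : ∀ z ∈ Metric.ball c R₂, ‖F z‖ ≤ M := by
    intro z hz
    refine Complex.norm_le_of_forall_mem_frontier_norm_le Metric.isBounded_ball hFd.diffContOnCl (fun w hw => ?_)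
      (subset_closure hz)
    rw [frontier_ball c hR20.ne', mem_sphere_iff_norm] at hw
    have : ‖F w‖ = ‖f w‖ := by
      rw [hfg, hF, norm_mul, norm_mul, norm_prod, norm_prod]
      congr 1
      refine prod_congr rfl fun ρ hρ => ?_
      rw [norm_pow, norm_pow]
      congr 1
      have e : (R₂ : ℂ) ^ 2 = (starRingEnd ℂ) (w - c) * (w - c) := by
        rw [← Complex.normSq_eq_conj_mul_self, Complex.normSq_eq_norm_sq, hw]; push_cast; ring
      have e2 : (R₂ : ℂ) ^ 2 - (starRingEnd ℂ) (ρ - c) * (w - c) = (starRingEnd ℂ) (w - ρ) * (w - c) := by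
        rw [e]; simp only [map_sub]; ring
      rw [hq]
      simp only
      rw [e2, norm_div, norm_mul, norm_conj, hw, norm_real, Real.norm_of_nonneg hR20.le]
      field_simp
    rw [this]
    exact hM w (by rw [Metric.mem_closedBall, dist_eq_norm, hw])
  have hFne : ∀ z ∈ Metric.ball c R, F z ≠ 0 := by
    intro z hz
    rw [hF]
    refine mul_ne_zero (prod_ne_zero_iff.2 fun ρ hρ => pow_ne_zero _ (hqne ρ hρ z hz)) ?_
    by_cases hzS : z ∈ S
    · exact hgS z hzS
    · intro h0
      exact hzS ((hS z).2 ⟨Metric.ball_subset_closedBall hz, by rw [hfg, h0, mul_zero]⟩)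
  have key := logDeriv_bound_max hr hrR hFd.differentiableOn hFne
    (fun z hz => hFM z (Metric.ball_subset_ball hR2.le hz)) 0
  rw [iteratedDeriv_zero] at key
  have hfc0 : 0 < ‖f c‖ := norm_pos_iff.2 hc
  have hM0 : 0 < M := hfc0.trans_le (hM c (Metric.mem_closedBall_self hR20.le))
  have hFc : ‖f c‖ ≤ ‖F c‖ := by
    rw [hfg, hF, norm_mul, norm_mul, norm_prod, norm_prod]
    gcongr with ρ hρ
    rw [norm_pow, norm_pow]
    gcongr
    rw [hqc, norm_real, Real.norm_of_nonneg hR20.le, norm_sub_rev]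
    exact (hSn ρ hρ).trans hR2.le
  have hlog : Real.log (M / ‖F c‖) ≤ Real.log (M / ‖f c‖) := by
    apply Real.log_le_log
    · exact div_pos hM0 (hfc0.trans_le hFc)
    · gcongr
  have hgc : g c ≠ 0 := fun h0 => hc (by rw [hfg, h0, mul_zero])
  have l1 : logDeriv f c = ∑ ρ ∈ S, (m ρ : ℂ) * (1 / (c - ρ)) + logDeriv g c := by
    have : f = fun z => (∏ ρ ∈ S, (z - ρ) ^ m ρ) * g z := funext hfg
    rw [this, logDeriv_prod_pow (q := fun ρ z => z - ρ) hcS (fun ρ _ => by fun_prop) hgc (hg c)]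
    congr 1
    refine sum_congr rfl fun ρ _ => ?_
    rw [logDeriv_apply]
    simp
  have l2 : logDeriv F c = ∑ ρ ∈ S, (m ρ : ℂ) * (-(starRingEnd ℂ) (ρ - c) / R₂ ^ 2) + logDeriv g c := by
    rw [hF, logDeriv_prod_pow (fun ρ _ => by rw [hqc]; exact hR2c) (fun ρ _ => hqd ρ c) hgc (hg c)]
    congr 1
    refine sum_congr rfl fun ρ _ => ?_
    rw [logDeriv_apply, hqc]
    have : HasDerivAt (q ρ) ((-((starRingEnd ℂ) (ρ - c) * 1)) / R₂) c := by
      simp only [hq]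
      exact (((((hasDerivAt_id c).sub_const c).const_mul _).const_sub _)).div_const _
    rw [this.deriv]; field_simp
  have hterm : ∀ ρ ∈ S, 0 ≤ (1 / (c - ρ)).re + (ρ.re - c.re) / R₂ ^ 2 := by
    intro ρ hρ
    have e1 : (1 / (c - ρ)).re = (c.re - ρ.re) / ‖ρ - c‖ ^ 2 := by
      rw [one_div, Complex.inv_re, Complex.normSq_eq_norm_sq, norm_sub_rev, sub_re]
    have h0 : 0 < ‖ρ - c‖ := norm_pos_iff.2 (by
      have := hcS ρ hρ; intro h; apply this; rw [← neg_sub, h, neg_zero])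
    have h1 : ‖ρ - c‖ ^ 2 ≤ R₂ ^ 2 := by
      have := hSn ρ hρ; gcongr; linarith
    have h2 : (c.re - ρ.re) / R₂ ^ 2 ≤ (c.re - ρ.re) / ‖ρ - c‖ ^ 2 := by
      apply div_le_div_of_nonneg_left (by linarith [hre ρ hρ]) (by positivity) h1
    rw [e1]
    have : (ρ.re - c.re) / R₂ ^ 2 = -((c.re - ρ.re) / R₂ ^ 2) := by ring
    linarith
  have hdiff : (logDeriv f c).re = (logDeriv F c).re +
      ∑ ρ ∈ S, (m ρ : ℝ) * ((1 / (c - ρ)).re + (ρ.re - c.re) / R₂ ^ 2) := by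
    have : logDeriv f c - logDeriv F c = ∑ ρ ∈ S, (m ρ : ℂ) * (1 / (c - ρ) + (starRingEnd ℂ) (ρ - c) / R₂ ^ 2) := by
      rw [l1, l2, add_sub_add_right_eq_sub, ← sum_sub_distrib]
      exact sum_congr rfl fun ρ _ => by ring
    have h2 := congrArg Complex.re this
    rw [sub_re, re_sum] at h2
    rw [← sub_eq_iff_eq_add', h2]
    refine sum_congr rfl fun ρ _ => ?_
    rw [show (m ρ : ℂ) = ((m ρ : ℝ) : ℂ) by simp, re_ofReal_mul, add_re]
    congr 2
    rw [show (R₂ : ℂ) ^ 2 = ((R₂ ^ 2 : ℝ) : ℂ) by push_cast; ring, div_ofReal_re]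
    simp
  have hFre : -(logDeriv F c).re ≤ 4 / r * Real.log (M / ‖f c‖) := by
    have h1 : -(logDeriv F c).re ≤ ‖logDeriv F c‖ := by
      have := Complex.abs_re_le_norm (logDeriv F c)
      exact (neg_le_abs _).trans this
    refine h1.trans (key.trans ?_)
    norm_num
    rw [← mul_assoc, inv_mul_eq_div]
    gcongr
  constructor
  · rw [hdiff]
    have : 0 ≤ ∑ ρ ∈ S, (m ρ : ℝ) * ((1 / (c - ρ)).re + (ρ.re - c.re) / R₂ ^ 2) :=
      sum_nonneg fun ρ hρ => mul_nonneg (Nat.cast_nonneg _) (hterm ρ hρ)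
    linarith
  · intro ρ₀ hρ₀
    rw [hdiff]
    have h1 := single_le_sum (f := fun ρ => (m ρ : ℝ) * ((1 / (c - ρ)).re + (ρ.re - c.re) / R₂ ^ 2))
      (fun ρ hρ => mul_nonneg (Nat.cast_nonneg _) (hterm ρ hρ)) hρ₀
    have hm : 1 ≤ m ρ₀ := by
      by_contra hlt
      have hm0 : m ρ₀ = 0 := by omega
      have h0 := ((hS ρ₀).1 hρ₀).2
      rw [hfg, mul_eq_zero] at h0
      rcases h0 with h0 | h0
      · obtain ⟨ρ, hρ, h⟩ := prod_eq_zero_iff.1 h0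
        rcases eq_or_ne ρ ρ₀ with rfl | hn
        · rw [hm0, pow_zero] at h; exact one_ne_zero h
        · exact pow_ne_zero _ (sub_ne_zero.2 hn.symm) h
      · exact hgS ρ₀ hρ₀ h0
    have hm' : (1 : ℝ) ≤ m ρ₀ := by exact_mod_cast hm
    have := hterm ρ₀ hρ₀
    nlinarith

lemma zeta1_zero_iff (z : ℂ) : riemannZeta₁ z = 0 ↔ riemannZeta z = 0 := by
  rcases eq_or_ne z 1 with rfl | hz
  · rw [riemannZeta₁_one]; simp [riemannZeta_one_ne_zero]
  · rw [riemannZeta_eq_inv_sub_mul hz]; simp [sub_ne_zero.2 hz]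

lemma zeta1_ne_zero_of_one_le (z : ℂ) (hz : 1 ≤ z.re) : riemannZeta₁ z ≠ 0 := by
  rw [Ne, zeta1_zero_iff]; exact riemannZeta_ne_zero_of_one_le_re hz

lemma logDeriv_zeta (s : ℂ) (hs : s ≠ 1) (h0 : riemannZeta s ≠ 0) :
    logDeriv riemannZeta s = logDeriv riemannZeta₁ s - 1 / (s - 1) := by
  have h1 : riemannZeta =ᶠ[nhds s] fun z => (z - 1)⁻¹ * riemannZeta₁ z := by
    filter_upwards [isOpen_ne.mem_nhds hs] with z hz
    exact riemannZeta_eq_inv_sub_mul hz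
  have hs1 : s - 1 ≠ 0 := sub_ne_zero.2 hs
  rw [(logDeriv_congr_nhds h1).self_of_nhds, logDeriv_mul (f := fun z : ℂ => (z - 1)⁻¹) s (inv_ne_zero hs1)
    (by rwa [Ne, zeta1_zero_iff]) (DifferentiableAt.fun_inv (by fun_prop) hs1) (differentiable_riemannZeta₁ s)]
  have : logDeriv (fun z : ℂ => (z - 1)⁻¹) s = -(1 / (s - 1)) := by
    rw [logDeriv_apply]
    have : HasDerivAt (fun z : ℂ => (z - 1)⁻¹) (-1 / (s - 1) ^ 2) s := ((hasDerivAt_id s).sub_const 1).inv hs1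
    rw [this.deriv]; field_simp
  rw [this]; ring

lemma three_four_one (σ t : ℝ) (hσ : 1 < σ) :
    0 ≤ -(3 * (logDeriv riemannZeta σ).re + 4 * (logDeriv riemannZeta (σ + t * I)).re +
      (logDeriv riemannZeta (σ + (2 * t : ℝ) * I)).re) := by
  have hh : ∀ u : ℝ, HasSum (fun n : ℕ => (LSeries.term (fun n => (ArithmeticFunction.vonMangoldt n : ℂ)) (σ + u * I) n).re)
      (-(logDeriv riemannZeta (σ + u * I)).re) := by
    intro u
    have hre : 1 < (σ + u * I : ℂ).re := by simpa using hσ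
    have h1 := ArithmeticFunction.LSeries_vonMangoldt_eq_deriv_riemannZeta_div hre
    have h2 := (ArithmeticFunction.LSeriesSummable_vonMangoldt hre).LSeriesHasSum
    unfold LSeriesHasSum at h2
    rw [h1] at h2
    have h3 := Complex.hasSum_re h2
    rw [logDeriv_apply]
    convert h3 using 1
    rw [neg_div, neg_re]
  have h0 := hh 0
  have e0 : (σ + (0 : ℝ) * I : ℂ) = σ := by simp
  rw [e0] at h0
  have H := ((h0.mul_left 3).add ((hh t).mul_left 4)).add (hh (2 * t))
  have := H.nonneg fun n => ?_
  · linarith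
  rcases Nat.eq_zero_or_pos n with rfl | hn
  · simp
  have hn' : (n : ℝ) ≠ 0 := by exact_mod_cast hn.ne'
  have hn0 : 0 < (n : ℝ) := by exact_mod_cast hn
  set v : ℝ := Real.log n with hv
  have ht : ∀ u : ℝ, (LSeries.term (fun n => (ArithmeticFunction.vonMangoldt n : ℂ)) (σ + u * I) n).re =
      ArithmeticFunction.vonMangoldt n * Real.exp (-(σ * v)) * Real.cos (u * v) := by
    intro u
    rw [LSeries.term_of_ne_zero hn.ne', div_eq_mul_inv, ← cpow_neg, re_ofReal_mul,
      cpow_def_of_ne_zero (by exact_mod_cast hn.ne'), mul_assoc]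
    congr 1
    rw [← Complex.natCast_log, ← hv, Complex.exp_re]
    have : ((v : ℂ) * -(σ + u * I)) = ((-(σ * v) : ℝ) : ℂ) + ((-(u * v) : ℝ) : ℂ) * I := by push_cast; ring
    rw [this]; simp
  have h4 := ht 0
  rw [e0] at h4
  rw [h4, ht, ht, mul_assoc 2 t v, Real.cos_two_mul]
  simp only [zero_mul, Real.cos_zero]
  have : 0 ≤ ArithmeticFunction.vonMangoldt n * Real.exp (-(σ * v)) :=
    mul_nonneg ArithmeticFunction.vonMangoldt_nonneg (Real.exp_pos _).le
  nlinarith [mul_nonneg this (sq_nonneg (1 + Real.cos (t * v)))]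

lemma logDeriv_zeta1_bd : ∃ C > 0, ∀ σ : ℝ, 1 ≤ σ → σ ≤ 2 → ‖logDeriv riemannZeta₁ σ‖ ≤ C := by
  have hc : ContinuousOn (fun σ : ℝ => logDeriv riemannZeta₁ (σ : ℂ)) (Set.Icc 1 2) := by
    intro σ hσ
    apply ContinuousAt.continuousWithinAt
    have h1 : ContinuousAt (logDeriv riemannZeta₁) (σ : ℂ) := by
      have ha : AnalyticAt ℂ riemannZeta₁ (σ : ℂ) := differentiable_riemannZeta₁.analyticAt _
      exact (ha.deriv.div ha (zeta1_ne_zero_of_one_le _ (by simpa using hσ.1))).continuousAt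
    exact ContinuousAt.comp (f := fun σ : ℝ => (σ : ℂ)) h1 continuous_ofReal.continuousAt
  obtain ⟨C, hC⟩ := isCompact_Icc.exists_bound_of_continuousOn hc
  exact ⟨|C| + 1, by positivity, fun σ h1 h2 => (hC σ ⟨h1, h2⟩).trans (by linarith [le_abs_self C])⟩

lemma zeta_real_bd : ∃ C > 0, ∀ σ : ℝ, 1 < σ → σ ≤ 2 → ∑' n : ℕ, 1 / (n : ℝ) ^ σ ≤ C / (σ - 1) := by
  have hc : ContinuousOn (fun σ : ℝ => riemannZeta₁ (σ : ℂ)) (Set.Icc 1 2) :=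
    (differentiable_riemannZeta₁.continuous.comp continuous_ofReal).continuousOn
  obtain ⟨C, hC⟩ := isCompact_Icc.exists_bound_of_continuousOn hc
  refine ⟨|C| + 1, by positivity, fun σ h1 h2 => ?_⟩
  have h3 : riemannZeta (σ : ℂ) = ((∑' n : ℕ, 1 / (n : ℝ) ^ σ : ℝ) : ℂ) := by
    rw [zeta_eq_tsum_one_div_nat_cpow (by simpa using h1), ofReal_tsum]
    refine tsum_congr fun n => ?_
    rw [ofReal_div, ofReal_cpow (by positivity)]; simp
  have h4 := congrArg norm h3
  rw [norm_real, riemannZeta_eq_inv_sub_mul (by exact_mod_cast h1.ne'), norm_mul, norm_inv,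
    show (σ : ℂ) - 1 = ((σ - 1 : ℝ) : ℂ) by push_cast; ring, norm_real, Real.norm_of_nonneg (by linarith : 0 ≤ σ - 1)] at h4
  have h5 := hC σ ⟨h1.le, h2⟩
  calc _ ≤ ‖∑' n : ℕ, 1 / (n : ℝ) ^ σ‖ := Real.le_norm_self _
    _ = (σ - 1)⁻¹ * ‖riemannZeta₁ σ‖ := h4.symm
    _ ≤ (σ - 1)⁻¹ * (|C| + 1) := by
      have : 0 < σ - 1 := by linarith
      gcongr; linarith [le_abs_self C]
    _ = _ := by rw [div_eq_inv_mul]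

lemma zeta_inv_bd (s : ℂ) (hs : 1 < s.re) : ‖riemannZeta s‖⁻¹ ≤ ∑' n : ℕ, 1 / (n : ℝ) ^ s.re := by
  have h1 := ArithmeticFunction.LSeries_zeta_mul_Lseries_moebius hs
  rw [ArithmeticFunction.LSeries_zeta_eq_riemannZeta hs] at h1
  have h2 : ‖riemannZeta s‖⁻¹ = ‖LSeries (fun n => (ArithmeticFunction.moebius n : ℂ)) s‖ := by
    have := congrArg norm h1
    rw [norm_mul, norm_one] at this
    exact inv_eq_of_mul_eq_one_right this
  rw [h2, LSeries]
  have hsum : Summable (fun n : ℕ => 1 / (n : ℝ) ^ s.re) := Real.summable_one_div_nat_rpow.2 hs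
  refine tsum_of_norm_bounded hsum.hasSum fun n => ?_
  rcases Nat.eq_zero_or_pos n with rfl | hn
  · simp; positivity
  rw [LSeries.norm_term_eq, if_neg hn.ne']
  gcongr
  have := ArithmeticFunction.abs_moebius_le_one (n := n)
  rw [Complex.norm_intCast]
  exact_mod_cast this

lemma zeta1_disc_bd (a t : ℝ) (ha : 0 < a) (ha8 : a ≤ 1 / 8) (z : ℂ)
    (hz : z ∈ Metric.closedBall (((1 + a : ℝ) : ℂ) + t * I) (1 / 2)) : ‖riemannZeta₁ z‖ ≤ (|t| + 4) ^ 4 := by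
  rw [Metric.mem_closedBall, dist_eq_norm] at hz
  have hre := (Complex.abs_re_le_norm _).trans hz
  have him := (Complex.abs_im_le_norm _).trans hz
  simp at hre him
  rw [abs_le] at hre
  have him2 : |z.im| ≤ |t| + 1 / 2 := by
    have := abs_sub_abs_le_abs_sub z.im t; linarith
  have ht := abs_nonneg t
  set X := |t| + 4 with hX
  have hX4 : 4 ≤ X := by linarith
  rcases eq_or_ne z 1 with rfl | hz1
  · rw [riemannZeta₁_one, norm_one]; exact one_le_pow₀ (by linarith)
  have e : riemannZeta₁ z = (z - 1) * riemannZeta z := by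
    rw [riemannZeta_eq_inv_sub_mul hz1, mul_inv_cancel_left₀ (sub_ne_zero.2 hz1)]
  have hb := zeta_bd z.re z.im (by linarith) (by linarith) (by rw [re_add_im]; exact hz1)
  rw [re_add_im] at hb
  have hp : 0 < ‖z - 1‖ := norm_pos_iff.2 (sub_ne_zero.2 hz1)
  have hz1n : ‖z - 1‖ ≤ X := by
    have : ‖z - 1‖ ≤ ‖z - (((1 + a : ℝ) : ℂ) + t * I)‖ + ‖((a : ℝ) : ℂ) + t * I‖ := by
      have e : z - 1 = (z - (((1 + a : ℝ) : ℂ) + t * I)) + (((a : ℝ) : ℂ) + t * I) := by push_cast; ring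
      rw [e]; exact norm_add_le _ _
    have h2 := norm_add_le ((a : ℝ) : ℂ) (t * I)
    simp [abs_of_pos ha] at h2
    linarith
  have hpow : (|z.im| + 2) ^ (max (1 - z.re) 0) ≤ X := by
    calc (|z.im| + 2) ^ (max (1 - z.re) 0) ≤ X ^ (max (1 - z.re) 0) := by gcongr; linarith
      _ ≤ X ^ (1 : ℝ) := Real.rpow_le_rpow_of_exponent_le (by linarith) (max_le (by linarith) (by norm_num))
      _ = X := Real.rpow_one X
  have hlog : Real.log (|z.im| + 2) ≤ X := by
    have := Real.log_le_sub_one_of_pos (by positivity : 0 < |z.im| + 2); linarith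
  rw [e, norm_mul]
  calc ‖z - 1‖ * ‖riemannZeta z‖ ≤ ‖z - 1‖ * (X * (8 + X + 1 / ‖z - 1‖)) := by
        refine mul_le_mul_of_nonneg_left (hb.trans ?_) hp.le
        gcongr
        have := Real.log_nonneg (by linarith [abs_nonneg z.im] : 1 ≤ |z.im| + 2)
        positivity
    _ = X * (‖z - 1‖ * (8 + X) + 1) := by field_simp
    _ ≤ X * (X * (8 + X) + 1) := by gcongr
    _ ≤ X ^ 4 := by nlinarith [mul_self_nonneg X, pow_pos (by linarith : 0 < X) 3]

lemma zeros_finset (c : ℂ) (R : ℝ) : ∃ S : Finset ℂ, ∀ z, z ∈ S ↔ z ∈ Metric.closedBall c R ∧ riemannZeta₁ z = 0 := by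
  have h := IsCompact.inter_riemannZetaZeros_finite (isCompact_closedBall c R)
  refine ⟨h.toFinset, fun z => ?_⟩
  rw [Set.Finite.mem_toFinset, zeta1_zero_iff]
  rfl

lemma zfr_step : ∃ K > 0, ∀ a t : ℝ, 0 < a → a ≤ 1 / 8 → 1 ≤ |t| →
    -(logDeriv riemannZeta (((1 + a : ℝ) : ℂ) + t * I)).re ≤ K * (Real.log (|t| + 4) + Real.log (1 / a)) ∧
    ∀ β : ℝ, 1 - 1 / 8 ≤ β → riemannZeta (β + t * I) = 0 →
    -(logDeriv riemannZeta (((1 + a : ℝ) : ℂ) + t * I)).re ≤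
      K * (Real.log (|t| + 4) + Real.log (1 / a)) - 1 / (1 + a - β) := by
  obtain ⟨C, hC, hz⟩ := zeta_real_bd
  refine ⟨128 + 32 * |Real.log C| + 2, by positivity, fun a t ha ha8 ht => ?_⟩
  set c : ℂ := ((1 + a : ℝ) : ℂ) + t * I with hc
  have hcre : c.re = 1 + a := by simp [hc]
  have hcim : c.im = t := by simp [hc]
  obtain ⟨S, hS⟩ := zeros_finset c (1 / 4)
  have hc0 : riemannZeta₁ c ≠ 0 := zeta1_ne_zero_of_one_le c (by rw [hcre]; linarith)
  have hz0 : riemannZeta c ≠ 0 := by rwa [Ne, ← zeta1_zero_iff]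
  have hre : ∀ z ∈ S, z.re ≤ c.re := by
    intro z hzS
    by_contra hlt
    push Not at hlt
    exact zeta1_ne_zero_of_one_le z (by rw [hcre] at hlt; linarith) ((hS z).1 hzS).2
  have B := blaschke differentiable_riemannZeta₁ (c := c) (r := 1 / 8) (R := 1 / 4) (R₂ := 1 / 2) (by norm_num)
    (by norm_num) (by norm_num) (fun z hz => zeta1_disc_bd a t ha ha8 z hz) hc0 S hS hre
  have hc1 : c ≠ 1 := by
    intro h; have := congrArg Complex.im h
    rw [hcim] at this; simp at this; rw [this] at ht; simp at ht; linarith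
  have hn1 : 1 ≤ ‖c - 1‖ := by
    have := Complex.abs_im_le_norm (c - 1)
    rw [sub_im, hcim] at this; simp at this; linarith
  have hX : 1 ≤ |t| + 4 := by linarith
  have hla : 0 ≤ Real.log (1 / a) := Real.log_nonneg (by rw [le_div_iff₀ ha]; linarith)
  have hlX : 1 ≤ Real.log (|t| + 4) := by
    rw [Real.le_log_iff_exp_le (by linarith)]
    have := Real.exp_one_lt_d9; linarith
  have hlog : Real.log ((|t| + 4) ^ 4 / ‖riemannZeta₁ c‖) ≤ 4 * Real.log (|t| + 4) + (|Real.log C| + Real.log (1 / a)) := by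
    have h1 : ‖riemannZeta₁ c‖⁻¹ ≤ C / a := by
      have e : riemannZeta₁ c = (c - 1) * riemannZeta c := by
        rw [riemannZeta_eq_inv_sub_mul hc1, mul_inv_cancel_left₀ (sub_ne_zero.2 hc1)]
      have h2 := zeta_inv_bd c (by rw [hcre]; linarith)
      rw [hcre] at h2
      have h3 := hz (1 + a) (by linarith) (by linarith)
      rw [add_sub_cancel_left] at h3
      rw [e, norm_mul, mul_inv]
      calc ‖c - 1‖⁻¹ * ‖riemannZeta c‖⁻¹ ≤ 1 * (C / a) := by
            gcongr
            · exact inv_le_one_of_one_le₀ hn1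
            · exact h2.trans h3
        _ = _ := one_mul _
    rw [div_eq_mul_inv]
    have hp : 0 < ‖riemannZeta₁ c‖⁻¹ := inv_pos.2 (norm_pos_iff.2 hc0)
    calc Real.log ((|t| + 4) ^ 4 * ‖riemannZeta₁ c‖⁻¹) ≤ Real.log ((|t| + 4) ^ 4 * (C / a)) := by
          apply Real.log_le_log (by positivity); gcongr
      _ = 4 * Real.log (|t| + 4) + (Real.log C + Real.log (1 / a)) := by
          rw [Real.log_mul (by positivity) (by positivity), Real.log_pow, div_eq_mul_one_div,
            Real.log_mul (by positivity) (by positivity)]; push_cast; ring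
      _ ≤ _ := by gcongr; exact le_abs_self _
  have hrel : -(logDeriv riemannZeta c).re ≤ -(logDeriv riemannZeta₁ c).re + 1 := by
    rw [logDeriv_zeta c hc1 hz0, sub_re]
    have : (1 / (c - 1)).re ≤ 1 := by
      refine (Complex.re_le_norm _).trans ?_
      rw [norm_div, norm_one, div_le_one (by linarith)]; exact hn1
    linarith
  have hlC := abs_nonneg (Real.log C)
  have h32 : 4 / (1 / 8 : ℝ) = 32 := by norm_num
  rw [h32] at B
  have main : 32 * Real.log ((|t| + 4) ^ 4 / ‖riemannZeta₁ c‖) + 2 ≤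
      (128 + 32 * |Real.log C| + 2) * (Real.log (|t| + 4) + Real.log (1 / a)) := by
    nlinarith [mul_nonneg hlC hla, mul_nonneg hlC (by linarith : 0 ≤ Real.log (|t| + 4) - 1)]
  refine ⟨by linarith [B.1], fun β hβ hzero => ?_⟩
  have hβ1 : β < 1 := by
    by_contra h; push Not at h
    exact riemannZeta_ne_zero_of_one_le_re (s := β + t * I) (by simpa using h) hzero
  have hmem : (β + t * I : ℂ) ∈ S := by
    rw [hS, zeta1_zero_iff]
    refine ⟨?_, hzero⟩
    rw [Metric.mem_closedBall, dist_eq_norm]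
    have : (β + t * I : ℂ) - c = ((β - (1 + a) : ℝ) : ℂ) := by rw [hc]; push_cast; ring
    rw [this, norm_real, Real.norm_eq_abs, abs_le]
    constructor <;> linarith
  have B2 := B.2 _ hmem
  have e1 : (1 / (c - (β + t * I))).re = 1 / (1 + a - β) := by
    have : c - (β + t * I) = ((1 + a - β : ℝ) : ℂ) := by rw [hc]; push_cast; ring
    rw [this, show (1 : ℂ) / ((1 + a - β : ℝ) : ℂ) = ((1 / (1 + a - β) : ℝ) : ℂ) by push_cast; ring, ofReal_re]
  have e2 : (β + t * I : ℂ).re = β := by simp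
  rw [e1, e2, hcre] at B2
  have : -1 ≤ (β - (1 + a)) / (1 / 2) ^ 2 := by rw [le_div_iff₀ (by norm_num)]; linarith
  linarith

lemma zfr_large : ∃ c > 0, ∀ β γ : ℝ, 1 ≤ |γ| → riemannZeta (β + γ * I) = 0 → β ≤ 1 - c / Real.log (|γ| + 4) := by
  obtain ⟨K, hK, h1⟩ := zfr_step
  obtain ⟨C, hC, h2⟩ := logDeriv_zeta1_bd
  set D := 3 * C + 6 * K with hD
  set θ := min (1 / (6 * D)) (1 / 4) with hθ
  have hD0 : 0 < D := by positivity
  have hθ0 : 0 < θ := lt_min (by positivity) (by norm_num)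
  have hθ4 : θ ≤ 1 / 4 := min_le_right _ _
  have hθD : D * θ ≤ 1 / 6 := by
    have := min_le_left (1 / (6 * D)) (1 / 4)
    calc D * θ ≤ D * (1 / (6 * D)) := by gcongr
      _ = 1 / 6 := by field_simp
  refine ⟨θ ^ 2 / 7, by positivity, fun β γ hγ hz => ?_⟩
  set L := Real.log (|γ| + 4) with hL
  have hL1 : 1 ≤ L := by
    rw [Real.le_log_iff_exp_le (by linarith)]
    have := Real.exp_one_lt_d9; linarith
  have hβ1 : β < 1 := by
    by_contra h; push Not at h
    exact riemannZeta_ne_zero_of_one_le_re (s := β + γ * I) (by simpa using h) hz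
  rcases lt_or_ge β (1 - 1 / 8) with hβ | hβ
  · have : θ ^ 2 / 7 / L ≤ 1 / 8 := by
      rw [div_le_iff₀ (by linarith)]; nlinarith
    linarith
  set a := θ ^ 2 / L with ha
  have ha0 : 0 < a := by positivity
  have ha8 : a ≤ 1 / 8 := by rw [ha, div_le_iff₀ (by linarith)]; nlinarith
  have hla : Real.log (1 / a) ≤ L + 2 / θ * L := by
    have e : 1 / a = L * (1 / θ) ^ 2 := by rw [ha]; field_simp
    rw [e, Real.log_mul (by positivity) (by positivity), Real.log_pow]
    have a1 := Real.log_le_self (by linarith : 0 ≤ L)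
    have a2 := Real.log_le_self (by positivity : 0 ≤ 1 / θ)
    have : 2 / θ ≤ 2 / θ * L := by
      have : 0 < 2 / θ := by positivity
      nlinarith
    push_cast
    have e3 : 2 / θ = 2 * (1 / θ) := by ring
    linarith
  have s1 := (h1 a γ ha0 ha8 hγ).2 β hβ hz
  have hγ2 : 1 ≤ |2 * γ| := by rw [abs_mul, abs_two]; linarith
  have s2 := (h1 a (2 * γ) ha0 ha8 hγ2).1
  have hL2 : Real.log (|2 * γ| + 4) ≤ 2 * L := by
    rw [hL, show 2 * Real.log (|γ| + 4) = Real.log ((|γ| + 4) ^ 2) by rw [Real.log_pow]; push_cast; ring]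
    apply Real.log_le_log (by positivity)
    rw [abs_mul, abs_two]; nlinarith [abs_nonneg γ]
  have s3 : -(logDeriv riemannZeta ((1 + a : ℝ) : ℂ)).re ≤ 1 / a + C := by
    have hne : ((1 + a : ℝ) : ℂ) ≠ 1 := by
      intro h; have := congrArg Complex.re h; simp at this; linarith
    rw [logDeriv_zeta _ hne (riemannZeta_ne_zero_of_one_le_re (by simp; linarith)), sub_re]
    have e : ((1 : ℂ) / (((1 + a : ℝ) : ℂ) - 1)).re = 1 / a := by
      rw [show (1 : ℂ) / (((1 + a : ℝ) : ℂ) - 1) = ((1 / a : ℝ) : ℂ) by push_cast; ring, ofReal_re]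
    have := (Complex.abs_re_le_norm (logDeriv riemannZeta₁ ((1 + a : ℝ) : ℂ))).trans (h2 (1 + a) (by linarith) (by linarith))
    have := neg_le_abs (logDeriv riemannZeta₁ ((1 + a : ℝ) : ℂ)).re
    linarith
  have s4 := three_four_one (1 + a) γ (by linarith)
  have hla0 : 0 ≤ Real.log (1 / a) := Real.log_nonneg (by rw [le_div_iff₀ ha0]; linarith)
  have tot : 4 * (1 / (1 + a - β)) ≤ 3 / a + 3 * C + 6 * K * L + 5 * K * Real.log (1 / a) := by
    have : K * Real.log (|2 * γ| + 4) ≤ K * (2 * L) := by gcongr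
    have e : 3 / a = 3 * (1 / a) := by ring
    rw [e]
    nlinarith
  have tot2 : 4 * (1 / (1 + a - β)) ≤ 7 / 2 * (1 / a) := by
    have k1 : K * Real.log (1 / a) ≤ K * (L + 2 / θ * L) := by gcongr
    have e1 : 1 / a = L / θ ^ 2 := by rw [ha]; field_simp
    have k2 : 3 * C + 6 * K * L + 5 * K * (L + 2 / θ * L) ≤ D * L * (2 + 2 / θ) := by
      have : 0 < 2 / θ := by positivity
      have t1 : 3 * C ≤ 3 * C * L := by nlinarith
      have t2 : 0 ≤ K * L * (2 / θ) := by positivity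
      have t3 : 0 ≤ C * L * (2 / θ) := by positivity
      have t4 : 0 ≤ C * L := by positivity
      have t5 : 0 ≤ K * L := by positivity
      rw [hD]; nlinarith
    have k3 : D * L * (2 + 2 / θ) ≤ 1 / 2 * (L / θ ^ 2) := by
      have : D * L * (2 + 2 / θ) = (D * θ) * (2 * θ + 2) * (L / θ ^ 2) := by field_simp
      rw [this]
      have : 0 < L / θ ^ 2 := by positivity
      have : (D * θ) * (2 * θ + 2) ≤ 1 / 2 := by nlinarith
      gcongr
    have e : 3 / a = 3 * (1 / a) := by ring
    linarith
  have hpos : 0 < 1 + a - β := by linarith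
  have fin : 8 / 7 * a ≤ 1 + a - β := by
    have h := mul_le_mul_of_nonneg_left tot2 (by positivity : 0 ≤ a * (1 + a - β))
    have e1 : a * (1 + a - β) * (4 * (1 / (1 + a - β))) = 4 * a := by field_simp
    have e2 : a * (1 + a - β) * (7 / 2 * (1 / a)) = 7 / 2 * (1 + a - β) := by field_simp
    rw [e1, e2] at h; linarith
  have : θ ^ 2 / 7 / L = a / 7 := by rw [ha]; ring
  linarith

lemma zfr : ∃ c > 0, ∀ s : ℂ, riemannZeta s = 0 → s.re ≤ 1 - c / Real.log (|s.im| + 4) := by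
  obtain ⟨c, hc, h⟩ := zfr_large
  have hfin := IsCompact.inter_riemannZetaZeros_finite (isCompact_RC 0 1 (-1) 1)
  have hη : ∃ η > 0, ∀ s ∈ RC 0 1 (-1) 1 ∩ riemannZetaZeros, s.re ≤ 1 - η := by
    rcases (RC 0 1 (-1) 1 ∩ riemannZetaZeros).eq_empty_or_nonempty with he | hne
    · exact ⟨1, one_pos, by simp [he]⟩
    · obtain ⟨z, hz, hmax⟩ := Set.exists_max_image _ Complex.re hfin hne
      have : z.re < 1 := by
        by_contra hh; push Not at hh
        exact riemannZeta_ne_zero_of_one_le_re hh hz.2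
      exact ⟨1 - z.re, by linarith, fun s hs => by linarith [hmax s hs]⟩
  obtain ⟨η, hη0, hη⟩ := hη
  refine ⟨min c (min η 1), by positivity, fun s hs => ?_⟩
  have hL1 : 1 ≤ Real.log (|s.im| + 4) := by
    rw [Real.le_log_iff_exp_le (by positivity)]
    have := Real.exp_one_lt_d9; linarith [abs_nonneg s.im]
  have hs1 : s.re < 1 := by
    by_contra hh; push Not at hh
    exact riemannZeta_ne_zero_of_one_le_re hh hs
  rcases le_or_gt 1 |s.im| with h1 | h1
  · have h2 := h s.re s.im h1 (by rwa [re_add_im])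
    have : min c (min η 1) / Real.log (|s.im| + 4) ≤ c / Real.log (|s.im| + 4) := by
      gcongr; exact min_le_left _ _
    linarith
  · have h3 : min c (min η 1) / Real.log (|s.im| + 4) ≤ min η 1 := by
      refine (div_le_self (by positivity) hL1).trans (min_le_right _ _)
    rcases lt_or_ge s.re 0 with h0 | h0
    · have := min_le_right η 1; linarith
    · have := hη s ⟨⟨h0, hs1.le, (abs_lt.1 h1).1.le, (abs_lt.1 h1).2.le⟩, hs⟩
      have := min_le_left η 1; linarith

/-- the coefficients `∑_{d ∣ n} Λ(d) log² d` -/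
noncomputable def bb (n : ℕ) : ℝ := ∑ d ∈ n.divisors, ArithmeticFunction.vonMangoldt d * Real.log d ^ 2

lemma bb_nonneg (n : ℕ) : 0 ≤ bb n :=
  sum_nonneg fun d _ => mul_nonneg ArithmeticFunction.vonMangoldt_nonneg (sq_nonneg _)

lemma bb_zero : bb 0 = 0 := by simp [bb]

lemma bb_le (n : ℕ) : bb n ≤ Real.log n ^ 3 := by
  calc bb n ≤ ∑ d ∈ n.divisors, ArithmeticFunction.vonMangoldt d * Real.log n ^ 2 := by
        refine sum_le_sum fun d hd => ?_
        have hd0 : 0 < d := Nat.pos_of_mem_divisors hd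
        have hle := Nat.divisor_le hd
        have h1 : (1 : ℝ) ≤ d := by exact_mod_cast hd0
        have h2 : (d : ℝ) ≤ n := by exact_mod_cast hle
        have h3 := Real.log_nonneg h1
        have h4 : Real.log d ≤ Real.log n := Real.log_le_log (by linarith) h2
        have := ArithmeticFunction.vonMangoldt_nonneg (n := d)
        gcongr
    _ = Real.log n ^ 3 := by rw [← sum_mul, ArithmeticFunction.vonMangoldt_sum]; ring

lemma Gop_hasSum (s : ℂ) (hs : 1 < s.re) :
    HasSum (fun n : ℕ => (bb n : ℂ) * (n : ℂ) ^ (-s)) (-(Gop riemannZeta s)) := by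
  set g : ArithmeticFunction ℂ := ⟨fun n => LSeries.logMul^[2] (fun n => (ArithmeticFunction.vonMangoldt n : ℂ)) n, by simp [LSeries.logMul]⟩ with hg
  have hab : LSeries.abscissaOfAbsConv (fun n => (ArithmeticFunction.vonMangoldt n : ℂ)) < s.re := by
    refine lt_of_le_of_lt (LSeries.abscissaOfAbsConv_le_of_forall_lt_LSeriesSummable (x := 1) fun y hy => ?_)
      (by exact_mod_cast hs)
    exact ArithmeticFunction.LSeriesSummable_vonMangoldt (by simpa using hy)
  have hgs : LSeriesSummable (fun n => g n) s := by
    apply LSeriesSummable_of_abscissaOfAbsConv_lt_re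
    have := LSeries.absicssaOfAbsConv_logPowMul (f := (fun n => (ArithmeticFunction.vonMangoldt n : ℂ))) (m := 2)
    exact lt_of_eq_of_lt this hab
  have hz : LSeriesSummable (fun n => ((ArithmeticFunction.zeta : ArithmeticFunction ℂ) n)) s := by
    have := ArithmeticFunction.LSeriesSummable_zeta_iff.2 hs
    simpa using this
  have h1 := ArithmeticFunction.LSeriesHasSum_mul hz.LSeriesHasSum hgs.LSeriesHasSum
  have hzv : LSeries (fun n => ((ArithmeticFunction.zeta : ArithmeticFunction ℂ) n)) s = riemannZeta s := by
    have := ArithmeticFunction.LSeries_zeta_eq_riemannZeta hs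
    simpa using this
  have hder : iteratedDeriv 2 (logDeriv riemannZeta) s = -LSeries (fun n => g n) s := by
    have he : logDeriv riemannZeta =ᶠ[nhds s] fun z => -(LSeries (fun n => (ArithmeticFunction.vonMangoldt n : ℂ)) z) := by
      filter_upwards [(isOpen_lt continuous_const continuous_re).mem_nhds hs] with z hz
      rw [ArithmeticFunction.LSeries_vonMangoldt_eq_deriv_riemannZeta_div hz, logDeriv_apply, neg_div, neg_neg]
    rw [he.iteratedDeriv_eq, iteratedDeriv_fun_neg, LSeries_iteratedDeriv 2 hab]
    simp [hg]
  have hval : LSeries (fun n => ((ArithmeticFunction.zeta : ArithmeticFunction ℂ) n)) s * LSeries (fun n => g n) s =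
      -(Gop riemannZeta s) := by
    rw [Gop, hder, hzv]; ring
  rw [hval] at h1
  unfold LSeriesHasSum at h1
  convert h1 using 1
  funext n
  rcases Nat.eq_zero_or_pos n with rfl | hn
  · simp [bb_zero]
  rw [LSeries.term_of_ne_zero hn.ne', cpow_neg, div_eq_mul_inv]
  congr 1
  rw [ArithmeticFunction.coe_zeta_mul_apply, bb]
  push_cast
  refine sum_congr rfl fun d hd => ?_
  simp only [hg, ArithmeticFunction.coe_mk, Function.iterate_succ, Function.iterate_zero, Function.comp, LSeries.logMul, id,
    Complex.natCast_log]
  ring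

lemma bb_term_norm (n : ℕ) (s : ℂ) (hs : 0 < s.re) : ‖(bb n : ℂ) * (n : ℂ) ^ (-s)‖ = bb n * (n : ℝ) ^ (-s.re) := by
  rcases Nat.eq_zero_or_pos n with rfl | hn
  · simp [bb_zero]
  rw [norm_mul, norm_real, Real.norm_of_nonneg (bb_nonneg n), show (n : ℂ) = ((n : ℝ) : ℂ) by simp,
    Complex.norm_cpow_eq_rpow_re_of_pos (by exact_mod_cast hn), neg_re]

lemma bb_summable (σ : ℝ) (hσ : 1 < σ) : Summable (fun n : ℕ => bb n * (n : ℝ) ^ (-σ)) := by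
  have h := (Gop_hasSum (σ : ℂ) (by simpa using hσ)).summable.norm
  refine h.congr fun n => ?_
  rw [bb_term_norm n _ (by simp; linarith)]; simp

lemma log_pow_le (n : ℕ) (ε : ℝ) (hε : 0 < ε) : Real.log n ^ 3 ≤ 216 / ε ^ 3 * (n : ℝ) ^ (ε / 2) := by
  have h := Real.log_le_rpow_div (Nat.cast_nonneg n) (by positivity : 0 < ε / 6)
  have h0 : 0 ≤ Real.log n := Real.log_natCast_nonneg n
  calc Real.log n ^ 3 ≤ ((n : ℝ) ^ (ε / 6) / (ε / 6)) ^ 3 := by gcongr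
    _ = 216 / ε ^ 3 * ((n : ℝ) ^ (ε / 6)) ^ 3 := by rw [div_pow, div_pow]; field_simp; norm_num; ring
    _ = _ := by
      rw [← Real.rpow_natCast ((n : ℝ) ^ (ε / 6)) 3, ← Real.rpow_mul (Nat.cast_nonneg n)]; congr 2; push_cast; ring

lemma bb_sum_bd : ∃ C > 0, ∀ ε : ℝ, 0 < ε → ε ≤ 1 → ∑' n : ℕ, bb n * (n : ℝ) ^ (-(1 + ε)) ≤ C / ε ^ 4 := by
  obtain ⟨C, hC, hz⟩ := zeta_real_bd
  refine ⟨432 * C, by positivity, fun ε h0 h1 => ?_⟩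
  have hS : Summable (fun n : ℕ => 1 / (n : ℝ) ^ (1 + ε / 2)) := Real.summable_one_div_nat_rpow.2 (by linarith)
  calc ∑' n : ℕ, bb n * (n : ℝ) ^ (-(1 + ε)) ≤ ∑' n : ℕ, 216 / ε ^ 3 * (1 / (n : ℝ) ^ (1 + ε / 2)) := by
        refine Summable.tsum_le_tsum (fun n => ?_) (bb_summable _ (by linarith)) (hS.mul_left _)
        rcases Nat.eq_zero_or_pos n with rfl | hn
        · simp [bb_zero]; positivity
        have hn' : (0 : ℝ) < n := by exact_mod_cast hn
        calc bb n * (n : ℝ) ^ (-(1 + ε)) ≤ (216 / ε ^ 3 * (n : ℝ) ^ (ε / 2)) * (n : ℝ) ^ (-(1 + ε)) := by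
              gcongr; exact (bb_le n).trans (log_pow_le n ε h0)
          _ = _ := by
            rw [mul_assoc, ← Real.rpow_add hn', one_div, ← Real.rpow_neg hn'.le]; congr 2; ring
    _ = 216 / ε ^ 3 * ∑' n : ℕ, 1 / (n : ℝ) ^ (1 + ε / 2) := tsum_mul_left
    _ ≤ 216 / ε ^ 3 * (C / (1 + ε / 2 - 1)) := by gcongr; exact hz _ (by linarith) (by linarith)
    _ = _ := by rw [show 1 + ε / 2 - 1 = ε / 2 by ring]; field_simp; ring

/-- summatory function of `bb` -/
noncomputable def BB (x : ℝ) : ℝ := ∑ n ∈ Finset.Icc 1 ⌊x⌋₊, bb n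

lemma taylor_rem {f : ℂ → ℂ} {U : Set ℂ} {c : ℂ} (hU : U ∈ nhds c) (hf : DifferentiableOn ℂ f U) (n : ℕ) :
    ∃ h : ℂ → ℂ, DifferentiableOn ℂ h U ∧ ∀ z, f z =
      ∑ i ∈ range n, iteratedDeriv i f c / (i.factorial : ℂ) * (z - c) ^ i + (z - c) ^ n * h z := by
  have hfa : AnalyticAt ℂ f c := hf.analyticAt hU
  have h0 : AnalyticAt ℂ (fun z => f (c + z)) 0 := by
    apply AnalyticAt.fun_comp (g := f)
    · simpa using hfa
    · fun_prop
  obtain ⟨F, hF, hFe⟩ := h0.exists_eq_sum_add_pow_mul n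
  have key : ∀ z, f z =
      ∑ i ∈ range n, iteratedDeriv i f c / (i.factorial : ℂ) * (z - c) ^ i + (z - c) ^ n * F (z - c) := by
    intro z
    have := hFe (z - c)
    simp only [add_sub_cancel, smul_eq_mul, iteratedDeriv_comp_const_add, add_zero] at this
    rw [this]; congr 1
    exact sum_congr rfl fun i _ => by ring
  refine ⟨fun z => F (z - c), fun z hz => ?_, key⟩
  rcases eq_or_ne z c with rfl | hzc
  · apply DifferentiableAt.differentiableWithinAt
    have h1 : DifferentiableAt ℂ F (z - z) := by simpa using hF.differentiableAt
    exact h1.comp (f := fun w => w - z) z (by fun_prop)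
  · have hz' : z - c ≠ 0 := sub_ne_zero.2 hzc
    have hd : DifferentiableWithinAt ℂ (fun w => (f w -
      ∑ i ∈ range n, iteratedDeriv i f c / (i.factorial : ℂ) * (w - c) ^ i) / (w - c) ^ n) U z := by
      refine DifferentiableWithinAt.fun_div ((hf z hz).fun_sub (by fun_prop)) (by fun_prop) ?_
      exact pow_ne_zero _ hz'
    refine hd.congr_of_eventuallyEq ?_ ?_
    · filter_upwards [mem_nhdsWithin_of_mem_nhds (isOpen_ne.mem_nhds hzc)] with w hw
      have : w - c ≠ 0 := sub_ne_zero.2 hw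
      rw [key w]; field_simp; ring
    · rw [key z]; field_simp; ring

lemma RC_mem_nhds {x0 x1 y0 y1 : ℝ} {p : ℂ} (h0 : x0 < p.re) (h1 : p.re < x1) (h2 : y0 < p.im) (h3 : p.im < y1) :
    RC x0 x1 y0 y1 ∈ nhds p := by
  have : {s : ℂ | x0 < s.re} ∩ {s : ℂ | s.re < x1} ∩ {s : ℂ | y0 < s.im} ∩ {s : ℂ | s.im < y1} ∈ nhds p :=
    IsOpen.mem_nhds ((((isOpen_lt continuous_const continuous_re).inter
      (isOpen_lt continuous_re continuous_const)).inter (isOpen_lt continuous_const continuous_im)).inter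
      (isOpen_lt continuous_im continuous_const)) ⟨⟨⟨h0, h1⟩, h2⟩, h3⟩
  refine Filter.mem_of_superset this ?_
  rintro s ⟨⟨⟨a, b⟩, c⟩, d⟩
  exact ⟨a.le, b.le, c.le, d.le⟩

lemma zero_nontriv {s : ℂ} (hs : riemannZeta s = 0) (him : s.im ≠ 0) : IsNontrivialZero s := by
  have key : ∀ z : ℂ, riemannZeta z = 0 → z.re < 1 := by
    intro z hz; by_contra! h; exact riemannZeta_ne_zero_of_one_le_re h hz
  refine ⟨hs, ?_, key s hs⟩
  have h1 : riemannZeta (1 - s) = 0 := by rw [zeta_fe s him, hs, mul_zero]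
  have := key _ h1
  simp at this; exact this

lemma zetaZeroOrder_eq {ρ : ℂ} (hρ : ρ ≠ 1) {n : ℕ} {g : ℂ → ℂ} (hg : Differentiable ℂ g) (h0 : g ρ ≠ 0)
    (h : ∀ᶠ z in nhds ρ, riemannZeta z = (z - ρ) ^ n * ((z - 1)⁻¹ * g z)) : zetaZeroOrder ρ = n := by
  have hz : AnalyticAt ℂ riemannZeta ρ := differentiableOn_riemannZeta.analyticAt (isOpen_ne.mem_nhds hρ)
  have hρ1 : ρ - 1 ≠ 0 := sub_ne_zero.2 hρ
  have ho : analyticOrderAt riemannZeta ρ = n := by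
    rw [hz.analyticOrderAt_eq_natCast]
    refine ⟨fun z => (z - 1)⁻¹ * g z, ?_, mul_ne_zero (inv_ne_zero hρ1) h0, by simpa using h⟩
    exact AnalyticAt.mul (AnalyticAt.inv (by fun_prop) hρ1) (hg.analyticAt ρ)
  rw [analyticOrderAt_eq_nat_iff_iteratedDeriv_eq_zero hz] at ho
  apply le_antisymm
  · exact Nat.sInf_le ho.2
  · apply le_csInf ⟨n, ho.2⟩
    intro k hk
    by_contra! hlt
    exact hk (ho.1 k hlt)

lemma iterDeriv2_inv_sub (p s : ℂ) (_h : s ≠ p) : iteratedDeriv 2 (fun z => (z - p)⁻¹) s = 2 / (s - p) ^ 3 := by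
  rw [iteratedDeriv_comp_sub_const (f := fun z : ℂ => z⁻¹), iteratedDeriv_eq_iterate]
  have := iter_deriv_inv 2 (s - p)
  rw [show (fun z : ℂ => z⁻¹) = Inv.inv from rfl]
  simp only [this]
  norm_num
  rw [div_eq_mul_inv]

lemma zero_sum_rect (a t0 T : ℝ) (ha : 1 < a) (ht0 : 0 < t0) (hT : t0 < T)
    (hb0 : ∀ s, riemannZeta s = 0 → s.im ≠ t0) (hb1 : ∀ s, riemannZeta s = 0 → s.im ≠ T) :
    rectInt (Gop riemannZeta) (1 - a) a t0 T = 2 * Real.pi * I *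
      ∑ᶠ ρ ∈ {ρ : ℂ | IsNontrivialZero ρ ∧ t0 < ρ.im ∧ ρ.im ≤ T},
    (zetaZeroOrder ρ : ℂ) * iteratedDeriv 2 riemannZeta ρ := by
  have hfin := (isCompact_RC (1 - a) a t0 T).inter_riemannZetaZeros_finite
  set S := hfin.toFinset with hS
  have hSm : ∀ z, z ∈ S ↔ z ∈ RC (1 - a) a t0 T ∧ riemannZeta z = 0 := by
    intro z; simp [hS, Set.Finite.mem_toFinset, mem_riemannZetaZeros]
  have hin : ∀ z ∈ S, 1 - a < z.re ∧ z.re < a ∧ t0 < z.im ∧ z.im < T := by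
    intro z hz
    rw [hSm] at hz
    obtain ⟨⟨h1, h2, h3, h4⟩, h5⟩ := hz
    have hn := zero_nontriv h5 (by linarith)
    refine ⟨by linarith [hn.2.1], by linarith [hn.2.2], lt_of_le_of_ne h3 (hb0 z h5).symm, lt_of_le_of_ne h4 (hb1 z h5)⟩
  have hset : {ρ : ℂ | IsNontrivialZero ρ ∧ t0 < ρ.im ∧ ρ.im ≤ T} = ↑S := by
    ext z
    simp only [Set.mem_ofPred_eq, mem_coe]
    constructor
    · rintro ⟨h1, h2, h3⟩
      rw [hSm]
      exact ⟨⟨by linarith [h1.2.1], by linarith [h1.2.2], h2.le, h3⟩, h1.1⟩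
    · intro hz
      have h1 := hin z hz
      exact ⟨zero_nontriv ((hSm z).1 hz).2 (by linarith), h1.2.2.1, h1.2.2.2.le⟩
  rw [hset, finsum_mem_coe_finset]
  obtain ⟨m, g, hg, hfg, hgS⟩ := factor_entire riemannZeta₁ differentiable_riemannZeta₁
    ⟨1, by rw [riemannZeta₁_one]; simp⟩ S
  have hg0 : ∀ z ∈ RC (1 - a) a t0 T, g z ≠ 0 := by
    intro z hz h0
    have h1 : z ∈ S := by
      rw [hSm, ← zeta1_zero_iff, hfg z, h0, mul_zero]; exact ⟨hz, rfl⟩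
    exact hgS z h1 h0
  have hne1 : ∀ z ∈ RC (1 - a) a t0 T, z ≠ 1 := by
    rintro z ⟨_, _, h, _⟩ rfl
    simp at h; linarith
  have hzm : ∀ z, z ≠ 1 → riemannZeta z = (∏ ρ ∈ S, (z - ρ) ^ m ρ) * ((z - 1)⁻¹ * g z) := by
    intro z hz
    rw [riemannZeta_eq_inv_sub_mul hz, hfg z]; ring
  have hord : ∀ ρ ∈ S, zetaZeroOrder ρ = m ρ := by
    intro ρ hρ
    have hρ1 := hne1 ρ ((hSm ρ).1 hρ).1
    refine zetaZeroOrder_eq hρ1 (g := fun z => (∏ q ∈ S.erase ρ, (z - q) ^ m q) * g z) ?_ ?_ ?_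
    · exact Differentiable.mul (by
        apply Differentiable.fun_finsetProd
        intro i _; fun_prop) hg
    · refine mul_ne_zero (prod_ne_zero_iff.2 fun q hq => pow_ne_zero _ (sub_ne_zero.2 ?_)) (hgS ρ hρ)
      exact (ne_of_mem_erase hq).symm
    · filter_upwards [isOpen_ne.mem_nhds hρ1] with z hz
      rw [hzm z hz, ← mul_prod_erase S _ hρ]; ring
  set g1 : ℂ → ℂ := fun z => (z - 1)⁻¹ * g z with hg1
  have hg1a : ∀ z ∈ RC (1 - a) a t0 T, AnalyticAt ℂ g1 z := fun z hz =>
    AnalyticAt.mul (AnalyticAt.inv (by fun_prop) (sub_ne_zero.2 (hne1 z hz))) (hg.analyticAt z)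
  have hg10 : ∀ z ∈ RC (1 - a) a t0 T, g1 z ≠ 0 := fun z hz =>
    mul_ne_zero (inv_ne_zero (sub_ne_zero.2 (hne1 z hz))) (hg0 z hz)
  have hla : ∀ z ∈ RC (1 - a) a t0 T, AnalyticAt ℂ (logDeriv g1) z := fun z hz =>
    (hg1a z hz).deriv.div (hg1a z hz) (hg10 z hz)
  have hld : ∀ z ∈ RC (1 - a) a t0 T, DifferentiableAt ℂ (iteratedDeriv 2 (logDeriv g1)) z := fun z hz => by
    rw [iteratedDeriv_eq_iterate]
    exact ((hla z hz).iterated_deriv 2).differentiableAt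
  have hzd : DifferentiableOn ℂ riemannZeta (RC (1 - a) a t0 T) :=
    differentiableOn_riemannZeta.mono fun z hz => hne1 z hz
  have hx : 1 - a ≤ a := by linarith
  have hRB : ∀ s ∈ RB (1 - a) a t0 T, ∀ ρ ∈ S, s - ρ ≠ 0 := fun s hs ρ hρ =>
    RB_ne (hin ρ hρ).1 (hin ρ hρ).2.1 (hin ρ hρ).2.2.1 (hin ρ hρ).2.2.2 hs
  have hG : Set.EqOn (Gop riemannZeta) (fun s => ∑ ρ ∈ S, (m ρ : ℂ) * (2 * riemannZeta s / (s - ρ) ^ 3) +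
      riemannZeta s * iteratedDeriv 2 (logDeriv g1) s) (RB (1 - a) a t0 T) := by
    intro s hs
    have hsR := RB_subset _ _ _ _ hs
    have hev : logDeriv riemannZeta =ᶠ[nhds s] fun z => ∑ ρ ∈ S, (m ρ : ℂ) * (z - ρ)⁻¹ + logDeriv g1 z := by
      have h1 : ∀ᶠ z in nhds s, ∀ ρ ∈ S, z - ρ ≠ 0 := by
        rw [Finset.eventually_all]
        intro ρ hρ
        exact ContinuousAt.eventually_ne (by fun_prop) (hRB s hs ρ hρ)
      have h2 : ∀ᶠ z in nhds s, g1 z ≠ 0 := (hg1a s hsR).continuousAt.eventually_ne (hg10 s hsR)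
      have h3 : ∀ᶠ z in nhds s, AnalyticAt ℂ g1 z := (hg1a s hsR).eventually_analyticAt
      filter_upwards [h1, h2, h3, isOpen_ne.mem_nhds (hne1 s hsR)] with z z1 z2 z3 z4
      have he : riemannZeta =ᶠ[nhds z] fun w => (∏ ρ ∈ S, (w - ρ) ^ m ρ) * g1 w := by
        filter_upwards [isOpen_ne.mem_nhds z4] with w hw using hzm w hw
      rw [logDeriv_apply, he.deriv_eq, he.eq_of_nhds, ← logDeriv_apply (f := fun w => (∏ ρ ∈ S, (w - ρ) ^ m ρ) * g1 w),
        logDeriv_prod_pow (q := fun ρ w => w - ρ) z1 (fun ρ _ => by fun_prop) z2 z3.differentiableAt]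
      congr 1
      refine sum_congr rfl fun ρ _ => ?_
      simp [logDeriv_apply]
    have hiv : ∀ ρ ∈ S, AnalyticAt ℂ (fun z => (m ρ : ℂ) * (z - ρ)⁻¹) s := fun ρ hρ =>
      analyticAt_const.mul (AnalyticAt.inv (by fun_prop) (hRB s hs ρ hρ))
    simp only [Gop]
    rw [hev.iteratedDeriv_eq, iteratedDeriv_fun_add (Finset.analyticAt_fun_sum _ hiv).contDiffAt (hla s hsR).contDiffAt,
      iteratedDeriv_fun_sum fun ρ hρ => (hiv ρ hρ).contDiffAt, mul_add, mul_sum]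
    congr 1
    refine sum_congr rfl fun ρ hρ => ?_
    rw [iteratedDeriv_const_mul_field, iterDeriv2_inv_sub ρ s (sub_ne_zero.1 (hRB s hs ρ hρ))]; ring
  have hsc : ∀ ρ ∈ S, ContinuousOn (fun s => (m ρ : ℂ) * (2 * riemannZeta s / (s - ρ) ^ 3)) (RB (1 - a) a t0 T) := by
    intro ρ hρ
    apply ContinuousOn.mul continuousOn_const
    apply ContinuousOn.div (continuousOn_const.mul (hzd.continuousOn.mono (RB_subset _ _ _ _))) (by fun_prop)
    intro s hs; exact pow_ne_zero _ (hRB s hs ρ hρ)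
  have hHd : DifferentiableOn ℂ (fun s => riemannZeta s * iteratedDeriv 2 (logDeriv g1) s) (RC (1 - a) a t0 T) :=
    hzd.mul fun z hz => (hld z hz).differentiableWithinAt
  rw [rectInt_congr hx hT.le hG, rectInt_add hx hT.le (continuousOn_finsetSum _ hsc)
    (hHd.continuousOn.mono (RB_subset _ _ _ _)), rectInt_zero hx hT.le hHd, add_zero,
    rectInt_sum hx hT.le _ _ hsc, mul_sum]
  refine sum_congr rfl fun ρ hρ => ?_
  obtain ⟨i1, i2, i3, i4⟩ := hin ρ hρ
  obtain ⟨h, hh, hhe⟩ := taylor_rem (RC_mem_nhds i1 i2 i3 i4) hzd 3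
  rw [rectInt_const_mul, rectInt_residue i1 i2 i3 i4 2 (fun i => 2 * (iteratedDeriv i riemannZeta ρ / (i.factorial : ℂ)))
    (h := fun s => 2 * h s) (hh.const_mul 2), hord ρ hρ]
  · simp [Nat.factorial]; ring
  · intro s hs
    have := hRB s hs ρ hρ
    conv_lhs => rw [hhe s]
    rw [mul_add, add_div, mul_sum]
    congr 1
    · congr 1; exact sum_congr rfl fun _ _ => by ring
    · field_simp

/-- dominant part of the integrand in Gonek's lemma -/
noncomputable def FN (N : ℝ) (w : ℂ) : ℂ := (N : ℂ) ^ (-w) * Complex.Gamma w * Complex.exp (-(Real.pi * w / 2 * I))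

lemma norm_exp_aux (w : ℂ) : ‖Complex.exp (-(Real.pi * w / 2 * I))‖ = Real.exp (Real.pi * w.im / 2) := by
  rw [Complex.norm_exp]; congr 1
  simp [Complex.mul_re, Complex.mul_im]

lemma FN_norm (N : ℝ) (hN : 0 < N) (w : ℂ) :
    ‖FN N w‖ = N ^ (-w.re) * ‖Complex.Gamma w‖ * Real.exp (Real.pi * w.im / 2) := by
  rw [FN, norm_mul, norm_mul, norm_exp_aux, Complex.norm_cpow_eq_rpow_re_of_pos hN, neg_re]

lemma FN_bd : ∃ C > 0, ∀ N σ t : ℝ, 0 < N → 0 ≤ σ → σ ≤ 3 → 1 ≤ t →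
    ‖FN N (σ + t * I)‖ ≤ C * N ^ (-σ) * t ^ (σ - 1 / 2) := by
  obtain ⟨C, hC, h⟩ := gamma_bd
  refine ⟨C, hC, fun N σ t hN h0 h1 ht => ?_⟩
  rw [FN_norm N hN]
  simp only [add_re, ofReal_re, mul_re, I_re, mul_zero, ofReal_im, I_im, mul_one, sub_self, add_zero, add_im, mul_im, zero_add]
  calc N ^ (-σ) * ‖Complex.Gamma (σ + t * I)‖ * Real.exp (Real.pi * t / 2)
      ≤ N ^ (-σ) * (C * t ^ (σ - 1 / 2) * Real.exp (-(Real.pi * t / 2))) * Real.exp (Real.pi * t / 2) := by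
        gcongr; exact h σ t h0 h1 ht
    _ = C * N ^ (-σ) * t ^ (σ - 1 / 2) * (Real.exp (-(Real.pi * t / 2)) * Real.exp (Real.pi * t / 2)) := by ring
    _ = _ := by rw [← Real.exp_add]; simp

lemma FN_low (N σ t : ℝ) (hN : 0 < N) (hσ : 0 < σ) :
    ‖FN N (σ + t * I)‖ ≤ N ^ (-σ) * Real.Gamma σ * Real.exp (Real.pi * t / 2) := by
  rw [FN_norm N hN]
  simp only [add_re, ofReal_re, mul_re, I_re, mul_zero, ofReal_im, I_im, mul_one, sub_self, add_zero, add_im, mul_im, zero_add]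
  gcongr
  exact norm_Gamma_le σ t hσ

lemma FN_succ (N : ℝ) (hN : 0 < N) (w : ℂ) (hw : w ≠ 0) : FN N (w + 1) = FN N w * (w / (I * N)) := by
  have hN' : (N : ℂ) ≠ 0 := by exact_mod_cast hN.ne'
  rw [FN, FN, Complex.Gamma_add_one w hw, show -(w + 1) = -w - 1 by ring, Complex.cpow_sub _ _ hN', Complex.cpow_one,
    show -(Real.pi * (w + 1) / 2 * I) = -(Real.pi * w / 2 * I) + (-(Real.pi / 2 * I)) by ring, Complex.exp_add,
    Complex.exp_neg (Real.pi / 2 * I), Complex.exp_pi_div_two_mul_I]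
  field_simp

lemma FN_symm (N σ t : ℝ) (hN : 0 < N) (ht : 0 ≤ t) : ‖FN N (σ + (-t : ℝ) * I)‖ ≤ ‖FN N (σ + t * I)‖ := by
  rw [FN_norm N hN, FN_norm N hN]
  have : Complex.Gamma (σ + (-t : ℝ) * I) = (starRingEnd ℂ) (Complex.Gamma (σ + t * I)) := by
    rw [← Complex.Gamma_conj]; congr 1; simp [Complex.conj_ofReal]
  rw [this, RCLike.norm_conj]
  simp only [add_re, ofReal_re, mul_re, I_re, mul_zero, ofReal_im, I_im, mul_one, sub_self, add_zero, add_im, mul_im, zero_add]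
  gcongr; linarith

lemma FN_diff (N : ℝ) (hN : 0 < N) (w : ℂ) (hw : ∀ m : ℕ, w ≠ -m) : DifferentiableAt ℂ (FN N) w := by
  have hN' : (N : ℂ) ≠ 0 := by exact_mod_cast hN.ne'
  unfold FN
  refine (DifferentiableAt.mul ?_ (Complex.differentiableAt_Gamma w hw)).mul (by fun_prop)
  exact DifferentiableAt.const_cpow (by fun_prop) (.inl hN')

/-- `k` shifts to the left on a horizontal line -/
lemma FN_shift (N T σ : ℝ) (hN : 0 < N) (hT : 0 < T) (k : ℕ) :
    ‖FN N ((σ - k : ℝ) + T * I)‖ ≤ ‖FN N (σ + T * I)‖ * (N / T) ^ k := by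
  induction k with
  | zero => simp
  | succ k ih =>
    set w : ℂ := ((σ - (k + 1 : ℕ) : ℝ) : ℂ) + T * I with hw
    have him : w.im = T := by simp [hw]
    have hw0 : w ≠ 0 := by
      intro h; rw [h] at him; simp at him; linarith
    have h1 := FN_succ N hN w hw0
    have h2 : w + 1 = ((σ - k : ℝ) : ℂ) + T * I := by rw [hw]; push_cast; ring
    have h3 : T ≤ ‖w‖ := by rw [← him]; exact (le_abs_self _).trans (abs_im_le_norm w)
    rw [h2] at h1
    have h4 : ‖FN N w‖ = ‖FN N (((σ - k : ℝ) : ℂ) + T * I)‖ * (N / ‖w‖) := by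
      rw [h1, norm_mul, norm_div, norm_mul, norm_I, norm_real, Real.norm_of_nonneg hN.le]
      have : ‖w‖ ≠ 0 := norm_ne_zero_iff.2 hw0
      field_simp
    rw [h4, pow_succ, ← mul_assoc]
    gcongr

lemma FN_vert_decay (N a T : ℝ) (hN : 0 < N) (ha : 1 < a) (ha2 : a < 2) :
    Tendsto (fun k : ℕ => ∫ t in (-T)..T, FN N ((a - k : ℝ) + t * I)) atTop (nhds 0) := by
  have hc : Continuous (fun t : ℝ => FN N ((a - 2 : ℝ) + t * I)) := by
    rw [continuous_iff_continuousAt]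
    intro t
    have : ContinuousAt (FN N) ((a - 2 : ℝ) + t * I) := by
      apply (FN_diff N hN _ _).continuousAt
      intro m h
      have := congrArg re h
      simp at this
      have h1 : (m : ℝ) < 1 := by linarith
      have h2 : 0 < (m : ℝ) := by linarith
      norm_cast at h1 h2; omega
    exact ContinuousAt.comp (f := fun t : ℝ => (((a - 2 : ℝ) : ℂ) + t * I)) this (by fun_prop)
  obtain ⟨B, hB⟩ := (isCompact_uIcc (a := -T) (b := T)).exists_bound_of_continuousOn hc.continuousOn
  have hB0 : 0 ≤ B := (norm_nonneg _).trans (hB T Set.right_mem_uIcc)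
  have key : ∀ j : ℕ, ∀ t ∈ Set.uIcc (-T) T, ‖FN N ((a - (j + 2 : ℕ) : ℝ) + t * I)‖ ≤ B * (N ^ j / j.factorial) := by
    intro j t ht
    induction j with
    | zero => simpa using hB t ht
    | succ j ih =>
      set w : ℂ := ((a - (j + 1 + 2 : ℕ) : ℝ) : ℂ) + t * I with hw
      have hre : w.re = a - (j + 3) := by simp [hw]; ring
      have h3 : (j : ℝ) + 1 ≤ ‖w‖ := by
        refine le_trans ?_ (abs_re_le_norm w)
        rw [hre, abs_of_neg (by linarith)]; linarith
      have hw0 : w ≠ 0 := by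
        intro h; rw [h] at h3; simp at h3; linarith
      have h1 := FN_succ N hN w hw0
      have h2 : w + 1 = ((a - (j + 2 : ℕ) : ℝ) : ℂ) + t * I := by rw [hw]; push_cast; ring
      rw [h2] at h1
      rw [h1, norm_mul, norm_div, norm_mul, norm_I, norm_real, Real.norm_of_nonneg hN.le, one_mul] at ih
      have hn : 0 < ‖w‖ := norm_pos_iff.2 hw0
      have hj : (0 : ℝ) < j + 1 := by positivity
      calc ‖FN N w‖ = (‖FN N w‖ * (‖w‖ / N)) * N / ‖w‖ := by field_simp
        _ ≤ (B * (N ^ j / j.factorial)) * N / (j + 1) := by gcongr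
        _ = _ := by rw [Nat.factorial_succ]; push_cast; field_simp; ring
  rw [← tendsto_add_atTop_iff_nat 2]
  have h0 : Tendsto (fun j : ℕ => B * (N ^ j / j.factorial) * |T - -T|) atTop (nhds 0) := by
    have := ((FloorSemiring.tendsto_pow_div_factorial_atTop N).const_mul B).mul_const |T - -T|
    simpa using this
  refine squeeze_zero_norm (fun j => ?_) h0
  exact intervalIntegral.norm_integral_le_of_norm_le_const fun t ht => key j t (Set.uIoc_subset_uIcc ht)

lemma FN_strip_res (N a T : ℝ) (hN : 0 < N) (ha : 1 < a) (ha2 : a < 2) (hT : 0 < T) (k : ℕ) :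
    rectInt (FN N) (a - (k + 1) - 1) (a - (k + 1)) (-T) T = 2 * Real.pi * I * ((-(I * N)) ^ k / k.factorial) := by
  have hN' : (N : ℂ) ≠ 0 := by exact_mod_cast hN.ne'
  set p : ℂ := -(k : ℂ) with hp
  have hpre : p.re = -k := by simp [hp]
  have hpim : p.im = 0 := by simp [hp]
  have i1 : a - (k + 1) - 1 < p.re := by rw [hpre]; linarith
  have i2 : p.re < a - (k + 1) := by rw [hpre]; linarith
  have i3 : -T < p.im := by rw [hpim]; linarith
  have i4 : p.im < T := by rw [hpim]; linarith
  set φ : ℂ → ℂ := fun w => (N : ℂ) ^ (-w) * Complex.exp (-(Real.pi * w / 2 * I)) *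
    (Complex.Gamma (w + k + 1) / ∏ j ∈ range k, (w + j)) with hφ
  have hprod : ∀ w ∈ RC (a - (k + 1) - 1) (a - (k + 1)) (-T) T, ∏ j ∈ range k, (w + j) ≠ 0 := by
    intro w hw
    rw [prod_ne_zero_iff]
    intro j hj h
    have h1 := congrArg re h
    simp at h1
    have h2 : (j : ℝ) + 1 ≤ k := by exact_mod_cast mem_range.1 hj
    have := hw.2.1
    linarith
  have hφd : DifferentiableOn ℂ φ (RC (a - (k + 1) - 1) (a - (k + 1)) (-T) T) := by
    intro w hw
    apply DifferentiableAt.differentiableWithinAt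
    refine DifferentiableAt.mul (DifferentiableAt.mul (DifferentiableAt.const_cpow (by fun_prop) (.inl hN')) (by fun_prop)) ?_
    refine DifferentiableAt.fun_div ?_ (DifferentiableAt.fun_finsetProd fun j _ => by fun_prop) (hprod w hw)
    refine DifferentiableAt.comp (g := Complex.Gamma) (f := fun w : ℂ => w + k + 1) w ?_ (by fun_prop)
    apply Complex.differentiableAt_Gamma
    intro m h
    have h1 := congrArg re h
    simp at h1
    have := hw.1
    have h2 : (0 : ℝ) ≤ m := by positivity
    linarith
  obtain ⟨h, hh, hhe⟩ := taylor_rem (RC_mem_nhds i1 i2 i3 i4) hφd 1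
  have hFφ : ∀ s ∈ RB (a - (k + 1) - 1) (a - (k + 1)) (-T) T, FN N s = φ s / (s - p) := by
    intro s hs
    have hsp := RB_ne i1 i2 i3 i4 hs
    have hne : ∀ j ≤ k, s + j ≠ 0 := by
      intro j hj
      rcases lt_or_eq_of_le hj with hj | rfl
      · exact (prod_ne_zero_iff.1 (hprod s hs.1)) j (mem_range.2 hj)
      · simpa [hp] using hsp
    have hG : ∀ n ≤ k + 1, Complex.Gamma (s + n) = Complex.Gamma s * ∏ j ∈ range n, (s + j) := by
      intro n hn
      induction n with
      | zero => simp
      | succ n ih =>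
        rw [prod_range_succ, ← mul_assoc, ← ih (by omega), Nat.cast_succ, ← add_assoc,
          Complex.Gamma_add_one _ (hne n (by omega))]; ring
    have := hG (k + 1) le_rfl
    rw [prod_range_succ] at this
    push_cast at this
    rw [hφ, FN]
    simp only
    rw [add_assoc s, this, hp, sub_neg_eq_add]
    have e1 := hprod s hs.1
    have e2 := hne k le_rfl
    field_simp
  rw [rectInt_residue i1 i2 i3 i4 0 (fun _ => φ p) hh]
  · congr 1
    rw [hφ]
    simp only [hp]
    rw [neg_add_cancel, zero_add, Complex.Gamma_one, neg_neg, Complex.cpow_natCast]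
    have e1 : Complex.exp (-(Real.pi * -(k : ℂ) / 2 * I)) = I ^ k := by
      rw [show -(Real.pi * -(k : ℂ) / 2 * I) = k * (Real.pi / 2 * I) by ring, Complex.exp_nat_mul,
        Complex.exp_pi_div_two_mul_I]
    have e2 : ∏ j ∈ range k, (-(k : ℂ) + j) = (-1) ^ k * k.factorial := by
      rw [← prod_range_add_one_eq_factorial, Nat.cast_prod, ← Finset.prod_range_reflect,
        show ((-1 : ℂ)) ^ k = ∏ j ∈ range k, (-1 : ℂ) by simp, ← prod_mul_distrib]
      refine prod_congr rfl fun j hj => ?_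
      have : j + 1 ≤ k := mem_range.1 hj
      rw [show k - 1 - j = k - (j + 1) by omega, Nat.cast_sub this]; push_cast; ring
    rw [e1, e2, show -(I * (N : ℂ)) = (-1) * (I * N) by ring, mul_pow, mul_pow]
    have e3 : ((-1 : ℂ)) ^ k * (-1) ^ k = 1 := by rw [← mul_pow]; simp
    have e4 : ((-1 : ℂ)) ^ k ≠ 0 := by simp
    have e5 : (k.factorial : ℂ) ≠ 0 := by exact_mod_cast Nat.factorial_ne_zero k
    field_simp
    linear_combination -e3
  · intro s hs
    have hsp := RB_ne i1 i2 i3 i4 hs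
    rw [hFφ s hs, hhe s]
    simp
    field_simp

lemma rp_eq (N T σ : ℝ) (hN : 0 < N) (hT : 0 < T) : N ^ (-σ) * T ^ (σ - 1 / 2) = T ^ (-(1 / 2) : ℝ) * (T / N) ^ σ := by
  rw [Real.div_rpow hT.le hN.le, sub_eq_add_neg, Real.rpow_add hT, Real.rpow_neg hN.le]
  field_simp

lemma FN_main_A : ∃ C > 0, ∀ N a T t0 : ℝ, 1 ≤ N → 1 < a → a < 2 → 1 ≤ t0 → t0 ≤ 2 → 2 ≤ T → N < T →
    ‖(∫ t in t0..T, FN N (a + t * I)) - 2 * Real.pi * Complex.exp (-(I * N))‖ ≤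
      C * (N ^ (-a) + T ^ (a - 1 / 2) * N ^ (-a) * (T / (T - N))) := by
  obtain ⟨C, hC, hb⟩ := FN_bd
  refine ⟨Real.exp Real.pi + 2 * C, by positivity, fun N a T t0 hN1 ha ha2 ht1 ht2 hT hNT => ?_⟩
  have hN : 0 < N := by linarith
  have hT0 : 0 < T := by linarith
  have hNa : 0 < N ^ (-a) := Real.rpow_pos_of_pos hN _
  set M : ℝ := C * (T ^ (a - 1 / 2) * N ^ (-a)) with hM
  have hM0 : 0 < M := by positivity
  set V : ℕ → ℂ := fun k => ∫ t in (-T)..T, FN N ((a - k : ℝ) + t * I) with hV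
  set r : ℝ := N / T with hr
  have hr0 : 0 < r := by positivity
  have hr1 : r < 1 := by rw [hr, div_lt_one hT0]; exact hNT
  have htop : ∀ σ : ℝ, a - 1 ≤ σ → σ ≤ a → ‖FN N (σ + T * I)‖ ≤ M := by
    intro σ h1 h2
    refine (hb N σ T hN (by linarith) (by linarith) (by linarith)).trans ?_
    rw [hM, mul_assoc, mul_comm (T ^ (a - 1 / 2)), rp_eq N T σ hN hT0, rp_eq N T a hN hT0]
    gcongr
    rw [le_div_iff₀ hN]; linarith
  have htopk : ∀ (k : ℕ) (σ : ℝ), a - k - 1 ≤ σ → σ ≤ a - k → ‖FN N (σ + T * I)‖ ≤ M * r ^ k := by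
    intro k σ h1 h2
    have h3 := FN_shift N T (σ + k) hN hT0 k
    rw [show σ + k - k = σ by ring] at h3
    refine h3.trans ?_
    gcongr
    exact htop _ (by linarith) (by linarith)
  have hedge : ∀ (k : ℕ) (y : ℝ), (y = T ∨ y = -T) →
      ‖∫ x in (a - k - 1)..(a - k), FN N (x + y * I)‖ ≤ M * r ^ k := by
    intro k y hy
    have := intervalIntegral.norm_integral_le_of_norm_le_const (a := a - k - 1) (b := a - k) (C := M * r ^ k)
      (f := fun x : ℝ => FN N (x + y * I)) (fun x hx => ?_)
    · refine this.trans (le_of_eq ?_)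
      rw [show a - k - (a - k - 1) = 1 by ring]; simp
    · rw [Set.uIoc_of_le (by linarith)] at hx
      rcases hy with rfl | rfl
      · exact htopk k x hx.1.le hx.2
      · exact (FN_symm N x T hN hT0.le).trans (htopk k x hx.1.le hx.2)
  set R : ℕ → ℂ := fun k => rectInt (FN N) (a - k - 1) (a - k) (-T) T with hR
  have hstep : ∀ k : ℕ, ‖V k - V (k + 1) - (-I) * R k‖ ≤ 2 * (M * r ^ k) := by
    intro k
    have e : V k - V (k + 1) - (-I) * R k = -I * ((∫ x in (a - k - 1)..(a - k), FN N (x + T * I)) -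
        ∫ x in (a - k - 1)..(a - k), FN N (x + (-T : ℝ) * I)) := by
      simp only [hV, hR, rectInt]
      rw [show (a - (k + 1 : ℕ) : ℝ) = a - k - 1 by push_cast; ring]
      ring_nf
      simp only [I_sq]
      ring_nf
    rw [e, norm_mul, norm_neg, norm_I, one_mul]
    refine (norm_sub_le _ _).trans ?_
    linarith [hedge k T (.inl rfl), hedge k (-T) (.inr rfl)]
  have hR0 : R 0 = 0 := by
    simp only [hR]
    apply rectInt_zero (by linarith) (by linarith)
    intro s hs
    apply (FN_diff N hN s _).differentiableWithinAt
    rintro m rfl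
    have := hs.1
    simp at this
    have h2 : (0 : ℝ) ≤ m := by positivity
    linarith
  have hRs : ∀ k : ℕ, R (k + 1) = 2 * Real.pi * I * ((-(I * N)) ^ k / k.factorial) := by
    intro k
    have := FN_strip_res N a T hN ha ha2 hT0 k
    simp only [hR]; push_cast; exact this
  have hsum : ∀ K : ℕ, ‖V 0 - V (K + 1) - 2 * Real.pi * ∑ j ∈ range K, (-(I * N)) ^ j / (j.factorial : ℂ)‖ ≤
      2 * M * (1 - r)⁻¹ := by
    intro K
    have e : V 0 - V (K + 1) - 2 * Real.pi * ∑ j ∈ range K, (-(I * N)) ^ j / (j.factorial : ℂ) =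
        ∑ k ∈ range (K + 1), (V k - V (k + 1) - (-I) * R k) := by
      rw [sum_sub_distrib, Finset.sum_range_sub', ← mul_sum, sum_range_succ', hR0, add_zero]
      simp only [hRs]
      rw [← mul_sum, ← mul_assoc]
      congr 2
      linear_combination (2 * (Real.pi : ℂ)) * I_mul_I
    rw [e]
    refine (norm_sum_le _ _).trans ?_
    calc ∑ k ∈ range (K + 1), ‖V k - V (k + 1) - (-I) * R k‖ ≤ ∑ k ∈ range (K + 1), 2 * (M * r ^ k) :=
          sum_le_sum fun k _ => hstep k
      _ = 2 * M * ∑ k ∈ range (K + 1), r ^ k := by rw [mul_sum]; exact sum_congr rfl fun _ _ => by ring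
      _ ≤ 2 * M * (1 - r)⁻¹ := by
        gcongr
        rw [← tsum_geometric_of_lt_one hr0.le hr1]
        exact (summable_geometric_of_lt_one hr0.le hr1).sum_le_tsum _ fun _ _ => by positivity
  have hlim : Tendsto (fun K : ℕ => V 0 - V (K + 1) - 2 * Real.pi * ∑ j ∈ range K, (-(I * N)) ^ j / (j.factorial : ℂ))
      atTop (nhds (V 0 - 0 - 2 * Real.pi * Complex.exp (-(I * N)))) := by
    have h1 := (FN_vert_decay N a T hN ha ha2).comp (tendsto_add_atTop_nat 1)
    have h2 : Tendsto (fun K : ℕ => ∑ j ∈ range K, (-(I * N)) ^ j / (j.factorial : ℂ)) atTop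
        (nhds (Complex.exp (-(I * N)))) := by
      have := (NormedSpace.expSeries_div_hasSum_exp (-(I * N) : ℂ)).tendsto_sum_nat
      rwa [← Complex.exp_eq_exp_ℂ] at this
    exact (tendsto_const_nhds.sub h1).sub (h2.const_mul _)
  have hfin := le_of_tendsto hlim.norm (Eventually.of_forall hsum)
  have hcont : Continuous (fun t : ℝ => FN N (a + t * I)) := by
    rw [continuous_iff_continuousAt]
    intro t
    have : ContinuousAt (FN N) (a + t * I) := by
      apply (FN_diff N hN _ _).continuousAt
      intro m h
      have := congrArg re h
      simp at this
      have h2 : (0 : ℝ) ≤ m := by positivity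
      linarith
    exact ContinuousAt.comp (f := fun t : ℝ => ((a : ℂ) + t * I)) this (by fun_prop)
  have hsplit : V 0 = (∫ t in (-T)..t0, FN N (a + t * I)) + ∫ t in t0..T, FN N (a + t * I) := by
    rw [intervalIntegral.integral_add_adjacent_intervals (hcont.intervalIntegrable _ _) (hcont.intervalIntegrable _ _)]
    simp [hV]
  have hlow : ‖∫ t in (-T)..t0, FN N (a + t * I)‖ ≤ Real.exp Real.pi * N ^ (-a) := by
    have hG : Real.Gamma a ≤ 1 := by
      have := Real.convexOn_Gamma.2 (show (1 : ℝ) ∈ Set.Ioi 0 by simp) (show (2 : ℝ) ∈ Set.Ioi 0 by simp)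
        (show 0 ≤ 2 - a by linarith) (show 0 ≤ a - 1 by linarith) (by ring)
      simp only [smul_eq_mul, Real.Gamma_one, Real.Gamma_two] at this
      rw [show (2 - a) * 1 + (a - 1) * 2 = a by ring] at this
      linarith
    have hd : ∀ t : ℝ, HasDerivAt (fun t : ℝ => N ^ (-a) * Real.exp (Real.pi * t / 2)) 
        (N ^ (-a) * (Real.exp (Real.pi * t / 2) * (Real.pi / 2))) t := by
      intro t
      have : HasDerivAt (fun t : ℝ => Real.pi * t / 2) (Real.pi / 2) t := by
        simpa using ((hasDerivAt_id t).const_mul Real.pi).div_const 2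
      exact (this.exp).const_mul _
    have hle := intervalIntegral.norm_integral_le_of_norm_le (μ := MeasureTheory.volume)
      (f := fun t : ℝ => FN N (a + t * I))
      (g := fun t : ℝ => N ^ (-a) * (Real.exp (Real.pi * t / 2) * (Real.pi / 2))) (a := -T) (b := t0) (by linarith)
      (Eventually.of_forall fun t _ => ?_) (Continuous.intervalIntegrable (by fun_prop) _ _)
    · refine hle.trans ?_
      rw [intervalIntegral.integral_eq_sub_of_hasDerivAt (fun t _ => hd t) (Continuous.intervalIntegrable (by fun_prop) _ _)]
      have h1 : Real.exp (Real.pi * t0 / 2) ≤ Real.exp Real.pi := by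
        apply Real.exp_le_exp.2; nlinarith [Real.pi_pos]
      have h2 := Real.exp_pos (Real.pi * -T / 2)
      nlinarith
    · refine (FN_low N a t hN (by linarith)).trans ?_
      rw [mul_assoc]
      apply mul_le_mul_of_nonneg_left _ hNa.le
      have h1 := Real.exp_pos (Real.pi * t / 2)
      have h3 : 1 ≤ Real.pi / 2 := by linarith [Real.two_le_pi]
      calc Real.Gamma a * Real.exp (Real.pi * t / 2) ≤ 1 * Real.exp (Real.pi * t / 2) := by gcongr
        _ ≤ _ := by nlinarith
  have e : (∫ t in t0..T, FN N (a + t * I)) - 2 * Real.pi * Complex.exp (-(I * N)) =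
      (V 0 - 0 - 2 * Real.pi * Complex.exp (-(I * N))) - ∫ t in (-T)..t0, FN N (a + t * I) := by
    rw [hsplit]; ring
  rw [e]
  refine (norm_sub_le _ _).trans ?_
  have e2 : (1 - r)⁻¹ = T / (T - N) := by
    rw [hr]; field_simp
  rw [e2] at hfin
  have hp : 0 < T ^ (a - 1 / 2) * N ^ (-a) * (T / (T - N)) := by
    have : 0 < T - N := by linarith
    positivity
  rw [hM] at hfin
  have h1 := Real.exp_pos Real.pi
  nlinarith [mul_pos h1 hp, mul_pos hC hNa]

lemma FN_cont (N a : ℝ) (hN : 0 < N) (ha : 0 < a) : Continuous (fun t : ℝ => FN N (a + t * I)) := by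
  rw [continuous_iff_continuousAt]
  intro t
  have : ContinuousAt (FN N) (a + t * I) := by
    apply (FN_diff N hN _ _).continuousAt
    intro m h
    have := congrArg re h
    simp at this
    have h2 : (0 : ℝ) ≤ m := by positivity
    linarith
  exact ContinuousAt.comp (f := fun t : ℝ => ((a : ℂ) + t * I)) this (by fun_prop)

lemma FN_main_B : ∃ C > 0, ∀ N a T t0 : ℝ, 4 ≤ N → 1 < a → a < 2 → 1 ≤ t0 → t0 ≤ 2 → 2 ≤ T → T < N →
    ‖(∫ t in t0..T, FN N (a + t * I))‖ ≤
      C * (N ^ (-a) + T ^ (a - 1 / 2) * N ^ (-a) * (N / (N - T))) := by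
  obtain ⟨C, hC, hb⟩ := FN_bd
  refine ⟨16 * C, by positivity, fun N a T t0 hN1 ha ha2 ht1 ht2 hT hNT => ?_⟩
  have hN : 0 < N := by linarith
  have hN' : (N : ℂ) ≠ 0 := by exact_mod_cast hN.ne'
  have hT0 : 0 < T := by linarith
  have hNT' : 0 < N - T := by linarith
  have hNa : 0 < N ^ (-a) := Real.rpow_pos_of_pos hN _
  set q : ℂ → ℂ := fun w => 1 - w / (I * N) with hq
  have hqre : ∀ w : ℂ, (q w).re = (N - w.im) / N := by
    intro w
    have : q w = 1 + w * I / N := by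
      simp only [hq]; field_simp; linear_combination (-w) * I_sq
    rw [this]
    simp [Complex.div_ofReal_re]; field_simp; ring
  have hqn : ∀ w : ℂ, (N - w.im) / N ≤ ‖q w‖ := fun w => by
    rw [← hqre]; exact re_le_norm _
  have hq0 : ∀ w : ℂ, w.im ≤ T → q w ≠ 0 := fun w hw h => by
    have := hqn w
    rw [h, norm_zero] at this
    have h2 : 0 < (N - w.im) / N := div_pos (by linarith) hN
    linarith
  have hx : a ≤ a + 1 := by linarith
  have hy : t0 ≤ T := by linarith
  have hFd : ∀ s ∈ RC a (a + 1) t0 T, DifferentiableAt ℂ (FN N) s := by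
    intro s hs
    apply FN_diff N hN
    rintro m rfl
    have := hs.1
    simp at this
    have h2 : (0 : ℝ) ≤ m := by positivity
    linarith
  have hΨd : DifferentiableOn ℂ (fun w => FN N w / q w) (RC a (a + 1) t0 T) := by
    intro s hs
    refine DifferentiableWithinAt.fun_div (hFd s hs).differentiableWithinAt ?_ (hq0 s hs.2.2.2)
    simp only [hq]; fun_prop
  have h0 := rectInt_zero hx hy hΨd
  have hcΨ := hΨd.continuousOn.mono (RB_subset a (a + 1) t0 T)
  have iv0 := edge_v hx hy hcΨ (.inl rfl)
  have iv1 := edge_v hx hy hcΨ (.inr rfl)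
  have hqs : ∀ w, q (w + 1) = q w + I / N := by
    intro w; simp only [hq]; field_simp; linear_combination (-1 : ℂ) * I_sq
  -- the identity
  have hid : ∀ t ∈ Set.uIcc t0 T, FN N (a + t * I) = (FN N (a + t * I) / q (a + t * I) -
      FN N ((a + 1 : ℝ) + t * I) / q ((a + 1 : ℝ) + t * I)) +
      FN N (a + t * I) * (I / N * (q (a + t * I) - 1) / (q (a + t * I) * q ((a + 1 : ℝ) + t * I))) := by
    intro t ht
    rw [Set.uIcc_of_le hy] at ht
    set w : ℂ := a + t * I with hw
    have hwim : w.im = t := by simp [hw]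
    have hw1 : ((a + 1 : ℝ) : ℂ) + t * I = w + 1 := by rw [hw]; push_cast; ring
    have hw0 : w ≠ 0 := by
      intro h; have := congrArg im h; rw [hwim] at this; simp at this; linarith [ht.1]
    have e1 := hq0 w (by rw [hwim]; exact ht.2)
    have e2 := hq0 (w + 1) (by rw [add_im, hwim]; simpa using ht.2)
    rw [hw1, FN_succ N hN w hw0, show w / (I * N) = 1 - q w by simp [hq]]
    have e3 : I / N = q (w + 1) - q w := by rw [hqs w]; ring
    rw [e3]
    field_simp
    ring
  have hqc : ∀ σ : ℝ, Continuous (fun t : ℝ => q (σ + t * I)) := by intro σ; simp only [hq]; fun_prop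
  have hEc : ContinuousOn (fun t : ℝ => FN N (a + t * I) * (I / N * (q (a + t * I) - 1) / (q (a + t * I) * q ((a + 1 : ℝ) + t * I)))) (Set.uIcc t0 T) := by
    refine (FN_cont N a hN (by linarith)).continuousOn.mul (ContinuousOn.div ?_ ?_ ?_)
    · exact (continuous_const.mul ((hqc a).sub continuous_const)).continuousOn
    · exact ((hqc a).mul (hqc (a + 1))).continuousOn
    · intro t ht
      rw [Set.uIcc_of_le hy] at ht
      exact mul_ne_zero (hq0 _ (by simpa using ht.2)) (hq0 _ (by simpa using ht.2))
  have hIint : (∫ t in t0..T, FN N (a + t * I)) = (-I) * ((∫ x in a..(a + 1), FN N (x + t0 * I) / q (x + t0 * I)) -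
      ∫ x in a..(a + 1), FN N (x + T * I) / q (x + T * I)) +
      ∫ t in t0..T, FN N (a + t * I) * (I / N * (q (a + t * I) - 1) / (q (a + t * I) * q ((a + 1 : ℝ) + t * I))) := by
    rw [intervalIntegral.integral_congr hid, intervalIntegral.integral_add (iv0.sub iv1) hEc.intervalIntegrable,
      intervalIntegral.integral_sub iv0 iv1]
    congr 1
    unfold rectInt at h0
    linear_combination (I : ℂ) * h0 + ((∫ t in t0..T, FN N (a + t * I) / q (a + t * I)) -
      ∫ t in t0..T, FN N ((a + 1 : ℝ) + t * I) / q ((a + 1 : ℝ) + t * I)) * I_sq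
  set P : ℝ := T ^ (a - 1 / 2) * N ^ (-a) * (N / (N - T)) with hP
  have hP0 : 0 < P := by positivity
  have htop : ‖∫ x in a..(a + 1), FN N (x + T * I) / q (x + T * I)‖ ≤ C * P := by
    have := intervalIntegral.norm_integral_le_of_norm_le_const (a := a) (b := a + 1) (C := C * P)
      (f := fun x : ℝ => FN N (x + T * I) / q (x + T * I)) (fun x hx => ?_)
    · refine this.trans (le_of_eq ?_)
      simp
    · rw [Set.uIoc_of_le (by linarith)] at hx
      rw [norm_div]
      have h1 : (N - T) / N ≤ ‖q (x + T * I)‖ := by simpa using hqn (x + T * I)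
      have h2 := hb N x T hN (by linarith [hx.1]) (by linarith [hx.2]) (by linarith)
      have h3 : 0 < (N - T) / N := by positivity
      calc _ ≤ C * N ^ (-x) * T ^ (x - 1 / 2) / ((N - T) / N) := by gcongr
        _ = C * (T ^ (-(1 / 2) : ℝ) * (T / N) ^ x) * (N / (N - T)) := by rw [← rp_eq N T x hN hT0]; field_simp
        _ ≤ C * (T ^ (-(1 / 2) : ℝ) * (T / N) ^ a) * (N / (N - T)) := by
          gcongr C * (_ * ?_) * _
          apply Real.rpow_le_rpow_of_exponent_ge (by positivity) _ hx.1.le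
          rw [div_le_one hN]; exact hNT.le
        _ = C * P := by rw [← rp_eq N T a hN hT0, hP]; ring
  have hbot : ‖∫ x in a..(a + 1), FN N (x + t0 * I) / q (x + t0 * I)‖ ≤ C * (16 * N ^ (-a)) := by
    have := intervalIntegral.norm_integral_le_of_norm_le_const (a := a) (b := a + 1) (C := C * (16 * N ^ (-a)))
      (f := fun x : ℝ => FN N (x + t0 * I) / q (x + t0 * I)) (fun x hx => ?_)
    · refine this.trans (le_of_eq ?_)
      simp
    · rw [Set.uIoc_of_le (by linarith)] at hx
      rw [norm_div]
      have h1 : (N - t0) / N ≤ ‖q (x + t0 * I)‖ := by simpa using hqn (x + t0 * I)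
      have h2 := hb N x t0 hN (by linarith [hx.1]) (by linarith [hx.2]) (by linarith)
      have h3 : 1 / 2 ≤ (N - t0) / N := by rw [le_div_iff₀ hN]; linarith
      calc _ ≤ C * N ^ (-x) * t0 ^ (x - 1 / 2) / (1 / 2) := by
            gcongr; linarith
        _ ≤ C * N ^ (-a) * 8 / (1 / 2) := by
          have : t0 ^ (x - 1 / 2) ≤ 8 := by
            calc t0 ^ (x - 1 / 2) ≤ (2 : ℝ) ^ (x - 1 / 2) := Real.rpow_le_rpow (by linarith) ht2 (by linarith [hx.1])
              _ ≤ 2 ^ (3 : ℝ) := Real.rpow_le_rpow_of_exponent_le (by norm_num) (by linarith [hx.2])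
              _ = 8 := by norm_num
          gcongr
          · linarith
          · exact hx.1.le
        _ = _ := by ring
  have hlast : ‖∫ t in t0..T, FN N (a + t * I) * (I / N * (q (a + t * I) - 1) / (q (a + t * I) * q ((a + 1 : ℝ) + t * I)))‖
      ≤ 3 * C * P := by
    set K : ℝ := 3 * C * N ^ (-a) * T ^ (a + 1 / 2) with hK
    have hd : ∀ t ∈ Set.uIcc t0 T, HasDerivAt (fun t : ℝ => K * (N - t)⁻¹) (K * (1 / (N - t) ^ 2)) t := by
      intro t ht
      rw [Set.uIcc_of_le hy] at ht
      have hne : N - t ≠ 0 := by linarith [ht.2]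
      have h1 : HasDerivAt (fun t : ℝ => N - t) (-1) t := by simpa using (hasDerivAt_id t).const_sub N
      have := (h1.inv hne).const_mul K
      refine this.congr_deriv ?_
      ring
    have hci : ContinuousOn (fun t : ℝ => K * (1 / (N - t) ^ 2)) (Set.uIcc t0 T) := by
      refine continuousOn_const.mul (continuousOn_const.div (by fun_prop) ?_)
      intro t ht
      rw [Set.uIcc_of_le hy] at ht
      have hne : N - t ≠ 0 := by linarith [ht.2]
      positivity
    have hle := intervalIntegral.norm_integral_le_of_norm_le (μ := MeasureTheory.volume) (a := t0) (b := T)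
      (f := fun t : ℝ => FN N (a + t * I) * (I / N * (q (a + t * I) - 1) / (q (a + t * I) * q ((a + 1 : ℝ) + t * I))))
      (g := fun t : ℝ => K * (1 / (N - t) ^ 2)) hy
      (Eventually.of_forall fun t ht => ?_) hci.intervalIntegrable
    · refine hle.trans ?_
      rw [intervalIntegral.integral_eq_sub_of_hasDerivAt hd hci.intervalIntegrable]
      have h1 : 0 < K * (N - t0)⁻¹ := by
        have : 0 < N - t0 := by linarith
        positivity
      have h2 : K * (N - T)⁻¹ ≤ 3 * C * P := by
        rw [hK, hP, show a + 1 / 2 = (a - 1 / 2) + 1 by ring, Real.rpow_add hT0, Real.rpow_one]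
        calc 3 * C * N ^ (-a) * (T ^ (a - 1 / 2) * T) * (N - T)⁻¹ ≤ 3 * C * N ^ (-a) * (T ^ (a - 1 / 2) * N) * (N - T)⁻¹ := by
              gcongr
          _ = _ := by field_simp
      linarith
    · have ht0 : 0 < t := by linarith [ht.1]
      have hNt : 0 < N - t := by linarith [ht.2]
      set w : ℂ := a + t * I with hw
      have hwim : w.im = t := by simp [hw]
      have hw1 : ((a + 1 : ℝ) : ℂ) + t * I = w + 1 := by rw [hw]; push_cast; ring
      rw [hw1]
      have h1 : (N - t) / N ≤ ‖q w‖ := by simpa [hwim] using hqn w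
      have h2 : (N - t) / N ≤ ‖q (w + 1)‖ := by simpa [hwim] using hqn (w + 1)
      have h3 : ‖q w - 1‖ = ‖w‖ / N := by
        rw [show q w - 1 = -(w / (I * N)) by simp [hq], norm_neg, norm_div, norm_mul, norm_I, one_mul, norm_real,
          Real.norm_of_nonneg hN.le]
      have h4 : ‖w‖ ≤ 3 * t := by
        calc ‖w‖ ≤ ‖(a : ℂ)‖ + ‖(t : ℂ) * I‖ := norm_add_le _ _
          _ = a + t := by simp [abs_of_pos ht0, abs_of_pos (show 0 < a by linarith)]
          _ ≤ _ := by linarith [ht.1]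
      have h5 := hb N a t hN (by linarith) (by linarith) (by linarith [ht.1])
      rw [norm_mul, norm_div, norm_mul, norm_mul, norm_div, norm_I, norm_real, Real.norm_of_nonneg hN.le, h3]
      have h6 : 0 < (N - t) / N := by positivity
      calc ‖FN N w‖ * (1 / N * (‖w‖ / N) / (‖q w‖ * ‖q (w + 1)‖))
          ≤ (C * N ^ (-a) * t ^ (a - 1 / 2)) * (1 / N * (3 * t / N) / ((N - t) / N * ((N - t) / N))) := by gcongr
        _ = 3 * C * N ^ (-a) * (t ^ (a - 1 / 2) * t) * (1 / (N - t) ^ 2) := by field_simp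
        _ ≤ K * (1 / (N - t) ^ 2) := by
          rw [hK]
          gcongr
          calc t ^ (a - 1 / 2) * t = t ^ (a + 1 / 2) := by
                rw [show a + 1 / 2 = (a - 1 / 2) + 1 by ring, Real.rpow_add ht0, Real.rpow_one]
            _ ≤ _ := Real.rpow_le_rpow ht0.le ht.2 (by linarith)
  rw [hIint]
  refine (norm_add_le _ _).trans ?_
  rw [norm_mul, norm_neg, norm_I, one_mul]
  have := norm_sub_le (∫ x in a..(a + 1), FN N (x + t0 * I) / q (x + t0 * I)) (∫ x in a..(a + 1), FN N (x + T * I) / q (x + T * I))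
  have hCP : 0 < C * P := by positivity
  nlinarith

/-- the error bound in Gonek's lemma -/
noncomputable def WW (a T N : ℝ) : ℝ := T ^ (a - 1 / 2) * N ^ (-a) * ((N + T) / (|N - T| + Real.sqrt T))

lemma FN_piece : ∃ C > 0, ∀ N a T1 T2 : ℝ, 0 < N → 1 < a → a < 2 → 1 ≤ T1 → T1 ≤ T2 →
    ‖∫ t in T1..T2, FN N (a + t * I)‖ ≤ C * N ^ (-a) * T2 ^ (a - 1 / 2) * (T2 - T1) := by
  obtain ⟨C, hC, hb⟩ := FN_bd
  refine ⟨C, hC, fun N a T1 T2 hN ha ha2 h1 h2 => ?_⟩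
  have := intervalIntegral.norm_integral_le_of_norm_le_const (a := T1) (b := T2) (C := C * N ^ (-a) * T2 ^ (a - 1 / 2))
    (f := fun t : ℝ => FN N (a + t * I)) (fun t ht => ?_)
  · rwa [abs_of_nonneg (by linarith)] at this
  · rw [Set.uIoc_of_le h2] at ht
    refine (hb N a t hN (by linarith) (by linarith) (by linarith [ht.1])).trans ?_
    have : t ^ (a - 1 / 2) ≤ T2 ^ (a - 1 / 2) := Real.rpow_le_rpow (by linarith [ht.1]) ht.2 (by linarith)
    gcongr

set_option maxHeartbeats 1600000 in
lemma gonek_F : ∃ C > 0, ∀ (n : ℕ) (a T t0 : ℝ), 1 ≤ n → 1 < a → a < 2 → 1 ≤ t0 → t0 ≤ 2 → 16 ≤ T →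
    ‖(∫ t in t0..T, FN (2 * Real.pi * n) (a + t * I)) - (if 2 * Real.pi * n ≤ T then 2 * Real.pi else 0 : ℝ)‖ ≤
      C * WW a T (2 * Real.pi * n) := by
  obtain ⟨CA, hCA, hA⟩ := FN_main_A
  obtain ⟨CB, hCB, hB⟩ := FN_main_B
  obtain ⟨CP, hCP, hP⟩ := FN_piece
  refine ⟨4 * CA + 4 * CB + 60 * (CA + CB + CP), by positivity, fun n a T t0 hn ha ha2 h1 h2 hT => ?_⟩
  have hn1 : (1 : ℝ) ≤ n := by exact_mod_cast hn
  set N : ℝ := 2 * Real.pi * n with hN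
  have hN4 : 4 ≤ N := by nlinarith [Real.pi_gt_three]
  have hN0 : 0 < N := by linarith
  have hexp : Complex.exp (-(I * N)) = 1 := by
    rw [Complex.exp_neg, inv_eq_one, hN, Complex.exp_eq_one_iff]
    exact ⟨n, by push_cast; ring⟩
  have hT0 : 0 < T := by linarith
  set r := Real.sqrt T with hr
  have hr2 : r * r = T := Real.mul_self_sqrt hT0.le
  have hr0 : 0 < r := Real.sqrt_pos.2 hT0
  have hr4 : 4 ≤ r := by nlinarith
  have hrT : 4 * r ≤ T := by nlinarith
  set Q := T ^ (a - 1 / 2) with hQ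
  set P := N ^ (-a) with hPdef
  have hP0 : 0 < P := Real.rpow_pos_of_pos hN0 _
  have hQ1 : 1 ≤ Q := Real.one_le_rpow (by linarith) (by linarith)
  have hW : WW a T N = Q * P * ((N + T) / (|N - T| + r)) := rfl
  have hCAB : 0 < CA + CB + CP := by positivity
  have hci : ∀ u v : ℝ, IntervalIntegrable (fun t : ℝ => FN N (a + t * I)) MeasureTheory.volume u v :=
    fun u v => (FN_cont N a hN0 (by linarith)).intervalIntegrable u v
  -- far case helper
  have hfar : ∀ D M : ℝ, r ≤ D → M ≤ N + T → D ≤ N + T → |N - T| = D → 0 ≤ M → P + Q * P * (M / D) ≤ 4 * WW a T N := by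
    intro D M hD hM hD2 habs hM0
    have hD0 : 0 < D := by linarith
    rw [hW, habs]
    have e1 : M / D ≤ 2 * ((N + T) / (D + r)) := by
      rw [← mul_div_assoc, div_le_div_iff₀ hD0 (by positivity)]; nlinarith
    have e2 : 1 ≤ 2 * ((N + T) / (D + r)) := by
      rw [← mul_div_assoc, le_div_iff₀ (by positivity)]; linarith
    have hQP : P ≤ Q * P := le_mul_of_one_le_left hP0.le hQ1
    have hQP0 : 0 < Q * P := by positivity
    nlinarith
  -- near case helper
  have hnear : |N - T| ≤ r → Q * P * r ≤ 2 * WW a T N := by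
    intro h
    rw [hW]
    have : r ≤ 2 * ((N + T) / (|N - T| + r)) := by
      rw [← mul_div_assoc, le_div_iff₀ (by positivity)]; nlinarith
    have hQP0 : 0 < Q * P := by positivity
    nlinarith
  rcases le_or_gt N (T - r) with c1 | c1
  · have habs : |N - T| = T - N := by rw [abs_of_nonpos (by linarith)]; ring
    have h := hA N a T t0 (by linarith) ha ha2 h1 h2 (by linarith) (by linarith)
    rw [hexp, mul_one] at h
    rw [if_pos (by linarith)]
    push_cast
    have := hfar (T - N) T (by linarith) (by linarith) (by linarith) habs hT0.le
    have hWW : 0 < WW a T N := by rw [hW]; positivity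
    refine h.trans ?_
    nlinarith
  rcases le_or_gt (T + r) N with c2 | c2
  · have habs : |N - T| = N - T := by rw [abs_of_nonneg (by linarith)]
    have h := hB N a T t0 (by linarith) ha ha2 h1 h2 (by linarith) (by linarith)
    rw [if_neg (by linarith)]
    simp only [ofReal_zero, sub_zero]
    have := hfar (N - T) N (by linarith) (by linarith) (by linarith) habs hN0.le
    have hWW : 0 < WW a T N := by rw [hW]; positivity
    refine h.trans ?_
    nlinarith
  have hWW : 0 < WW a T N := by rw [hW]; positivity
  have hab : |N - T| ≤ r := by rw [abs_le]; constructor <;> linarith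
  have hne := hnear hab
  have hPQr : P ≤ Q * P * r := by
    have : P ≤ Q * P := le_mul_of_one_le_left hP0.le hQ1
    have : 0 < Q * P := by positivity
    nlinarith
  rcases le_or_gt N T with c3 | c3
  · rw [if_pos c3]
    have h := hA N a (T + r) t0 (by linarith) ha ha2 h1 h2 (by linarith) (by linarith)
    rw [hexp, mul_one] at h
    have h' := hP N a T (T + r) hN0 ha ha2 (by linarith) (by linarith)
    have e : (∫ t in t0..T, FN N (a + t * I)) - ((2 * Real.pi : ℝ) : ℂ) =
        ((∫ t in t0..(T + r), FN N (a + t * I)) - 2 * Real.pi) - ∫ t in T..(T + r), FN N (a + t * I) := by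
      rw [← intervalIntegral.integral_add_adjacent_intervals (hci t0 T) (hci T (T + r))]; push_cast; ring
    rw [e]
    refine (norm_sub_le _ _).trans ?_
    have hQ' : (T + r) ^ (a - 1 / 2) ≤ 4 * Q := by
      calc (T + r) ^ (a - 1 / 2) ≤ (2 * T) ^ (a - 1 / 2) := Real.rpow_le_rpow (by linarith) (by linarith) (by linarith)
        _ = 2 ^ (a - 1 / 2) * Q := Real.mul_rpow (by norm_num) hT0.le
        _ ≤ 2 ^ (2 : ℝ) * Q := by
          gcongr
          · norm_num
          · linarith
        _ = 4 * Q := by norm_num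
    have e1 : (T + r) / (T + r - N) ≤ 2 * r := by
      rw [div_le_iff₀ (by linarith)]; nlinarith
    have b1 : CA * (P + (T + r) ^ (a - 1 / 2) * P * ((T + r) / (T + r - N))) ≤ CA * (Q * P * r + 4 * Q * P * (2 * r)) := by
      have : 0 < T + r - N := by linarith
      gcongr
    have b2 : CP * P * (T + r) ^ (a - 1 / 2) * (T + r - T) ≤ CP * P * (4 * Q) * r := by
      rw [add_sub_cancel_left]; gcongr
    have b3 : CA * (Q * P * r) ≤ CA * (2 * WW a T N) := by gcongr
    have b4 : CP * (Q * P * r) ≤ CP * (2 * WW a T N) := by gcongr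
    have p1 := mul_pos hCA hWW
    have p2 := mul_pos hCB hWW
    have p3 := mul_pos hCP hWW
    linarith
  · rw [if_neg (by linarith)]
    have h := hB N a (T - r) t0 (by linarith) ha ha2 h1 h2 (by linarith) (by linarith)
    have h' := hP N a (T - r) T hN0 ha ha2 (by linarith) (by linarith)
    have e : (∫ t in t0..T, FN N (a + t * I)) - ((0 : ℝ) : ℂ) =
        (∫ t in t0..(T - r), FN N (a + t * I)) + ∫ t in (T - r)..T, FN N (a + t * I) := by
      rw [intervalIntegral.integral_add_adjacent_intervals (hci t0 (T - r)) (hci (T - r) T)]; simp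
    rw [e]
    refine (norm_add_le _ _).trans ?_
    have hQ' : (T - r) ^ (a - 1 / 2) ≤ Q := Real.rpow_le_rpow (by linarith) (by linarith) (by linarith)
    have e1 : N / (N - (T - r)) ≤ 2 * r := by
      rw [div_le_iff₀ (by linarith)]; nlinarith
    have b1 : CB * (P + (T - r) ^ (a - 1 / 2) * P * (N / (N - (T - r)))) ≤ CB * (Q * P * r + Q * P * (2 * r)) := by
      have : 0 < N - (T - r) := by linarith
      gcongr
    have b2 : CP * P * T ^ (a - 1 / 2) * (T - (T - r)) ≤ CP * P * Q * r := by
      rw [sub_sub_cancel]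
    have b3 : CB * (Q * P * r) ≤ CB * (2 * WW a T N) := by gcongr
    have b4 : CP * (Q * P * r) ≤ CP * (2 * WW a T N) := by gcongr
    have p1 := mul_pos hCA hWW
    have p2 := mul_pos hCB hWW
    have p3 := mul_pos hCP hWW
    linarith

lemma Gamma_le_one' (a : ℝ) (h1 : 1 < a) (h2 : a < 2) : Real.Gamma a ≤ 1 := by
  have := Real.convexOn_Gamma.2 (show (1 : ℝ) ∈ Set.Ioi 0 by simp) (show (2 : ℝ) ∈ Set.Ioi 0 by simp)
    (show 0 ≤ 2 - a by linarith) (show 0 ≤ a - 1 by linarith) (by ring)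
  simp only [smul_eq_mul, Real.Gamma_one, Real.Gamma_two] at this
  rw [show (2 - a) * 1 + (a - 1) * 2 = a by ring] at this
  linarith

lemma Xf_diff (w : ℂ) (hw : 0 < w.re) : DifferentiableAt ℂ Xf w := by
  unfold Xf
  have h1 : DifferentiableAt ℂ Complex.Gamma w := by
    apply Complex.differentiableAt_Gamma
    intro m h
    have := congrArg re h
    simp at this
    have h2 : (0 : ℝ) ≤ m := by positivity
    linarith
  have h2 : DifferentiableAt ℂ (fun w : ℂ => (2 * (Real.pi : ℂ)) ^ (-w)) w := by
    apply DifferentiableAt.const_cpow (by fun_prop)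
    left; norm_num [Real.pi_ne_zero]
  fun_prop

lemma Xf_cont (a : ℝ) (ha : 0 < a) : Continuous (fun t : ℝ => Xf (a + t * I)) := by
  rw [continuous_iff_continuousAt]
  intro t
  have h : ContinuousAt Xf (a + t * I) := (Xf_diff _ (by simpa using ha)).continuousAt
  exact ContinuousAt.comp (f := fun t : ℝ => (a + t * I : ℂ)) h (by fun_prop)

lemma npow_cont (a : ℝ) (n : ℕ) (hn : n ≠ 0) : Continuous (fun t : ℝ => (n : ℂ) ^ (-(a + t * I : ℂ))) := by
  apply Continuous.const_cpow (by fun_prop)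
  left; exact_mod_cast hn

lemma Xf_FN (n : ℕ) (w : ℂ) : Xf w * (n : ℂ) ^ (-w) = FN (2 * Real.pi * n) w +
    ((2 * Real.pi * n : ℝ) : ℂ) ^ (-w) * Complex.Gamma w * Complex.exp (Real.pi * w / 2 * I) := by
  rw [Xf, FN, Complex.cos, ofReal_mul, Complex.mul_cpow_ofReal_nonneg (by positivity) (by positivity)]
  push_cast
  rw [show -(Real.pi * w / 2) * I = -(Real.pi * w / 2 * I) by ring]
  ring

lemma WW_ge (a T N : ℝ) (ha : 1 < a) (hT : 1 ≤ T) (hN : 0 < N) : N ^ (-a) ≤ 2 * WW a T N := by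
  have hr : Real.sqrt T ≤ T := by
    rw [Real.sqrt_le_left (by linarith)]; nlinarith
  have hP0 : 0 < N ^ (-a) := Real.rpow_pos_of_pos hN _
  have hQ1 : 1 ≤ T ^ (a - 1 / 2) := Real.one_le_rpow (by linarith) (by linarith)
  have habs : |N - T| ≤ N + T := by rw [abs_le]; constructor <;> linarith
  have hs : 0 < Real.sqrt T := Real.sqrt_pos.2 (by linarith)
  have e2 : 1 ≤ 2 * ((N + T) / (|N - T| + Real.sqrt T)) := by
    rw [← mul_div_assoc, le_div_iff₀ (by positivity)]; linarith
  unfold WW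
  have : N ^ (-a) ≤ T ^ (a - 1 / 2) * N ^ (-a) := le_mul_of_one_le_left hP0.le hQ1
  nlinarith

lemma gonek_X : ∃ C > 0, ∀ (n : ℕ) (a T t0 : ℝ), 1 ≤ n → 1 < a → a < 2 → 1 ≤ t0 → t0 ≤ 2 → 16 ≤ T →
    ‖(∫ t in t0..T, Xf (a + t * I) * (n : ℂ) ^ (-(a + t * I : ℂ))) - (if 2 * Real.pi * n ≤ T then 2 * Real.pi else 0 : ℝ)‖ ≤
      C * WW a T (2 * Real.pi * n) := by
  obtain ⟨C, hC, h⟩ := gonek_F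
  refine ⟨C + 2, by positivity, fun n a T t0 hn ha ha2 h1 h2 hT => ?_⟩
  have hn1 : (1 : ℝ) ≤ n := by exact_mod_cast hn
  have hN0 : 0 < 2 * Real.pi * n := by positivity
  set N := 2 * Real.pi * n with hN
  have hF := h n a T t0 hn ha ha2 h1 h2 hT
  rw [← hN] at hF
  have hc1 := FN_cont N a hN0 (by linarith)
  have hc2 : Continuous (fun t : ℝ => Xf (a + t * I) * (n : ℂ) ^ (-(a + t * I : ℂ))) :=
    (Xf_cont a (by linarith)).mul (npow_cont a n (by omega))
  have hIint : ‖∫ t in t0..T, (Xf (a + t * I) * (n : ℂ) ^ (-(a + t * I : ℂ)) - FN N (a + t * I))‖ ≤ N ^ (-a) := by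
    have hle := intervalIntegral.norm_integral_le_of_norm_le (μ := MeasureTheory.volume)
      (f := fun t : ℝ => (Xf (a + t * I) * (n : ℂ) ^ (-(a + t * I : ℂ)) - FN N (a + t * I)))
      (g := fun t : ℝ => N ^ (-a) * Real.exp (-t)) (a := t0) (b := T) (by linarith)
      (Eventually.of_forall fun t ht => ?_) (Continuous.intervalIntegrable (by fun_prop) _ _)
    · refine hle.trans ?_
      rw [intervalIntegral.integral_const_mul]
      have e : ∫ t in t0..T, Real.exp (-t) = Real.exp (-t0) - Real.exp (-T) := by
        rw [intervalIntegral.integral_comp_neg (fun x => Real.exp x), integral_exp]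
      rw [e]
      have e1 : Real.exp (-t0) ≤ 1 := Real.exp_le_one_iff.2 (by linarith)
      have e2 := Real.exp_pos (-T)
      have : 0 < N ^ (-a) := Real.rpow_pos_of_pos hN0 _
      nlinarith
    · rw [Xf_FN, add_sub_cancel_left, norm_mul, norm_mul, Complex.norm_cpow_eq_rpow_re_of_pos hN0, Complex.norm_exp]
      have e1 := norm_Gamma_le a t (by linarith)
      have e2 := Gamma_le_one' a ha ha2
      have e3 : ((Real.pi : ℂ) * (a + t * I) / 2 * I).re = -(Real.pi * t / 2) := by
        simp [Complex.mul_re, Complex.mul_im]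
      rw [e3]
      have e4 : Real.exp (-(Real.pi * t / 2)) ≤ Real.exp (-t) := by
        apply Real.exp_le_exp.2
        nlinarith [Real.pi_gt_three, ht.1]
      simp only [neg_re, add_re, ofReal_re, mul_re, I_re, mul_zero, ofReal_im, I_im, mul_one, sub_self, add_zero]
      calc N ^ (-a) * ‖Complex.Gamma (a + t * I)‖ * Real.exp (-(Real.pi * t / 2)) ≤ N ^ (-a) * 1 * Real.exp (-t) := by
            gcongr; linarith
        _ = _ := by ring
  rw [intervalIntegral.integral_sub (hc2.intervalIntegrable _ _) (hc1.intervalIntegrable _ _)] at hIint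
  have hW := WW_ge a T N ha (by linarith) hN0
  have : ∀ A B D : ℂ, ‖A - D‖ ≤ ‖A - B‖ + ‖B - D‖ := fun A B D => norm_sub_le_norm_sub_add_norm_sub A B D
  refine (this _ (∫ t in t0..T, FN N (a + t * I)) _).trans ?_
  linarith

lemma sum_near (x : ℝ) (hx : 0 ≤ x) (M : ℕ) :
    ∑ n ∈ range M, 1 / (|(n : ℝ) - x| + 1) ≤ 2 * (1 + Real.log (M + x + 1)) := by
  set m := ⌊x⌋₊ with hm
  have hm1 : (m : ℝ) ≤ x := Nat.floor_le hx
  have hm2 : x < m + 1 := Nat.lt_floor_add_one x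
  have h0 : ∑ n ∈ range M, 1 / (|(n : ℝ) - x| + 1) ≤ ∑ n ∈ range (m + 1 + M), 1 / (|(n : ℝ) - x| + 1) := by
    apply Finset.sum_le_sum_of_subset_of_nonneg
    · intro i hi; simp only [Finset.mem_range] at *; omega
    · intro i _ _; positivity
  rw [Finset.sum_range_add] at h0
  have h1 : ∑ n ∈ range (m + 1), 1 / (|(n : ℝ) - x| + 1) ≤ ∑ n ∈ range (m + 1), ((n : ℝ) + 1)⁻¹ := by
    rw [← Finset.sum_range_reflect]
    apply Finset.sum_le_sum
    intro i hi
    rw [Finset.mem_range] at hi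
    rw [one_div]
    apply inv_anti₀ (by positivity)
    have e : ((m + 1 - 1 - i : ℕ) : ℝ) = m - i := by
      rw [show m + 1 - 1 - i = m - i by omega, Nat.cast_sub (by omega)]
    rw [e]
    have : (i : ℝ) ≤ x - (m - i) := by linarith
    have := neg_abs_le ((m : ℝ) - i - x)
    linarith
  have h2 : ∑ n ∈ range M, 1 / (|((m + 1 + n : ℕ) : ℝ) - x| + 1) ≤ ∑ n ∈ range M, ((n : ℝ) + 1)⁻¹ := by
    apply Finset.sum_le_sum
    intro i hi
    rw [one_div]
    apply inv_anti₀ (by positivity)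
    have := le_abs_self (((m + 1 + i : ℕ) : ℝ) - x)
    push_cast at *
    linarith
  have h3 := sum_inv_le (m + 1)
  have h4 := sum_inv_le M
  have h5 : Real.log ((m + 1 : ℕ) : ℝ) ≤ Real.log (M + x + 1) := by
    apply Real.log_le_log (by positivity)
    push_cast
    have : (0 : ℝ) ≤ M := by positivity
    linarith
  have h6 : Real.log (M : ℝ) ≤ Real.log (M + x + 1) := by
    rcases Nat.eq_zero_or_pos M with h | h
    · subst h; simp; exact Real.log_nonneg (by linarith)
    · apply Real.log_le_log (by exact_mod_cast h)
      linarith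
  linarith

lemma W_term (T : ℝ) (hT : 16 ≤ T) (n : ℕ) : bb n * WW (1 + 1 / Real.log T) T (2 * Real.pi * n) ≤
    (Real.exp 1 * Real.sqrt T) * (3 * (bb n * (n : ℝ) ^ (-(1 + 1 / Real.log T))) +
      if n ∈ range (⌈T⌉₊ + 1) then 3 * Real.log T ^ 3 * (1 / (|(n : ℝ) - T / (2 * Real.pi)| + 1)) else 0) := by
  rcases Nat.eq_zero_or_pos n with h | h
  · subst h
    rw [bb_zero]
    have : 0 < Real.log T := Real.log_pos (by linarith)
    simp only [zero_mul, mul_zero, zero_add]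
    split_ifs <;> positivity
  have hn1 : (1 : ℝ) ≤ n := by exact_mod_cast h
  have hL : 1 < Real.log T := by
    rw [Real.lt_log_iff_exp_lt (by linarith)]
    have := Real.exp_one_lt_d9; linarith
  set a := 1 + 1 / Real.log T with ha
  have ha1 : 1 < a := by
    have : 0 < 1 / Real.log T := by positivity
    linarith
  have hT0 : 0 < T := by linarith
  have hpi := Real.pi_gt_three
  have hNn : (n : ℝ) ≤ 2 * Real.pi * n := by nlinarith
  have hTa : T ^ (a - 1 / 2) = Real.exp 1 * Real.sqrt T := by
    rw [show a - 1 / 2 = 1 / Real.log T + 1 / 2 by rw [ha]; ring, Real.rpow_add hT0, Real.sqrt_eq_rpow]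
    congr 1
    rw [Real.rpow_def_of_pos hT0, mul_one_div_cancel (by linarith)]
  set N := 2 * Real.pi * n with hN
  have hN0 : 0 < N := by linarith
  have hs : 0 < Real.sqrt T := Real.sqrt_pos.2 hT0
  have hs1 : 1 ≤ Real.sqrt T := by rw [Real.one_le_sqrt]; linarith
  have hP : N ^ (-a) ≤ (n : ℝ) ^ (-a) := Real.rpow_le_rpow_of_nonpos (by linarith) hNn (by linarith)
  have hP0 : 0 < N ^ (-a) := Real.rpow_pos_of_pos hN0 _
  have hb := bb_nonneg n
  unfold WW
  rw [hTa]
  have key : bb n * (N ^ (-a) * ((N + T) / (|N - T| + Real.sqrt T))) ≤ (3 * (bb n * (n : ℝ) ^ (-a)) +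
      if n ∈ range (⌈T⌉₊ + 1) then 3 * Real.log T ^ 3 * (1 / (|(n : ℝ) - T / (2 * Real.pi)| + 1)) else 0) := by
    have hnn : 0 ≤ if n ∈ range (⌈T⌉₊ + 1) then 3 * Real.log T ^ 3 * (1 / (|(n : ℝ) - T / (2 * Real.pi)| + 1)) else 0 := by
      split_ifs <;> positivity
    have hfar : (N + T) / (|N - T| + Real.sqrt T) ≤ 3 → bb n * (N ^ (-a) * ((N + T) / (|N - T| + Real.sqrt T))) ≤ 3 * (bb n * (n : ℝ) ^ (-a)) := by
      intro h3
      calc bb n * (N ^ (-a) * ((N + T) / (|N - T| + Real.sqrt T))) ≤ bb n * ((n : ℝ) ^ (-a) * 3) := by gcongr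
        _ = _ := by ring
    rcases le_or_gt N (T / 2) with c1 | c1
    · have := hfar (by
        rw [div_le_iff₀ (by positivity)]
        have := neg_abs_le (N - T)
        linarith)
      linarith
    rcases le_or_gt (2 * T) N with c2 | c2
    · have := hfar (by
        rw [div_le_iff₀ (by positivity)]
        have := le_abs_self (N - T)
        linarith)
      linarith
    have hnT : (n : ℝ) ≤ T := by nlinarith
    have hmem : n ∈ range (⌈T⌉₊ + 1) := by
      rw [Finset.mem_range, Nat.lt_succ_iff]
      exact_mod_cast hnT.trans (Nat.le_ceil T)
    rw [if_pos hmem]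
    have e1 : bb n ≤ Real.log T ^ 3 := by
      refine (bb_le n).trans ?_
      have := Real.log_le_log (by linarith) hnT
      have h0 := Real.log_nonneg hn1
      gcongr
    have e2 : N ^ (-a) * (N + T) ≤ 3 := by
      have : N ^ (-a) ≤ N ^ (-1 : ℝ) := Real.rpow_le_rpow_of_exponent_le (by linarith) (by linarith)
      rw [Real.rpow_neg_one] at this
      calc N ^ (-a) * (N + T) ≤ N⁻¹ * (3 * N) := by gcongr; linarith
        _ = 3 := by field_simp
    have e3 : 1 / (|N - T| + Real.sqrt T) ≤ 1 / (|(n : ℝ) - T / (2 * Real.pi)| + 1) := by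
      apply one_div_le_one_div_of_le (by positivity)
      have : N - T = 2 * Real.pi * (n - T / (2 * Real.pi)) := by rw [hN]; field_simp
      rw [this, abs_mul, abs_of_pos (show 0 < 2 * Real.pi by positivity)]
      nlinarith [abs_nonneg ((n : ℝ) - T / (2 * Real.pi))]
    have e4 : 0 ≤ 3 * (bb n * (n : ℝ) ^ (-a)) := by positivity
    calc bb n * (N ^ (-a) * ((N + T) / (|N - T| + Real.sqrt T))) = bb n * ((N ^ (-a) * (N + T)) * (1 / (|N - T| + Real.sqrt T))) := by ring
      _ ≤ Real.log T ^ 3 * (3 * (1 / (|(n : ℝ) - T / (2 * Real.pi)| + 1))) := by gcongr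
      _ ≤ _ := by linarith
  calc bb n * (Real.exp 1 * Real.sqrt T * N ^ (-a) * ((N + T) / (|N - T| + Real.sqrt T)))
      = (Real.exp 1 * Real.sqrt T) * (bb n * (N ^ (-a) * ((N + T) / (|N - T| + Real.sqrt T)))) := by ring
    _ ≤ _ := by gcongr

lemma W_sum : ∃ C > 0, ∀ T : ℝ, 16 ≤ T → Summable (fun n : ℕ => bb n * WW (1 + 1 / Real.log T) T (2 * Real.pi * n)) ∧
    ∑' n : ℕ, bb n * WW (1 + 1 / Real.log T) T (2 * Real.pi * n) ≤ C * (Real.sqrt T * Real.log T ^ 4) := by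
  obtain ⟨C, hC, h⟩ := bb_sum_bd
  refine ⟨Real.exp 1 * (3 * C + 24), by positivity, fun T hT => ?_⟩
  have hL : 1 < Real.log T := by
    rw [Real.lt_log_iff_exp_lt (by linarith)]
    have := Real.exp_one_lt_d9; linarith
  have hL0 : 0 < 1 / Real.log T := by positivity
  have hT0 : 0 < T := by linarith
  set A : ℝ := Real.exp 1 * Real.sqrt T with hA
  set f1 : ℕ → ℝ := fun n => bb n * (n : ℝ) ^ (-(1 + 1 / Real.log T)) with hf1
  set f2 : ℕ → ℝ := fun n => if n ∈ range (⌈T⌉₊ + 1) then 3 * Real.log T ^ 3 * (1 / (|(n : ℝ) - T / (2 * Real.pi)| + 1)) else 0 with hf2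
  have hs1 : Summable f1 := bb_summable (1 + 1 / Real.log T) (by linarith)
  have hs2 : HasSum f2 (∑ n ∈ range (⌈T⌉₊ + 1), f2 n) := by
    apply hasSum_sum_of_ne_finset_zero
    intro b hb
    simp only [hf2, if_neg hb]
  have hsum : Summable (fun n => A * (3 * f1 n + f2 n)) := ((hs1.mul_left 3).add hs2.summable).mul_left A
  have hle := W_term T hT
  have hnn : ∀ n : ℕ, 0 ≤ bb n * WW (1 + 1 / Real.log T) T (2 * Real.pi * n) := by
    intro n
    have := bb_nonneg n
    unfold WW
    positivity
  have hS := Summable.of_nonneg_of_le hnn hle hsum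
  refine ⟨hS, ?_⟩
  refine (hS.tsum_le_tsum hle hsum).trans ?_
  rw [tsum_mul_left, (hs1.mul_left 3).tsum_add hs2.summable, tsum_mul_left, hs2.tsum_eq]
  have b1 : ∑' n, f1 n ≤ C * Real.log T ^ 4 := by
    have := h (1 / Real.log T) hL0 (by rw [div_le_one (by linarith)]; exact hL.le)
    refine this.trans (le_of_eq ?_)
    field_simp
  have b2 : ∑ n ∈ range (⌈T⌉₊ + 1), f2 n ≤ 24 * Real.log T ^ 4 := by
    have e : ∑ n ∈ range (⌈T⌉₊ + 1), f2 n = 3 * Real.log T ^ 3 * ∑ n ∈ range (⌈T⌉₊ + 1), (1 / (|(n : ℝ) - T / (2 * Real.pi)| + 1)) := by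
      rw [Finset.mul_sum]
      apply Finset.sum_congr rfl
      intro n hn
      simp only [hf2, if_pos hn]
    rw [e]
    have hx : T / (2 * Real.pi) ≤ T := div_le_self hT0.le (by linarith [Real.pi_gt_three])
    have h1 := sum_near (T / (2 * Real.pi)) (by positivity) (⌈T⌉₊ + 1)
    have h2 : Real.log (((⌈T⌉₊ + 1 : ℕ) : ℝ) + T / (2 * Real.pi) + 1) ≤ 2 * Real.log T := by
      rw [show 2 * Real.log T = Real.log (T ^ 2) by simp]
      apply Real.log_le_log (by positivity)
      push_cast
      have := Nat.ceil_lt_add_one hT0.le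
      nlinarith
    calc _ ≤ 3 * Real.log T ^ 3 * (2 * (1 + 2 * Real.log T)) := by
          gcongr
          linarith
      _ ≤ 3 * Real.log T ^ 3 * (8 * Real.log T) := mul_le_mul_of_nonneg_left (by linarith) (by positivity)
      _ = _ := by ring
  calc A * (3 * ∑' n, f1 n + ∑ n ∈ range (⌈T⌉₊ + 1), f2 n) ≤ A * (3 * (C * Real.log T ^ 4) + 24 * Real.log T ^ 4) := by gcongr
    _ = _ := by rw [hA]; ring

lemma zeta_analytic (s : ℂ) (hs : s ≠ 1) : AnalyticAt ℂ riemannZeta s :=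
  differentiableOn_riemannZeta.analyticAt (isOpen_ne.mem_nhds hs)

lemma analytic_logDeriv {f : ℂ → ℂ} {c : ℂ} (hf : AnalyticAt ℂ f c) (h0 : f c ≠ 0) : AnalyticAt ℂ (logDeriv f) c := by
  have : logDeriv f = fun z => deriv f z / f z := rfl
  rw [this]; exact hf.deriv.fun_div hf h0

lemma LD2_mul {f g : ℂ → ℂ} {c : ℂ} (hf : AnalyticAt ℂ f c) (hg : AnalyticAt ℂ g c) (hf0 : f c ≠ 0) (hg0 : g c ≠ 0) :
    iteratedDeriv 2 (logDeriv (fun z => f z * g z)) c = iteratedDeriv 2 (logDeriv f) c + iteratedDeriv 2 (logDeriv g) c := by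
  have hev : logDeriv (fun z => f z * g z) =ᶠ[nhds c] fun z => logDeriv f z + logDeriv g z := by
    filter_upwards [hf.eventually_analyticAt, hg.eventually_analyticAt, hf.continuousAt.eventually_ne hf0,
      hg.continuousAt.eventually_ne hg0] with z h1 h2 h3 h4
    exact logDeriv_mul (f := f) (g := g) z h3 h4 h1.differentiableAt h2.differentiableAt
  rw [hev.iteratedDeriv_eq, iteratedDeriv_fun_add (analytic_logDeriv hf hf0).contDiffAt (analytic_logDeriv hg hg0).contDiffAt]

lemma Gop_mul {f g : ℂ → ℂ} {c : ℂ} (hf : AnalyticAt ℂ f c) (hg : AnalyticAt ℂ g c) (hf0 : f c ≠ 0) (hg0 : g c ≠ 0) :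
    Gop (fun z => f z * g z) c = f c * Gop g c + f c * g c * iteratedDeriv 2 (logDeriv f) c := by
  rw [Gop, LD2_mul hf hg hf0 hg0, Gop]; ring

lemma logDeriv_one_sub (f : ℂ → ℂ) : logDeriv (fun z => f (1 - z)) = fun z => -(logDeriv f (1 - z)) := by
  funext z
  simp only [logDeriv_apply]
  rw [deriv_comp_const_sub, neg_div]

lemma Gop_one_sub (f : ℂ → ℂ) (w : ℂ) : Gop (fun z => f (1 - z)) w = -Gop f (1 - w) := by
  rw [Gop, logDeriv_one_sub, iteratedDeriv_fun_neg, iteratedDeriv_comp_const_sub (f := logDeriv f), Gop]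
  norm_num

lemma Gop_congr {f g : ℂ → ℂ} {c : ℂ} (h : f =ᶠ[nhds c] g) : Gop f c = Gop g c := by
  have h' : logDeriv f =ᶠ[nhds c] logDeriv g := by
    filter_upwards [h, h.eventuallyEq_nhds] with z h1 h2
    rw [logDeriv_apply, logDeriv_apply, h1, h2.deriv_eq]
  rw [Gop, Gop, h.eq_of_nhds, h'.iteratedDeriv_eq]

lemma Xf_ne (w : ℂ) (hw : 0 < w.re) (him : w.im ≠ 0) : Xf w ≠ 0 := by
  unfold Xf
  have h1 : Complex.Gamma w ≠ 0 := Complex.Gamma_ne_zero_of_re_pos hw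
  have h2 : Complex.cos (Real.pi * w / 2) ≠ 0 := by
    rw [Ne, Complex.cos_eq_zero_iff]
    rintro ⟨k, hk⟩
    apply him
    have := congrArg im hk
    simp [Complex.mul_im, Complex.mul_re] at this
    simpa [Real.pi_ne_zero] using this
  have h3 : (2 * (Real.pi : ℂ)) ^ (-w) ≠ 0 := by
    rw [Ne, Complex.cpow_eq_zero_iff]
    simp [Real.pi_ne_zero]
  simp [h1, h2, h3]

lemma Xf_analytic (w : ℂ) (hw : 0 < w.re) : AnalyticAt ℂ Xf w := by
  have h : DifferentiableOn ℂ Xf {z | 0 < z.re} := fun z hz => (Xf_diff z hz).differentiableWithinAt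
  exact h.analyticAt ((isOpen_lt continuous_const continuous_re).mem_nhds hw)

lemma Gop_fe (w : ℂ) (hw : 1 < w.re) (him : w.im ≠ 0) :
    Gop riemannZeta (1 - w) = -(Xf w * Gop riemannZeta w + Xf w * riemannZeta w * iteratedDeriv 2 (logDeriv Xf) w) := by
  have hne : w ≠ 1 := by rintro rfl; simp at him
  rw [← Gop_mul (Xf_analytic w (by linarith)) (zeta_analytic w hne) (Xf_ne w (by linarith) him)
    (riemannZeta_ne_zero_of_one_le_re hw.le)]
  rw [← neg_eq_iff_eq_neg, ← Gop_one_sub]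
  apply Gop_congr
  have : {z : ℂ | z.im ≠ 0} ∈ nhds w := (isOpen_ne_fun continuous_im continuous_const).mem_nhds him
  filter_upwards [this] with z hz
  exact zeta_fe z hz

lemma iter_conj {f : ℂ → ℂ} (h : (starRingEnd ℂ ∘ f ∘ starRingEnd ℂ) = f) : (starRingEnd ℂ ∘ deriv f ∘ starRingEnd ℂ) = deriv f := by
  rw [← deriv_conj_conj, h]

lemma logDeriv_zeta_conj (s : ℂ) : (starRingEnd ℂ) (logDeriv riemannZeta ((starRingEnd ℂ) s)) = logDeriv riemannZeta s := by
  have h : (starRingEnd ℂ ∘ riemannZeta ∘ starRingEnd ℂ) = riemannZeta := by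
    funext z; simp [riemannZeta_conj]
  simp only [logDeriv_apply, map_div₀]
  rw [riemannZeta_conj, conj_conj]
  congr 1
  exact congrFun (iter_conj h) s

lemma Gop_conj (s : ℂ) : Gop riemannZeta ((starRingEnd ℂ) s) = (starRingEnd ℂ) (Gop riemannZeta s) := by
  have h0 : (starRingEnd ℂ ∘ logDeriv riemannZeta ∘ starRingEnd ℂ) = logDeriv riemannZeta := by
    funext z; exact logDeriv_zeta_conj z
  have h2 := iter_conj (iter_conj h0)
  have e : iteratedDeriv 2 (logDeriv riemannZeta) = deriv (deriv (logDeriv riemannZeta)) := by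
    rw [iteratedDeriv_succ, iteratedDeriv_one]
  rw [Gop, Gop, e, map_mul, riemannZeta_conj]
  congr 1
  have := congrFun h2 ((starRingEnd ℂ) s)
  simp only [Function.comp_apply, conj_conj] at this
  exact this.symm

lemma Gamma_shift_bd (m : ℕ) : ∀ z : ℂ, 1 / 2 ≤ z.im → ‖Complex.Gamma z‖ ≤ 2 ^ m * ‖Complex.Gamma (z + m)‖ := by
  induction m with
  | zero => intro z _; simp
  | succ m ih =>
    intro z hz
    have hz0 : z ≠ 0 := by rintro rfl; simp at hz; linarith
    have h1 := ih (z + 1) (by simpa using hz)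
    rw [Complex.Gamma_add_one z hz0, norm_mul] at h1
    have h2 : 1 / 2 ≤ ‖z‖ := hz.trans ((le_abs_self _).trans (Complex.abs_im_le_norm z))
    have h3 : z + ((m + 1 : ℕ) : ℂ) = z + 1 + m := by push_cast; ring
    rw [h3, pow_succ]
    nlinarith [norm_nonneg (Complex.Gamma z)]

lemma Gamma_upper (y : ℝ) (hy : 1 ≤ y) (z : ℂ) (h1 : 1 - y / 2 ≤ z.re) (h2 : z.re ≤ 3 / 2 + y / 2) (h3 : 1 / 2 ≤ z.im) :
    ‖Complex.Gamma z‖ ≤ Real.exp (20 * y * (1 + Real.log y)) := by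
  set m := ⌈y⌉₊ + 1 with hm
  have hm1 : y ≤ ⌈y⌉₊ := Nat.le_ceil y
  have hm2 := Nat.ceil_lt_add_one (show 0 ≤ y by linarith)
  have hmr : (m : ℝ) = ⌈y⌉₊ + 1 := by rw [hm]; push_cast; ring
  set k := ⌈5 * y⌉₊ with hk
  have hk1 : 5 * y ≤ k := Nat.le_ceil _
  have hk2 : (k : ℝ) < 5 * y + 1 := Nat.ceil_lt_add_one (by linarith)
  have e0 : z + m = ((z.re + m : ℝ) : ℂ) + z.im * I := by
    apply Complex.ext <;> simp
  have e1 : ‖Complex.Gamma (z + m)‖ ≤ Real.Gamma (z.re + m) := by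
    rw [e0]; exact norm_Gamma_le _ _ (by linarith)
  have e2 : Real.Gamma (z.re + m) ≤ Real.Gamma (k + 1) := by
    apply Real.Gamma_strictMonoOn_Ici.monotoneOn
    · simp only [Set.mem_Ici]; linarith
    · simp only [Set.mem_Ici]; linarith
    · linarith
  rw [Real.Gamma_nat_eq_factorial] at e2
  have e3 : (k.factorial : ℝ) ≤ (k : ℝ) ^ k := by exact_mod_cast Nat.factorial_le_pow k
  have hk0 : (0 : ℝ) < k := by linarith
  have hly : 0 ≤ Real.log y := Real.log_nonneg hy
  have e4 : (k : ℝ) ^ k ≤ Real.exp (12 * y + 6 * y * Real.log y) := by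
    rw [← Real.rpow_natCast, Real.rpow_def_of_pos hk0]
    apply Real.exp_le_exp.2
    have : Real.log k ≤ 2 + Real.log y := by
      have h6 : Real.log k ≤ Real.log (Real.exp 2 * y) := by
        apply Real.log_le_log hk0
        have : (6 : ℝ) ≤ Real.exp 2 := by
          have := Real.exp_one_gt_d9
          rw [show (2 : ℝ) = 1 + 1 by norm_num, Real.exp_add]; nlinarith
        nlinarith
      rwa [Real.log_mul (Real.exp_pos _).ne' (by linarith), Real.log_exp] at h6
    calc Real.log k * k ≤ (2 + Real.log y) * (6 * y) := by gcongr; linarith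
      _ = _ := by ring
  have e5 : (2 : ℝ) ^ m ≤ Real.exp (3 * y) := by
    calc (2 : ℝ) ^ m ≤ (Real.exp 1) ^ m := by
          gcongr; have := Real.exp_one_gt_d9; linarith
      _ = Real.exp m := by rw [← Real.exp_nat_mul]; simp
      _ ≤ _ := Real.exp_le_exp.2 (by linarith)
  calc ‖Complex.Gamma z‖ ≤ 2 ^ m * ‖Complex.Gamma (z + m)‖ := Gamma_shift_bd m z h3
    _ ≤ Real.exp (3 * y) * Real.exp (12 * y + 6 * y * Real.log y) := by
        gcongr; linarith
    _ = Real.exp (15 * y + 6 * y * Real.log y) := by rw [← Real.exp_add]; congr 1; ring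
    _ ≤ _ := by
        apply Real.exp_le_exp.2
        have : 0 ≤ y * Real.log y := by positivity
        nlinarith

lemma Gamma_lower (a y : ℝ) (ha : 1 < a) (ha2 : a ≤ 3 / 2) (hy : 1 ≤ y) : Real.exp (-(4 * y)) ≤ ‖Complex.Gamma (a + y * I)‖ := by
  set c : ℂ := a + y * I with hc
  have h := Complex.Gamma_mul_Gamma_one_sub c
  have hcre : c.re = a := by simp [hc]
  have hcim : c.im = y := by simp [hc]
  have h1c : 1 - c ≠ 0 := by
    intro h0
    have := congrArg im h0
    simp [hcim] at this
    linarith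
  have h1 : ‖Complex.Gamma (1 - c)‖ ≤ 2 := by
    have e := Complex.Gamma_add_one (1 - c) h1c
    have e1 : 1 - c + 1 = ((2 - a : ℝ) : ℂ) + (-y : ℝ) * I := by rw [hc]; push_cast; ring
    rw [e1] at e
    have e2 := norm_Gamma_le (2 - a) (-y) (by linarith)
    rw [e, norm_mul] at e2
    have e3 : 1 ≤ ‖1 - c‖ := by
      have := Complex.abs_im_le_norm (1 - c)
      simp [hcim, abs_of_pos (show 0 < y by linarith)] at this
      linarith
    have e4 : Real.Gamma (2 - a) ≤ 2 := by
      have e5 := Real.Gamma_add_one (show 2 - a ≠ 0 by linarith)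
      have e6 := Gamma_le_one' (2 - a + 1) (by linarith) (by linarith)
      rw [e5] at e6
      have := Real.Gamma_pos_of_pos (show 0 < 2 - a by linarith)
      nlinarith
    nlinarith [norm_nonneg (Complex.Gamma (1 - c))]
  have h2 : ‖Complex.sin (Real.pi * c)‖ ≤ Real.exp (Real.pi * y) := by
    rw [← Complex.cos_sub_pi_div_two]
    refine (norm_cos_le_exp _).trans ?_
    apply Real.exp_le_exp.2
    have : ((Real.pi : ℂ) * c - Real.pi / 2).im = Real.pi * y := by
      have : (Real.pi : ℂ) * c - Real.pi / 2 = ((Real.pi * a - Real.pi / 2 : ℝ) : ℂ) + (Real.pi * y : ℝ) * I := by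
        rw [hc]; push_cast; ring
      rw [this]; simp
    rw [this, abs_of_nonneg (by positivity)]
  have hs0 : Complex.sin (Real.pi * c) ≠ 0 := by
    rw [Ne, Complex.sin_eq_zero_iff]
    rintro ⟨k, hk⟩
    have := congrArg im hk
    simp [hcim, Real.pi_ne_zero] at this
    linarith
  have h3 := congrArg norm h
  rw [norm_mul, norm_div, norm_real, Real.norm_of_nonneg Real.pi_pos.le] at h3
  have h4 : Real.pi / Real.exp (Real.pi * y) ≤ Real.pi / ‖Complex.sin (Real.pi * c)‖ :=
    div_le_div_of_nonneg_left Real.pi_pos.le (norm_pos_iff.2 hs0) h2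
  rw [← h3, div_eq_mul_inv, ← Real.exp_neg] at h4
  have h5 : Real.exp (-(4 * y)) ≤ Real.exp (-(Real.pi * y)) := by
    apply Real.exp_le_exp.2
    nlinarith [Real.pi_lt_four]
  have h6 := Real.exp_pos (-(4 * y))
  nlinarith [norm_nonneg (Complex.Gamma c), Real.pi_gt_three]

lemma LD2_Gamma (a y : ℝ) (ha : 1 < a) (ha2 : a ≤ 3 / 2) (hy : 1 ≤ y) :
    ‖iteratedDeriv 2 (logDeriv Complex.Gamma) (a + y * I)‖ ≤ 36864 * (1 + Real.log y) / y ^ 2 := by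
  set c : ℂ := a + y * I with hc
  have hcre : c.re = a := by simp [hc]
  have hcim : c.im = y := by simp [hc]
  have hball : ∀ z ∈ Metric.ball c (y / 2), 1 - y / 2 ≤ z.re ∧ z.re ≤ 3 / 2 + y / 2 ∧ 1 / 2 ≤ z.im := by
    intro z hz
    rw [Metric.mem_ball, dist_eq_norm] at hz
    have h1 := abs_le.1 ((Complex.abs_re_le_norm (z - c)).trans hz.le)
    have h2 := abs_le.1 ((Complex.abs_im_le_norm (z - c)).trans hz.le)
    simp only [sub_re, sub_im, hcre, hcim] at h1 h2
    exact ⟨by linarith [h1.1], by linarith [h1.2], by linarith [h2.1]⟩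
  have hnp : ∀ z ∈ Metric.ball c (y / 2), ∀ m : ℕ, z ≠ -m := by
    intro z hz m h
    have := (hball z hz).2.2
    rw [h] at this; simp at this; linarith
  have h := logDeriv_bound_max (f := Complex.Gamma) (c := c) (R := y / 2) (r := y / 4)
    (M := Real.exp (20 * y * (1 + Real.log y))) (by linarith) (by linarith)
    (fun z hz => (Complex.differentiableAt_Gamma z (hnp z hz)).differentiableWithinAt)
    (fun z hz => Complex.Gamma_ne_zero (hnp z hz))
    (fun z hz => Gamma_upper y hy z (hball z hz).1 (hball z hz).2.1 (hball z hz).2.2) 2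
  have hlow := Gamma_lower a y ha ha2 hy
  rw [← hc] at hlow
  have hly : 0 ≤ Real.log y := Real.log_nonneg hy
  have hl : Real.log (Real.exp (20 * y * (1 + Real.log y)) / ‖Complex.Gamma c‖) ≤ 24 * y * (1 + Real.log y) := by
    have hpos : 0 < ‖Complex.Gamma c‖ := (Real.exp_pos _).trans_le hlow
    rw [Real.log_div (Real.exp_pos _).ne' hpos.ne', Real.log_exp]
    have := Real.log_le_log (Real.exp_pos _) hlow
    rw [Real.log_exp] at this
    nlinarith
  refine h.trans ?_
  calc _ ≤ ((2 + 1).factorial : ℝ) / (y / 4) ^ (2 + 1) * (4 * (24 * y * (1 + Real.log y))) := by gcongr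
    _ = _ := by
      norm_num [Nat.factorial]
      field_simp
      ring

/-- the factor `1 + exp(iπw)` of the cosine -/
noncomputable def ge (w : ℂ) : ℂ := 1 + Complex.exp (Real.pi * w * I)

lemma LD2_ge (a y : ℝ) (hy : 1 ≤ y) :
    ‖iteratedDeriv 2 (logDeriv ge) (a + y * I)‖ ≤ 6144 / y ^ 2 := by
  set c : ℂ := a + y * I with hc
  have hcim : c.im = y := by simp [hc]
  have hnorm : ∀ z : ℂ, ‖Complex.exp (Real.pi * z * I)‖ = Real.exp (-(Real.pi * z.im)) := by
    intro z
    rw [Complex.norm_exp]; congr 1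
    simp [Complex.mul_re, Complex.mul_im]
  have hsm : ∀ z : ℂ, 1 / 2 ≤ z.im → ‖Complex.exp (Real.pi * z * I)‖ ≤ 1 / 2 := by
    intro z hz
    rw [hnorm]
    calc Real.exp (-(Real.pi * z.im)) ≤ Real.exp (-1) := by
          apply Real.exp_le_exp.2; nlinarith [Real.pi_gt_three]
      _ ≤ 1 / 2 := by
          rw [Real.exp_neg, one_div]
          exact inv_anti₀ (by norm_num) (by have := Real.exp_one_gt_d9; linarith)
  have hball : ∀ z ∈ Metric.ball c (y / 2), 1 / 2 ≤ z.im := by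
    intro z hz
    rw [Metric.mem_ball, dist_eq_norm] at hz
    have h2 := abs_le.1 ((Complex.abs_im_le_norm (z - c)).trans hz.le)
    simp only [sub_im, hcim] at h2
    linarith [h2.1]
  have hlow : ∀ z : ℂ, 1 / 2 ≤ z.im → 1 / 2 ≤ ‖ge z‖ := by
    intro z hz
    have h1 := norm_sub_norm_le (1 : ℂ) (-Complex.exp (Real.pi * z * I))
    rw [sub_neg_eq_add, norm_neg, norm_one] at h1
    have := hsm z hz
    unfold ge; linarith
  have h := logDeriv_bound_max (f := ge) (c := c) (R := y / 2) (r := y / 4) (M := 2) (by linarith) (by linarith)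
    (by unfold ge; fun_prop)
    (fun z hz => by
      have := hlow z (hball z hz)
      exact norm_pos_iff.1 (by linarith))
    (fun z hz => by
      refine (norm_add_le _ _).trans ?_
      rw [norm_one]
      linarith [hsm z (hball z hz)]) 2
  have hl : Real.log (2 / ‖ge c‖) ≤ 4 := by
    have h1 := hlow c (by rw [hcim]; linarith)
    have h0 : 0 < ‖ge c‖ := by linarith
    have h2 : 2 / ‖ge c‖ ≤ 4 := by rw [div_le_iff₀ h0]; linarith
    have := Real.log_le_sub_one_of_pos (show 0 < 2 / ‖ge c‖ by positivity)
    linarith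
  refine h.trans ?_
  calc _ ≤ ((2 + 1).factorial : ℝ) / (y / 4) ^ (2 + 1) * (4 * 4) := by gcongr
    _ = 6144 / y ^ 3 := by
      norm_num [Nat.factorial]
      field_simp
      ring
    _ ≤ _ := by
      apply div_le_div_of_nonneg_left (by norm_num) (by positivity)
      exact pow_le_pow_right₀ hy (by norm_num)

lemma LD2_Xf (a y : ℝ) (ha : 1 < a) (ha2 : a ≤ 3 / 2) (hy : 1 ≤ y) :
    ‖iteratedDeriv 2 (logDeriv Xf) (a + y * I)‖ ≤ 50000 * (1 + Real.log y) / y ^ 2 := by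
  set c : ℂ := a + y * I with hc
  have hcre : c.re = a := by simp [hc]
  have hcim : c.im = y := by simp [hc]
  set lam : ℂ := -(Real.log (2 * Real.pi) : ℂ) - Real.pi / 2 * I with hlam
  have hX : Xf = fun z => Complex.exp (lam * z) * (Complex.Gamma z * ge z) := by
    funext z
    rw [Xf, ge, Complex.cos]
    have e : (2 * (Real.pi : ℂ)) ^ (-z) = Complex.exp (-(Real.log (2 * Real.pi) : ℂ) * z) := by
      rw [Complex.cpow_def_of_ne_zero (by simp [Real.pi_ne_zero]), Complex.ofReal_log (by positivity)]
      push_cast; congr 1; ring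
    rw [e]
    have e2 : Complex.exp (lam * z) = Complex.exp (-(Real.log (2 * Real.pi) : ℂ) * z) * Complex.exp (-(Real.pi * z / 2) * I) := by
      rw [← Complex.exp_add]; congr 1; rw [hlam]; ring
    have e3 : Complex.exp (Real.pi * z / 2 * I) = Complex.exp (-(Real.pi * z / 2) * I) * Complex.exp (Real.pi * z * I) := by
      rw [← Complex.exp_add]; congr 1; ring
    rw [e2, e3]
    ring
  have hXne := Xf_ne c (by rw [hcre]; linarith) (by rw [hcim]; linarith)
  rw [hX] at hXne
  simp only [mul_ne_zero_iff] at hXne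
  obtain ⟨n1, n2, n3⟩ := hXne
  have a1 : AnalyticAt ℂ (fun z => Complex.exp (lam * z)) c := by fun_prop
  have a2 : AnalyticAt ℂ Complex.Gamma c := by
    have h : DifferentiableOn ℂ Complex.Gamma {z | 0 < z.re} := fun z hz => by
      apply DifferentiableAt.differentiableWithinAt
      apply Complex.differentiableAt_Gamma
      intro m h
      rw [h] at hz
      simp at hz
      have h2 : (0 : ℝ) ≤ m := by positivity
      linarith
    exact h.analyticAt ((isOpen_lt continuous_const continuous_re).mem_nhds (show 0 < c.re by rw [hcre]; linarith))
  have a3 : AnalyticAt ℂ ge c := by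
    have : Differentiable ℂ ge := by unfold ge; fun_prop
    exact this.analyticAt c
  rw [hX, LD2_mul a1 (a2.fun_mul a3) n1 (mul_ne_zero n2 n3), LD2_mul a2 a3 n2 n3]
  have hE : logDeriv (fun z => Complex.exp (lam * z)) = fun _ => lam := by
    funext z
    have hd : HasDerivAt (fun z => Complex.exp (lam * z)) (Complex.exp (lam * z) * lam) z := by
      simpa using ((hasDerivAt_id z).const_mul lam).cexp
    rw [logDeriv_apply, hd.deriv]
    field_simp [Complex.exp_ne_zero]
  rw [hE]
  have h0 : iteratedDeriv 2 (fun _ : ℂ => lam) c = 0 := by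
    rw [iteratedDeriv_succ, iteratedDeriv_one]; simp
  rw [h0, zero_add]
  refine (norm_add_le _ _).trans ?_
  have h1 := LD2_Gamma a y ha ha2 hy
  have h2 := LD2_ge a y hy
  refine (add_le_add h1 h2).trans ?_
  rw [← add_div]
  have hly : 0 ≤ Real.log y := Real.log_nonneg hy
  apply div_le_div_of_nonneg_right _ (by positivity)
  linarith

lemma Gop_analytic {f : ℂ → ℂ} {c : ℂ} (hf : AnalyticAt ℂ f c) (h0 : f c ≠ 0) : AnalyticAt ℂ (Gop f) c := by
  have : Gop f = fun s => f s * iteratedDeriv 2 (logDeriv f) s := rfl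
  rw [this, iteratedDeriv_eq_iterate]
  exact hf.fun_mul ((analytic_logDeriv hf h0).iterated_deriv 2)

lemma LD2_cont {f : ℂ → ℂ} {c : ℂ} (hf : AnalyticAt ℂ f c) (h0 : f c ≠ 0) : ContinuousAt (iteratedDeriv 2 (logDeriv f)) c := by
  rw [iteratedDeriv_eq_iterate]
  exact ((analytic_logDeriv hf h0).iterated_deriv 2).continuousAt

lemma Gop_zeta_an (s : ℂ) (hs : s ≠ 1) (h0 : riemannZeta s ≠ 0) : AnalyticAt ℂ (Gop riemannZeta) s :=
  Gop_analytic (zeta_analytic s hs) h0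

lemma Gop_line_cont (a : ℝ) (ha : 1 < a) : Continuous (fun t : ℝ => Gop riemannZeta (a + t * I)) := by
  rw [continuous_iff_continuousAt]
  intro t
  have h : ContinuousAt (Gop riemannZeta) (a + t * I) := by
    apply (Gop_zeta_an _ _ _).continuousAt
    · intro h; have := congrArg re h; simp at this; linarith
    · apply riemannZeta_ne_zero_of_one_le_re; simp; linarith
  exact ContinuousAt.comp (f := fun t : ℝ => (a + t * I : ℂ)) h (by fun_prop)

lemma int_swap (a t0 T : ℝ) (ha : 1 < a) (hT : t0 ≤ T) (c : ℝ → ℂ) (hc : Continuous c) :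
    HasSum (fun n : ℕ => (bb n : ℂ) * ∫ t in t0..T, c t * (n : ℂ) ^ (-(a + t * I : ℂ)))
      (-∫ t in t0..T, c t * Gop riemannZeta (a + t * I)) := by
  obtain ⟨K, hK⟩ := (isCompact_Icc (a := t0) (b := T)).exists_bound_of_continuousOn hc.continuousOn
  have hre : ∀ t : ℝ, (a + t * I : ℂ).re = a := by intro t; simp
  have h := intervalIntegral.hasSum_integral_of_dominated_convergence (μ := MeasureTheory.volume) (a := t0) (b := T)
    (F := fun (n : ℕ) (t : ℝ) => c t * ((bb n : ℂ) * (n : ℂ) ^ (-(a + t * I : ℂ))))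
    (f := fun t => c t * (-(Gop riemannZeta (a + t * I))))
    (fun n _ => K * (bb n * (n : ℝ) ^ (-a))) ?_ ?_ ?_ ?_ ?_
  · simp only [mul_neg, intervalIntegral.integral_neg] at h
    refine h.congr_fun ?_ |> fun x => x
    intro n
    rw [← intervalIntegral.integral_const_mul]
    apply intervalIntegral.integral_congr
    intro t _
    ring
  · intro n
    rcases Nat.eq_zero_or_pos n with rfl | hn
    · simp [bb_zero]
      exact MeasureTheory.aestronglyMeasurable_const
    · exact (hc.mul (continuous_const.mul (npow_cont a n hn.ne'))).aestronglyMeasurable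
  · intro n
    refine Eventually.of_forall fun t ht => ?_
    rw [Set.uIoc_of_le hT] at ht
    rw [norm_mul, bb_term_norm n _ (by rw [hre]; linarith), hre]
    have := bb_nonneg n
    have := hK t ⟨ht.1.le, ht.2⟩
    gcongr
  · exact Eventually.of_forall fun t _ => (bb_summable a ha).mul_left K
  · exact intervalIntegrable_const
  · refine Eventually.of_forall fun t _ => ?_
    exact (Gop_hasSum _ (by rw [hre]; exact ha)).mul_left _

lemma npow_int (a t0 T : ℝ) (n : ℕ) (hn : 2 ≤ n) :
    ‖∫ t in t0..T, (n : ℂ) ^ (-(a + t * I : ℂ))‖ ≤ 4 * (n : ℝ) ^ (-a) := by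
  have hn0 : (0 : ℝ) < n := by positivity
  have hl : Real.log 2 ≤ Real.log n := Real.log_le_log (by norm_num) (by exact_mod_cast hn)
  have hl2 := Real.log_two_gt_d9
  have hl0 : 0 < Real.log n := by linarith
  have hlc : (Real.log n : ℂ) ≠ 0 := by exact_mod_cast hl0.ne'
  have hd : ∀ t : ℝ, HasDerivAt (fun t : ℝ => (n : ℂ) ^ (-(a + t * I : ℂ)) / (-(I * Real.log n)))
      ((n : ℂ) ^ (-(a + t * I : ℂ))) t := by
    intro t
    have h1 : HasDerivAt (fun z : ℂ => -(a + z * I : ℂ)) (-I) (t : ℂ) := by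
      simpa using (((hasDerivAt_id (t : ℂ)).mul_const I).const_add (a : ℂ)).fun_neg
    have h2 := ((h1.const_cpow (c := (n : ℂ)) (.inl (by exact_mod_cast hn0.ne'))).div_const (-(I * Real.log n))).comp_ofReal
    refine h2.congr_deriv ?_
    rw [← Complex.natCast_log]
    have : I ≠ 0 := I_ne_zero
    field_simp
  rw [intervalIntegral.integral_eq_sub_of_hasDerivAt (fun t _ => hd t) ((npow_cont a n (by omega)).intervalIntegrable _ _)]
  have hb : ∀ t : ℝ, ‖(n : ℂ) ^ (-(a + t * I : ℂ)) / (-(I * Real.log n))‖ ≤ 2 * (n : ℝ) ^ (-a) := by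
    intro t
    rw [norm_div, show (n : ℂ) = ((n : ℝ) : ℂ) by simp, Complex.norm_cpow_eq_rpow_re_of_pos hn0]
    simp only [neg_re, add_re, ofReal_re, mul_re, I_re, mul_zero, ofReal_im, I_im, mul_one, sub_self, add_zero, norm_neg, norm_mul, norm_I, one_mul, norm_real]
    rw [Real.norm_of_nonneg hl0.le, div_le_iff₀ hl0]
    have := Real.rpow_pos_of_pos hn0 (-a)
    nlinarith
  refine (norm_sub_le _ _).trans ?_
  linarith [hb t0, hb T]

lemma bb_one : bb 1 = 0 := by simp [bb]

lemma right_edge : ∃ C > 0, ∀ t0 T : ℝ, 16 ≤ T → t0 ≤ 2 →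
    ‖∫ t in t0..T, Gop riemannZeta ((1 + 1 / Real.log T : ℝ) + t * I)‖ ≤ C * Real.log T ^ 4 := by
  obtain ⟨C, hC, h⟩ := bb_sum_bd
  refine ⟨4 * C, by positivity, fun t0 T hT h0 => ?_⟩
  have hL : 1 < Real.log T := by
    rw [Real.lt_log_iff_exp_lt (by linarith)]
    have := Real.exp_one_lt_d9; linarith
  have hL0 : 0 < 1 / Real.log T := by positivity
  set a := 1 + 1 / Real.log T with ha
  have hs := int_swap a t0 T (by linarith) (by linarith) (fun _ => 1) continuous_const
  simp only [one_mul] at hs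
  have hsum := bb_summable a (by linarith)
  have hle : ∀ n : ℕ, ‖(bb n : ℂ) * ∫ t in t0..T, (n : ℂ) ^ (-(a + t * I : ℂ))‖ ≤ 4 * (bb n * (n : ℝ) ^ (-a)) := by
    intro n
    rcases Nat.lt_or_ge n 2 with hn | hn
    · interval_cases n
      · simp [bb_zero]
      · simp [bb_one]
    · rw [norm_mul, norm_real, Real.norm_of_nonneg (bb_nonneg n)]
      have := npow_int a t0 T n hn
      have := bb_nonneg n
      nlinarith
  have := tsum_of_norm_bounded (hsum.mul_left 4).hasSum hle
  rw [hs.tsum_eq, norm_neg] at this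
  refine this.trans ?_
  rw [tsum_mul_left]
  have := h (1 / Real.log T) hL0 (by rw [div_le_one (by linarith)]; exact hL.le)
  calc 4 * ∑' n : ℕ, bb n * (n : ℝ) ^ (-a) ≤ 4 * (C / (1 / Real.log T) ^ 4) := by gcongr
    _ = _ := by field_simp

lemma main_edge : ∃ C > 0, ∀ t0 T : ℝ, 16 ≤ T → 1 ≤ t0 → t0 ≤ 2 →
    ‖(∫ t in t0..T, Xf ((1 + 1 / Real.log T : ℝ) + t * I) * Gop riemannZeta ((1 + 1 / Real.log T : ℝ) + t * I))
      + (2 * Real.pi * BB (T / (2 * Real.pi)) : ℝ)‖ ≤ C * (Real.sqrt T * Real.log T ^ 4) := by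
  obtain ⟨C, hC, h⟩ := gonek_X
  obtain ⟨C', hC', h'⟩ := W_sum
  refine ⟨C * C', by positivity, fun t0 T hT h1 h2 => ?_⟩
  have hL : 1 < Real.log T := by
    rw [Real.lt_log_iff_exp_lt (by linarith)]
    have := Real.exp_one_lt_d9; linarith
  have hL0 : 0 < 1 / Real.log T := by positivity
  have hL1 : 1 / Real.log T < 1 := by rw [div_lt_one (by linarith)]; exact hL
  obtain ⟨w1, w2⟩ := h' T hT
  set a := 1 + 1 / Real.log T with ha
  have hs := int_swap a t0 T (by linarith) (by linarith) (fun t => Xf (a + t * I)) (Xf_cont a (by linarith))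
  have hfin : HasSum (fun n : ℕ => (bb n : ℂ) * ((if 2 * Real.pi * n ≤ T then 2 * Real.pi else 0 : ℝ) : ℂ))
      ((2 * Real.pi * BB (T / (2 * Real.pi)) : ℝ) : ℂ) := by
    have hmem : ∀ n : ℕ, 1 ≤ n → (n ∈ Finset.Icc 1 ⌊T / (2 * Real.pi)⌋₊ ↔ 2 * Real.pi * n ≤ T) := by
      intro n hn
      rw [Finset.mem_Icc, Nat.le_floor_iff (by positivity), le_div_iff₀ (by positivity), mul_comm]
      exact ⟨fun h => h.2, fun h => ⟨hn, h⟩⟩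
    have := hasSum_sum_of_ne_finset_zero (L := SummationFilter.unconditional ℕ) (f := fun n : ℕ => (bb n : ℂ) * ((if 2 * Real.pi * n ≤ T then 2 * Real.pi else 0 : ℝ) : ℂ))
      (s := Finset.Icc 1 ⌊T / (2 * Real.pi)⌋₊) (fun n hn => by
        rcases Nat.eq_zero_or_pos n with rfl | hn0
        · simp [bb_zero]
        · rw [hmem n hn0] at hn
          rw [if_neg hn]; simp)
    convert this using 1
    rw [BB]
    push_cast
    rw [Finset.mul_sum]
    apply Finset.sum_congr rfl
    intro n hn
    rw [if_pos ((hmem n (Finset.mem_Icc.1 hn).1).1 hn)]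
    push_cast; ring
  have hd := hs.sub hfin
  have hle : ∀ n : ℕ, ‖(bb n : ℂ) * (∫ t in t0..T, Xf (a + t * I) * (n : ℂ) ^ (-(a + t * I : ℂ))) -
      (bb n : ℂ) * ((if 2 * Real.pi * n ≤ T then 2 * Real.pi else 0 : ℝ) : ℂ)‖ ≤ C * (bb n * WW a T (2 * Real.pi * n)) := by
    intro n
    rcases Nat.eq_zero_or_pos n with rfl | hn0
    · simp [bb_zero]
    · rw [← mul_sub, norm_mul, norm_real, Real.norm_of_nonneg (bb_nonneg n)]
      have := h n a T t0 hn0 (by linarith) (by linarith) h1 h2 hT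
      have h3 := bb_nonneg n
      calc _ ≤ bb n * (C * WW a T (2 * Real.pi * n)) := by gcongr
        _ = _ := by ring
  have := tsum_of_norm_bounded (w1.mul_left C).hasSum hle
  rw [hd.tsum_eq, ← neg_add', norm_neg, tsum_mul_left] at this
  refine this.trans ?_
  calc _ ≤ C * (C' * (Real.sqrt T * Real.log T ^ 4)) := by gcongr
    _ = _ := by ring

lemma err_edge : ∃ C > 0, ∀ t0 T : ℝ, 16 ≤ T → 1 ≤ t0 → t0 ≤ 2 →
    ‖∫ t in t0..T, Xf ((1 + 1 / Real.log T : ℝ) + t * I) * riemannZeta ((1 + 1 / Real.log T : ℝ) + t * I) *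
      iteratedDeriv 2 (logDeriv Xf) ((1 + 1 / Real.log T : ℝ) + t * I)‖ ≤ C * Real.log T ^ 4 := by
  obtain ⟨C, hC, h⟩ := Xf_bd
  refine ⟨C * Real.exp 1 * 12 * 100000, by positivity, fun t0 T hT h1 h2 => ?_⟩
  have hL : 2 ≤ Real.log T := by
    rw [Real.le_log_iff_exp_le (by linarith), show (2 : ℝ) = 1 + 1 by norm_num, Real.exp_add]
    have := Real.exp_one_lt_d9
    have := Real.exp_pos 1
    nlinarith
  have hL0 : 0 < 1 / Real.log T := by positivity
  have hL1 : 1 / Real.log T ≤ 1 / 2 := one_div_le_one_div_of_le (by norm_num) hL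
  have hT0 : 0 < T := by linarith
  set a := 1 + 1 / Real.log T with ha
  set L := Real.log T with hLdef
  have hle := intervalIntegral.norm_integral_le_of_norm_le (μ := MeasureTheory.volume)
    (f := fun t : ℝ => Xf (a + t * I) * riemannZeta (a + t * I) * iteratedDeriv 2 (logDeriv Xf) (a + t * I))
    (g := fun t : ℝ => C * Real.exp 1 * 12 * 100000 * L ^ 2 * t⁻¹ ) (a := t0) (b := T) (by linarith)
    (Eventually.of_forall fun t ht => ?_) ?_
  · refine hle.trans ?_
    rw [intervalIntegral.integral_const_mul, integral_inv_of_pos (by linarith) hT0]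
    have : Real.log (T / t0) ≤ L := Real.log_le_log (by positivity) (div_le_self hT0.le h1)
    calc C * Real.exp 1 * 12 * 100000 * L ^ 2 * Real.log (T / t0) ≤ C * Real.exp 1 * 12 * 100000 * L ^ 2 * L ^ 2 := by
          gcongr; nlinarith
      _ = _ := by ring
  · have ht1 : 1 ≤ t := by linarith [ht.1]
    have htT : t ≤ T := ht.2
    have ht0 : 0 < t := by linarith
    have e1 := h a t (by linarith) (by linarith) ht1
    have e1' : t ^ (a - 1 / 2) ≤ Real.exp 1 * t := by
      have : t ^ (a - 1 / 2) ≤ t ^ (1 / L + 1) := Real.rpow_le_rpow_of_exponent_le ht1 (by rw [ha]; linarith)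
      refine this.trans ?_
      rw [Real.rpow_add ht0, Real.rpow_one]
      gcongr
      calc t ^ (1 / L) ≤ T ^ (1 / L) := Real.rpow_le_rpow ht0.le htT hL0.le
        _ = Real.exp 1 := by rw [Real.rpow_def_of_pos hT0, mul_one_div_cancel (by linarith)]
    have hne : (a + t * I : ℂ) ≠ 1 := by intro h; have := congrArg im h; simp at this; linarith
    have e2 : ‖riemannZeta (a + t * I)‖ ≤ 12 * L := by
      have := zeta_bd a t (by linarith) (by linarith) hne
      rw [max_eq_right (by linarith), Real.rpow_zero, one_mul, abs_of_pos ht0] at this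
      refine this.trans ?_
      have i1 : Real.log (t + 2) ≤ 2 * L := by
        rw [hLdef, show 2 * Real.log T = Real.log (T ^ 2) by simp]
        apply Real.log_le_log (by linarith); nlinarith
      have i2 : 1 / ‖(a + t * I - 1 : ℂ)‖ ≤ 1 := by
        rw [div_le_one (norm_pos_iff.2 (sub_ne_zero.2 hne))]
        have := Complex.abs_im_le_norm (a + t * I - 1 : ℂ)
        simp [abs_of_pos ht0] at this
        linarith
      linarith
    have e3 := LD2_Xf a t (by linarith) (by linarith) ht1
    have e3' : 50000 * (1 + Real.log t) / t ^ 2 ≤ 100000 * L / t ^ 2 := by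
      have : Real.log t ≤ L := Real.log_le_log ht0 htT
      apply div_le_div_of_nonneg_right _ (by positivity)
      linarith
    rw [norm_mul, norm_mul]
    calc _ ≤ (C * (Real.exp 1 * t)) * (12 * L) * (100000 * L / t ^ 2) := by
          gcongr
          · exact e1.trans (by gcongr)
          · exact e3.trans e3'
      _ = _ := by field_simp
  · apply ContinuousOn.intervalIntegrable
    apply ContinuousOn.mul continuousOn_const
    apply ContinuousOn.inv₀ continuousOn_id
    intro t ht
    rw [Set.uIcc_of_le (by linarith)] at ht
    have := ht.1
    simp only [id]; linarith

lemma left_edge : ∃ C > 0, ∀ t0 T : ℝ, 16 ≤ T → 1 ≤ t0 → t0 ≤ 2 →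
    ‖(∫ t in t0..T, Gop riemannZeta ((1 - (1 + 1 / Real.log T) : ℝ) + t * I)) -
      (2 * Real.pi * BB (T / (2 * Real.pi)) : ℝ)‖ ≤ C * (Real.sqrt T * Real.log T ^ 4) := by
  obtain ⟨C1, hC1, h1⟩ := main_edge
  obtain ⟨C2, hC2, h2⟩ := err_edge
  refine ⟨C1 + C2, by positivity, fun t0 T hT ht1 ht2 => ?_⟩
  have hL : 1 < Real.log T := by
    rw [Real.lt_log_iff_exp_lt (by linarith)]
    have := Real.exp_one_lt_d9; linarith
  have hL0 : 0 < 1 / Real.log T := by positivity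
  have b1 := h1 t0 T hT ht1 ht2
  have b2 := h2 t0 T hT ht1 ht2
  set a := 1 + 1 / Real.log T with ha
  have ha1 : 1 < a := by linarith
  have e : ∀ t ∈ Set.uIcc t0 T, Gop riemannZeta ((1 - a : ℝ) + t * I) = (starRingEnd ℂ)
      (-(Xf (a + t * I) * Gop riemannZeta (a + t * I) +
      Xf (a + t * I) * riemannZeta (a + t * I) * iteratedDeriv 2 (logDeriv Xf) (a + t * I))) := by
    intro t ht
    rw [Set.uIcc_of_le (by linarith)] at ht
    rw [← Gop_fe (a + t * I) (by simpa using ha1) (by simp; linarith [ht.1]), ← Gop_conj]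
    congr 1
    apply Complex.ext <;> simp
  have hnz : ∀ t ∈ Set.uIcc t0 T, (a + t * I : ℂ).im ≠ 0 := by
    intro t ht
    rw [Set.uIcc_of_le (by linarith)] at ht
    simp; linarith [ht.1]
  have hcX := Xf_cont a (by linarith)
  have i1 : IntervalIntegrable (fun t : ℝ => Xf (a + t * I) * Gop riemannZeta (a + t * I)) MeasureTheory.volume t0 T :=
    (hcX.mul (Gop_line_cont a ha1)).intervalIntegrable _ _
  have i2 : IntervalIntegrable (fun t : ℝ => Xf (a + t * I) * riemannZeta (a + t * I) * iteratedDeriv 2 (logDeriv Xf) (a + t * I)) MeasureTheory.volume t0 T := by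
    apply ContinuousOn.intervalIntegrable
    intro t ht
    apply ContinuousAt.continuousWithinAt
    have hl : ContinuousAt (fun t : ℝ => (a + t * I : ℂ)) t := by fun_prop
    have hz : ContinuousAt riemannZeta (a + t * I) := by
      apply (zeta_analytic _ _).continuousAt
      intro h; have := congrArg re h; simp at this; linarith
    refine (hcX.continuousAt.mul (ContinuousAt.comp (f := fun t : ℝ => (a + t * I : ℂ)) hz hl)).mul
      (ContinuousAt.comp (f := fun t : ℝ => (a + t * I : ℂ)) (LD2_cont (Xf_analytic _ ?_) (Xf_ne _ ?_ (hnz t ht))) hl)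
    · simp; linarith
    · simp; linarith
  rw [intervalIntegral.integral_congr e, intervalIntegral_conj', intervalIntegral.integral_neg, intervalIntegral.integral_add i1 i2]
  have e2 : (((2 * Real.pi * BB (T / (2 * Real.pi)) : ℝ)) : ℂ) = (starRingEnd ℂ) ((2 * Real.pi * BB (T / (2 * Real.pi)) : ℝ) : ℂ) := by
    rw [conj_ofReal]
  rw [e2, ← map_sub, RCLike.norm_conj, ← neg_add', norm_neg, add_right_comm]
  refine (norm_add_le _ _).trans ?_
  refine (add_le_add b1 b2).trans ?_
  have : Real.log T ^ 4 ≤ Real.sqrt T * Real.log T ^ 4 := by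
    apply le_mul_of_one_le_left (by positivity)
    rw [Real.one_le_sqrt]; linarith
  nlinarith

lemma log_ge_two (T : ℝ) (hT : 16 ≤ T) : 2 ≤ Real.log T := by
  rw [Real.le_log_iff_exp_le (by linarith), show (2 : ℝ) = 1 + 1 by norm_num, Real.exp_add]
  have := Real.exp_one_lt_d9
  have := Real.exp_pos 1
  nlinarith

lemma ball_re_im {c z : ℂ} {R : ℝ} (hz : z ∈ Metric.ball c R) : c.re - R ≤ z.re ∧ z.re ≤ c.re + R ∧ c.im - R < z.im ∧ z.im < c.im + R := by
  rw [Metric.mem_ball, dist_eq_norm] at hz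
  have h1 := abs_le.1 ((Complex.abs_re_le_norm (z - c)).trans hz.le)
  have h2 := abs_lt.1 ((Complex.abs_im_le_norm (z - c)).trans_lt hz)
  simp only [sub_re, sub_im] at h1 h2
  exact ⟨by linarith [h1.1], by linarith [h1.2], by linarith [h2.1], by linarith [h2.2]⟩

lemma top_edge (δ : ℝ) (hδ : 0 < δ) (hδ1 : δ ≤ 1) : ∃ C > 0, ∀ T : ℝ, 16 ≤ T → AdmissibleHeight δ T →
    ‖∫ x in (1 - (1 + 1 / Real.log T))..(1 + 1 / Real.log T), Gop riemannZeta (x + T * I)‖ ≤ C * (Real.sqrt T * Real.log T ^ 4) := by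
  obtain ⟨C, hC, h⟩ := zeta_bd_all
  refine ⟨24 * 8 / δ ^ 3 * (C * 4 * Real.exp 4) * 2, by positivity, fun T hT hadm => ?_⟩
  have hL := log_ge_two T hT
  have hT0 : 0 < T := by linarith
  have hL0 : 0 < 1 / Real.log T := by positivity
  have hL1 : 1 / Real.log T ≤ 1 / 2 := one_div_le_one_div_of_le (by norm_num) hL
  set a := 1 + 1 / Real.log T with ha
  set L := Real.log T with hLdef
  have hRL : δ / L ≤ 1 / L := div_le_div_of_nonneg_right hδ1 (by linarith)
  have hR0 : 0 < δ / L := by positivity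
  have hpt : ∀ x ∈ Set.uIoc (1 - a) a, ‖Gop riemannZeta (x + T * I)‖ ≤ 24 / (δ / L / 2) ^ 3 * (C * (2 * Real.sqrt T * Real.exp 4) * (2 * L)) := by
    intro x hx
    rw [Set.uIoc_of_le (by linarith)] at hx
    have hb : ∀ z ∈ Metric.ball (x + T * I : ℂ) (δ / L), -(2 / L) ≤ z.re ∧ z.re ≤ 2 ∧ T - 1 / 2 < z.im ∧ z.im < T + 1 / 2 ∧ |T - z.im| < δ / L := by
      intro z hz
      obtain ⟨p1, p2, p3, p4⟩ := ball_re_im hz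
      simp at p1 p2 p3 p4
      have : 2 / L = 1 / L + 1 / L := by ring
      refine ⟨by linarith [hx.1], by linarith [hx.2], by linarith, by linarith, ?_⟩
      rw [abs_lt]; constructor <;> linarith
    apply Gop_bound_max (R := δ / L) (by linarith) (by linarith)
    · intro z hz
      apply (differentiableAt_riemannZeta _).differentiableWithinAt
      rintro rfl
      have := (hb 1 hz).2.2.1
      simp at this; linarith
    · intro z hz h0
      have hbz := hb z hz
      have := hadm z (zero_nontriv h0 (by linarith [hbz.2.2.1]))
      linarith [hbz.2.2.2.2]
    · intro z hz
      obtain ⟨p1, p2, p3, p4, _⟩ := hb z hz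
      have h2L : 2 / L ≤ 1 := by rw [div_le_one (by linarith)]; exact hL
      have hz' := h z.re z.im (by linarith) (by linarith) (by linarith)
      rw [re_add_im] at hz'
      refine hz'.trans ?_
      have q1 : (z.im + 2) ^ (1 / 2 + max (-z.re) 0) ≤ 2 * Real.sqrt T * Real.exp 4 := by
        have r1 : max (-z.re) 0 ≤ 2 / L := max_le (by linarith) (by positivity)
        have r0 : 0 ≤ max (-z.re) 0 := le_max_right _ _
        calc (z.im + 2) ^ (1 / 2 + max (-z.re) 0) ≤ (T ^ (2 : ℝ)) ^ (2 / L) * (4 * T) ^ (1 / 2 : ℝ) := by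
              rw [add_comm (1 / 2 : ℝ), Real.rpow_add (by linarith)]
              have s1 : (z.im+2)^(max (-z.re) 0) ≤ (T^(2:ℝ))^(2/L) :=
                (Real.rpow_le_rpow_of_exponent_le (by linarith) r1).trans
                  (Real.rpow_le_rpow (by linarith) (by rw [Real.rpow_two]; nlinarith) (by positivity))
              have s2 : (z.im+2)^(1/2:ℝ) ≤ (4*T)^(1/2:ℝ) := Real.rpow_le_rpow (by linarith) (by linarith) (by norm_num)
              exact mul_le_mul s1 s2 (Real.rpow_nonneg (by linarith) _) (by positivity)
          _ = 2 * Real.sqrt T * Real.exp 4 := by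
              rw [← Real.sqrt_eq_rpow, Real.sqrt_mul (by norm_num), ← Real.rpow_mul hT0.le, Real.rpow_def_of_pos hT0]
              rw [show Real.sqrt 4 = 2 by rw [show (4 : ℝ) = 2 ^ 2 by norm_num]; exact Real.sqrt_sq (by norm_num)]
              rw [show Real.log T * (2 * (2 / L)) = 4 by rw [← hLdef]; field_simp; norm_num]
              ring
      have q2 : Real.log (z.im + 2) ≤ 2 * L := by
        rw [hLdef, show 2 * Real.log T = Real.log (T ^ 2) by simp]
        apply Real.log_le_log (by linarith); nlinarith
      have q3 : 0 ≤ Real.log (z.im + 2) := Real.log_nonneg (by linarith)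
      gcongr
  have := intervalIntegral.norm_integral_le_of_norm_le_const hpt
  refine this.trans ?_
  rw [abs_of_nonneg (by linarith)]
  calc _ ≤ 24 / (δ / L / 2) ^ 3 * (C * (2 * Real.sqrt T * Real.exp 4) * (2 * L)) * 2 := by
        gcongr; linarith
    _ = _ := by field_simp; ring

lemma bottom_edge (t0 : ℝ) (ht0 : 0 < t0) (hz : ∀ s, riemannZeta s = 0 → s.im ≠ t0) : ∃ C > 0, ∀ T : ℝ, 16 ≤ T →
    ‖∫ x in (1 - (1 + 1 / Real.log T))..(1 + 1 / Real.log T), Gop riemannZeta (x + t0 * I)‖ ≤ C := by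
  have hc : Continuous (fun x : ℝ => Gop riemannZeta (x + t0 * I)) := by
    rw [continuous_iff_continuousAt]
    intro x
    have him : (x + t0 * I : ℂ).im = t0 := by simp
    have h : ContinuousAt (Gop riemannZeta) (x + t0 * I) := by
      apply (Gop_zeta_an _ _ _).continuousAt
      · intro h; have := congrArg im h; rw [him] at this; simp at this; linarith
      · intro h; exact hz _ h him
    exact ContinuousAt.comp (f := fun t : ℝ => (t + t0 * I : ℂ)) h (by fun_prop)
  obtain ⟨K, hK⟩ := (isCompact_Icc (a := (-1 : ℝ)) (b := 2)).exists_bound_of_continuousOn hc.continuousOn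
  have hK0 : 0 ≤ K := (norm_nonneg _).trans (hK 0 ⟨by norm_num, by norm_num⟩)
  refine ⟨2 * K + 1, by positivity, fun T hT => ?_⟩
  have hL := log_ge_two T hT
  have hL0 : 0 < 1 / Real.log T := by positivity
  have hL1 : 1 / Real.log T ≤ 1 / 2 := one_div_le_one_div_of_le (by norm_num) hL
  have := intervalIntegral.norm_integral_le_of_norm_le_const (C := K) (a := (1 - (1 + 1 / Real.log T))) (b := (1 + 1 / Real.log T))
    (f := fun x : ℝ => Gop riemannZeta (x + t0 * I)) (fun x hx => by
      rw [Set.uIoc_of_le (by linarith)] at hx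
      exact hK x ⟨by linarith [hx.1], by linarith [hx.2]⟩)
  refine this.trans ?_
  rw [abs_of_nonneg (by linarith)]
  nlinarith

lemma zeros_fin (t1 t2 : ℝ) (h : 0 < t1) : {ρ : ℂ | IsNontrivialZero ρ ∧ t1 ≤ ρ.im ∧ ρ.im ≤ t2}.Finite := by
  have hfin := (isCompact_RC 0 1 t1 t2).inter_riemannZetaZeros_finite
  refine hfin.subset ?_
  rintro ρ ⟨h1, h2, h3⟩
  exact ⟨⟨h1.2.1.le, h1.2.2.le, h2, h3⟩, h1.1⟩

lemma zeros_fin0 (t2 : ℝ) : {ρ : ℂ | IsNontrivialZero ρ ∧ 0 < ρ.im ∧ ρ.im ≤ t2}.Finite := by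
  have hfin := (isCompact_RC 0 1 0 t2).inter_riemannZetaZeros_finite
  refine hfin.subset ?_
  rintro ρ ⟨h1, h2, h3⟩
  exact ⟨⟨h1.2.1.le, h1.2.2.le, h2.le, h3⟩, h1.1⟩

lemma exists_t0 : ∃ t0 : ℝ, 1 ≤ t0 ∧ t0 ≤ 2 ∧ ∀ s, riemannZeta s = 0 → s.im ≠ t0 := by
  have hfin := (zeros_fin 1 2 one_pos).image Complex.im
  have hinf : (Set.Icc (1 : ℝ) 2).Infinite := Set.Icc_infinite (by norm_num)
  obtain ⟨t, ht, hn⟩ := hinf.exists_notMem_finite hfin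
  refine ⟨t, ht.1, ht.2, fun s hs him => hn ⟨s, ⟨zero_nontriv hs ?_, ?_, ?_⟩, him⟩⟩
  · rw [him]; linarith [ht.1]
  · rw [him]; exact ht.1
  · rw [him]; exact ht.2

lemma zeroSum_BB (δ : ℝ) (hδ : 0 < δ) : ∃ K > 0, ∀ T : ℝ, 16 ≤ T → AdmissibleHeight δ T →
    ‖zetaZeroSum 2 T + (BB (T / (2 * Real.pi)) : ℝ)‖ ≤ K * (Real.sqrt T * Real.log T ^ 4) := by
  wlog hδ1 : δ ≤ 1 generalizing δ
  · obtain ⟨K, hK, h⟩ := this 1 one_pos le_rfl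
    refine ⟨K, hK, fun T hT hadm => h T hT fun ρ hρ => ?_⟩
    refine le_trans ?_ (hadm ρ hρ)
    push Not at hδ1
    apply div_le_div_of_nonneg_right hδ1.le
    linarith [log_ge_two T hT]
  obtain ⟨t0, h1, h2, h3⟩ := exists_t0
  obtain ⟨C1, hC1, b1⟩ := bottom_edge t0 (by linarith) h3
  obtain ⟨C2, hC2, b2⟩ := top_edge δ hδ hδ1
  obtain ⟨C3, hC3, b3⟩ := right_edge
  obtain ⟨C4, hC4, b4⟩ := left_edge
  refine ⟨‖zetaZeroSum 2 t0‖ + C1 + C2 + C3 + C4, by positivity, fun T hT hadm => ?_⟩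
  have hL := log_ge_two T hT
  have hL0 : 0 < 1 / Real.log T := by positivity
  have hsplit : zetaZeroSum 2 T = zetaZeroSum 2 t0 + ∑ᶠ ρ ∈ {ρ : ℂ | IsNontrivialZero ρ ∧ t0 < ρ.im ∧ ρ.im ≤ T},
    (zetaZeroOrder ρ : ℂ) * iteratedDeriv 2 riemannZeta ρ := by
    rw [zetaZeroSum, zetaZeroSum, ← finsum_mem_union]
    · have hset : {ρ : ℂ | IsNontrivialZero ρ ∧ 0 < ρ.im ∧ ρ.im ≤ T} = {ρ : ℂ | IsNontrivialZero ρ ∧ 0 < ρ.im ∧ ρ.im ≤ t0} ∪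
          {ρ : ℂ | IsNontrivialZero ρ ∧ t0 < ρ.im ∧ ρ.im ≤ T} := ?_
      · rw [hset]
      ext ρ
      simp only [Set.mem_union, Set.mem_ofPred_eq]
      constructor
      · rintro ⟨p1, p2, p3⟩
        rcases le_or_gt ρ.im t0 with h | h
        · exact .inl ⟨p1, p2, h⟩
        · exact .inr ⟨p1, h, p3⟩
      · rintro (⟨p1, p2, p3⟩ | ⟨p1, p2, p3⟩)
        · exact ⟨p1, p2, by linarith⟩
        · exact ⟨p1, by linarith, p3⟩
    · rw [Set.disjoint_left]
      rintro ρ ⟨_, _, p⟩ ⟨_, q, _⟩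
      linarith
    · exact zeros_fin0 t0
    · refine (zeros_fin0 T).subset ?_
      rintro ρ ⟨p1, p2, p3⟩
      exact ⟨p1, by linarith, p3⟩
  have hR := zero_sum_rect (1 + 1 / Real.log T) t0 T (by linarith) (by linarith) (by linarith) h3 (fun s hs him => by
    have := hadm s (zero_nontriv hs (by rw [him]; linarith))
    rw [him, sub_self, abs_zero] at this
    have : 0 < δ / Real.log T := by positivity
    linarith)
  set S := ∑ᶠ ρ ∈ {ρ : ℂ | IsNontrivialZero ρ ∧ t0 < ρ.im ∧ ρ.im ≤ T},
    (zetaZeroOrder ρ : ℂ) * iteratedDeriv 2 riemannZeta ρ with hS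
  have e1 := b1 T hT
  have e2 := b2 T hT hadm
  have e3 := b3 t0 T hT h2
  have e4 := b4 t0 T hT h1 h2
  rw [rectInt] at hR
  set Bo := ∫ x in (1 - (1 + 1 / Real.log T))..(1 + 1 / Real.log T), Gop riemannZeta (x + t0 * I)
  set To := ∫ x in (1 - (1 + 1 / Real.log T))..(1 + 1 / Real.log T), Gop riemannZeta (x + T * I)
  set Ri := ∫ t in t0..T, Gop riemannZeta ((1 + 1 / Real.log T : ℝ) + t * I)
  set Le := ∫ t in t0..T, Gop riemannZeta ((1 - (1 + 1 / Real.log T) : ℝ) + t * I)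
  set B := BB (T / (2 * Real.pi)) with hB
  have key : 2 * Real.pi * I * (S + B) = Bo - To + I * Ri - I * (Le - (2 * Real.pi * B : ℝ)) := by
    rw [mul_add, ← hR]; push_cast; ring
  have hn := congrArg norm key
  have hpi := Real.pi_gt_three
  rw [norm_mul, norm_mul, norm_I, mul_one, norm_mul, norm_real, Real.norm_of_nonneg Real.pi_pos.le, Complex.norm_two] at hn
  have hn2 : ‖Bo - To + I * Ri - I * (Le - (2 * Real.pi * B : ℝ))‖ ≤ ‖Bo‖ + ‖To‖ + ‖Ri‖ + ‖Le - (2 * Real.pi * B : ℝ)‖ := by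
    refine (norm_sub_le _ _).trans ?_
    rw [norm_mul, norm_I, one_mul]
    gcongr
    refine (norm_add_le _ _).trans ?_
    rw [norm_mul, norm_I, one_mul]
    gcongr
    exact norm_sub_le _ _
  have hSB : ‖S + B‖ ≤ ‖Bo‖ + ‖To‖ + ‖Ri‖ + ‖Le - (2 * Real.pi * B : ℝ)‖ := by
    nlinarith [norm_nonneg (S + B)]
  have hs1 : 1 ≤ Real.sqrt T := by rw [Real.one_le_sqrt]; linarith
  have hl1 : 1 ≤ Real.log T ^ 4 := one_le_pow₀ (by linarith)
  set W := Real.sqrt T * Real.log T ^ 4 with hW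
  have hW1 : Real.log T ^ 4 ≤ W := le_mul_of_one_le_left (by linarith) hs1
  have f1 : C3 * Real.log T ^ 4 ≤ C3 * W := by gcongr
  have f2 : C1 ≤ C1 * W := le_mul_of_one_le_right hC1.le (by linarith)
  have f3 : ‖zetaZeroSum 2 t0‖ ≤ ‖zetaZeroSum 2 t0‖ * W := le_mul_of_one_le_right (norm_nonneg _) (by linarith)
  rw [hsplit, add_assoc]
  refine (norm_add_le _ _).trans ?_
  linarith

lemma perron_diff (y : ℝ) (hy : 0 < y) : Differentiable ℂ (fun s : ℂ => (y : ℂ) ^ s) := by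
  intro s
  exact differentiableAt_id.const_cpow (.inl (by exact_mod_cast hy.ne'))

lemma perron_norm (y : ℝ) (hy : 0 < y) (a b : ℝ) (d : ℝ) (hd : 0 < d) (h : d ≤ ‖(a + b * I : ℂ)‖) :
    ‖(y : ℂ) ^ (a + b * I : ℂ) / (a + b * I)‖ ≤ y ^ a / d := by
  rw [norm_div, Complex.norm_cpow_eq_rpow_re_of_pos hy]
  simp only [add_re, ofReal_re, mul_re, I_re, mul_zero, ofReal_im, I_im, mul_one, sub_self, add_zero]
  gcongr

lemma im_le_norm' (a b : ℝ) : |b| ≤ ‖(a + b * I : ℂ)‖ := by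
  simpa using Complex.abs_im_le_norm (a + b * I)

lemma re_le_norm' (a b : ℝ) : |a| ≤ ‖(a + b * I : ℂ)‖ := by
  simpa using Complex.abs_re_le_norm (a + b * I)

lemma rpow_int (y : ℝ) (hy : 0 < y) (hy1 : y ≠ 1) (a b : ℝ) :
    ∫ x in a..b, y ^ x = (y ^ b - y ^ a) / Real.log y := by
  have hl : Real.log y ≠ 0 := Real.log_ne_zero_of_pos_of_ne_one hy hy1
  have hd : ∀ x ∈ Set.uIcc a b, HasDerivAt (fun x : ℝ => y ^ x / Real.log y) (y ^ x) x := by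
    intro x _
    have := ((hasDerivAt_id x).const_rpow hy).div_const (Real.log y)
    refine this.congr_deriv ?_
    simp; field_simp
  rw [intervalIntegral.integral_eq_sub_of_hasDerivAt hd]
  · ring
  · apply Continuous.intervalIntegrable
    exact Continuous.rpow continuous_const continuous_id (fun x => .inl hy.ne')

lemma perron_h (y : ℝ) (hy : 0 < y) (hy1 : y ≠ 1) (a b v U : ℝ) (hab : a ≤ b) (hU : 0 < U) (hv : |v| = U) :
    ‖∫ x in a..b, (y : ℂ) ^ (x + v * I : ℂ) / (x + v * I)‖ ≤ (y ^ b - y ^ a) / Real.log y / U := by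
  rw [← rpow_int y hy hy1, ← intervalIntegral.integral_div]
  apply intervalIntegral.norm_integral_le_of_norm_le hab
  · filter_upwards with x _
    exact perron_norm y hy x v U hU (hv ▸ im_le_norm' x v)
  · apply Continuous.intervalIntegrable
    exact (Continuous.rpow continuous_const continuous_id (fun x => .inl hy.ne')).div_const _

lemma perron_v (y : ℝ) (hy : 0 < y) (R U : ℝ) (hR : R ≠ 0) (hU : 0 < U) (h1 : y ^ R ≤ 1) :
    ‖∫ t in (-U)..U, (y : ℂ) ^ (R + t * I : ℂ) / (R + t * I)‖ ≤ 2 * U / |R| := by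
  have := intervalIntegral.norm_integral_le_of_norm_le_const (C := 1 / |R|) (a := -U) (b := U)
    (f := fun t : ℝ => (y : ℂ) ^ (R + t * I : ℂ) / (R + t * I)) (fun t _ => by
      refine (perron_norm y hy R t |R| (abs_pos.2 hR) (re_le_norm' R t)).trans ?_
      gcongr)
  refine this.trans (le_of_eq ?_)
  rw [show U - -U = 2 * U by ring, abs_of_pos (show 0 < 2 * U by linarith)]; ring

lemma perron_gt (y c U : ℝ) (hy : 1 < y) (hc : 0 < c) (hU : 0 < U) :
    ‖(∫ t in (-U)..U, (y : ℂ) ^ (c + t * I : ℂ) / (c + t * I)) - 2 * Real.pi‖ ≤ 2 * (y ^ c / (U * Real.log y)) := by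
  have hy0 : 0 < y := by linarith
  have hl := Real.log_pos hy
  apply le_of_forall_pos_le_add
  intro ε hε
  set R := 2 * U / ε with hR
  have hR0 : 0 < R := by positivity
  have hdiff := perron_diff y hy0
  obtain ⟨h, hh, heq⟩ := taylor_rem (U := Set.univ) (c := 0) Filter.univ_mem hdiff.differentiableOn 1
  have key := rectInt_residue (f := fun s => (y : ℂ) ^ s / s) (x0 := -R) (x1 := c) (y0 := -U) (y1 := U) (p := 0)
    (by simpa using hR0) (by simpa using hc) (by simpa using hU) (by simpa using hU) 0 (fun _ => 1) (hh.mono (Set.subset_univ _)) (by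
      intro s hs
      have hs0 : s ≠ 0 := by
        rintro rfl
        obtain ⟨_, h | h | h | h⟩ := hs <;> simp at h <;> linarith
      have := heq s
      simp at this ⊢
      rw [this]; field_simp)
  rw [rectInt] at key
  have b1 := perron_h y hy0 hy.ne' (-R) c (-U) U (by linarith) hU (by rw [abs_neg, abs_of_pos hU])
  have b2 := perron_h y hy0 hy.ne' (-R) c U U (by linarith) hU (abs_of_pos hU)
  have b3 := perron_v y hy0 (-R) U (by linarith) hU (Real.rpow_le_one_of_one_le_of_nonpos hy.le (by linarith))
  have b4 : 2 * U / |-R| = ε := by rw [abs_neg, abs_of_pos hR0, hR]; field_simp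
  have b5 : (y ^ c - y ^ (-R)) / Real.log y / U ≤ y ^ c / (U * Real.log y) := by
    rw [div_div, mul_comm U]; gcongr
    linarith [Real.rpow_pos_of_pos hy0 (-R)]
  set Bo := ∫ x in (-R)..c, (y : ℂ) ^ (x + (-U : ℝ) * I : ℂ) / (x + (-U : ℝ) * I)
  set To := ∫ x in (-R)..c, (y : ℂ) ^ (x + U * I : ℂ) / (x + U * I)
  set Ri := ∫ t in (-U)..U, (y : ℂ) ^ (c + t * I : ℂ) / (c + t * I)
  set Le := ∫ t in (-U)..U, (y : ℂ) ^ ((-R : ℝ) + t * I : ℂ) / ((-R : ℝ) + t * I)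
  have e : Ri - 2 * Real.pi = Le + I * Bo - I * To := by
    have hI : I * I = -1 := I_mul_I
    linear_combination (-I) * key + (Ri - Le - 2 * Real.pi) * hI
  rw [e]
  refine (norm_sub_le _ _).trans ?_
  have := norm_add_le Le (I * Bo)
  rw [norm_mul, norm_I, one_mul] at *
  linarith

lemma perron_lt (y c U : ℝ) (hy0 : 0 < y) (hy : y < 1) (hc : 0 < c) (hU : 0 < U) :
    ‖(∫ t in (-U)..U, (y : ℂ) ^ (c + t * I : ℂ) / (c + t * I))‖ ≤ 2 * (y ^ c / (U * -Real.log y)) := by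
  have hl := Real.log_neg hy0 hy
  apply le_of_forall_pos_le_add
  intro ε hε
  set R := c + 2 * U / ε with hR
  have hRε : 0 < 2 * U / ε := by positivity
  have hR0 : 0 < R := by positivity
  have hdiff := perron_diff y hy0
  have key := rectInt_zero (f := fun s => (y : ℂ) ^ s / s) (x0 := c) (x1 := R) (y0 := -U) (y1 := U)
    (by linarith) (by linarith) (by
      apply DifferentiableOn.fun_div hdiff.differentiableOn differentiableOn_id
      rintro s ⟨h, _⟩ h0
      simp at h0
      rw [h0] at h; simp at h; linarith)
  rw [rectInt] at key
  have b1 := perron_h y hy0 hy.ne c R (-U) U (by linarith) hU (by rw [abs_neg, abs_of_pos hU])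
  have b2 := perron_h y hy0 hy.ne c R U U (by linarith) hU (abs_of_pos hU)
  have b3 := perron_v y hy0 R U (by linarith) hU (Real.rpow_le_one hy0.le hy.le (by linarith))
  have b4 : 2 * U / |R| ≤ ε := by
    rw [abs_of_pos hR0, div_le_iff₀ hR0, hR]; field_simp; nlinarith
  have b5 : (y ^ R - y ^ c) / Real.log y / U ≤ y ^ c / (U * -Real.log y) := by
    have hp : 0 < U * -Real.log y := mul_pos hU (by linarith)
    have e1 : (y ^ R - y ^ c) / Real.log y / U = (y ^ c - y ^ R) / (U * -Real.log y) := by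
      have := hl.ne
      field_simp; ring
    rw [e1]
    gcongr
    linarith [Real.rpow_pos_of_pos hy0 R]
  set Bo := ∫ x in c..R, (y : ℂ) ^ (x + (-U : ℝ) * I : ℂ) / (x + (-U : ℝ) * I)
  set To := ∫ x in c..R, (y : ℂ) ^ (x + U * I : ℂ) / (x + U * I)
  set Le := ∫ t in (-U)..U, (y : ℂ) ^ (c + t * I : ℂ) / (c + t * I)
  set Ri := ∫ t in (-U)..U, (y : ℂ) ^ ((R : ℝ) + t * I : ℂ) / ((R : ℝ) + t * I)
  have e : Le = Ri - I * Bo + I * To := by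
    have hI : I * I = -1 := I_mul_I
    linear_combination (I) * key - (Ri - Le) * hI
  rw [e]
  refine (norm_add_le _ _).trans ?_
  have := norm_sub_le Ri (I * Bo)
  rw [norm_mul, norm_I, one_mul] at *
  linarith

lemma perron_coef (n : ℕ) (X c U : ℝ) (hX : 1 ≤ X) (hc1 : 1 ≤ c) (hc2 : c ≤ 2) (hU : 0 < U) (hn : 1 ≤ n)
    (hX2 : 1 / 2 ≤ |(n : ℝ) - X|) :
    ‖(∫ t in (-U)..U, (X : ℂ) ^ (c + t * I : ℂ) / (c + t * I) * (n : ℂ) ^ (-(c + t * I : ℂ))) -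
      (if (n : ℝ) < X then (2 * Real.pi : ℂ) else 0)‖ ≤ 2 / U * (2 * (X ^ c * (n : ℝ) ^ (-c)) +
        if (n : ℝ) ≤ 2 * X then 24 * X * (1 / (|(n : ℝ) - X| + 1)) else 0) := by
  have hn0 : (1 : ℝ) ≤ n := by exact_mod_cast hn
  have hn1 : (0 : ℝ) < n := by linarith
  have hX0 : 0 < X := by linarith
  set y := X / n with hy
  have hy0 : 0 < y := by positivity
  have e : ∀ t : ℝ, (X : ℂ) ^ (c + t * I : ℂ) / (c + t * I) * (n : ℂ) ^ (-(c + t * I : ℂ)) = (y : ℂ) ^ (c + t * I : ℂ) / (c + t * I) := by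
    intro t
    have : (X : ℂ) = (y : ℂ) * ((n : ℝ) : ℂ) := by
      rw [← ofReal_mul, hy]; congr 1; field_simp
    rw [this, Complex.mul_cpow_ofReal_nonneg hy0.le hn1.le, Complex.cpow_neg]
    have : (n : ℂ) ^ (c + t * I : ℂ) ≠ 0 := by
      rw [Ne, Complex.cpow_eq_zero_iff]; simp; omega
    rw [ofReal_natCast]
    field_simp
  simp_rw [e]
  have hyc : y ^ c = X ^ c * (n : ℝ) ^ (-c) := by
    rw [hy, Real.div_rpow hX0.le hn1.le, Real.rpow_neg hn1.le]; rfl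
  -- lower bound for the logarithm
  have hlog : |(n : ℝ) - X| / max (n : ℝ) X ≤ |Real.log y| := by
    rcases le_total (n : ℝ) X with h | h
    · rw [max_eq_right h, abs_of_nonpos (by linarith)]
      have : 1 ≤ y := by rw [hy, one_le_div hn1]; exact h
      rw [abs_of_nonneg (Real.log_nonneg this)]
      have := Real.one_sub_inv_le_log_of_pos hy0
      refine le_trans (le_of_eq ?_) this
      rw [hy]; field_simp; ring
    · rw [max_eq_left h, abs_of_nonneg (by linarith)]
      have : y ≤ 1 := by rw [hy, div_le_one hn1]; exact h
      rw [abs_of_nonpos (Real.log_nonpos hy0.le this)]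
      have := Real.log_le_sub_one_of_pos hy0
      have e2 : (n - X) / n = 1 - y := by rw [hy]; field_simp
      linarith
  have hlogpos : 0 < |Real.log y| := lt_of_lt_of_le (div_pos (by linarith) (lt_max_of_lt_right hX0)) hlog
  have hmain : ‖(∫ t in (-U)..U, (y : ℂ) ^ (c + t * I : ℂ) / (c + t * I)) -
      (if (n : ℝ) < X then (2 * Real.pi : ℂ) else 0)‖ ≤ 2 * (y ^ c / (U * |Real.log y|)) := by
    split_ifs with h
    · have h1 : 1 < y := by rw [hy, one_lt_div hn1]; exact h
      rw [abs_of_pos (Real.log_pos h1)]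
      exact perron_gt y c U h1 (by linarith) hU
    · have h1 : y < 1 := by
        rw [hy, div_lt_one hn1]
        rcases lt_or_eq_of_le (not_lt.1 h) with h | h
        · exact h
        · rw [h] at hX2; norm_num at hX2
      rw [abs_of_neg (Real.log_neg hy0 h1), sub_zero]
      exact perron_lt y c U hy0 h1 (by linarith) hU
  refine hmain.trans ?_
  have e3 : 2 * (y ^ c / (U * |Real.log y|)) = 2 / U * (y ^ c * (1 / |Real.log y|)) := by field_simp
  rw [e3]
  apply mul_le_mul_of_nonneg_left _ (by positivity)
  have hyc0 : 0 < y ^ c := by positivity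
  have hinv : 1 / |Real.log y| ≤ max (n : ℝ) X / |(n : ℝ) - X| := by
    have hq := one_div_le_one_div_of_le (div_pos (by linarith) (lt_max_of_lt_right hX0)) hlog
    rwa [one_div_div] at hq
  have hnear : 0 ≤ (if (n : ℝ) ≤ 2 * X then 24 * X * (1 / (|(n : ℝ) - X| + 1)) else 0) := by
    split_ifs <;> positivity
  rw [← hyc]
  by_cases hfar : max (n : ℝ) X / |(n : ℝ) - X| ≤ 2
  · have : y ^ c * (1 / |Real.log y|) ≤ y ^ c * 2 := mul_le_mul_of_nonneg_left (hinv.trans hfar) hyc0.le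
    linarith
  · push Not at hfar
    rw [lt_div_iff₀ (by linarith)] at hfar
    have hn2 : (n : ℝ) ≤ 2 * X ∧ X ≤ 2 * n := by
      rcases le_total (n : ℝ) X with h | h
      · rw [max_eq_right h, abs_of_nonpos (by linarith)] at hfar; constructor <;> linarith
      · rw [max_eq_left h, abs_of_nonneg (by linarith)] at hfar; constructor <;> linarith
    rw [if_pos hn2.1]
    have hy2 : y ≤ 2 := by rw [hy, div_le_iff₀ hn1]; exact hn2.2
    have hy4 : y ^ c ≤ 4 := by
      calc y ^ c ≤ 2 ^ c := Real.rpow_le_rpow hy0.le hy2 (by linarith)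
        _ ≤ 2 ^ (2 : ℝ) := Real.rpow_le_rpow_of_exponent_le (by norm_num) hc2
        _ = 4 := by norm_num
    have hd : max (n : ℝ) X / |(n : ℝ) - X| ≤ 6 * X * (1 / (|(n : ℝ) - X| + 1)) := by
      rw [mul_one_div, div_le_div_iff₀ (by linarith) (by linarith)]
      have hm : max (n : ℝ) X ≤ 2 * X := max_le hn2.1 (by linarith)
      have : |(n : ℝ) - X| + 1 ≤ 3 * |(n : ℝ) - X| := by linarith
      calc max (n : ℝ) X * (|(n : ℝ) - X| + 1) ≤ (2 * X) * (3 * |(n : ℝ) - X|) := by gcongr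
        _ = _ := by ring
    have := mul_le_mul hy4 (hinv.trans hd) (by positivity) (by norm_num)
    linarith

lemma BB_tsum (x : ℝ) (hx : 1 ≤ x) : HasSum (fun n : ℕ => (bb n : ℂ) * (if (n : ℝ) < ⌊x⌋₊ + 1 / 2 then (2 * Real.pi : ℂ) else 0))
    (2 * Real.pi * BB x) := by
  have : (2 * Real.pi * BB x : ℂ) = ∑ n ∈ Finset.Icc 1 ⌊x⌋₊, (bb n : ℂ) * (if (n : ℝ) < ⌊x⌋₊ + 1 / 2 then (2 * Real.pi : ℂ) else 0) := by
    rw [BB, ofReal_sum, mul_sum]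
    apply Finset.sum_congr rfl
    intro n hn
    rw [Finset.mem_Icc] at hn
    have : (n : ℝ) ≤ ⌊x⌋₊ := by exact_mod_cast hn.2
    rw [if_pos (by linarith)]; ring
  rw [this]
  apply hasSum_sum_of_ne_finset_zero
  intro n hn
  rcases Nat.eq_zero_or_pos n with rfl | h
  · rw [bb_zero]; simp
  · have h2 : ⌊x⌋₊ + 1 ≤ n := by
      rw [Finset.mem_Icc] at hn; omega
    have : (⌊x⌋₊ : ℝ) + 1 ≤ n := by exact_mod_cast h2
    rw [if_neg (by linarith), mul_zero]

lemma perron_BB : ∃ C > 0, ∀ x U : ℝ, 16 ≤ x → 1 ≤ U →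
    ‖(2 * Real.pi * BB x : ℂ) + ∫ t in (-U)..U, ((⌊x⌋₊ + 1 / 2 : ℝ) : ℂ) ^ ((1 + 1 / Real.log x : ℝ) + t * I : ℂ) / ((1 + 1 / Real.log x : ℝ) + t * I) *
      Gop riemannZeta ((1 + 1 / Real.log x : ℝ) + t * I)‖ ≤ C * (x * Real.log x ^ 4 / U) := by
  obtain ⟨C, hC, hb⟩ := bb_sum_bd
  refine ⟨8 * Real.exp 2 * C + 100000, by positivity, fun x U hx hU => ?_⟩
  have hL := log_ge_two x hx
  set L := Real.log x with hLd
  set c := 1 + 1 / L with hc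
  have hc0 : 0 < 1 / L := by positivity
  have hc1 : 1 / L ≤ 1 / 2 := one_div_le_one_div_of_le (by norm_num) hL
  set X : ℝ := ⌊x⌋₊ + 1 / 2 with hX
  have hf1 : (⌊x⌋₊ : ℝ) ≤ x := Nat.floor_le (by linarith)
  have hf2 : x < ⌊x⌋₊ + 1 := Nat.lt_floor_add_one x
  have hX1 : 1 ≤ X := by rw [hX]; linarith
  have hX2 : X ≤ 2 * x := by rw [hX]; linarith
  have hX0 : 0 < X := by linarith
  have hcont : Continuous (fun t : ℝ => (X : ℂ) ^ (c + t * I : ℂ) / (c + t * I)) := by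
    apply Continuous.div
    · exact Continuous.const_cpow (by fun_prop) (.inl (by exact_mod_cast hX0.ne'))
    · fun_prop
    · intro t h
      have := congrArg re h
      simp at this; linarith
  have hs1 := int_swap c (-U) U (by linarith) (by linarith) _ hcont
  have hs2 := hs1.sub (BB_tsum x (by linarith))
  set M := ⌊2 * X⌋₊ + 1 with hM
  have hM2 : ((⌊2 * X⌋₊ : ℕ) : ℝ) ≤ 2 * X := Nat.floor_le (by linarith)
  have hM1 : (M : ℝ) ≤ 2 * X + 1 := by rw [hM]; push_cast; linarith
  have hl0 : 0 ≤ Real.log (2 * X) := Real.log_nonneg (by linarith)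
  set D := 24 * X * Real.log (2 * X) ^ 3 with hD
  have hgs : HasSum (fun n : ℕ => 2 / U * (2 * X ^ c * (bb n * (n : ℝ) ^ (-c)) +
      if n ∈ range M then D * (1 / (|(n : ℝ) - X| + 1)) else 0))
      (2 / U * (2 * X ^ c * (∑' n : ℕ, bb n * (n : ℝ) ^ (-c)) + D * ∑ n ∈ range M, 1 / (|(n : ℝ) - X| + 1))) := by
    apply HasSum.mul_left
    apply HasSum.add
    · exact (bb_summable c (by linarith)).hasSum.mul_left _
    · rw [mul_sum]
      have : ∑ n ∈ range M, D * (1 / (|(n : ℝ) - X| + 1)) = ∑ n ∈ range M, (if n ∈ range M then D * (1 / (|(n : ℝ) - X| + 1)) else 0) :=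
        Finset.sum_congr rfl fun n hn => by rw [if_pos hn]
      rw [this]
      exact hasSum_sum_of_ne_finset_zero (fun n hn => if_neg hn)
  have hbound := tsum_of_norm_bounded hgs (f := fun n : ℕ => (bb n : ℂ) * (∫ t in (-U)..U, (X : ℂ) ^ (c + t * I : ℂ) / (c + t * I) * (n : ℂ) ^ (-(c + t * I : ℂ))) -
      (bb n : ℂ) * (if (n : ℝ) < X then (2 * Real.pi : ℂ) else 0)) (by
    intro n
    rw [← mul_sub, norm_mul, norm_real, Real.norm_of_nonneg (bb_nonneg n)]
    rcases Nat.eq_zero_or_pos n with rfl | hn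
    · rw [bb_zero]
      simp only [zero_mul, mul_zero]
      have : 0 ≤ D := by positivity
      split_ifs <;> positivity
    · have hh : 1 / 2 ≤ |(n : ℝ) - X| := by
        rcases Nat.lt_or_ge ⌊x⌋₊ n with h | h
        · have : (⌊x⌋₊ : ℝ) + 1 ≤ n := by exact_mod_cast h
          rw [le_abs]; left; rw [hX]; linarith
        · have : (n : ℝ) ≤ ⌊x⌋₊ := by exact_mod_cast h
          rw [le_abs]; right; rw [hX]; linarith
      have := perron_coef n X c U hX1 (by linarith) (by linarith) (by linarith) hn hh
      refine (mul_le_mul_of_nonneg_left this (bb_nonneg n)).trans ?_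
      rw [mul_left_comm]
      apply mul_le_mul_of_nonneg_left _ (by positivity)
      rw [mul_add]
      apply add_le_add (le_of_eq (by ring))
      by_cases h : (n : ℝ) ≤ 2 * X
      · rw [if_pos h, if_pos (by rw [Finset.mem_range, hM]; exact Nat.lt_succ_of_le (Nat.le_floor h))]
        have hn0 : (0 : ℝ) < n := by exact_mod_cast hn
        have b1 : bb n ≤ Real.log (2 * X) ^ 3 := (bb_le n).trans (by
          have : 0 ≤ Real.log n := Real.log_natCast_nonneg n
          have : Real.log n ≤ Real.log (2 * X) := Real.log_le_log hn0 h
          gcongr)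
        have b2 : 0 ≤ 24 * X * (1 / (|(n : ℝ) - X| + 1)) := by positivity
        have := mul_le_mul_of_nonneg_right b1 b2
        rw [hD]; linarith
      · rw [if_neg h, mul_zero]
        have : 0 ≤ D := by positivity
        split_ifs <;> positivity)
  rw [hs2.tsum_eq, ← norm_neg] at hbound
  have e1 : -((-∫ t in (-U)..U, (X : ℂ) ^ (c + t * I : ℂ) / (c + t * I) * Gop riemannZeta (c + t * I)) - 2 * Real.pi * BB x) =
     (2 * Real.pi * BB x : ℂ) + ∫ t in (-U)..U, (X : ℂ) ^ (c + t * I : ℂ) / (c + t * I) * Gop riemannZeta (c + t * I) := by ring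
  rw [e1] at hbound
  refine hbound.trans ?_
  have c1 : X ^ c ≤ 2 * x * Real.exp 2 := by
    rw [hc, Real.rpow_add hX0, Real.rpow_one]
    apply mul_le_mul hX2 _ (by positivity) (by linarith)
    calc X ^ (1 / L) ≤ (x ^ (2 : ℝ)) ^ (1 / L) := by
          apply Real.rpow_le_rpow hX0.le _ hc0.le
          rw [Real.rpow_two]; nlinarith
      _ = Real.exp 2 := by
          rw [← Real.rpow_mul (by linarith), Real.rpow_def_of_pos (by linarith), ← hLd]
          congr 1; field_simp
  have c2 := hb (1 / L) hc0 (by linarith)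
  have c2' : C / (1 / L) ^ 4 = C * L ^ 4 := by field_simp
  rw [c2'] at c2
  have c3 : Real.log (2 * X) ≤ 2 * L := by
    rw [hLd, show 2 * Real.log x = Real.log (x ^ 2) by simp]
    apply Real.log_le_log (by linarith); nlinarith
  have c4 : D ≤ 24 * (2 * x) * (2 * L) ^ 3 := by rw [hD]; gcongr
  have c5 := sum_near X hX0.le M
  have c6 : Real.log (M + X + 1) ≤ 2 * L := by
    rw [hLd, show 2 * Real.log x = Real.log (x ^ 2) by simp]
    apply Real.log_le_log (by positivity); nlinarith
  have c7 : ∑ n ∈ range M, 1 / (|(n : ℝ) - X| + 1) ≤ 6 * L := by linarith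
  have hD0 : 0 ≤ D := by positivity
  have c8 : X ^ c * (∑' n : ℕ, bb n * (n : ℝ) ^ (-c)) ≤ (2 * x * Real.exp 2) * (C * L ^ 4) :=
    mul_le_mul c1 c2 (tsum_nonneg fun n => mul_nonneg (bb_nonneg n) (by positivity)) (by positivity)
  have c9 : D * ∑ n ∈ range M, 1 / (|(n : ℝ) - X| + 1) ≤ (24 * (2 * x) * (2 * L) ^ 3) * (6 * L) :=
    mul_le_mul c4 c7 (Finset.sum_nonneg fun n _ => by positivity) (by positivity)
  calc _ ≤ 2 / U * (2 * ((2 * x * Real.exp 2) * (C * L ^ 4)) + (24 * (2 * x) * (2 * L) ^ 3) * (6 * L)) := by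
        apply mul_le_mul_of_nonneg_left _ (by positivity)
        linarith
    _ = (8 * Real.exp 2 * C + 4608) * (x * L ^ 4 / U) := by field_simp; ring
    _ ≤ _ := by gcongr; norm_num

/-- The main term, as a function of `X = T / 2π`. -/
noncomputable def MT (C : ℕ → ℂ) (X : ℝ) : ℂ :=
  -(1 / 3) * ((X * Real.log X ^ 3 : ℝ) : ℂ) + (1 - C 0) * ((X * Real.log X ^ 2 : ℝ) : ℂ)
  + (-2 + 2 * C 0 - 2 * C 1) * ((X * Real.log X : ℝ) : ℂ)
  + (2 - 2 * C 0 + 2 * C 1 + 4 * C 2 - 6 * C 0 * C 1 + 2 * (C 0) ^ 3) * (X : ℂ)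

lemma MT_eq (C : ℕ → ℂ) (T : ℝ) : secondDerivMainTerm C T = MT C (T / (2 * Real.pi)) := by
  rw [secondDerivMainTerm, MT]
  have : T / (6 * Real.pi) = (1 / 3) * (T / (2 * Real.pi)) := by ring
  rw [this]; push_cast; ring

lemma xlog_stab (k : ℕ) (x X : ℝ) (hx : 16 ≤ x) (h1 : x - 1 ≤ X) (h2 : X ≤ x + 1) :
    |X * Real.log X ^ k - x * Real.log x ^ k| ≤ (k + 1) * (2 * Real.log x) ^ k := by
  have hL := log_ge_two x hx
  have hd : ∀ u ∈ Set.Icc (x - 1) (x + 1), HasDerivWithinAt (fun u : ℝ => u * Real.log u ^ k) (Real.log u ^ k + k * Real.log u ^ (k - 1)) (Set.Icc (x - 1) (x + 1)) u := by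
    intro u hu
    have hu0 : u ≠ 0 := by linarith [hu.1]
    have := (hasDerivAt_id u).mul ((Real.hasDerivAt_log hu0).pow k)
    refine (this.congr_deriv ?_).hasDerivWithinAt
    simp; field_simp
  have hb : ∀ u ∈ Set.Icc (x - 1) (x + 1), ‖Real.log u ^ k + k * Real.log u ^ (k - 1)‖ ≤ (k + 1) * (2 * Real.log x) ^ k := by
    intro u hu
    have l0 : 0 ≤ Real.log u := Real.log_nonneg (by linarith [hu.1])
    have l1 : Real.log u ≤ 2 * Real.log x := by
      rw [show 2 * Real.log x = Real.log (x ^ 2) by simp]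
      exact Real.log_le_log (by linarith [hu.1]) (by nlinarith [hu.2])
    rw [Real.norm_of_nonneg (by positivity)]
    have q1 : Real.log u ^ k ≤ (2 * Real.log x) ^ k := by gcongr
    have q2 : Real.log u ^ (k - 1) ≤ (2 * Real.log x) ^ k :=
      (pow_le_pow_left₀ l0 l1 _).trans (pow_le_pow_right₀ (by linarith) (by omega))
    have : (k : ℝ) * Real.log u ^ (k - 1) ≤ k * (2 * Real.log x) ^ k := by gcongr
    linarith
  have := (convex_Icc (x - 1) (x + 1)).norm_image_sub_le_of_norm_hasDerivWithin_le hd hb (x := x) (y := X)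
    ⟨by linarith, by linarith⟩ ⟨h1, h2⟩
  rw [Real.norm_eq_abs] at this
  refine this.trans ?_
  have hX : ‖X - x‖ ≤ 1 := by rw [Real.norm_eq_abs, abs_le]; constructor <;> linarith
  exact mul_le_of_le_one_right (by positivity) hX

lemma MT_stab (C : ℕ → ℂ) : ∃ K > 0, ∀ x : ℝ, 16 ≤ x →
    ‖MT C (⌊x⌋₊ + 1 / 2 : ℝ) - MT C x‖ ≤ K * Real.log x ^ 3 := by
  refine ⟨(‖(-(1 / 3) : ℂ)‖ + ‖1 - C 0‖ + ‖-2 + 2 * C 0 - 2 * C 1‖ + ‖2 - 2 * C 0 + 2 * C 1 + 4 * C 2 - 6 * C 0 * C 1 + 2 * (C 0) ^ 3‖) * 32 + 1, by positivity, fun x hx => ?_⟩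
  have hL := log_ge_two x hx
  have hf1 : (⌊x⌋₊ : ℝ) ≤ x := Nat.floor_le (by linarith)
  have hf2 : x < ⌊x⌋₊ + 1 := Nat.lt_floor_add_one x
  set X : ℝ := ⌊x⌋₊ + 1 / 2 with hX
  have key : ∀ k : ℕ, k ≤ 3 → ‖((X * Real.log X ^ k : ℝ) : ℂ) - ((x * Real.log x ^ k : ℝ) : ℂ)‖ ≤ 32 * Real.log x ^ 3 := by
    intro k hk
    rw [← ofReal_sub, norm_real, Real.norm_eq_abs]
    refine (xlog_stab k x X hx (by linarith) (by linarith)).trans ?_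
    have : (2 * Real.log x) ^ k ≤ (2 * Real.log x) ^ 3 := pow_le_pow_right₀ (by linarith) hk
    have hk' : (k : ℝ) ≤ 3 := by exact_mod_cast hk
    calc ((k : ℝ) + 1) * (2 * Real.log x) ^ k ≤ 4 * (2 * Real.log x) ^ 3 := by gcongr; linarith
      _ = _ := by ring
  have k3 := key 3 le_rfl
  have k2 := key 2 (by norm_num)
  have k1 := key 1 (by norm_num)
  have k0 := key 0 (by norm_num)
  rw [pow_one, pow_one] at k1
  rw [pow_zero, pow_zero, mul_one, mul_one] at k0
  rw [MT, MT]
  set A3 := ((X * Real.log X ^ 3 : ℝ) : ℂ)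
  set A2 := ((X * Real.log X ^ 2 : ℝ) : ℂ)
  set A1 := ((X * Real.log X : ℝ) : ℂ)
  set B3 := ((x * Real.log x ^ 3 : ℝ) : ℂ)
  set B2 := ((x * Real.log x ^ 2 : ℝ) : ℂ)
  set B1 := ((x * Real.log x : ℝ) : ℂ)
  set c1 := 1 - C 0
  set c2 := -2 + 2 * C 0 - 2 * C 1
  set c3 := 2 - 2 * C 0 + 2 * C 1 + 4 * C 2 - 6 * C 0 * C 1 + 2 * (C 0) ^ 3
  set W := Real.log x ^ 3 with hW
  have hW0 : 0 ≤ W := by positivity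
  have e : -(1 / 3) * A3 + c1 * A2 + c2 * A1 + c3 * X - (-(1 / 3) * B3 + c1 * B2 + c2 * B1 + c3 * x) =
    -(1 / 3) * (A3 - B3) + c1 * (A2 - B2) + c2 * (A1 - B1) + c3 * (X - x) := by ring
  rw [e]
  have t3 := mul_le_mul_of_nonneg_left k3 (norm_nonneg (-(1 / 3) : ℂ))
  have t2 := mul_le_mul_of_nonneg_left k2 (norm_nonneg c1)
  have t1 := mul_le_mul_of_nonneg_left k1 (norm_nonneg c2)
  have t0 := mul_le_mul_of_nonneg_left k0 (norm_nonneg c3)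
  rw [← norm_mul] at t3 t2 t1 t0
  have := norm_add₄_le (a := -(1 / 3) * (A3 - B3)) (b := c1 * (A2 - B2)) (c := c2 * (A1 - B1)) (d := c3 * ((X : ℂ) - x))
  linarith

lemma zeta1_coef (C : ℕ → ℂ)
    (hC : ∀ᶠ s in nhdsWithin (1 : ℂ) {(1 : ℂ)}ᶜ,
      HasSum (fun j : ℕ => C j * (s - 1) ^ j) (riemannZeta s - 1 / (s - 1))) (n : ℕ) :
    iteratedDeriv (n + 1) riemannZeta₁ 1 = ((n + 1).factorial : ℂ) * C n := by
  set D : ℕ → ℂ := fun n => Nat.casesOn n 1 C with hD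
  have hD0 : D 0 = 1 := rfl
  have hDs : ∀ n, D (n + 1) = C n := fun _ => rfl
  have h1 : HasFPowerSeriesAt riemannZeta₁ (FormalMultilinearSeries.ofScalars ℂ D) 1 := by
    rw [hasFPowerSeriesAt_iff']
    rw [eventually_nhdsWithin_iff] at hC
    filter_upwards [hC] with s hs
    simp only [FormalMultilinearSeries.coeff_ofScalars, smul_eq_mul]
    rcases eq_or_ne s 1 with rfl | h
    · rw [riemannZeta₁_one]
      have := hasSum_single (f := fun n : ℕ => ((1 : ℂ) - 1) ^ n * D n) 0 (by
        intro n hn; simp [hn])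
      simpa [hD] using this
    · have h' := (hs h).mul_left (s - 1)
      have hs1 : s - 1 ≠ 0 := sub_ne_zero.2 h
      rw [riemannZeta_eq_inv_sub_mul h] at h'
      rw [← hasSum_nat_add_iff' 1]
      simp only [range_one, sum_singleton, pow_zero, one_mul]
      have e : (s - 1) * ((s - 1)⁻¹ * riemannZeta₁ s - 1 / (s - 1)) = riemannZeta₁ s - D 0 := by
        rw [hD0]; field_simp
      rw [e] at h'
      have e2 : (fun n : ℕ => (s - 1) ^ (n + 1) * D (n + 1)) = fun i => (s - 1) * (C i * (s - 1) ^ i) := by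
        funext i; rw [hDs]; ring
      rw [e2]; exact h'
  have h2 := (differentiable_riemannZeta₁.analyticAt 1).hasFPowerSeriesAt
  have h3 := h1.eq_formalMultilinearSeries h2
  have h4 := congrArg (fun p => p.coeff (n + 1)) h3
  simp only [FormalMultilinearSeries.coeff_ofScalars, hD] at h4
  rw [h4, mul_div_cancel₀ _ (Nat.cast_ne_zero.2 (Nat.factorial_ne_zero _))]

lemma LD2_formula {f : ℂ → ℂ} {c : ℂ} (hf : AnalyticAt ℂ f c) (h1 : f c = 1) :
    iteratedDeriv 2 (logDeriv f) c = iteratedDeriv 3 f c - 3 * iteratedDeriv 1 f c * iteratedDeriv 2 f c + 2 * iteratedDeriv 1 f c ^ 3 := by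
  have hne : ∀ᶠ z in nhds c, f z ≠ 0 := hf.continuousAt.eventually_ne (by rw [h1]; exact one_ne_zero)
  have hd : ∀ (g : ℂ → ℂ), AnalyticAt ℂ g c → ∀ᶠ z in nhds c, DifferentiableAt ℂ g z := fun g hg => by
    filter_upwards [hg.eventually_analyticAt] with z hz using hz.differentiableAt
  have e1 : deriv (logDeriv f) =ᶠ[nhds c] fun z => (deriv (deriv f) z * f z - deriv f z * deriv f z) / f z ^ 2 := by
    filter_upwards [hne, hd f hf, hd _ hf.deriv] with z h0 h2 h3
    have : logDeriv f = fun z => deriv f z / f z := rfl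
    rw [this]
    exact (h3.hasDerivAt.fun_div h2.hasDerivAt h0).deriv
  have i1 : iteratedDeriv 1 f c = deriv f c := by rw [iteratedDeriv_one]
  have i2 : iteratedDeriv 2 f c = deriv (deriv f) c := by rw [iteratedDeriv_succ, iteratedDeriv_one]
  have i3 : iteratedDeriv 3 f c = deriv (deriv (deriv f)) c := by
    rw [iteratedDeriv_succ, iteratedDeriv_succ, iteratedDeriv_one]
  rw [i1, i2, i3, iteratedDeriv_succ, iteratedDeriv_one, e1.deriv_eq]
  have d0 := hf.differentiableAt.hasDerivAt
  have d1 := hf.deriv.differentiableAt.hasDerivAt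
  have d2 := hf.deriv.deriv.differentiableAt.hasDerivAt
  have := (((d2.fun_mul d0).fun_sub (d1.fun_mul d1)).fun_div (d0.fun_pow 2) (by rw [h1]; norm_num)).deriv
  rw [this, h1]; norm_num; ring

lemma Gop_zeta_eq (s : ℂ) (hs : s ≠ 1) (h0 : riemannZeta s ≠ 0) :
    Gop riemannZeta s = (-2 * riemannZeta₁ s + (s - 1) ^ 3 * Gop riemannZeta₁ s) / (s - 1) ^ 4 := by
  have hs1 : s - 1 ≠ 0 := sub_ne_zero.2 hs
  have hev : logDeriv riemannZeta =ᶠ[nhds s] fun z => logDeriv riemannZeta₁ z - (z - 1)⁻¹ := by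
    filter_upwards [isOpen_ne.mem_nhds hs, (zeta_analytic s hs).continuousAt.eventually_ne h0] with z h1 h2
    rw [logDeriv_zeta z h1 h2, one_div]
  have h10 : riemannZeta₁ s ≠ 0 := by rwa [Ne, zeta1_zero_iff]
  have hA : ContDiffAt ℂ 2 (logDeriv riemannZeta₁) s := (analytic_logDeriv (differentiable_riemannZeta₁.analyticAt s) h10).contDiffAt
  have hB : ContDiffAt ℂ 2 (fun z : ℂ => (z - 1)⁻¹) s := ContDiffAt.inv (by fun_prop) hs1
  rw [Gop, hev.iteratedDeriv_eq, iteratedDeriv_fun_sub hA hB, iterDeriv2_inv_sub 1 s hs, Gop, riemannZeta_eq_inv_sub_mul hs]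
  field_simp; ring

lemma T4_mul {S : Set ℂ} {f g : ℂ → ℂ} {a0 a1 a2 a3 b0 b1 b2 b3 : ℂ}
    (hf : ∃ h, DifferentiableOn ℂ h S ∧ ∀ z ∈ S, f z = a0 + a1 * (z - 1) + a2 * (z - 1) ^ 2 + a3 * (z - 1) ^ 3 + (z - 1) ^ 4 * h z)
    (hg : ∃ h, DifferentiableOn ℂ h S ∧ ∀ z ∈ S, g z = b0 + b1 * (z - 1) + b2 * (z - 1) ^ 2 + b3 * (z - 1) ^ 3 + (z - 1) ^ 4 * h z) :
    ∃ h, DifferentiableOn ℂ h S ∧ ∀ z ∈ S, f z * g z = a0 * b0 + (a0 * b1 + a1 * b0) * (z - 1) + (a0 * b2 + a1 * b1 + a2 * b0) * (z - 1) ^ 2 +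
      (a0 * b3 + a1 * b2 + a2 * b1 + a3 * b0) * (z - 1) ^ 3 + (z - 1) ^ 4 * h z := by
  obtain ⟨h, hh, e⟩ := hf
  obtain ⟨k, hk, e'⟩ := hg
  refine ⟨fun z => (a1 * b3 + a2 * b2 + a3 * b1) + (a2 * b3 + a3 * b2) * (z - 1) + a3 * b3 * (z - 1) ^ 2 +
    (a0 + a1 * (z - 1) + a2 * (z - 1) ^ 2 + a3 * (z - 1) ^ 3) * k z + h z * (b0 + b1 * (z - 1) + b2 * (z - 1) ^ 2 + b3 * (z - 1) ^ 3 + (z - 1) ^ 4 * k z), ?_, ?_⟩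
  · fun_prop
  · intro z hz
    rw [e z hz, e' z hz]; ring

lemma T4_pow {S : Set ℂ} (hS : S ∈ nhds (1 : ℂ)) (X : ℝ) (hX : 0 < X) :
    ∃ h, DifferentiableOn ℂ h S ∧ ∀ z ∈ S, (X : ℂ) ^ z = (X : ℂ) + (X * Real.log X : ℂ) * (z - 1) + (X * Real.log X ^ 2 / 2 : ℂ) * (z - 1) ^ 2 +
      (X * Real.log X ^ 3 / 6 : ℂ) * (z - 1) ^ 3 + (z - 1) ^ 4 * h z := by
  obtain ⟨h, hh, e⟩ := taylor_rem hS (perron_diff X hX).differentiableOn 4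
  refine ⟨h, hh, fun z _ => ?_⟩
  rw [e z]
  have hfun : (fun s : ℂ => (X : ℂ) ^ s) = fun s => Complex.exp ((Real.log X : ℂ) * s) := by
    funext s
    rw [Complex.cpow_def_of_ne_zero (by exact_mod_cast hX.ne'), Complex.ofReal_log hX.le]
  have hE : Complex.exp (Real.log X : ℂ) = X := by rw [← ofReal_exp, Real.exp_log hX]
  rw [hfun]
  simp only [iteratedDeriv_cexp_const_mul, Finset.sum_range_succ, Finset.range_zero, Finset.sum_empty, mul_one, hE]
  simp [Nat.factorial]
  ring

lemma T4_inv {S : Set ℂ} (hS : ∀ z ∈ S, z ≠ 0) :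
    ∃ h, DifferentiableOn ℂ h S ∧ ∀ z ∈ S, z⁻¹ = 1 + (-1) * (z - 1) + 1 * (z - 1) ^ 2 + (-1) * (z - 1) ^ 3 + (z - 1) ^ 4 * h z := by
  refine ⟨fun z => z⁻¹, differentiableOn_id.inv hS, fun z hz => ?_⟩
  have := hS z hz
  field_simp; ring

lemma T4_zeta {S : Set ℂ} (hS : S ∈ nhds (1 : ℂ)) (hS0 : ∀ z ∈ S, riemannZeta₁ z ≠ 0) (C : ℕ → ℂ)
    (hC : ∀ᶠ s in nhdsWithin (1 : ℂ) {(1 : ℂ)}ᶜ,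
      HasSum (fun j : ℕ => C j * (s - 1) ^ j) (riemannZeta s - 1 / (s - 1))) :
    ∃ h, DifferentiableOn ℂ h S ∧ ∀ z ∈ S, (-2 * riemannZeta₁ z + (z - 1) ^ 3 * Gop riemannZeta₁ z) =
      -2 + (-2 * C 0) * (z - 1) + (-2 * C 1) * (z - 1) ^ 2 + (4 * C 2 - 6 * C 0 * C 1 + 2 * C 0 ^ 3) * (z - 1) ^ 3 + (z - 1) ^ 4 * h z := by
  obtain ⟨h, hh, e⟩ := taylor_rem hS differentiable_riemannZeta₁.differentiableOn 4
  have hG : DifferentiableOn ℂ (Gop riemannZeta₁) S := fun z hz =>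
    (Gop_analytic (differentiable_riemannZeta₁.analyticAt z) (hS0 z hz)).differentiableAt.differentiableWithinAt
  obtain ⟨k, hk, e'⟩ := taylor_rem hS hG 1
  refine ⟨fun z => -2 * h z + k z, by fun_prop, fun z hz => ?_⟩
  have c0 := zeta1_coef C hC 0
  have c1 := zeta1_coef C hC 1
  have c2 := zeta1_coef C hC 2
  have hK : Gop riemannZeta₁ 1 = 6 * C 2 - 6 * C 0 * C 1 + 2 * C 0 ^ 3 := by
    rw [Gop, LD2_formula (differentiable_riemannZeta₁.analyticAt 1) riemannZeta₁_one, riemannZeta₁_one]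
    rw [show iteratedDeriv 1 riemannZeta₁ 1 = _ from c0, show iteratedDeriv 2 riemannZeta₁ 1 = _ from c1,
      show iteratedDeriv 3 riemannZeta₁ 1 = _ from c2]
    norm_num [Nat.factorial]; ring
  have ez := e z
  have ez' := e' z
  simp only [Finset.sum_range_succ, Finset.range_zero, Finset.sum_empty] at ez ez'
  norm_num at c0 c1 c2
  norm_num at ez ez'
  rw [hK] at ez'
  rw [ez', ez, c0, c1, c2]
  ring

lemma T4_residue {x0 x1 U : ℝ} {F f : ℂ → ℂ} {a0 a1 a2 a3 : ℂ} (hx1 : x0 < 1) (hx2 : 1 < x1) (hU : 0 < U)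
    (hF : ∃ h, DifferentiableOn ℂ h (RC x0 x1 (-U) U) ∧ ∀ z ∈ RC x0 x1 (-U) U, F z = a0 + a1 * (z - 1) + a2 * (z - 1) ^ 2 + a3 * (z - 1) ^ 3 + (z - 1) ^ 4 * h z)
    (hf : ∀ z ∈ RC x0 x1 (-U) U, z ≠ 1 → f z = F z / (z - 1) ^ 4) :
    rectInt f x0 x1 (-U) U = 2 * Real.pi * I * a3 := by
  obtain ⟨h, hh, e⟩ := hF
  have key := rectInt_residue (f := f) (p := 1) (x0 := x0) (x1 := x1) (y0 := -U) (y1 := U)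
    (by simpa using hx1) (by simpa using hx2) (by simpa using hU) (by simpa using hU) 3
    (fun j => if j = 0 then a0 else if j = 1 then a1 else if j = 2 then a2 else a3) hh (by
      intro s hs
      have hs1 : s ≠ 1 := by
        rintro rfl
        obtain ⟨_, h | h | h | h⟩ := hs <;> simp at h <;> linarith
      have hsub : s - 1 ≠ 0 := sub_ne_zero.2 hs1
      have hsR := hs.1
      simp only [Finset.sum_range_succ, Finset.range_zero, Finset.sum_empty]
      norm_num
      rw [hf s hsR hs1, e s hsR, add_div, mul_div_cancel_left₀ _ (pow_ne_zero 4 hsub)])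
  rw [key]; norm_num

lemma residue_main (C : ℕ → ℂ)
    (hC : ∀ᶠ s in nhdsWithin (1 : ℂ) {(1 : ℂ)}ᶜ,
      HasSum (fun j : ℕ => C j * (s - 1) ^ j) (riemannZeta s - 1 / (s - 1))) (X x0 x1 U : ℝ) (hX : 0 < X)
    (hx0 : 0 < x0) (hx1 : x0 < 1) (hx2 : 1 < x1) (hU : 0 < U)
    (hz : ∀ s ∈ RC x0 x1 (-U) U, riemannZeta s ≠ 0) :
    rectInt (fun s => (X : ℂ) ^ s / s * Gop riemannZeta s) x0 x1 (-U) U = 2 * Real.pi * I * MT C X := by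
  have hS : RC x0 x1 (-U) U ∈ nhds (1 : ℂ) := RC_mem_nhds (by simpa using hx1) (by simpa using hx2) (by simpa using hU) (by simpa using hU)
  have hS0 : ∀ z ∈ RC x0 x1 (-U) U, z ≠ 0 := by
    rintro z ⟨h, _⟩ rfl
    simp at h; linarith
  have hS1 : ∀ z ∈ RC x0 x1 (-U) U, riemannZeta₁ z ≠ 0 := fun z h => by rw [Ne, zeta1_zero_iff]; exact hz z h
  have key := T4_residue (f := fun s => (X : ℂ) ^ s / s * Gop riemannZeta s) hx1 hx2 hU
    (T4_mul (T4_mul (T4_pow hS X hX) (T4_inv hS0)) (T4_zeta hS hS1 C hC)) (by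
      intro s hs h1
      rw [Gop_zeta_eq s h1 (hz s hs)]; ring)
  rw [key, MT]
  push_cast
  ring

lemma combine (C : ℕ → ℂ)
    (hC : ∀ᶠ s in nhdsWithin (1 : ℂ) {(1 : ℂ)}ᶜ,
      HasSum (fun j : ℕ => C j * (s - 1) ^ j) (riemannZeta s - 1 / (s - 1))) :
    ∃ K > 0, ∀ x U x0 : ℝ, 16 ≤ x → 1 ≤ U → 0 < x0 → x0 < 1 →
    (∀ s ∈ RC x0 (1 + 1 / Real.log x) (-U) U, riemannZeta s ≠ 0) →
    ‖(BB x : ℂ) + MT C x‖ ≤ K * (x * Real.log x ^ 4 / U) + K * Real.log x ^ 3 +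
      ‖∫ t in (-U)..U, ((⌊x⌋₊ + 1 / 2 : ℝ) : ℂ) ^ (x0 + t * I : ℂ) / (x0 + t * I) * Gop riemannZeta (x0 + t * I)‖ +
      ‖∫ t in x0..(1 + 1 / Real.log x), ((⌊x⌋₊ + 1 / 2 : ℝ) : ℂ) ^ (t + (-U : ℝ) * I : ℂ) / (t + (-U : ℝ) * I) * Gop riemannZeta (t + (-U : ℝ) * I)‖ +
      ‖∫ t in x0..(1 + 1 / Real.log x), ((⌊x⌋₊ + 1 / 2 : ℝ) : ℂ) ^ (t + U * I : ℂ) / (t + U * I) * Gop riemannZeta (t + U * I)‖ := by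
  obtain ⟨K1, hK1, hP⟩ := perron_BB
  obtain ⟨K2, hK2, hM⟩ := MT_stab C
  refine ⟨K1 + K2, by positivity, fun x U x0 hx hU h0 h1 hz => ?_⟩
  have hL := log_ge_two x hx
  have hc0 : 0 < 1 / Real.log x := by positivity
  have hp := hP x U hx hU
  have hm := hM x hx
  set X : ℝ := ⌊x⌋₊ + 1 / 2 with hX
  have hX0 : 0 < X := by positivity
  have key := residue_main C hC X x0 (1 + 1 / Real.log x) U hX0 h0 h1 (by linarith) (by linarith) hz
  rw [rectInt] at key
  set Bo := ∫ t in x0..(1 + 1 / Real.log x), (X : ℂ) ^ (t + (-U : ℝ) * I : ℂ) / (t + (-U : ℝ) * I) * Gop riemannZeta (t + (-U : ℝ) * I)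
  set To := ∫ t in x0..(1 + 1 / Real.log x), (X : ℂ) ^ (t + U * I : ℂ) / (t + U * I) * Gop riemannZeta (t + U * I)
  set Le := ∫ t in (-U)..U, (X : ℂ) ^ (x0 + t * I : ℂ) / (x0 + t * I) * Gop riemannZeta (x0 + t * I)
  set Ri := ∫ t in (-U)..U, (X : ℂ) ^ ((1 + 1 / Real.log x : ℝ) + t * I : ℂ) / ((1 + 1 / Real.log x : ℝ) + t * I) * Gop riemannZeta ((1 + 1 / Real.log x : ℝ) + t * I)
  have e : 2 * Real.pi * ((BB x : ℂ) + MT C x) = ((2 * Real.pi * BB x : ℂ) + Ri) + (-2 * Real.pi * (MT C X - MT C x) - Le + (I * To - I * Bo)) := by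
    have hI : I * I = -1 := I_mul_I
    linear_combination I * key - (Ri - Le - 2 * Real.pi * MT C X) * hI
  have hn := congrArg norm e
  have hpi := Real.pi_gt_three
  rw [norm_mul, norm_mul, norm_real, Real.norm_of_nonneg Real.pi_pos.le, Complex.norm_two] at hn
  have b1 := norm_add_le ((2 * Real.pi * BB x : ℂ) + Ri) (-2 * Real.pi * (MT C X - MT C x) - Le + (I * To - I * Bo))
  have b2 := norm_add_le (-2 * Real.pi * (MT C X - MT C x) - Le) (I * To - I * Bo)
  have b3 := norm_sub_le (-2 * Real.pi * (MT C X - MT C x)) Le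
  have b4 := norm_sub_le (I * To) (I * Bo)
  rw [norm_mul, norm_I, one_mul, norm_mul, norm_I, one_mul] at b4
  rw [norm_mul, norm_mul, norm_real, Real.norm_of_nonneg Real.pi_pos.le, norm_neg, Complex.norm_two] at b3
  set A := ‖(BB x : ℂ) + MT C x‖
  have hA : 0 ≤ A := norm_nonneg _
  set W := x * Real.log x ^ 4 / U
  have hW : 0 ≤ W := by positivity
  set V := Real.log x ^ 3
  have hV : 0 ≤ V := by positivity
  have f1 : 0 ≤ K2 * W := by positivity
  have f2 : 0 ≤ K1 * V := by positivity
  have f3 : 0 ≤ K1 * W := by positivity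
  have g : 2 * Real.pi * A ≤ K1 * W + 2 * Real.pi * (K2 * V) + ‖Le‖ + ‖Bo‖ + ‖To‖ := by
    have := mul_le_mul_of_nonneg_left hm (show 0 ≤ 2 * Real.pi by positivity)
    linarith
  have g2 : K1 * W + ‖Le‖ + ‖Bo‖ + ‖To‖ ≤ 2 * Real.pi * (K1 * W + ‖Le‖ + ‖Bo‖ + ‖To‖) :=
    le_mul_of_one_le_left (by positivity) (by linarith)
  have g3 : 2 * Real.pi * A ≤ 2 * Real.pi * (K2 * V + (K1 * W + ‖Le‖ + ‖Bo‖ + ‖To‖)) := by linarith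
  have g4 := le_of_mul_le_mul_left g3 (by positivity)
  linarith

lemma G_bd_zfr : ∃ c K : ℝ, 0 < c ∧ c ≤ 1 ∧ 0 < K ∧ ∀ U : ℝ, 1 ≤ U →
    (∀ s : ℂ, |s.im| ≤ U + 1 → 1 - c / Real.log (U + 5) < s.re → riemannZeta s ≠ 0) ∧
    (∀ s : ℂ, |s.im| ≤ U → 1 - c / (4 * Real.log (U + 5)) ≤ s.re → s.re ≤ 2 → c / (4 * Real.log (U + 5)) ≤ ‖s - 1‖ →
      ‖Gop riemannZeta s‖ ≤ K * Real.log (U + 5) ^ 4) := by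
  obtain ⟨c0, hc0, hz⟩ := zfr
  set c := min c0 1 with hc
  have hcp : 0 < c := lt_min hc0 one_pos
  have hc1 : c ≤ 1 := min_le_right _ _
  refine ⟨c, 24 * (16 / c) ^ 3 * (Real.exp 1 * (9 + 8 / c)), hcp, hc1, by positivity, fun U hU => ?_⟩
  set l := Real.log (U + 5) with hl
  have hl1 : 1 ≤ l := by
    rw [hl, Real.le_log_iff_exp_le (by linarith)]
    linarith [Real.exp_one_lt_d9]
  have hl0 : 0 < l := by linarith
  have hnz : ∀ s : ℂ, |s.im| ≤ U + 1 → 1 - c / l < s.re → riemannZeta s ≠ 0 := by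
    intro s h1 h2 h0
    have h3 := hz s h0
    have h4 : 0 < Real.log (|s.im| + 4) := Real.log_pos (by linarith [abs_nonneg s.im])
    have h5 : Real.log (|s.im| + 4) ≤ l := Real.log_le_log (by linarith [abs_nonneg s.im]) (by linarith)
    have h6 : c / l ≤ c0 / Real.log (|s.im| + 4) := by
      apply div_le_div₀ hc0.le (min_le_left _ _) h4 h5
    linarith
  refine ⟨hnz, fun s h1 h2 h3 h4 => ?_⟩
  have hcl : c / l ≤ 1 := by rw [div_le_one hl0]; linarith
  have hclp : 0 < c / l := by positivity
  have e4 : c / (4 * l) = c / l / 4 := by field_simp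
  rw [e4] at h2 h4
  set q := c / l with hq
  have hb : ∀ z ∈ Metric.ball s (q / 8), |z.im| ≤ U + 1 ∧ 1 - 3 * q / 8 ≤ z.re ∧ z.re ≤ 3 ∧ q / 8 ≤ ‖z - 1‖ := by
    intro z hzb
    obtain ⟨p1, p2, p3, p4⟩ := ball_re_im hzb
    rw [abs_le] at h1
    refine ⟨by rw [abs_le]; constructor <;> linarith, by linarith, by linarith, ?_⟩
    rw [Metric.mem_ball, dist_eq_norm] at hzb
    have := norm_add_le (z - 1) (s - z)
    rw [show z - 1 + (s - z) = s - 1 by ring, norm_sub_rev s z] at this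
    linarith
  have hg := Gop_bound_max (f := riemannZeta) (c := s) (r := q / 16) (R := q / 8) (M := Real.exp 1 * ((9 + 8 / c) * l)) (by positivity) (by linarith)
    (by
      intro z hzb
      apply (differentiableAt_riemannZeta _).differentiableWithinAt
      rintro rfl
      have := (hb 1 hzb).2.2.2
      simp at this; linarith)
    (by
      intro z hzb
      obtain ⟨p1, p2, p3, p4⟩ := hb z hzb
      exact hnz z p1 (by linarith))
    (by
      intro z hzb
      obtain ⟨p1, p2, p3, p4⟩ := hb z hzb
      have p40 : 0 < ‖z - 1‖ := by linarith
      have h := zeta_bd z.re z.im (by linarith) p3 (by rw [re_add_im]; rintro rfl; simp at p40)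
      rw [re_add_im] at h
      refine h.trans ?_
      have h5 : Real.log (|z.im| + 2) ≤ l := Real.log_le_log (by linarith [abs_nonneg z.im]) (by linarith)
      have h50 : 0 ≤ Real.log (|z.im| + 2) := Real.log_nonneg (by linarith [abs_nonneg z.im])
      have h6 : (|z.im| + 2) ^ (max (1 - z.re) 0) ≤ Real.exp 1 := by
        rw [Real.rpow_def_of_pos (by linarith [abs_nonneg z.im])]
        apply Real.exp_le_exp.2
        have : max (1 - z.re) 0 ≤ q := max_le (by linarith) hclp.le
        calc _ ≤ l * q := mul_le_mul h5 this (le_max_right _ _) hl0.le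
          _ = c := by rw [hq]; field_simp
          _ ≤ 1 := hc1
      have h7 : 1 / ‖z - 1‖ ≤ 8 / c * l := by
        calc 1 / ‖z - 1‖ ≤ 1 / (q / 8) := one_div_le_one_div_of_le (by positivity) p4
          _ = _ := by rw [hq]; field_simp
      apply mul_le_mul h6 _ (by positivity) (by positivity)
      linarith)
  refine hg.trans (le_of_eq ?_)
  rw [hq]; field_simp

lemma X_pow_bd (x c : ℝ) (hx : 16 ≤ x) (hc : 0 ≤ c) (hc2 : c ≤ 2) : ((⌊x⌋₊ : ℝ) + 1 / 2) ^ c ≤ 4 * x ^ c := by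
  have hf1 : (⌊x⌋₊ : ℝ) ≤ x := Nat.floor_le (by linarith)
  calc ((⌊x⌋₊ : ℝ) + 1 / 2) ^ c ≤ (2 * x) ^ c := Real.rpow_le_rpow (by positivity) (by linarith) hc
    _ = 2 ^ c * x ^ c := Real.mul_rpow (by norm_num) (by linarith)
    _ ≤ 2 ^ (2 : ℝ) * x ^ c := by
        have : (2 : ℝ) ^ c ≤ 2 ^ (2 : ℝ) := Real.rpow_le_rpow_of_exponent_le (by norm_num) hc2
        gcongr
    _ = _ := by norm_num

lemma pow_four_le_exp (y a : ℝ) (hy : 0 ≤ y) (ha : 0 < a) : y ^ 4 ≤ 24 / a ^ 4 * Real.exp (a * y) := by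
  have := Real.pow_div_factorial_le_exp (a * y) (by positivity) 4
  norm_num [Nat.factorial] at this
  rw [div_mul_eq_mul_div, le_div_iff₀ (by positivity)]
  have e : (a * y) ^ 4 = y ^ 4 * a ^ 4 := by ring
  rw [e] at this
  linarith

set_option maxHeartbeats 1600000 in
lemma uncond_BB (C : ℕ → ℂ)
    (hC : ∀ᶠ s in nhdsWithin (1 : ℂ) {(1 : ℂ)}ᶜ,
      HasSum (fun j : ℕ => C j * (s - 1) ^ j) (riemannZeta s - 1 / (s - 1))) :
    ∃ κ > 0, ∃ K > 0, ∃ x1 : ℝ, ∀ x ≥ x1, ‖(BB x : ℂ) + MT C x‖ ≤ K * (x * Real.exp (-κ * Real.sqrt (Real.log x))) := by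
  obtain ⟨K1, hK1, hcomb⟩ := combine C hC
  obtain ⟨c, K, hc0, hc1, hK, hG⟩ := G_bd_zfr
  set k := c / 16 with hk
  have hk0 : 0 < k := by positivity
  have hk1 : k ≤ 1 / 16 := by rw [hk]; linarith
  set B8 := 24 / (k / 8) ^ 4 with hB8
  refine ⟨k / 2, by positivity, 2 * K1 * B8 ^ 2 + 16 * K * B8 + 64 * Real.exp 1 * K * B8, by positivity, max 16 (Real.exp ((2 / k) ^ 2)), fun x hx => ?_⟩
  have hx16 : 16 ≤ x := (le_max_left _ _).trans hx
  have hx0 : 0 < x := by linarith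
  have hL := log_ge_two x hx16
  set L := Real.log x with hLd
  set r := Real.sqrt L with hr
  have hr0 : 0 ≤ r := Real.sqrt_nonneg _
  have hr2 : r ^ 2 = L := Real.sq_sqrt (by linarith)
  have hrk : 2 / k ≤ r := by
    apply Real.le_sqrt_of_sq_le
    rw [hLd, Real.le_log_iff_exp_le hx0]
    exact (le_max_right _ _).trans hx
  have hkr : 2 ≤ k * r := by
    rw [div_le_iff₀ hk0] at hrk; linarith
  set U := Real.exp (k * r) with hU
  have hU7 : 6 ≤ U := by
    have h1 : Real.exp 2 ≤ U := Real.exp_le_exp.2 hkr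
    have h2 : Real.exp 2 = Real.exp 1 * Real.exp 1 := by rw [← Real.exp_add]; norm_num
    nlinarith [Real.exp_one_gt_d9]
  set l := Real.log (U + 5) with hl
  have hl1 : 1 ≤ l := by
    rw [hl, Real.le_log_iff_exp_le (by linarith)]
    linarith [Real.exp_one_lt_d9]
  have hl2 : l ≤ 2 * (k * r) := by
    have : 2 * (k * r) = Real.log (U ^ 2) := by rw [Real.log_pow, hU, Real.log_exp]; norm_num
    rw [this]
    exact Real.log_le_log (by linarith) (by nlinarith)
  have hlr : l ≤ r := hl2.trans (by nlinarith)
  obtain ⟨hnz, hGb⟩ := hG U (by linarith)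
  set x0 := 1 - c / (4 * l) with hx0d
  have hq0 : 0 < c / (4 * l) := by positivity
  have hq1 : c / (4 * l) ≤ 1 / 4 := by rw [div_le_div_iff₀ (by positivity) (by norm_num)]; nlinarith
  have hcl : c / (4 * l) < c / l := by
    apply div_lt_div_of_pos_left hc0 (by linarith) (by linarith)
  have hc0' : 0 < 1 / L := by positivity
  have hc1' : 1 / L ≤ 1 / 2 := one_div_le_one_div_of_le (by norm_num) hL
  have hmain := hcomb x U x0 hx16 (by linarith) (by linarith) (by linarith) (by
    rintro s ⟨h1, h2, h3, h4⟩
    apply hnz s _ (by linarith)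
    rw [abs_le]; constructor <;> linarith)
  refine hmain.trans ?_
  set X : ℝ := ⌊x⌋₊ + 1 / 2 with hX
  have hXp : 0 < X := by positivity
  -- left edge
  have hxx0 : x ^ x0 ≤ x * Real.exp (-2 * r) := by
    rw [hx0d, Real.rpow_sub hx0, Real.rpow_one, Real.exp_eq_exp_ℝ, ← Real.exp_eq_exp_ℝ, neg_mul, Real.exp_neg, div_eq_mul_inv]
    gcongr
    rw [Real.rpow_def_of_pos hx0, ← hLd, ← hr2]
    apply Real.exp_le_exp.2
    rw [← mul_div_assoc, le_div_iff₀ (by positivity)]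
    have : c = 16 * k := by rw [hk]; ring
    rw [this]
    have := mul_le_mul_of_nonneg_left hl2 (show 0 ≤ 8 * r by positivity)
    nlinarith
  have hLe : ‖∫ t in (-U)..U, (X : ℂ) ^ (x0 + t * I : ℂ) / (x0 + t * I) * Gop riemannZeta (x0 + t * I)‖ ≤ 16 * (x * Real.exp (-2 * r)) * (K * l ^ 4) * U := by
    have hpt : ∀ t ∈ Set.uIoc (-U) U, ‖(X : ℂ) ^ (x0 + t * I : ℂ) / (x0 + t * I) * Gop riemannZeta (x0 + t * I)‖ ≤ 8 * (x * Real.exp (-2 * r)) * (K * l ^ 4) := by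
      intro t ht
      rw [Set.uIoc_of_le (by linarith)] at ht
      rw [norm_mul]
      have p1 := perron_norm X hXp x0 t (1 / 2) (by norm_num) (by
        refine le_trans ?_ (re_le_norm' x0 t)
        rw [abs_of_nonneg (by linarith)]; linarith)
      have p2 := X_pow_bd x x0 hx16 (by linarith) (by linarith)
      have p3 := hGb (x0 + t * I) (by simp [abs_le]; exact ⟨ht.1.le, ht.2⟩) (le_of_eq (by simp only [add_re, ofReal_re, mul_re, I_re, I_im, ofReal_im]; rw [hx0d]; ring)) (by simp; linarith) (by
        have := Complex.abs_re_le_norm (x0 + t * I - 1)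
        refine le_trans ?_ this
        simp
        rw [abs_of_nonpos (by linarith)]; linarith)
      apply mul_le_mul _ p3 (norm_nonneg _) (by positivity)
      linarith
    have := intervalIntegral.norm_integral_le_of_norm_le_const hpt
    refine this.trans (le_of_eq ?_)
    rw [show U - -U = 2 * U by ring, abs_of_pos (by linarith)]; ring
  have hXc : X ^ (1 + 1 / L) ≤ 4 * (x * Real.exp 1) := by
    refine (X_pow_bd x (1 + 1 / L) hx16 (by linarith) (by linarith)).trans (le_of_eq ?_)
    rw [Real.rpow_add hx0, Real.rpow_one, Real.rpow_def_of_pos hx0 (1 / L), ← hLd]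
    congr 3; field_simp
  have hTo : ∀ v : ℝ, |v| = U → ‖∫ t in x0..(1 + 1 / L), (X : ℂ) ^ (t + v * I : ℂ) / (t + v * I) * Gop riemannZeta (t + v * I)‖ ≤ 4 * (x * Real.exp 1) / U * (K * l ^ 4) := by
    intro v hv
    have hpt : ∀ t ∈ Set.uIoc x0 (1 + 1 / L), ‖(X : ℂ) ^ (t + v * I : ℂ) / (t + v * I) * Gop riemannZeta (t + v * I)‖ ≤ 4 * (x * Real.exp 1) / U * (K * l ^ 4) := by
      intro t ht
      rw [Set.uIoc_of_le (by linarith)] at ht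
      rw [norm_mul]
      have p1 := perron_norm X hXp t v U (by linarith) (hv ▸ im_le_norm' t v)
      have p2 : X ^ t ≤ X ^ (1 + 1 / L) := by
        apply Real.rpow_le_rpow_of_exponent_le _ ht.2
        have : (1 : ℝ) ≤ ⌊x⌋₊ := by exact_mod_cast Nat.le_floor (by norm_num; linarith)
        rw [hX]; linarith
      have p3 := hGb (t + v * I) (by simp [hv]) (by simp; linarith [ht.1]) (by simp; linarith [ht.2]) (by
        have := Complex.abs_im_le_norm (t + v * I - 1)
        refine le_trans ?_ this
        simp [hv]; linarith)
      apply mul_le_mul _ p3 (norm_nonneg _) (by positivity)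
      refine p1.trans ?_
      gcongr
      exact p2.trans hXc
    have := intervalIntegral.norm_integral_le_of_norm_le_const hpt
    refine this.trans (mul_le_of_le_one_right (by positivity) ?_)
    rw [abs_of_pos (by linarith)]; linarith
  have t1 := hTo (-U) (by rw [abs_neg, abs_of_pos (by linarith)])
  have t2 := hTo U (abs_of_pos (by linarith))
  -- final comparison
  set E := Real.exp (-(k / 2) * r) with hE
  have hE0 : 0 < E := Real.exp_pos _
  have hr4 : r ^ 4 ≤ B8 * Real.exp (k / 8 * r) := pow_four_le_exp r (k / 8) hr0 (by positivity)
  have hB80 : 1 ≤ B8 := by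
    rw [hB8, le_div_iff₀ (by positivity), one_mul]
    calc (k / 8) ^ 4 ≤ 1 ^ 4 := by gcongr; linarith
      _ ≤ 24 := by norm_num
  have hl4 : l ^ 4 ≤ B8 * Real.exp (k / 8 * r) := (pow_le_pow_left₀ (by linarith) hlr 4).trans hr4
  have hL4 : L ^ 4 ≤ B8 ^ 2 * Real.exp (k / 4 * r) := by
    have : L ^ 4 = r ^ 4 * r ^ 4 := by rw [← hr2]; ring
    rw [this]
    calc r ^ 4 * r ^ 4 ≤ (B8 * Real.exp (k / 8 * r)) * (B8 * Real.exp (k / 8 * r)) := by gcongr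
      _ = B8 ^ 2 * (Real.exp (k / 8 * r) * Real.exp (k / 8 * r)) := by ring
      _ = _ := by rw [← Real.exp_add]; ring_nf
  have hUinv : ∀ a b : ℝ, 0 ≤ b → b * Real.exp a / U = b * Real.exp (a - k * r) := by
    intro a b _
    rw [Real.exp_sub, hU]; ring
  have w1 : x * L ^ 4 / U ≤ B8 ^ 2 * (x * E) := by
    calc x * L ^ 4 / U ≤ x * (B8 ^ 2 * Real.exp (k / 4 * r)) / U := by gcongr
      _ = x * B8 ^ 2 * Real.exp (k / 4 * r) / U := by ring
      _ = x * B8 ^ 2 * Real.exp (k / 4 * r - k * r) := hUinv _ _ (by positivity)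
      _ ≤ x * B8 ^ 2 * E :=
          mul_le_mul_of_nonneg_left (Real.exp_le_exp.2 (by linarith only [hkr])) (by positivity)
      _ = _ := by ring
  have w2 : L ^ 3 ≤ B8 ^ 2 * (x * E) := by
    have h1 : L ^ 3 ≤ L ^ 4 := pow_le_pow_right₀ (by linarith) (by norm_num)
    have hUx : U ≤ x := by
      rw [← Real.exp_log hx0, ← hLd, hU]
      apply Real.exp_le_exp.2
      rw [← hr2]; nlinarith
    have h2 : L ^ 4 ≤ x * L ^ 4 / U := by
      rw [le_div_iff₀ (by linarith), mul_comm]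
      gcongr
    linarith
  have w3 : 4 * (x * Real.exp 1) / U * (K * l ^ 4) ≤ 4 * Real.exp 1 * K * B8 * (x * E) := by
    calc 4 * (x * Real.exp 1) / U * (K * l ^ 4) ≤ 4 * (x * Real.exp 1) / U * (K * (B8 * Real.exp (k / 8 * r))) := by gcongr
      _ = (4 * Real.exp 1 * K * B8 * x) * Real.exp (k / 8 * r) / U := by ring
      _ = (4 * Real.exp 1 * K * B8 * x) * Real.exp (k / 8 * r - k * r) := hUinv _ _ (by positivity)
      _ ≤ (4 * Real.exp 1 * K * B8 * x) * E :=
          mul_le_mul_of_nonneg_left (Real.exp_le_exp.2 (by linarith only [hkr])) (by positivity)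
      _ = _ := by ring
  have w4 : 16 * (x * Real.exp (-2 * r)) * (K * l ^ 4) * U ≤ 16 * K * B8 * (x * E) := by
    calc 16 * (x * Real.exp (-2 * r)) * (K * l ^ 4) * U ≤ 16 * (x * Real.exp (-2 * r)) * (K * (B8 * Real.exp (k / 8 * r))) * U := by gcongr
      _ = 16 * K * B8 * x * (Real.exp (-2 * r) * Real.exp (k / 8 * r) * U) := by ring
      _ = 16 * K * B8 * x * Real.exp (-2 * r + k / 8 * r + k * r) := by rw [hU, Real.exp_add, Real.exp_add]
      _ ≤ 16 * K * B8 * x * E :=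
          mul_le_mul_of_nonneg_left (Real.exp_le_exp.2 (by
            have := mul_le_mul_of_nonneg_right hk1 hr0
            linarith only [this, hr0, hkr])) (by positivity)
      _ = _ := by ring
  have v1 := mul_le_mul_of_nonneg_left w1 hK1.le
  have v2 := mul_le_mul_of_nonneg_left w2 hK1.le
  have v3 : 0 ≤ Real.exp 1 * K * B8 * (x * E) := by positivity
  linarith

lemma norm_sq_trig (s : Finset ℕ) (c l : ℕ → ℝ) (t : ℝ) :
    ‖∑ n ∈ s, (c n : ℂ) * Complex.exp (((-(t * l n) : ℝ) : ℂ) * I)‖ ^ 2 =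
      ∑ m ∈ s, ∑ n ∈ s, c m * c n * Real.cos (t * (l m - l n)) := by
  rw [← Complex.normSq_eq_norm_sq, Complex.normSq_apply, Complex.re_sum, Complex.im_sum]
  have h1 : ∀ n, ((c n : ℂ) * Complex.exp (((-(t * l n) : ℝ) : ℂ) * I)).re = c n * Real.cos (t * l n) := by
    intro n
    rw [Complex.re_ofReal_mul, Complex.exp_ofReal_mul_I_re, Real.cos_neg]
  have h2 : ∀ n, ((c n : ℂ) * Complex.exp (((-(t * l n) : ℝ) : ℂ) * I)).im = -(c n * Real.sin (t * l n)) := by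
    intro n
    rw [Complex.im_ofReal_mul, Complex.exp_ofReal_mul_I_im, Real.sin_neg]; ring
  simp_rw [h1, h2]
  rw [Finset.sum_mul_sum, Finset.sum_mul_sum, ← Finset.sum_add_distrib]
  refine Finset.sum_congr rfl fun m _ => ?_
  rw [← Finset.sum_add_distrib]
  refine Finset.sum_congr rfl fun n _ => ?_
  rw [mul_sub, Real.cos_sub]; ring

lemma int_cos_le (T l : ℝ) (hl : l ≠ 0) : ∫ t in (-T)..T, Real.cos (t * l) ≤ 2 / |l| := by
  rw [intervalIntegral.integral_comp_mul_right _ hl, integral_cos, smul_eq_mul]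
  refine (le_abs_self _).trans ?_
  rw [abs_mul, abs_inv, inv_mul_eq_div]
  gcongr
  have a1 := Real.abs_sin_le_one (T * l)
  have a2 := Real.abs_sin_le_one (-T * l)
  rw [abs_le] at a1 a2 ⊢
  constructor <;> linarith

lemma ms_gen (s : Finset ℕ) (x : ℕ → ℝ) (hx : ∀ n ∈ s, 0 < x n) (a T : ℝ) (B : ℕ → ℕ → ℝ)
    (hd : ∀ m ∈ s, 2 * T * (x m ^ (-a) * x m ^ (-a)) ≤ B m m)
    (ho : ∀ m ∈ s, ∀ n ∈ s, m ≠ n → 0 < |Real.log (x m) - Real.log (x n)| ∧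
      x m ^ (-a) * x n ^ (-a) * (2 / |Real.log (x m) - Real.log (x n)|) ≤ B m n) :
    ∫ t in (-T)..T, ‖∑ n ∈ s, (x n : ℂ) ^ (-(a + t * I : ℂ))‖ ^ 2 ≤ ∑ m ∈ s, ∑ n ∈ s, B m n := by
  have e : ∀ t : ℝ, ‖∑ n ∈ s, (x n : ℂ) ^ (-(a + t * I : ℂ))‖ ^ 2 =
      ∑ m ∈ s, ∑ n ∈ s, x m ^ (-a) * x n ^ (-a) * Real.cos (t * (Real.log (x m) - Real.log (x n))) := by
    intro t
    rw [← norm_sq_trig]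
    congr 2
    refine Finset.sum_congr rfl fun n hn => ?_
    have h0 : (x n : ℂ) ≠ 0 := by exact_mod_cast (hx n hn).ne'
    rw [show (-(a + t * I : ℂ)) = ((-a : ℝ) : ℂ) + (-(t * I)) by push_cast; ring, Complex.cpow_add _ _ h0,
      Complex.ofReal_cpow (hx n hn).le, Complex.cpow_def_of_ne_zero h0 (-(t * I)), ← Complex.ofReal_log (hx n hn).le]
    congr 2; push_cast; ring
  simp_rw [e]
  have hi : ∀ m n : ℕ, IntervalIntegrable (fun t : ℝ => x m ^ (-a) * x n ^ (-a) *
      Real.cos (t * (Real.log (x m) - Real.log (x n)))) MeasureTheory.volume (-T) T := by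
    intro m n
    apply Continuous.intervalIntegrable; fun_prop
  rw [intervalIntegral.integral_finsetSum fun m _ => by
    apply Continuous.intervalIntegrable; fun_prop]
  refine Finset.sum_le_sum fun m hm => ?_
  rw [intervalIntegral.integral_finsetSum fun n _ => hi m n]
  refine Finset.sum_le_sum fun n hn => ?_
  rw [intervalIntegral.integral_const_mul]
  have p1 : 0 ≤ x m ^ (-a) * x n ^ (-a) :=
    mul_nonneg (Real.rpow_nonneg (hx m hm).le _) (Real.rpow_nonneg (hx n hn).le _)
  by_cases h : m = n
  · subst h
    refine le_trans (le_of_eq ?_) (hd m hm)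
    simp; ring
  · obtain ⟨q1, q2⟩ := ho m hm n hn h
    exact (mul_le_mul_of_nonneg_left (int_cos_le T _ (abs_pos.1 q1)) p1).trans q2

/-- log difference lower bound -/
lemma log_gap (y z : ℝ) (hy : 0 < y) (hz : 0 < z) (h : y ≠ z) :
    0 < |Real.log y - Real.log z| ∧ 1 / |Real.log y - Real.log z| ≤ max y z / |y - z| := by
  have key : ∀ u w : ℝ, 0 < u → u < w → 0 < Real.log w - Real.log u ∧
      1 / (Real.log w - Real.log u) ≤ w / (w - u) := by
    intro u w hu huw
    have h1 : Real.log (u / w) ≤ u / w - 1 := Real.log_le_sub_one_of_pos (div_pos hu (by linarith))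
    rw [Real.log_div hu.ne' (by linarith)] at h1
    have h2 : u / w < 1 := (div_lt_one (by linarith)).2 huw
    have hw : 0 < w := by linarith
    have h3 : (w - u) / w = 1 - u / w := by field_simp
    have h4 : 0 < (w - u) / w := by rw [h3]; linarith
    refine ⟨by linarith, ?_⟩
    rw [show w / (w - u) = 1 / ((w - u) / w) by rw [one_div_div]]
    apply one_div_le_one_div_of_le h4
    linarith
  rcases lt_or_gt_of_ne h with h | h
  · obtain ⟨a, b⟩ := key y z hy h
    rw [abs_sub_comm, abs_of_pos a, max_eq_right h.le, abs_sub_comm y z, abs_of_pos (by linarith)]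
    exact ⟨a, b⟩
  · obtain ⟨a, b⟩ := key z y hz h
    rw [abs_of_pos a, max_eq_left h.le, abs_of_pos (by linarith)]
    exact ⟨a, b⟩

lemma half_pair (y z : ℝ) (hy : 0 < y) (hz : 0 < z) (h : y ≠ z) :
    y ^ (-(1 / 2) : ℝ) * z ^ (-(1 / 2) : ℝ) * (max y z / |y - z|) ≤ 1 / y + 1 / z + 1 / |y - z| ∧
    y ^ (-(1 / 2) : ℝ) * y⁻¹ * (z ^ (-(1 / 2) : ℝ) * z⁻¹) * (max y z / |y - z|) ≤ (1 / y ^ 2 + 1 / z ^ 2) / |y - z| := by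
  have key : ∀ u w : ℝ, 0 < u → u < w → u ^ (-(1 / 2) : ℝ) * w ^ (-(1 / 2) : ℝ) ≤ 1 / u := by
    intro u w hu huw
    calc u ^ (-(1 / 2) : ℝ) * w ^ (-(1 / 2) : ℝ) ≤ u ^ (-(1 / 2) : ℝ) * u ^ (-(1 / 2) : ℝ) := by
          apply mul_le_mul_of_nonneg_left _ (Real.rpow_nonneg hu.le _)
          exact Real.rpow_le_rpow_of_nonpos hu huw.le (by norm_num)
      _ = 1 / u := by
          rw [← Real.rpow_add hu]; norm_num; rw [Real.rpow_neg_one]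
  have main : ∀ u w : ℝ, 0 < u → u < w → 
      u ^ (-(1 / 2) : ℝ) * w ^ (-(1 / 2) : ℝ) * (w / (w - u)) ≤ 1 / u + 1 / w + 1 / (w - u) ∧
      u ^ (-(1 / 2) : ℝ) * u⁻¹ * (w ^ (-(1 / 2) : ℝ) * w⁻¹) * (w / (w - u)) ≤ (1 / u ^ 2 + 1 / w ^ 2) / (w - u) := by
    intro u w hu huw
    have hw : 0 < w := by linarith
    have hd : 0 < w - u := by linarith
    have k := key u w hu huw
    constructor
    · calc u ^ (-(1 / 2) : ℝ) * w ^ (-(1 / 2) : ℝ) * (w / (w - u)) ≤ 1 / u * (w / (w - u)) := by gcongr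
        _ = 1 / u + 1 / (w - u) := by field_simp; ring
        _ ≤ _ := by have : 0 < 1 / w := by positivity
                    linarith
    · calc u ^ (-(1 / 2) : ℝ) * u⁻¹ * (w ^ (-(1 / 2) : ℝ) * w⁻¹) * (w / (w - u))
          = (u ^ (-(1 / 2) : ℝ) * w ^ (-(1 / 2) : ℝ)) * (u⁻¹ * w⁻¹ * (w / (w - u))) := by ring
        _ ≤ 1 / u * (u⁻¹ * w⁻¹ * (w / (w - u))) := by gcongr
        _ = (1 / u ^ 2) / (w - u) := by field_simp
        _ ≤ _ := by gcongr; have : 0 < 1 / w ^ 2 := by positivity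
                    linarith
  rcases lt_or_gt_of_ne h with h | h
  · obtain ⟨a, b⟩ := main y z hy h
    rw [max_eq_right h.le, abs_sub_comm, abs_of_pos (by linarith)]
    exact ⟨a, b⟩
  · obtain ⟨a, b⟩ := main z y hz h
    rw [max_eq_left h.le, abs_of_pos (by linarith)]
    constructor
    · linarith
    · calc _ = _ := by ring
        _ ≤ _ := b
        _ = _ := by ring

lemma nat_gap (m n : ℕ) (h : m ≠ n) : 1 / |(m : ℝ) - n| ≤ 2 * (1 / (|(n : ℝ) - m| + 1)) := by
  have : (1 : ℝ) ≤ |(m : ℝ) - n| := by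
    have h1 : (1 : ℤ) ≤ |(m : ℤ) - n| := Int.one_le_abs (by omega)
    exact_mod_cast h1
  rw [abs_sub_comm (n : ℝ), mul_one_div, div_le_div_iff₀ (by linarith) (by linarith)]
  linarith

lemma poly_ms (N : ℕ) (a T : ℝ) (ha : 1 / 2 ≤ a) (hT : 0 ≤ T) :
    ∫ t in (-T)..T, ‖∑ n ∈ range N, (((n : ℝ) + 1 : ℝ) : ℂ) ^ (-(a + t * I : ℂ))‖ ^ 2 ≤
      (2 * T + 12 * N) * (1 + Real.log (2 * N)) := by
  have hp : ∀ n : ℕ, (1 : ℝ) ≤ (n : ℝ) + 1 := fun n => by linarith [(Nat.cast_nonneg n : (0 : ℝ) ≤ n)]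
  have hle : ∀ n : ℕ, ((n : ℝ) + 1) ^ (-a) ≤ ((n : ℝ) + 1) ^ (-(1 / 2) : ℝ) := fun n =>
    Real.rpow_le_rpow_of_exponent_le (hp n) (by linarith)
  have h := ms_gen (range N) (fun n => (n : ℝ) + 1) (fun n _ => by positivity) a T
    (fun m n => (if m = n then 2 * T * ((m : ℝ) + 1)⁻¹ else 0) + 2 * ((m : ℝ) + 1)⁻¹ + 2 * ((n : ℝ) + 1)⁻¹ +
      4 * (1 / (|(n : ℝ) - m| + 1))) ?_ ?_
  · refine h.trans ?_
    simp only [Finset.sum_add_distrib, ← Finset.mul_sum, Finset.sum_const, Finset.card_range, nsmul_eq_mul,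
      Finset.sum_ite_eq, Finset.mem_range]
    have hH := sum_inv_le N
    have hlog : Real.log N ≤ Real.log (2 * N) := by
      rcases Nat.eq_zero_or_pos N with h0 | h0
      · simp [h0]
      · have : (1 : ℝ) ≤ N := by exact_mod_cast h0
        apply Real.log_le_log <;> linarith
    have s1 : ∑ m ∈ range N, (if m < N then 2 * T * ((m : ℝ) + 1)⁻¹ else 0) = 2 * T * ∑ m ∈ range N, ((m : ℝ) + 1)⁻¹ := by
      rw [Finset.mul_sum]
      refine Finset.sum_congr rfl fun m hm => ?_
      rw [if_pos (Finset.mem_range.1 hm)]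
    have s2 : ∑ m ∈ range N, ∑ n ∈ range N, 1 / (|(n : ℝ) - m| + 1) ≤ N * (2 * (1 + Real.log (2 * N))) := by
      have : ∀ m ∈ range N, ∑ n ∈ range N, 1 / (|(n : ℝ) - m| + 1) ≤ 2 * (1 + Real.log (2 * N)) := by
        intro m hm
        refine (sum_near m (by positivity) N).trans ?_
        have : (m : ℝ) + 1 ≤ N := by exact_mod_cast Finset.mem_range.1 hm
        gcongr
        linarith
      have := Finset.sum_le_card_nsmul _ _ _ this
      simpa using this
    rw [s1]
    have q1 := mul_le_mul_of_nonneg_left hH (show 0 ≤ 2 * T + 4 * N by positivity)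
    have q2 := mul_le_mul_of_nonneg_left hlog (show 0 ≤ 2 * T + 4 * N by positivity)
    linarith
  · intro m _
    rw [if_pos rfl]
    have h1 : ((m : ℝ) + 1) ^ (-a) * ((m : ℝ) + 1) ^ (-a) ≤ ((m : ℝ) + 1)⁻¹ := by
      calc ((m : ℝ) + 1) ^ (-a) * ((m : ℝ) + 1) ^ (-a) ≤ ((m : ℝ) + 1) ^ (-(1 / 2) : ℝ) * ((m : ℝ) + 1) ^ (-(1 / 2) : ℝ) := by
            gcongr ?_ * ?_ <;> exact hle m
        _ = _ := by rw [← Real.rpow_add (by positivity)]; norm_num; rw [Real.rpow_neg_one]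
    have h2 := mul_le_mul_of_nonneg_left h1 (show 0 ≤ 2 * T by positivity)
    have h3 : 0 ≤ ((m : ℝ) + 1)⁻¹ := by positivity
    have h4 : 0 ≤ 1 / (|(m : ℝ) - m| + 1) := by positivity
    linarith
  · intro m _ n _ hmn
    have hne : (m : ℝ) + 1 ≠ n + 1 := by simpa using hmn
    obtain ⟨g1, g2⟩ := log_gap _ _ (show (0 : ℝ) < (m : ℝ) + 1 by positivity) (show (0 : ℝ) < (n : ℝ) + 1 by positivity) hne
    refine ⟨g1, ?_⟩
    have hb := (half_pair _ _ (show (0 : ℝ) < (m : ℝ) + 1 by positivity) (show (0 : ℝ) < (n : ℝ) + 1 by positivity) hne).1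
    rw [if_neg hmn]
    have e1 : ((m : ℝ) + 1) ^ (-a) * ((n : ℝ) + 1) ^ (-a) ≤ ((m : ℝ) + 1) ^ (-(1 / 2) : ℝ) * ((n : ℝ) + 1) ^ (-(1 / 2) : ℝ) := by
      gcongr ?_ * ?_
      · exact hle m
      · exact hle n
    have e2 := mul_le_mul e1 g2 (by positivity) (by positivity)
    have e3 := nat_gap m n hmn
    rw [show (m : ℝ) + 1 - (n + 1) = m - n by ring] at hb e2
    simp only [one_div] at *
    rw [div_eq_mul_inv]
    linarith

lemma sum_inv_sq (N K : ℕ) (hN : 1 ≤ N) (v : ℝ) (hv : 0 ≤ v) :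
    ∑ n ∈ range K, 1 / ((n : ℝ) + N + v) ^ 2 ≤ 2 / (N : ℝ) := by
  have hN' : (1 : ℝ) ≤ N := by exact_mod_cast hN
  have : ∑ n ∈ range K, 1 / ((n : ℝ) + N + v) ^ 2 ≤ 2 / (N : ℝ) - 2 / ((K : ℝ) + N) := by
    induction K with
    | zero => simp
    | succ k ih =>
      rw [Finset.sum_range_succ]
      have h1 : 1 / ((k : ℝ) + N + v) ^ 2 ≤ 1 / ((k : ℝ) + N) ^ 2 := by
        apply one_div_le_one_div_of_le (by positivity)
        apply pow_le_pow_left₀ (by positivity); linarith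
      have h2 : 1 / ((k : ℝ) + N) ^ 2 ≤ 2 / (k + N) - 2 / ((k + 1 : ℕ) + N) := by
        have : (1 : ℝ) ≤ k + N := by linarith [(Nat.cast_nonneg k : (0 : ℝ) ≤ k)]
        set y := (k : ℝ) + N
        rw [show (((k + 1 : ℕ) : ℝ) + N) = y + 1 by simp only [y]; push_cast; ring,
          show 2 / y - 2 / (y + 1) = 2 / (y * (y + 1)) by field_simp; ring,
          div_le_div_iff₀ (by positivity) (by positivity)]
        nlinarith
      linarith
  have h0 : 0 ≤ 2 / ((K : ℝ) + N) := by positivity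
  linarith

lemma tail_ms (N K : ℕ) (hN : 1 ≤ N) (hK : N ≤ K) (a T v : ℝ) (ha : 3 / 2 ≤ a) (hT : 0 ≤ T) (hTN : T ≤ N) (hv : 0 ≤ v) :
    ∫ t in (-T)..T, ‖∑ n ∈ range K, (((n : ℝ) + N + v : ℝ) : ℂ) ^ (-(a + t * I : ℂ))‖ ^ 2 ≤
      (36 + 32 * Real.log (2 * K)) / N := by
  have hN' : (1 : ℝ) ≤ N := by exact_mod_cast hN
  have hp : ∀ n : ℕ, (N : ℝ) ≤ (n : ℝ) + N + v := fun n => by linarith [(Nat.cast_nonneg n : (0 : ℝ) ≤ n)]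
  have hp0 : ∀ n : ℕ, 0 < (n : ℝ) + N + v := fun n => by linarith [hp n]
  have hle : ∀ n : ℕ, ((n : ℝ) + N + v) ^ (-a) ≤ ((n : ℝ) + N + v) ^ (-(1 / 2) : ℝ) * ((n : ℝ) + N + v)⁻¹ := fun n => by
    rw [← Real.rpow_neg_one, ← Real.rpow_add (hp0 n)]
    exact Real.rpow_le_rpow_of_exponent_le (by linarith [hp n]) (by linarith)
  have hnn : ∀ n : ℕ, 0 ≤ ((n : ℝ) + N + v) ^ (-a) := fun n => Real.rpow_nonneg (hp0 n).le _
  have h := ms_gen (range K) (fun n => (n : ℝ) + N + v) (fun n _ => hp0 n) a T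
    (fun m n => (if m = n then 2 * (1 / ((m : ℝ) + N + v) ^ 2) else 0) +
      4 * (1 / ((m : ℝ) + N + v) ^ 2 * (1 / (|(n : ℝ) - m| + 1))) +
      4 * (1 / ((n : ℝ) + N + v) ^ 2 * (1 / (|(m : ℝ) - n| + 1)))) ?_ ?_
  · refine h.trans ?_
    simp only [Finset.sum_add_distrib, ← Finset.mul_sum, Finset.sum_ite_eq, Finset.mem_range]
    have hS := sum_inv_sq N K hN v hv
    have s1 : ∑ m ∈ range K, (if m < K then 2 * (1 / ((m : ℝ) + N + v) ^ 2) else 0) = 2 * ∑ m ∈ range K, 1 / ((m : ℝ) + N + v) ^ 2 := by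
      rw [Finset.mul_sum]
      refine Finset.sum_congr rfl fun m hm => ?_
      rw [if_pos (Finset.mem_range.1 hm)]
    have hl0 : 0 ≤ Real.log (2 * K) := Real.log_nonneg (by
      have : (N : ℝ) ≤ K := by exact_mod_cast hK
      linarith)
    have s2 : ∑ m ∈ range K, 1 / ((m : ℝ) + N + v) ^ 2 * ∑ n ∈ range K, 1 / (|(n : ℝ) - m| + 1) ≤
        2 / N * (2 * (1 + Real.log (2 * K))) := by
      calc _ ≤ ∑ m ∈ range K, 1 / ((m : ℝ) + N + v) ^ 2 * (2 * (1 + Real.log (2 * K))) := by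
            refine Finset.sum_le_sum fun m hm => ?_
            apply mul_le_mul_of_nonneg_left _ (by positivity)
            refine (sum_near m (by positivity) K).trans ?_
            have : (m : ℝ) + 1 ≤ K := by exact_mod_cast Finset.mem_range.1 hm
            gcongr
            linarith
        _ ≤ _ := by rw [← Finset.sum_mul]; gcongr
    have s3 : ∑ m ∈ range K, ∑ n ∈ range K, 1 / ((n : ℝ) + N + v) ^ 2 * (1 / (|(m : ℝ) - n| + 1)) =
        ∑ m ∈ range K, 1 / ((m : ℝ) + N + v) ^ 2 * ∑ n ∈ range K, 1 / (|(n : ℝ) - m| + 1) := by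
      rw [Finset.sum_comm]
      simp_rw [Finset.mul_sum]
    rw [s1, s3]
    have e : (36 + 32 * Real.log (2 * K)) / N = 2 * (2 / N) + 8 * (2 / N * (2 * (1 + Real.log (2 * K)))) := by ring
    rw [e]; linarith
  · intro m _
    rw [if_pos rfl]
    set y := (m : ℝ) + N + v with hy
    have h1 : y ^ (-a) * y ^ (-a) ≤ y⁻¹ * (1 / y ^ 2) := by
      calc y ^ (-a) * y ^ (-a) ≤ (y ^ (-(1 / 2) : ℝ) * y⁻¹) * (y ^ (-(1 / 2) : ℝ) * y⁻¹) :=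
            mul_le_mul (hle m) (hle m) (hnn m) ((hnn m).trans (hle m))
        _ = (y ^ (-(1 / 2) : ℝ) * y ^ (-(1 / 2) : ℝ)) * (1 / y ^ 2) := by ring
        _ = _ := by rw [← Real.rpow_add (hp0 m)]; norm_num; left; rw [Real.rpow_neg_one]
    have h2 : T * y⁻¹ ≤ 1 := by
      rw [mul_inv_le_iff₀ (hp0 m)]; linarith [hp m]
    have h3 := mul_le_mul_of_nonneg_left h1 hT
    have h5 := mul_le_mul_of_nonneg_right h2 (show 0 ≤ 1 / y ^ 2 by positivity)
    have h4 : 0 ≤ 1 / y ^ 2 * (1 / (|(m : ℝ) - m| + 1)) := by positivity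
    linarith
  · intro m _ n _ hmn
    have hne : (m : ℝ) + N + v ≠ n + N + v := by simpa using hmn
    obtain ⟨g1, g2⟩ := log_gap _ _ (hp0 m) (hp0 n) hne
    refine ⟨g1, ?_⟩
    have hb := (half_pair _ _ (hp0 m) (hp0 n) hne).2
    rw [if_neg hmn]
    have e1 := mul_le_mul (hle m) (hle n) (hnn n) ((hnn m).trans (hle m))
    have e2 := mul_le_mul e1 g2 (by positivity) (le_trans (mul_nonneg (hnn m) (hnn n)) e1)
    have e3 := nat_gap m n hmn
    have e4 := mul_le_mul_of_nonneg_left e3 (show 0 ≤ 1 / ((m : ℝ) + N + v) ^ 2 + 1 / ((n : ℝ) + N + v) ^ 2 by positivity)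
    rw [show (m : ℝ) + N + v - (n + N + v) = m - n by ring] at hb e2
    rw [abs_sub_comm (m : ℝ) n] at hb e2 e4 ⊢
    have hc := e2.trans (hb.trans_eq (div_eq_mul_one_div _ _))
    rw [div_eq_mul_one_div 2]
    linarith

lemma cs_int (f : ℝ → ℝ) (hf : Continuous f) (a b : ℝ) (hab : a < b) :
    (∫ t in a..b, f t) ^ 2 ≤ (b - a) * ∫ t in a..b, f t ^ 2 := by
  set m := ∫ t in a..b, f t with hm
  have h0 : 0 ≤ ∫ t in a..b, ((b - a) * f t - m) ^ 2 :=
    intervalIntegral.integral_nonneg hab.le fun t _ => sq_nonneg _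
  have e : ∫ t in a..b, ((b - a) * f t - m) ^ 2 =
      (b - a) ^ 2 * (∫ t in a..b, f t ^ 2) - 2 * (b - a) * m * (∫ t in a..b, f t) + m ^ 2 * (b - a) := by
    have : ∀ t, ((b - a) * f t - m) ^ 2 = (b - a) ^ 2 * f t ^ 2 - 2 * (b - a) * m * f t + m ^ 2 := fun t => by ring
    simp_rw [this]
    rw [intervalIntegral.integral_add, intervalIntegral.integral_sub, intervalIntegral.integral_const_mul,
      intervalIntegral.integral_const_mul, intervalIntegral.integral_const, smul_eq_mul]
    · ring
    all_goals apply Continuous.intervalIntegrable; fun_prop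
  rw [e, ← hm] at h0
  have : 0 ≤ (b - a) * ((b - a) * (∫ t in a..b, f t ^ 2) - m ^ 2) := by nlinarith
  have := nonneg_of_mul_nonneg_right this (by linarith)
  linarith

lemma swap_cont (F : ℝ → ℝ → ℝ) (hF : Continuous fun p : ℝ × ℝ => F p.1 p.2) (a b c d : ℝ) (hab : a ≤ b) (hcd : c ≤ d) :
    ∫ t in a..b, ∫ v in c..d, F t v = ∫ v in c..d, ∫ t in a..b, F t v := by
  simp_rw [intervalIntegral.integral_of_le hab, intervalIntegral.integral_of_le hcd]
  apply MeasureTheory.integral_integral_swap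
  rw [MeasureTheory.Measure.prod_restrict]
  exact ((hF.continuousOn (s := Set.Icc a b ×ˢ Set.Icc c d)).integrableOn_compact
    (isCompact_Icc.prod isCompact_Icc)).mono_set (Set.prod_mono Set.Ioc_subset_Icc_self Set.Ioc_subset_Icc_self)

noncomputable def tailA (N K : ℕ) (a v t : ℝ) : ℂ :=
  ∑ n ∈ range K, (((n : ℝ) + N + |v| : ℝ) : ℂ) ^ (-(a + t * I : ℂ))

lemma tailA_cont (N K : ℕ) (hN : 1 ≤ N) (a : ℝ) : Continuous (fun p : ℝ × ℝ => tailA N K a p.1 p.2) := by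
  unfold tailA
  refine continuous_finsetSum _ fun n _ => ?_
  have hN' : (1 : ℝ) ≤ N := by exact_mod_cast hN
  refine Continuous.cpow (by fun_prop) (by fun_prop) fun p => ?_
  rw [Complex.ofReal_mem_slitPlane]; positivity

lemma zI_sum_eq (N K : ℕ) (hN : 1 ≤ N) (a t : ℝ) :
    ∑ n ∈ range K, zI (n + N) (a + t * I) = ∫ v in (0 : ℝ)..1, (v : ℂ) * tailA N K (a + 1) v t := by
  have hN' : (1 : ℝ) ≤ N := by exact_mod_cast hN
  simp_rw [tailA, Finset.mul_sum]
  rw [intervalIntegral.integral_finsetSum]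
  · refine Finset.sum_congr rfl fun n _ => ?_
    have h := intervalIntegral.integral_comp_add_left (a := 0) (b := 1)
      (fun u : ℝ => ((u - (n + N : ℕ) : ℝ) : ℂ) * (u : ℂ) ^ (-(a + t * I : ℂ) - 1)) ((n + N : ℕ) : ℝ)
    rw [add_zero] at h
    rw [zI, ← h]
    apply intervalIntegral.integral_congr
    intro v hv
    rw [Set.uIcc_of_le (by norm_num)] at hv
    simp only [add_sub_cancel_left, abs_of_nonneg hv.1]
    congr 2
    · push_cast; ring
    · push_cast; ring
  · intro n _
    apply Continuous.intervalIntegrable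
    refine Continuous.mul (by fun_prop) (Continuous.cpow (by fun_prop) (by fun_prop) fun p => ?_)
    rw [Complex.ofReal_mem_slitPlane]; positivity

lemma zI_sum_cont (N K : ℕ) (hN : 1 ≤ N) (a : ℝ) : Continuous fun t : ℝ => ∑ n ∈ range K, zI (n + N) (a + t * I) := by
  simp_rw [zI_sum_eq N K hN]
  have := tailA_cont N K hN (a + 1)
  apply intervalIntegral.continuous_parametric_intervalIntegral_of_continuous'
  have h2 : Continuous fun p : ℝ × ℝ => tailA N K (a + 1) p.2 p.1 := this.comp (continuous_swap)
  exact Continuous.mul (by fun_prop) h2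

lemma zI_sum_ms (N K : ℕ) (hN : 1 ≤ N) (hK : N ≤ K) (a : ℝ) (ha : 1 / 2 ≤ a) :
    ∫ t in (-(N : ℝ))..N, ‖∑ n ∈ range K, zI (n + N) (a + t * I)‖ ^ 2 ≤ (36 + 32 * Real.log (2 * K)) / N := by
  have hN' : (1 : ℝ) ≤ N := by exact_mod_cast hN
  have hc := tailA_cont N K hN (a + 1)
  have hcs : Continuous fun p : ℝ × ℝ => ‖tailA N K (a + 1) p.2 p.1‖ ^ 2 := (hc.comp continuous_swap).norm.pow 2
  have hpt : ∀ t : ℝ, ‖∑ n ∈ range K, zI (n + N) (a + t * I)‖ ^ 2 ≤ ∫ v in (0 : ℝ)..1, ‖tailA N K (a + 1) v t‖ ^ 2 := by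
    intro t
    have hct : Continuous fun v : ℝ => tailA N K (a + 1) v t := hc.comp (by fun_prop : Continuous fun v : ℝ => (v, t))
    rw [zI_sum_eq N K hN]
    have h1 : ‖∫ v in (0 : ℝ)..1, (v : ℂ) * tailA N K (a + 1) v t‖ ≤ ∫ v in (0 : ℝ)..1, ‖tailA N K (a + 1) v t‖ := by
      apply intervalIntegral.norm_integral_le_of_norm_le (by norm_num) _ (hct.norm.intervalIntegrable _ _)
      refine Filter.Eventually.of_forall fun v hv => ?_
      rw [norm_mul, Complex.norm_real, Real.norm_eq_abs, abs_of_pos hv.1]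
      exact mul_le_of_le_one_left (norm_nonneg _) hv.2
    refine (pow_le_pow_left₀ (norm_nonneg _) h1 2).trans ?_
    have := cs_int _ hct.norm 0 1 (by norm_num)
    simpa using this
  calc _ ≤ ∫ t in (-(N : ℝ))..N, ∫ v in (0 : ℝ)..1, ‖tailA N K (a + 1) v t‖ ^ 2 := by
        apply intervalIntegral.integral_mono_on (by linarith)
        · exact ((zI_sum_cont N K hN a).norm.pow 2).intervalIntegrable _ _
        · apply Continuous.intervalIntegrable
          exact intervalIntegral.continuous_parametric_intervalIntegral_of_continuous' hcs _ _
        · intro t _; exact hpt t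
    _ = ∫ v in (0 : ℝ)..1, ∫ t in (-(N : ℝ))..N, ‖tailA N K (a + 1) v t‖ ^ 2 := by
        exact swap_cont _ hcs _ _ _ _ (by linarith) (by norm_num)
    _ ≤ ∫ v in (0 : ℝ)..1, (36 + 32 * Real.log (2 * K)) / N := by
        apply intervalIntegral.integral_mono_on (by norm_num)
        · apply Continuous.intervalIntegrable
          apply intervalIntegral.continuous_parametric_intervalIntegral_of_continuous'
          exact hc.norm.pow 2
        · simp
        · intro v _
          have := tail_ms N K hN hK (a + 1) N |v| (by linarith) (by linarith) le_rfl (abs_nonneg _)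
          simpa only [tailA] using this
    _ = _ := by simp

lemma zeta_line_cont (a : ℝ) (ha : a < 1) : Continuous fun t : ℝ => riemannZeta (a + t * I) := by
  rw [continuous_iff_continuousAt]
  intro t
  have h1 : (a + t * I : ℂ) ≠ 1 := fun h => by
    have := congrArg Complex.re h
    simp at this; linarith
  exact ContinuousAt.comp (f := fun t : ℝ => (a + t * I : ℂ)) (differentiableAt_riemannZeta h1).continuousAt (by fun_prop)

lemma zeta_split (N : ℕ) (hN : 1 ≤ N) (a t : ℝ) (ha : 1 / 2 ≤ a) (ha1 : a ≤ 3 / 4) (ht : |t| ≤ N) :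
    ‖riemannZeta (a + t * I)‖ ^ 2 ≤ 4 * ‖∑ n ∈ range N, (((n : ℝ) + 1 : ℝ) : ℂ) ^ (-(a + t * I : ℂ))‖ ^ 2 +
      64 * N * (1 + t ^ 2)⁻¹ + 8 * N ^ 2 * ‖∑ n ∈ range (N ^ 2), zI (n + N) (a + t * I)‖ ^ 2 + 32 := by
  have hN' : (1 : ℝ) ≤ N := by exact_mod_cast hN
  set s : ℂ := a + t * I with hs
  have hre : s.re = a := by simp [hs]
  have him : s.im = t := by simp [hs]
  have hs1 : s ≠ 1 := fun h => by
    have := congrArg Complex.re h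
    rw [hre] at this; simp at this; linarith
  have ht2 : t ^ 2 ≤ N ^ 2 := sq_le_sq.2 (by rwa [abs_of_nonneg (show (0 : ℝ) ≤ N by linarith)])
  have h := zeta_eq_N s (by rw [hre]; linarith) hs1 N hN
  have hsum := (zTail_summable s (by rw [hre]; linarith) N hN).1.of_norm
  have htail : zTail N s = ∑ n ∈ range (N ^ 2), zI (n + N) s + zTail (N + N ^ 2) s := by
    rw [zTail, ← hsum.sum_add_tsum_nat_add (N ^ 2), zTail]
    congr 1
    refine tsum_congr fun i => ?_
    rw [show i + N ^ 2 + N = i + (N + N ^ 2) by ring]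
  set Z := ∑ n ∈ range (N ^ 2), zI (n + N) s
  set R := zTail (N + N ^ 2) s with hR
  set P := ∑ n ∈ range N, (((n : ℝ) + 1 : ℝ) : ℂ) ^ (-s) with hP
  have hP' : ∑ n ∈ range N, ((n : ℂ) + 1) ^ (-s) = P := by
    rw [hP]; push_cast; rfl
  rw [hP', htail] at h
  have hsn : ‖s‖ ^ 2 ≤ 2 * N ^ 2 := by
    rw [← Complex.normSq_eq_norm_sq, Complex.normSq_apply, hre, him]; nlinarith
  have hQ : ‖(N : ℂ) ^ (1 - s) / (s - 1)‖ ^ 2 ≤ 16 * N * (1 + t ^ 2)⁻¹ := by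
    rw [norm_div, div_pow]
    have h1 : ‖(N : ℂ) ^ (1 - s)‖ ^ 2 ≤ N := by
      rw [show (N : ℂ) = ((N : ℝ) : ℂ) by push_cast; rfl, Complex.norm_cpow_eq_rpow_re_of_pos (by linarith), ← Real.rpow_natCast,
        ← Real.rpow_mul (by linarith)]
      nth_rewrite 2 [← Real.rpow_one (N : ℝ)]
      apply Real.rpow_le_rpow_of_exponent_le hN'
      simp [hre]; linarith
    have h2 : (1 + t ^ 2) / 16 ≤ ‖s - 1‖ ^ 2 := by
      rw [← Complex.normSq_eq_norm_sq, Complex.normSq_apply]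
      simp only [sub_re, sub_im, hre, him, one_re, one_im]; nlinarith
    calc _ ≤ (N : ℝ) / ((1 + t ^ 2) / 16) := by gcongr
      _ = _ := by field_simp
  have hRb : ‖R‖ ^ 2 ≤ 4 / N ^ 2 := by
    have h1 := (zTail_summable s (by rw [hre]; linarith) (N + N ^ 2) (by omega)).2
    rw [hre, ← hR] at h1
    have h2 : (((N + N ^ 2 : ℕ) : ℝ)) ^ (-a) ≤ 1 / N := by
      have hq : (1 : ℝ) ≤ ((N ^ 2 : ℕ) : ℝ) := by push_cast; nlinarith
      calc (((N + N ^ 2 : ℕ) : ℝ)) ^ (-a) ≤ ((N ^ 2 : ℕ) : ℝ) ^ (-a) := by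
            apply Real.rpow_le_rpow_of_nonpos (by linarith) _ (by linarith)
            push_cast; linarith
        _ ≤ ((N ^ 2 : ℕ) : ℝ) ^ (-(1 / 2) : ℝ) := Real.rpow_le_rpow_of_exponent_le hq (by linarith)
        _ = 1 / N := by
            push_cast
            rw [← Real.rpow_natCast, ← Real.rpow_mul (by linarith)]; norm_num; rw [Real.rpow_neg_one]
    have h3 : ‖R‖ ≤ 2 / N := by
      refine h1.trans ?_
      rw [div_le_iff₀ (by linarith)]
      have h4 : (1 : ℝ) / N ≤ 2 / N * a := by
        rw [div_mul_eq_mul_div]; gcongr; linarith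
      linarith
    calc ‖R‖ ^ 2 ≤ (2 / (N : ℝ)) ^ 2 := by gcongr
      _ = _ := by ring
  have hsR : ‖s‖ ^ 2 * ‖R‖ ^ 2 ≤ 8 := by
    calc ‖s‖ ^ 2 * ‖R‖ ^ 2 ≤ (2 * N ^ 2) * (4 / N ^ 2) := by gcongr
      _ = 8 := by field_simp; norm_num
  have hsZ : ‖s‖ ^ 2 * ‖Z‖ ^ 2 ≤ 2 * N ^ 2 * ‖Z‖ ^ 2 := by gcongr
  have hn : ‖riemannZeta s‖ ≤ ‖P‖ + ‖(N : ℂ) ^ (1 - s) / (s - 1)‖ + ‖s‖ * ‖Z‖ + ‖s‖ * ‖R‖ := by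
    rw [h, mul_add, ← sub_sub]
    refine (norm_sub_le _ _).trans ?_
    refine (add_le_add_left (norm_sub_le _ _) _).trans ?_
    refine (add_le_add_left (add_le_add_left (norm_add_le _ _) _) _).trans ?_
    rw [norm_mul, norm_mul]
  set Q := ‖(N : ℂ) ^ (1 - s) / (s - 1)‖
  have key : ‖riemannZeta s‖ ^ 2 ≤ 4 * (‖P‖ ^ 2 + Q ^ 2 + (‖s‖ * ‖Z‖) ^ 2 + (‖s‖ * ‖R‖) ^ 2) := by
    refine (pow_le_pow_left₀ (norm_nonneg _) hn 2).trans ?_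
    generalize ‖s‖ * ‖Z‖ = u, ‖s‖ * ‖R‖ = w, ‖P‖ = p
    nlinarith [sq_nonneg (p - Q), sq_nonneg (p - u), sq_nonneg (p - w), sq_nonneg (Q - u), sq_nonneg (Q - w), sq_nonneg (u - w)]
  rw [mul_pow, mul_pow] at key
  linarith

lemma int_lin4 (f g h : ℝ → ℝ) (hf : Continuous f) (hg : Continuous g) (hh : Continuous h) (a b A B C D : ℝ) :
    ∫ t in a..b, (A * f t + B * g t + C * h t + D) = A * (∫ t in a..b, f t) + B * (∫ t in a..b, g t) +
      C * (∫ t in a..b, h t) + (b - a) * D := by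
  rw [intervalIntegral.integral_add, intervalIntegral.integral_add, intervalIntegral.integral_add,
    intervalIntegral.integral_const_mul, intervalIntegral.integral_const_mul, intervalIntegral.integral_const_mul,
    intervalIntegral.integral_const, smul_eq_mul]
  all_goals apply Continuous.intervalIntegrable; fun_prop

lemma zeta_ms (N : ℕ) (hN : 1 ≤ N) (a : ℝ) (ha : 1 / 2 ≤ a) (ha1 : a ≤ 3 / 4) :
    ∫ t in (-(N : ℝ))..N, ‖riemannZeta (a + t * I)‖ ^ 2 ≤ 1000 * N * (1 + Real.log (2 * N)) := by
  have hN' : (1 : ℝ) ≤ N := by exact_mod_cast hN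
  have c1 : Continuous fun t : ℝ => ‖∑ n ∈ range N, (((n : ℝ) + 1 : ℝ) : ℂ) ^ (-(a + t * I : ℂ))‖ ^ 2 := by
    refine (continuous_finsetSum _ fun n _ => ?_).norm.pow 2
    refine Continuous.cpow (by fun_prop) (by fun_prop) fun p => ?_
    rw [Complex.ofReal_mem_slitPlane]; positivity
  have c2 : Continuous fun t : ℝ => (1 + t ^ 2)⁻¹ := by
    refine Continuous.inv₀ (by fun_prop) fun t => by positivity
  have c3 : Continuous fun t : ℝ => ‖∑ n ∈ range (N ^ 2), zI (n + N) (a + t * I)‖ ^ 2 :=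
    (zI_sum_cont N (N ^ 2) hN a).norm.pow 2
  have h1 : ∫ t in (-(N : ℝ))..N, ‖riemannZeta (a + t * I)‖ ^ 2 ≤ ∫ t in (-(N : ℝ))..N,
      (4 * ‖∑ n ∈ range N, (((n : ℝ) + 1 : ℝ) : ℂ) ^ (-(a + t * I : ℂ))‖ ^ 2 +
      64 * N * (1 + t ^ 2)⁻¹ + 8 * N ^ 2 * ‖∑ n ∈ range (N ^ 2), zI (n + N) (a + t * I)‖ ^ 2 + 32) := by
    apply intervalIntegral.integral_mono_on (by linarith)
    · exact ((zeta_line_cont a (by linarith)).norm.pow 2).intervalIntegrable _ _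
    · exact ((((c1.const_mul 4).add (c2.const_mul _)).add (c3.const_mul _)).add_const 32).intervalIntegrable _ _
    · intro t ht
      exact zeta_split N hN a t ha ha1 (abs_le.2 ht)
  rw [int_lin4 _ _ _ c1 c2 c3] at h1
  have i1 := poly_ms N a N ha (by linarith)
  have i2 : ∫ t in (-(N : ℝ))..N, (1 + t ^ 2)⁻¹ ≤ 4 := by
    rw [integral_inv_one_add_sq]
    linarith [Real.arctan_lt_pi_div_two N, Real.neg_pi_div_two_lt_arctan (-(N : ℝ)), Real.pi_le_four]
  have i3 := zI_sum_ms N (N ^ 2) hN (by nlinarith) a ha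
  have hl : Real.log (2 * (N ^ 2 : ℕ)) ≤ 2 * Real.log (2 * N) := by
    have : 2 * Real.log (2 * N) = Real.log ((2 * N) ^ 2) := by rw [Real.log_pow]; norm_num
    rw [this]
    apply Real.log_le_log (by positivity)
    push_cast; nlinarith
  have hl0 : 0 ≤ Real.log (2 * N) := Real.log_nonneg (by linarith)
  have j2 := mul_le_mul_of_nonneg_left i2 (show (0 : ℝ) ≤ 64 * N by positivity)
  have j3 : 8 * (N : ℝ) ^ 2 * ∫ t in (-(N : ℝ))..N, ‖∑ n ∈ range (N ^ 2), zI (n + N) (a + t * I)‖ ^ 2 ≤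
      N * (288 + 512 * Real.log (2 * N)) := by
    calc _ ≤ 8 * (N : ℝ) ^ 2 * ((36 + 32 * (2 * Real.log (2 * N))) / N) := by
          apply mul_le_mul_of_nonneg_left _ (by positivity)
          refine i3.trans ?_
          gcongr
      _ = _ := by field_simp; ring
  have := mul_nonneg (show (0 : ℝ) ≤ N by linarith) hl0
  nlinarith

lemma zeta_m1 (j : ℕ) (a : ℝ) (ha : 1 / 2 ≤ a) (ha1 : a ≤ 3 / 4) :
    ∫ t in (-(2 : ℝ) ^ j)..2 ^ j, ‖riemannZeta (a + t * I)‖ ≤ 45 * 2 ^ j * √(j + 2) := by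
  have h := zeta_ms (2 ^ j) Nat.one_le_two_pow a ha ha1
  push_cast at h
  have hp : (0 : ℝ) < 2 ^ j := by positivity
  have hcs := cs_int _ (zeta_line_cont a (by linarith)).norm (-(2 : ℝ) ^ j) (2 ^ j) (by linarith)
  have hl : Real.log (2 * 2 ^ j) ≤ j + 1 := by
    rw [← pow_succ', Real.log_pow]
    push_cast
    nlinarith [Real.log_two_lt_d9, Real.log_two_gt_d9, (Nat.cast_nonneg j : (0 : ℝ) ≤ j)]
  have hsq : √((j : ℝ) + 2) ^ 2 = j + 2 := Real.sq_sqrt (by positivity)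
  refine le_of_sq_le_sq ?_ (by positivity)
  refine hcs.trans ?_
  rw [mul_pow, hsq]
  have h2 := mul_le_mul_of_nonneg_left h (show (0 : ℝ) ≤ 2 * 2 ^ j by positivity)
  have h3 := mul_le_mul_of_nonneg_left hl (show (0 : ℝ) ≤ 2000 * (2 ^ j) ^ 2 by positivity)
  have h4 : (0 : ℝ) ≤ (2 ^ j) ^ 2 * (j + 2) := by positivity
  linarith

lemma zeta_w (J : ℕ) (a : ℝ) (ha : 1 / 2 ≤ a) (ha1 : a ≤ 3 / 4) :
    ∫ t in (-(2 : ℝ) ^ J)..2 ^ J, ‖riemannZeta (a + t * I)‖ * (1 + |t|)⁻¹ ≤ 90 * (J + 1) * √(J + 2) := by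
  have hz := (zeta_line_cont a (by linarith)).norm
  have hi : Continuous fun t : ℝ => (1 + |t|)⁻¹ := Continuous.inv₀ (by fun_prop) fun t => by positivity
  have hc : Continuous fun t : ℝ => ‖riemannZeta (a + t * I)‖ * (1 + |t|)⁻¹ := hz.mul hi
  induction J with
  | zero =>
    have h := zeta_m1 0 a ha ha1
    have h2 : ∫ t in (-(2 : ℝ) ^ 0)..2 ^ 0, ‖riemannZeta (a + t * I)‖ * (1 + |t|)⁻¹ ≤ ∫ t in (-(2 : ℝ) ^ 0)..2 ^ 0, ‖riemannZeta (a + t * I)‖ := by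
      apply intervalIntegral.integral_mono_on (by norm_num) (hc.intervalIntegrable _ _) (hz.intervalIntegrable _ _)
      intro t _
      exact mul_le_of_le_one_right (norm_nonneg _) (inv_le_one_of_one_le₀ (by linarith [abs_nonneg t]))
    refine h2.trans (h.trans ?_)
    have h3 : 0 ≤ √(((0 : ℕ) : ℝ) + 2) := Real.sqrt_nonneg _
    rw [pow_zero, Nat.cast_zero] at *
    linarith
  | succ J ih =>
    have hp : (0 : ℝ) < 2 ^ J := by positivity
    have hp2 : (2 : ℝ) ^ (J + 1) = 2 * 2 ^ J := by ring
    have h := zeta_m1 (J + 1) a ha ha1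
    rw [hp2] at h ⊢
    set A : ℝ := 2 ^ J
    have piece : ∀ u v : ℝ, u ≤ v → (∀ t ∈ Set.Icc u v, A ≤ |t|) →
        ∫ t in u..v, ‖riemannZeta (a + t * I)‖ * (1 + |t|)⁻¹ ≤ A⁻¹ * ∫ t in u..v, ‖riemannZeta (a + t * I)‖ := by
      intro u v huv hA
      rw [← intervalIntegral.integral_const_mul]
      apply intervalIntegral.integral_mono_on huv (hc.intervalIntegrable _ _) ((hz.const_mul _).intervalIntegrable _ _)
      intro t ht
      rw [mul_comm]
      apply mul_le_mul_of_nonneg_right _ (norm_nonneg _)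
      exact inv_anti₀ hp (by linarith [hA t ht])
    have p1 := piece (-(2 * A)) (-A) (by linarith) fun t ht => by
      rw [abs_of_neg (by linarith [ht.2])]; linarith [ht.2]
    have p2 := piece A (2 * A) (by linarith) fun t ht => by
      rw [abs_of_pos (by linarith [ht.1])]; linarith [ht.1]
    have s1 := intervalIntegral.integral_add_adjacent_intervals (hc.intervalIntegrable (-(2 * A)) (-A)) (hc.intervalIntegrable (-A) A)
      (μ := MeasureTheory.volume)
    have s2 := intervalIntegral.integral_add_adjacent_intervals (hc.intervalIntegrable (-(2 * A)) A) (hc.intervalIntegrable A (2 * A))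
      (μ := MeasureTheory.volume)
    have s3 := intervalIntegral.integral_add_adjacent_intervals (hz.intervalIntegrable (-(2 * A)) (-A)) (hz.intervalIntegrable (-A) A)
      (μ := MeasureTheory.volume)
    have s4 := intervalIntegral.integral_add_adjacent_intervals (hz.intervalIntegrable (-(2 * A)) A) (hz.intervalIntegrable A (2 * A))
      (μ := MeasureTheory.volume)
    have n0 : 0 ≤ ∫ t in (-A)..A, ‖riemannZeta (a + t * I)‖ :=
      intervalIntegral.integral_nonneg (by linarith) fun t _ => norm_nonneg _
    have q : A⁻¹ * ((∫ t in (-(2 * A))..(-A), ‖riemannZeta (a + t * I)‖) + ∫ t in A..(2 * A), ‖riemannZeta (a + t * I)‖) ≤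
        90 * √(((J + 1 : ℕ) : ℝ) + 2) := by
      rw [inv_mul_le_iff₀ hp]
      linarith
    have m : √((J : ℝ) + 2) ≤ √(((J + 1 : ℕ) : ℝ) + 2) := Real.sqrt_le_sqrt (by push_cast; linarith)
    have m2 := mul_le_mul_of_nonneg_left m (show (0 : ℝ) ≤ 90 * (J + 1) by positivity)
    rw [mul_add] at q
    have e : 90 * (((J + 1 : ℕ) : ℝ) + 1) * √(((J + 1 : ℕ) : ℝ) + 2) =
      90 * (J + 1) * √(((J + 1 : ℕ) : ℝ) + 2) + 90 * √(((J + 1 : ℕ) : ℝ) + 2) := by push_cast; ring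
    rw [e]
    linarith

lemma rh_ne (hRH : RiemannHypothesis) (s : ℂ) (hs : 1 / 2 < s.re) : riemannZeta s ≠ 0 := by
  intro h
  by_cases h1 : s = 1
  · exact riemannZeta_one_ne_zero (h1 ▸ h)
  · have := hRH s h (by
      rintro ⟨n, hn⟩
      rw [hn] at hs
      have : (0 : ℝ) ≤ n := Nat.cast_nonneg n
      simp at hs
      linarith) h1
    linarith

lemma zeta_w_log (x L V a : ℝ) (hL : 2 ≤ L) (hLx : L = Real.log x) (hx : 1 ≤ x) (hV : V ≤ x ^ 4) (ha : 1 / 2 ≤ a) (ha1 : a ≤ 3 / 4)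
    (u v : ℝ) (huv : u ≤ v) (hu : -V ≤ u) (hv : v ≤ V) :
    ∫ t in u..v, ‖riemannZeta (a + t * I)‖ * (1 + |t|)⁻¹ ≤ 2160 * (L * √L) := by
  have hz := (zeta_line_cont a (by linarith)).norm
  have hi : Continuous fun t : ℝ => (1 + |t|)⁻¹ := Continuous.inv₀ (by fun_prop) fun t => by positivity
  have hc : Continuous fun t : ℝ => ‖riemannZeta (a + t * I)‖ * (1 + |t|)⁻¹ := hz.mul hi
  set J := ⌈6 * L⌉₊ with hJ
  have hJ1 : 6 * L ≤ J := Nat.le_ceil _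
  have hJ2 : (J : ℝ) < 6 * L + 1 := Nat.ceil_lt_add_one (by linarith)
  have hVJ : V ≤ 2 ^ J := by
    refine hV.trans ?_
    rw [← Real.exp_log (show (0 : ℝ) < x ^ 4 by positivity), ← Real.exp_log (show (0 : ℝ) < 2 ^ J by positivity)]
    apply Real.exp_le_exp.2
    rw [Real.log_pow, Real.log_pow, ← hLx]
    push_cast
    nlinarith [Real.log_two_gt_d9]
  have h := zeta_w J a ha ha1
  have hmono : ∫ t in u..v, ‖riemannZeta (a + t * I)‖ * (1 + |t|)⁻¹ ≤
      ∫ t in (-(2 : ℝ) ^ J)..2 ^ J, ‖riemannZeta (a + t * I)‖ * (1 + |t|)⁻¹ := by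
    apply intervalIntegral.integral_mono_interval (by linarith) huv (by linarith) _ (hc.intervalIntegrable _ _)
    exact Filter.Eventually.of_forall fun t => by positivity
  refine hmono.trans (h.trans ?_)
  have h2 : √((J : ℝ) + 2) ≤ 3 * √L := by
    rw [show (3 : ℝ) = √9 by rw [show (9 : ℝ) = 3 ^ 2 by norm_num, Real.sqrt_sq (by norm_num)], ← Real.sqrt_mul (by norm_num)]
    exact Real.sqrt_le_sqrt (by linarith)
  calc 90 * ((J : ℝ) + 1) * √(J + 2) ≤ 90 * (8 * L) * (3 * √L) := by
        gcongr; linarith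
    _ = _ := by ring

set_option maxHeartbeats 1600000 in
lemma rh_left (hRH : RiemannHypothesis) (x X : ℝ) (hx : Real.exp 16 ≤ x) (hX : X = ⌊x⌋₊ + 1 / 2) :
    ‖∫ t in (-(x ^ 2))..(x ^ 2), (X : ℂ) ^ (((1 / 2 + 1 / Real.log x : ℝ) : ℂ) + t * I : ℂ) / (((1 / 2 + 1 / Real.log x : ℝ) : ℂ) + t * I) *
      Gop riemannZeta (((1 / 2 + 1 / Real.log x : ℝ) : ℂ) + t * I)‖ ≤
      4 * x ^ (1 / 2 + 1 / Real.log x) * (24 * 8 * Real.log x ^ 3 * (8640 * (Real.log x * √(Real.log x)))) := by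
  have hx0 : 0 < x := (Real.exp_pos _).trans_le hx
  have hx17 : 17 ≤ x := by linarith [Real.add_one_le_exp (16 : ℝ)]
  set L := Real.log x with hL
  have hL16 : 16 ≤ L := by rw [hL, Real.le_log_iff_exp_le hx0]; exact hx
  have hL0 : 0 < L := by linarith
  have hb0 : 0 < 1 / L := by positivity
  have hb1 : 1 / L ≤ 1 / 16 := one_div_le_one_div_of_le (by norm_num) hL16
  set r := 1 / (2 * L) with hr
  have hr0 : 0 < r := by positivity
  have hrb : r = 1 / L / 2 := by rw [hr]; field_simp
  set x0 := 1 / 2 + 1 / L with hx0d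
  have hXp : 0 < X := by rw [hX]; positivity
  clear_value x0 r L
  have hpi := Real.pi_pos
  obtain ⟨H, hH⟩ : ∃ H : ℝ → ℝ → ℝ, H = fun t θ => ‖riemannZeta (((x0 + r * Real.cos θ : ℝ) : ℂ) + ((t + r * Real.sin θ : ℝ) : ℂ) * I)‖ *
    (1 + |t + r * Real.sin θ|)⁻¹ := ⟨_, rfl⟩
  have hcos : ∀ θ, -r ≤ r * Real.cos θ ∧ r * Real.cos θ ≤ r := fun θ =>
    ⟨by nlinarith [Real.neg_one_le_cos θ], by nlinarith [Real.cos_le_one θ]⟩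
  have hsin : ∀ θ, |r * Real.sin θ| ≤ r := fun θ => by
    rw [abs_mul, abs_of_pos hr0]
    exact mul_le_of_le_one_right hr0.le (Real.abs_sin_le_one θ)
  have hHc : Continuous fun p : ℝ × ℝ => H p.1 p.2 := by
    simp only [hH]
    refine Continuous.mul ?_ (Continuous.inv₀ (by fun_prop) fun p => by positivity)
    refine Continuous.norm ?_
    rw [continuous_iff_continuousAt]
    intro p
    have h1 : (((x0 + r * Real.cos p.2 : ℝ) : ℂ) + ((p.1 + r * Real.sin p.2 : ℝ) : ℂ) * I) ≠ 1 := fun h => by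
      have := congrArg Complex.re h
      simp only [add_re, ofReal_re, mul_re, I_re, I_im, ofReal_im, one_re] at this
      linarith [(hcos p.2).2]
    exact ContinuousAt.comp (f := fun p : ℝ × ℝ => (((x0 + r * Real.cos p.2 : ℝ) : ℂ) + ((p.1 + r * Real.sin p.2 : ℝ) : ℂ) * I))
      (differentiableAt_riemannZeta h1).continuousAt (by fun_prop)
  have hG : ∀ t : ℝ, ‖(X : ℂ) ^ ((x0 : ℂ) + t * I : ℂ) / (x0 + t * I) * Gop riemannZeta (x0 + t * I)‖ ≤
      X ^ x0 * (24 / r ^ 3 * ((2 * Real.pi)⁻¹ * (4 * ∫ θ in (0 : ℝ)..2 * Real.pi, H t θ))) := by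
    intro t
    have hn0 : 0 < ‖(x0 + t * I : ℂ)‖ := lt_of_lt_of_le (by rw [abs_pos]; linarith) (re_le_norm' x0 t)
    have g1 := Gop_bound (f := riemannZeta) (c := x0 + t * I) (R := 1 / L) hr0 (by linarith) (by
      intro z hz
      apply DifferentiableAt.differentiableWithinAt
      apply differentiableAt_riemannZeta
      intro h
      rw [Metric.mem_ball, dist_eq_norm, h] at hz
      have := (Complex.abs_re_le_norm _).trans hz.le
      simp only [sub_re, add_re, ofReal_re, mul_re, I_re, I_im, ofReal_im, one_re] at this
      rw [abs_of_pos (by linarith)] at this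
      linarith) (by
      intro z hz
      apply rh_ne hRH
      rw [Metric.mem_ball, dist_eq_norm] at hz
      have := (Complex.abs_re_le_norm _).trans_lt hz
      simp only [sub_re, add_re, ofReal_re, mul_re, I_re, I_im, ofReal_im] at this
      rw [abs_lt] at this
      linarith [this.1])
    have hHt : Continuous fun θ => H t θ := Continuous.comp (g := fun p : ℝ × ℝ => H p.1 p.2) (f := fun θ : ℝ => (t, θ)) hHc (continuous_const.prodMk continuous_id)
    have hcirc : ∀ θ, circleMap (x0 + t * I) r θ = ((x0 + r * Real.cos θ : ℝ) : ℂ) + ((t + r * Real.sin θ : ℝ) : ℂ) * I := by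
      intro θ
      rw [circleMap, Complex.exp_mul_I]; push_cast; ring
    have hle : ∀ θ, ‖riemannZeta (circleMap (x0 + t * I) r θ)‖ ≤ 4 * H t θ * ‖(x0 + t * I : ℂ)‖ := by
      intro θ
      rw [hcirc]
      simp only [hH]
      have hden : 1 + |t + r * Real.sin θ| ≤ 4 * ‖(x0 + t * I : ℂ)‖ := by
        have a1 := abs_add_le t (r * Real.sin θ)
        have a2 := re_le_norm' x0 t
        have a3 := im_le_norm' x0 t
        rw [abs_of_pos (by linarith)] at a2
        linarith [hsin θ]
      have hd0 : 0 < 1 + |t + r * Real.sin θ| := by positivity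
      have : 1 ≤ 4 * ‖(x0 + t * I : ℂ)‖ * (1 + |t + r * Real.sin θ|)⁻¹ := by
        rw [le_mul_inv_iff₀ hd0]; linarith
      have := mul_le_mul_of_nonneg_left this (norm_nonneg (riemannZeta (((x0 + r * Real.cos θ : ℝ) : ℂ) + ((t + r * Real.sin θ : ℝ) : ℂ) * I)))
      linarith
    have hIint : ∫ θ in (0 : ℝ)..2 * Real.pi, ‖riemannZeta (circleMap (x0 + t * I) r θ)‖ ≤
        (4 * ∫ θ in (0 : ℝ)..2 * Real.pi, H t θ) * ‖(x0 + t * I : ℂ)‖ := by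
      rw [← intervalIntegral.integral_const_mul, ← intervalIntegral.integral_mul_const]
      apply intervalIntegral.integral_mono_on_of_le_Ioo (by positivity) _ (Continuous.intervalIntegrable (by fun_prop) _ _) (fun θ _ => hle θ)
      apply Continuous.intervalIntegrable
      have : Continuous fun θ => riemannZeta (circleMap (x0 + t * I) r θ) := by
        rw [continuous_iff_continuousAt]
        intro θ
        have h1 : circleMap (x0 + t * I) r θ ≠ 1 := fun h => by
          rw [hcirc] at h
          have := congrArg Complex.re h
          simp only [add_re, ofReal_re, mul_re, I_re, I_im, ofReal_im, one_re] at this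
          linarith [(hcos θ).2]
        exact ContinuousAt.comp (differentiableAt_riemannZeta h1).continuousAt (continuous_circleMap _ _).continuousAt
      exact this.norm
    rw [norm_mul, norm_div, Complex.norm_cpow_eq_rpow_re_of_pos hXp]
    have hre : (x0 + t * I : ℂ).re = x0 := by simp
    rw [hre, div_mul_eq_mul_div, mul_div_assoc]
    have hXx0 : 0 ≤ X ^ x0 := Real.rpow_nonneg hXp.le _
    refine mul_le_mul_of_nonneg_left ?_ hXx0
    rw [div_le_iff₀ hn0]
    refine g1.trans ?_
    have hr3 : 0 ≤ 24 / r ^ 3 := by positivity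
    have hp2 : 0 ≤ (2 * Real.pi)⁻¹ := by positivity
    rw [mul_assoc (24 / r ^ 3), mul_assoc (2 * Real.pi)⁻¹]
    exact mul_le_mul_of_nonneg_left (mul_le_mul_of_nonneg_left hIint hp2) hr3
  have hpar : Continuous fun t => ∫ θ in (0 : ℝ)..2 * Real.pi, H t θ :=
    intervalIntegral.continuous_parametric_intervalIntegral_of_continuous' hHc _ _
  have hx2 : 0 < x ^ 2 := by positivity
  have hmain := intervalIntegral.norm_integral_le_of_norm_le (a := -(x ^ 2)) (b := x ^ 2) (by linarith)
    (Filter.Eventually.of_forall fun t _ => hG t) (Continuous.intervalIntegrable (by fun_prop) _ _) (μ := MeasureTheory.volume)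
  refine hmain.trans ?_
  rw [intervalIntegral.integral_const_mul, intervalIntegral.integral_const_mul, intervalIntegral.integral_const_mul,
    intervalIntegral.integral_const_mul, swap_cont H hHc _ _ _ _ (by linarith) (by positivity)]
  have hin : ∫ θ in (0 : ℝ)..2 * Real.pi, ∫ t in (-(x ^ 2))..(x ^ 2), H t θ ≤ ∫ θ in (0 : ℝ)..2 * Real.pi, 2160 * (L * √L) := by
    apply intervalIntegral.integral_mono_on (by positivity) _ (by simp)
    · intro θ _
      simp only [hH]
      rw [intervalIntegral.integral_comp_add_right (fun t : ℝ => ‖riemannZeta (((x0 + r * Real.cos θ : ℝ) : ℂ) + (t : ℂ) * I)‖ * (1 + |t|)⁻¹)]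
      have hs := abs_le.1 (hsin θ)
      have hx4 : x ^ 2 + 1 ≤ x ^ 4 := by
        have h2 : 2 ≤ x ^ 2 := by nlinarith
        nlinarith [mul_le_mul h2 h2 (by norm_num) (by positivity)]
      exact zeta_w_log x L (x ^ 2 + 1) _ (by linarith) hL (by linarith) hx4 (by linarith [(hcos θ).1]) (by linarith [(hcos θ).2])
        _ _ (by linarith) (by linarith) (by linarith)
    · apply Continuous.intervalIntegrable
      exact intervalIntegral.continuous_parametric_intervalIntegral_of_continuous' (f := fun θ t => H t θ)
        (Continuous.comp (g := fun p : ℝ × ℝ => H p.1 p.2) hHc continuous_swap) _ _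
  rw [intervalIntegral.integral_const, smul_eq_mul, sub_zero] at hin
  have hXx := X_pow_bd x x0 (by linarith) (by linarith) (by linarith)
  rw [← hX] at hXx
  have hr3 : 24 / r ^ 3 = 24 * 8 * L ^ 3 := by rw [hr]; field_simp; norm_num
  rw [hr3]
  apply mul_le_mul hXx _ _ (by positivity)
  · apply mul_le_mul_of_nonneg_left _ (by positivity)
    rw [inv_mul_le_iff₀ (by positivity)]
    linarith
  · apply mul_nonneg (by positivity)
    apply mul_nonneg (by positivity)
    apply mul_nonneg (by norm_num)
    apply intervalIntegral.integral_nonneg (by positivity) fun θ _ => ?_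
    apply intervalIntegral.integral_nonneg (by linarith) fun t _ => ?_
    simp only [hH]; positivity

lemma rh_zeta_bd (x : ℝ) (hx : Real.exp 16 ≤ x) (z : ℂ) (h1 : 1 / 2 ≤ z.re) (h2 : z.re ≤ 3)
    (h3 : x ^ 2 - 1 ≤ |z.im|) (h4 : |z.im| ≤ x ^ 2 + 1) : ‖riemannZeta z‖ ≤ 8 * x * Real.log x := by
  have hx0 : 0 < x := (Real.exp_pos _).trans_le hx
  have hx17 : 17 ≤ x := by linarith [Real.add_one_le_exp (16 : ℝ)]
  have hL16 : 16 ≤ Real.log x := by rw [Real.le_log_iff_exp_le hx0]; exact hx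
  have hx2 : 17 * x ≤ x ^ 2 := by nlinarith
  have hn : 1 ≤ ‖z - 1‖ := by
    refine le_trans ?_ (Complex.abs_im_le_norm _)
    simp only [sub_im, one_im, sub_zero]; linarith
  have hzz : ((z.re : ℂ) + z.im * I) = z := Complex.re_add_im z
  have hne : z ≠ 1 := fun h => by rw [h] at hn; norm_num at hn
  have h := zeta_bd z.re z.im h1 h2 (by rw [hzz]; exact hne)
  rw [hzz] at h
  refine h.trans ?_
  set Y := |z.im| + 2 with hY
  have hY1 : 1 ≤ Y := by linarith [abs_nonneg z.im]
  have hY2 : Y ≤ (2 * x) ^ 2 := by nlinarith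
  have hY3 : Y ≤ x ^ 3 := by nlinarith
  have a1 : Y ^ (max (1 - z.re) 0) ≤ 2 * x := by
    calc Y ^ (max (1 - z.re) 0) ≤ Y ^ (1 / 2 : ℝ) := by
          apply Real.rpow_le_rpow_of_exponent_le hY1
          apply max_le <;> linarith
      _ ≤ 2 * x := by
          rw [← Real.sqrt_eq_rpow]
          exact Real.sqrt_le_iff.2 ⟨by linarith, hY2⟩
  have a2 : Real.log Y ≤ 3 * Real.log x := by
    have := Real.log_le_log (by linarith) hY3
    rwa [Real.log_pow] at this
  have a3 : 1 / ‖z - 1‖ ≤ 1 := by rw [div_le_one (by linarith)]; exact hn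
  have a4 : 0 ≤ Real.log Y := Real.log_nonneg hY1
  have a5 : 0 ≤ 1 / ‖z - 1‖ := by positivity
  calc _ ≤ 2 * x * (4 * Real.log x) := mul_le_mul a1 (by linarith) (by linarith) (by linarith)
    _ = _ := by ring

lemma rh_hor (hRH : RiemannHypothesis) (x X : ℝ) (hx : Real.exp 16 ≤ x) (hX : X = ⌊x⌋₊ + 1 / 2) (v : ℝ) (hv : |v| = x ^ 2) :
    ‖∫ t in (1 / 2 + 1 / Real.log x)..(1 + 1 / Real.log x), (X : ℂ) ^ (t + v * I : ℂ) / (t + v * I) *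
      Gop riemannZeta (t + v * I)‖ ≤ 24 * 64 * 8 * 4 * Real.exp 1 * Real.log x ^ 4 := by
  have hx0 : 0 < x := (Real.exp_pos _).trans_le hx
  have hx17 : 17 ≤ x := by linarith [Real.add_one_le_exp (16 : ℝ)]
  set L := Real.log x with hL
  have hL16 : 16 ≤ L := by rw [hL, Real.le_log_iff_exp_le hx0]; exact hx
  have hL0 : 0 < L := by linarith
  have hb0 : 0 < 1 / L := by positivity
  have hb1 : 1 / L ≤ 1 / 16 := one_div_le_one_div_of_le (by norm_num) hL16
  have hXp : 0 < X := by rw [hX]; positivity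
  have hXc : X ^ (1 + 1 / L) ≤ 4 * (x * Real.exp 1) := by
    rw [hX]
    refine (X_pow_bd x (1 + 1 / L) (by linarith) (by linarith) (by linarith)).trans (le_of_eq ?_)
    rw [Real.rpow_add hx0, Real.rpow_one, Real.rpow_def_of_pos hx0 (1 / L), ← hL]
    congr 3; field_simp
  have hpt : ∀ t ∈ Set.uIoc (1 / 2 + 1 / L) (1 + 1 / L), ‖(X : ℂ) ^ (t + v * I : ℂ) / (t + v * I) * Gop riemannZeta (t + v * I)‖ ≤
      4 * (x * Real.exp 1) / x ^ 2 * (24 / (1 / L / 4) ^ 3 * (8 * x * L)) := by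
    intro t ht
    rw [Set.uIoc_of_le (by linarith)] at ht
    rw [norm_mul]
    have p1 := perron_norm X hXp t v (x ^ 2) (by positivity) (hv ▸ im_le_norm' t v)
    have p2 : X ^ t ≤ X ^ (1 + 1 / L) := by
      apply Real.rpow_le_rpow_of_exponent_le _ ht.2
      have : (1 : ℝ) ≤ ⌊x⌋₊ := by exact_mod_cast Nat.le_floor (by norm_num; linarith)
      rw [hX]; linarith
    have hball : ∀ z ∈ Metric.ball (t + v * I : ℂ) (1 / L / 2), 1 / 2 < z.re ∧ z.re ≤ 3 ∧ x ^ 2 - 1 ≤ |z.im| ∧ |z.im| ≤ x ^ 2 + 1 := by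
      intro z hz
      rw [Metric.mem_ball, dist_eq_norm] at hz
      have a1 := abs_lt.1 ((Complex.abs_re_le_norm _).trans_lt hz)
      have a2 := (Complex.abs_im_le_norm _).trans_lt hz
      have e1 : (z - (t + v * I : ℂ)).re = z.re - t := by simp
      have e2 : (z - (t + v * I : ℂ)).im = z.im - v := by simp
      rw [e1] at a1
      rw [e2] at a2
      have a3 := abs_lt.1 ((abs_abs_sub_abs_le_abs_sub z.im v).trans_lt a2)
      rw [hv] at a3
      exact ⟨by linarith [ht.1, a1.1], by linarith [ht.2, a1.2], by linarith [a3.1], by linarith [a3.2]⟩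
    have p3 := Gop_bound_max (f := riemannZeta) (c := t + v * I) (r := 1 / L / 4) (R := 1 / L / 2) (M := 8 * x * L)
      (by positivity) (by linarith) (by
        intro z hz
        apply DifferentiableAt.differentiableWithinAt
        apply differentiableAt_riemannZeta
        intro h
        have := (hball z hz).2.2.1
        rw [h] at this
        simp only [one_im, abs_zero] at this
        nlinarith) (fun z hz => rh_ne hRH z (hball z hz).1)
      (fun z hz => by
        obtain ⟨b1, b2, b3, b4⟩ := hball z hz
        exact rh_zeta_bd x hx z b1.le b2 b3 b4)
    refine mul_le_mul ?_ p3 (norm_nonneg _) (by positivity)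
    refine p1.trans ?_
    have := p2.trans hXc
    gcongr
  have := intervalIntegral.norm_integral_le_of_norm_le_const hpt
  refine this.trans ?_
  refine (mul_le_of_le_one_right (by positivity) ?_).trans (le_of_eq ?_)
  · rw [abs_of_pos (by linarith)]; linarith
  · field_simp; norm_num

lemma rh_BB (hRH : RiemannHypothesis) (C : ℕ → ℂ)
    (hC : ∀ᶠ s in nhdsWithin (1 : ℂ) {(1 : ℂ)}ᶜ,
      HasSum (fun j : ℕ => C j * (s - 1) ^ j) (riemannZeta s - 1 / (s - 1))) :
    ∃ K > 0, ∃ x1 : ℝ, ∀ x ≥ x1, ‖(BB x : ℂ) + MT C x‖ ≤ K * (√x * (Real.log x ^ 4 * √(Real.log x))) := by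
  obtain ⟨K1, hK1, hcomb⟩ := combine C hC
  refine ⟨2 * K1 + 4 * Real.exp 1 * (24 * 8 * 8640) + 2 * (24 * 64 * 8 * 4 * Real.exp 1), by positivity, Real.exp 16, fun x hx => ?_⟩
  have hx0 : 0 < x := (Real.exp_pos _).trans_le hx
  have hx17 : 17 ≤ x := by linarith [Real.add_one_le_exp (16 : ℝ)]
  have hl := rh_left hRH x _ hx rfl
  have hh1 := rh_hor hRH x _ hx rfl (-(x ^ 2)) (by rw [abs_neg, abs_of_pos (by positivity)])
  have hh2 := rh_hor hRH x _ hx rfl (x ^ 2) (by rw [abs_of_pos (by positivity)])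
  set L := Real.log x with hL
  have hL16 : 16 ≤ L := by rw [hL, Real.le_log_iff_exp_le hx0]; exact hx
  have hL0 : 0 < L := by linarith
  have hb0 : 0 < 1 / L := by positivity
  have hb1 : 1 / L ≤ 1 / 16 := one_div_le_one_div_of_le (by norm_num) hL16
  have hm := hcomb x (x ^ 2) (1 / 2 + 1 / L) (by linarith) (by nlinarith) (by linarith) (by linarith)
    (by rintro s ⟨h1, -⟩; exact rh_ne hRH s (by linarith))
  have hxp : x ^ (1 / 2 + 1 / L) = √x * Real.exp 1 := by
    rw [Real.rpow_add hx0, ← Real.sqrt_eq_rpow, Real.rpow_def_of_pos hx0 (1 / L), ← hL]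
    congr 2; field_simp
  rw [hxp] at hl
  have hsx : 1 ≤ √x := Real.one_le_sqrt.2 (by linarith)
  have hsL : 1 ≤ √L := Real.one_le_sqrt.2 (by linarith)
  set Q := √x * (L ^ 4 * √L) with hQ
  have hLQ : L ^ 4 ≤ Q := by
    have : 0 ≤ L ^ 4 := by positivity
    calc L ^ 4 ≤ L ^ 4 * √L := le_mul_of_one_le_right this hsL
      _ ≤ Q := le_mul_of_one_le_left (by positivity) hsx
  have w1 : x * L ^ 4 / x ^ 2 ≤ Q := by
    refine le_trans ?_ hLQ
    rw [div_le_iff₀ (by positivity), mul_comm]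
    apply mul_le_mul_of_nonneg_left _ (by positivity)
    nlinarith
  have w2 : L ^ 3 ≤ Q := (pow_le_pow_right₀ (by linarith) (by norm_num)).trans hLQ
  have w3 : 4 * (√x * Real.exp 1) * (24 * 8 * L ^ 3 * (8640 * (L * √L))) = 4 * Real.exp 1 * (24 * 8 * 8640) * Q := by
    rw [hQ]; ring
  rw [w3] at hl
  have w4 := mul_le_mul_of_nonneg_left hLQ (show 0 ≤ 24 * 64 * 8 * 4 * Real.exp 1 by positivity)
  have w5 := mul_le_mul_of_nonneg_left w1 hK1.le
  have w6 := mul_le_mul_of_nonneg_left w2 hK1.le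
  refine hm.trans ?_
  linarith only [hl, hh1, hh2, w4, w5, w6]

/-- asymptotic expansion of `∑_{0<γ≤T} ζ''(ρ)`, with error
`O(T e^{-C√(log T)})` unconditionally and `O(T^{1/2} log^{9/2} T)` under the
Riemann Hypothesis. -/
theorem second_derivative_asymptotic (C : ℕ → ℂ)
    (hC : ∀ᶠ s in nhdsWithin (1 : ℂ) {(1 : ℂ)}ᶜ,
      HasSum (fun j : ℕ => C j * (s - 1) ^ j) (riemannZeta s - 1 / (s - 1)))
    (δ : ℝ) (hδ : 0 < δ) :
    (∃ c > (0 : ℝ), ∃ K > (0 : ℝ), ∃ T₀ : ℝ, ∀ T ≥ T₀, AdmissibleHeight δ T →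
      ‖zetaZeroSum 2 T - secondDerivMainTerm C T‖ ≤
        K * T * Real.exp (-c * Real.sqrt (Real.log T))) ∧
    (RiemannHypothesis →
      ∃ K > (0 : ℝ), ∃ T₀ : ℝ, ∀ T ≥ T₀, AdmissibleHeight δ T →
        ‖zetaZeroSum 2 T - secondDerivMainTerm C T‖ ≤
          K * T ^ ((1 : ℝ) / 2) * Real.log T ^ ((9 : ℝ) / 2)) := by
  obtain ⟨K2, hK2, hZ⟩ := zeroSum_BB δ hδ
  have hpi := Real.pi_gt_three
  have hpi4 := Real.pi_lt_d2
  have hx : ∀ T : ℝ, 112 ≤ T → 16 ≤ T / (2 * Real.pi) ∧ T / (2 * Real.pi) ≤ T := by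
    intro T hT
    refine ⟨by rw [le_div_iff₀ (by positivity)]; linarith, div_le_self (by linarith) (by linarith)⟩
  have hdec : ∀ T : ℝ, zetaZeroSum 2 T - secondDerivMainTerm C T =
      (zetaZeroSum 2 T + (BB (T / (2 * Real.pi)) : ℝ)) - ((BB (T / (2 * Real.pi)) : ℂ) + MT C (T / (2 * Real.pi))) := by
    intro T; rw [MT_eq]; ring
  constructor
  · obtain ⟨κ, hκ, K3, hK3, x1, hB⟩ := uncond_BB C hC
    have hc : 0 < min (κ / 2) (1 / 4) := lt_min (by linarith) (by norm_num)
    have hc1 : min (κ / 2) (1 / 4) ≤ κ / 2 := min_le_left _ _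
    have hc2 : min (κ / 2) (1 / 4) ≤ 1 / 4 := min_le_right _ _
    generalize min (κ / 2) (1 / 4) = c at hc hc1 hc2
    refine ⟨c, hc, K2 * (24 / (1 / 4) ^ 4) + K3, by positivity, max 112 (2 * Real.pi * x1), fun T hT hA => ?_⟩
    have hT1 : 112 ≤ T := (le_max_left _ _).trans hT
    have hT2 : x1 ≤ T / (2 * Real.pi) := by
      rw [le_div_iff₀ (by positivity)]; linarith [(le_max_right (112 : ℝ) (2 * Real.pi * x1)).trans hT]
    obtain ⟨hx16, hxT⟩ := hx T hT1
    have hT0 : 0 < T := by linarith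
    have b1 := hZ T (by linarith) hA
    have b2 := hB _ hT2
    have hL := log_ge_two T (by linarith)
    have hTx : T ≤ (T / (2 * Real.pi)) ^ 4 := by
      have e : T = 2 * Real.pi * (T / (2 * Real.pi)) := by field_simp
      generalize T / (2 * Real.pi) = x at *
      have : 16 ^ 3 ≤ x ^ 3 := pow_le_pow_left₀ (by norm_num) hx16 3
      calc T = 2 * Real.pi * x := e
        _ ≤ x ^ 3 * x := mul_le_mul_of_nonneg_right (by linarith) (by linarith)
        _ = x ^ 4 := by ring
    have hlx := Real.log_le_log hT0 hTx
    rw [Real.log_pow] at hlx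
    push_cast at hlx
    have hTe : T = Real.exp (Real.log T) := (Real.exp_log hT0).symm
    set L := Real.log T with hLd
    have hr : √L / 2 ≤ √(Real.log (T / (2 * Real.pi))) := by
      apply Real.le_sqrt_of_sq_le
      rw [div_pow, Real.sq_sqrt (by linarith)]; linarith
    have hr0 := Real.sqrt_nonneg L
    have hrL : √L ≤ L := Real.sqrt_le_iff.2 ⟨by linarith, by nlinarith⟩
    have g1 : √T * L ^ 4 ≤ 24 / (1 / 4) ^ 4 * (T * Real.exp (-c * √L)) := by
      have h4 := pow_four_le_exp L (1 / 4) (by linarith) (by norm_num)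
      have hs : √T = Real.exp (L / 2) := by
        rw [Real.sqrt_eq_iff_mul_self_eq hT0.le (Real.exp_pos _).le, ← Real.exp_add]
        rw [add_halves]; exact hTe
      calc √T * L ^ 4 ≤ Real.exp (L / 2) * (24 / (1 / 4) ^ 4 * Real.exp (1 / 4 * L)) := by
            rw [hs]; exact mul_le_mul_of_nonneg_left h4 (Real.exp_pos _).le
        _ = 24 / (1 / 4) ^ 4 * Real.exp (L / 2 + 1 / 4 * L) := by rw [Real.exp_add]; ring
        _ ≤ 24 / (1 / 4) ^ 4 * Real.exp (L + -c * √L) := by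
            apply mul_le_mul_of_nonneg_left _ (by norm_num)
            apply Real.exp_le_exp.2
            have := mul_le_mul_of_nonneg_right hc2 hr0
            linarith
        _ = _ := by rw [Real.exp_add, ← hTe]
    have g2 : T / (2 * Real.pi) * Real.exp (-κ * √(Real.log (T / (2 * Real.pi)))) ≤ T * Real.exp (-c * √L) := by
      apply mul_le_mul hxT _ (Real.exp_pos _).le hT0.le
      apply Real.exp_le_exp.2
      have h1 := mul_le_mul_of_nonneg_left hr hκ.le
      have h2 := mul_le_mul_of_nonneg_right hc1 hr0
      linarith
    rw [hdec]
    refine (norm_sub_le _ _).trans ?_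
    have := mul_le_mul_of_nonneg_left g1 hK2.le
    have := mul_le_mul_of_nonneg_left g2 hK3.le
    linarith
  · intro hRH
    obtain ⟨K3, hK3, x1, hB⟩ := rh_BB hRH C hC
    refine ⟨K2 + K3, by positivity, max 112 (2 * Real.pi * x1), fun T hT hA => ?_⟩
    have hT1 : 112 ≤ T := (le_max_left _ _).trans hT
    have hT2 : x1 ≤ T / (2 * Real.pi) := by
      rw [le_div_iff₀ (by positivity)]; linarith [(le_max_right (112 : ℝ) (2 * Real.pi * x1)).trans hT]
    obtain ⟨hx16, hxT⟩ := hx T hT1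
    have hT0 : 0 < T := by linarith
    have b1 := hZ T (by linarith) hA
    have b2 := hB _ hT2
    have hL := log_ge_two T (by linarith)
    have hl0 := log_ge_two _ hx16
    have hlx := Real.log_le_log (by linarith) hxT
    have e9 : Real.log T ^ ((9 : ℝ) / 2) = Real.log T ^ 4 * √(Real.log T) := by
      rw [show (9 : ℝ) / 2 = (4 : ℕ) + 1 / 2 by norm_num, Real.rpow_add (by linarith), Real.rpow_natCast, Real.sqrt_eq_rpow]
    rw [hdec, e9, ← Real.sqrt_eq_rpow]
    have h1 : 1 ≤ √(Real.log T) := Real.one_le_sqrt.2 (by linarith)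
    have g1 : √T * Real.log T ^ 4 ≤ √T * (Real.log T ^ 4 * √(Real.log T)) :=
      mul_le_mul_of_nonneg_left (le_mul_of_one_le_right (by positivity) h1) (Real.sqrt_nonneg _)
    have g2 : √(T / (2 * Real.pi)) * (Real.log (T / (2 * Real.pi)) ^ 4 * √(Real.log (T / (2 * Real.pi)))) ≤
        √T * (Real.log T ^ 4 * √(Real.log T)) := by
      gcongr
    refine (norm_sub_le _ _).trans ?_
    have := mul_le_mul_of_nonneg_left g1 hK2.le
    have := mul_le_mul_of_nonneg_left g2 hK3.le
    linarith
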